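/- There exist constants C > 0 and 0 < c ≤ 1 such that the following holds for all n, d and λ > 0. If G is an (n,d,λ)-graph with d/λ ≥ C, then G contains a spanning subdivision of the complete graph K_t for every integer t with 2 ≤ t ≤ min{cd, c·√(n/log n)}. -/

import Mathlib

open SimpleGraph

/-- `G` is an `(n,d,λ)`-graph: `n` vertices, `d`-regular, and all adjacency-matrix
eigenvalues except the largest one `d` are at most `λ` in absolute value. -/
def IsNDLGraph (n d : ℕ) (lam : ℝ) {V : Type*} [Fintype V] [DecidableEq V]
    (G : SimpleGraph V) [DecidableRel G.Adj] : Prop :=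
  Fintype.card V = n ∧ G.IsRegularOfDegree d ∧
    ∀ hA : (G.adjMatrix ℝ).IsHermitian,
      ∃ i₀ : V, hA.eigenvalues i₀ = (d : ℝ) ∧
        ∀ i : V, i ≠ i₀ → |hA.eigenvalues i| ≤ lam

/-- `G` contains a spanning subdivision of the complete graph `K_t`:
there are `t` (distinct) branch vertices, pairwise internally disjoint paths
joining every pair of branch vertices, and every vertex of `G` lies on one of
these paths. -/
def HasSpanningKSubdivision {V : Type*} (G : SimpleGraph V) (t : ℕ) : Prop :=
  ∃ (b : Fin t ↪ V) (P : ∀ i j : Fin t, i < j → G.Walk (b i) (b j)),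
    (∀ i j (h : i < j), (P i j h).IsPath) ∧
    (∀ i j (h : i < j) (k : Fin t), k ≠ i → k ≠ j → b k ∉ (P i j h).support) ∧
    (∀ i j (h : i < j) (i' j' : Fin t) (h' : i' < j'), ¬(i = i' ∧ j = j') →
      ∀ v : V, v ∈ (P i j h).support → v ∈ (P i' j' h').support →
        ∃ k : Fin t, v = b k) ∧
    (∀ v : V, ∃ (i j : Fin t) (h : i < j), v ∈ (P i j h).support)

section Spectral
open Finset
open scoped Classical

/-- The neighbours of `u` as a finset (with classical decidability). -/
noncomputable def nb {V : Type} [Fintype V] (G : SimpleGraph V) (u : V) : Finset V :=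
  univ.filter (fun v => G.Adj u v)

theorem mem_nb {V : Type} [Fintype V] {G : SimpleGraph V} {u v : V} :
    v ∈ nb G u ↔ G.Adj u v := by simp [nb]

/-- Regularity together with the functional form of the expander mixing lemma. -/
structure Pseudorandom {V : Type} [Fintype V] (G : SimpleGraph V) (d : ℕ) (lam : ℝ) : Prop where
  card_nb : ∀ u, (nb G u).card = d
  mix : ∀ x y : V → ℝ, |∑ u, ∑ v ∈ nb G u, x u * y v
      - (d : ℝ) / Fintype.card V * ((∑ u, x u) * ∑ v, y v)|
    ≤ lam * (Real.sqrt (∑ u, x u ^ 2) * Real.sqrt (∑ v, y v ^ 2))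

theorem IsNDLGraph.pseudorandom {n d : ℕ} {lam : ℝ} {V : Type} [Fintype V] [DecidableEq V]
    {G : SimpleGraph V} [DecidableRel G.Adj] (h : IsNDLGraph n d lam G) (h0 : 0 < lam)
    (hlt : lam < d) : Pseudorandom G d lam := by
  obtain ⟨hcard, hreg, hev⟩ := h
  have hnb : ∀ u, nb G u = G.neighborFinset u := by
    intro u; ext v; simp [mem_nb]
  refine ⟨fun u => by rw [hnb]; exact hreg u, ?_⟩
  intro x y
  have hA : (G.adjMatrix ℝ).IsHermitian := by
    rw [Matrix.IsHermitian, Matrix.conjTranspose_eq_transpose_of_trivial]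
    exact G.transpose_adjMatrix
  obtain ⟨i₀, hi₀, hrest⟩ := hev hA
  set A := G.adjMatrix ℝ with hAdef
  set e := hA.eigenvectorBasis with he
  have hsymm : ∀ a b : V → ℝ, a ⬝ᵥ (A.mulVec b) = (A.mulVec a) ⬝ᵥ b := by
    intro a b
    rw [Matrix.dotProduct_mulVec, ← Matrix.mulVec_transpose, G.transpose_adjMatrix]
  have hae : ∀ i, A.mulVec (e i).ofLp = hA.eigenvalues i • (e i).ofLp := by
    intro i; exact hA.mulVec_eigenvectorBasis i
  have hone : A.mulVec (fun _ => (1:ℝ)) = fun _ => (d:ℝ) := by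
    ext u
    rw [hAdef, adjMatrix_mulVec_apply]
    simp [hreg u]
  let co : (V → ℝ) → V → ℝ := fun a i => (e i).ofLp ⬝ᵥ a
  have hco : ∀ (a : V → ℝ) i, inner ℝ (e i) (WithLp.toLp 2 a) = co a i := by
    intro a i
    simp [co, EuclideanSpace.inner_eq_star_dotProduct, dotProduct_comm]
  have hpars : ∀ a b : V → ℝ, a ⬝ᵥ b = ∑ i, co a i * co b i := by
    intro a b
    have := e.sum_inner_mul_inner (WithLp.toLp 2 a) (WithLp.toLp 2 b)
    have h2 : inner ℝ (WithLp.toLp 2 a : EuclideanSpace ℝ V) (WithLp.toLp 2 b) = a ⬝ᵥ b := by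
      simp [EuclideanSpace.inner_eq_star_dotProduct, dotProduct_comm]
    rw [← h2, ← this]
    refine Finset.sum_congr rfl fun i _ => ?_
    rw [hco b i, real_inner_comm, hco a i]
  have hcoA : ∀ b i, co (A.mulVec b) i = hA.eigenvalues i * co b i := by
    intro b i
    simp only [co]
    rw [hsymm, hae, smul_dotProduct, smul_eq_mul]
  have hone0 : ∀ i, i ≠ i₀ → co (fun _ => (1:ℝ)) i = 0 := by
    intro i hi
    have h1 := hcoA (fun _ => (1:ℝ)) i
    have h2 : co (A.mulVec (fun _ => (1:ℝ))) i = d * co (fun _ => (1:ℝ)) i := by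
      rw [hone]; simp [co, dotProduct, Finset.mul_sum, mul_comm]
    have h3 : hA.eigenvalues i < d := lt_of_le_of_lt ((le_abs_self _).trans (hrest i hi)) hlt
    have h4 : (d - hA.eigenvalues i) * co (fun _ => (1:ℝ)) i = 0 := by linarith
    rcases mul_eq_zero.mp h4 with h5 | h5
    · linarith
    · exact h5
  set w := co (fun _ => (1:ℝ)) i₀ with hw
  have hsum : ∀ a : V → ℝ, ∑ u, a u = w * co a i₀ := by
    intro a
    have : (fun _ => (1:ℝ)) ⬝ᵥ a = ∑ u, a u := by simp [dotProduct]
    rw [← this, hpars, Finset.sum_eq_single i₀]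
    · intro i _ hi; rw [hone0 i hi, zero_mul]
    · simp
  have hww : (Fintype.card V : ℝ) = w * w := by
    have := hsum (fun _ => (1:ℝ))
    simpa using this
  have hnpos : (0:ℝ) < Fintype.card V := by
    have : Nonempty V := ⟨i₀⟩
    exact_mod_cast Fintype.card_pos
  have hmain : ∑ u, ∑ v ∈ nb G u, x u * y v = ∑ i, hA.eigenvalues i * (co x i * co y i) := by
    have h1 : ∑ u, ∑ v ∈ nb G u, x u * y v = x ⬝ᵥ A.mulVec y := by
      simp only [dotProduct, hAdef]
      refine Finset.sum_congr rfl fun u _ => ?_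
      rw [adjMatrix_mulVec_apply, Finset.mul_sum, hnb]
    rw [h1, hpars]
    refine Finset.sum_congr rfl fun i _ => ?_
    rw [hcoA]; ring
  rw [hmain, hsum x, hsum y, hww, ← Finset.add_sum_erase _ _ (Finset.mem_univ i₀), hi₀]
  have hwne : w ≠ 0 := by
    intro h; rw [h, mul_zero] at hww; linarith
  have h5 : (d:ℝ) / (w * w) * (w * co x i₀ * (w * co y i₀)) = d * (co x i₀ * co y i₀) := by
    field_simp
  rw [h5, add_sub_cancel_left]
  have hsq : ∀ a : V → ℝ, ∑ u, a u ^ 2 = ∑ i, co a i ^ 2 := by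
    intro a
    have := hpars a a
    simpa [dotProduct, sq] using this
  calc |∑ i ∈ univ.erase i₀, hA.eigenvalues i * (co x i * co y i)|
      ≤ ∑ i ∈ univ.erase i₀, |hA.eigenvalues i * (co x i * co y i)| :=
        Finset.abs_sum_le_sum_abs _ _
    _ ≤ ∑ i ∈ univ.erase i₀, lam * (|co x i| * |co y i|) := by
        refine Finset.sum_le_sum fun i hi => ?_
        rw [abs_mul, abs_mul]
        exact mul_le_mul_of_nonneg_right (hrest i (Finset.ne_of_mem_erase hi)) (by positivity)
    _ ≤ ∑ i, lam * (|co x i| * |co y i|) :=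
        Finset.sum_le_sum_of_subset_of_nonneg (Finset.subset_univ _)
          (fun i _ _ => by positivity)
    _ = lam * ∑ i, |co x i| * |co y i| := by rw [Finset.mul_sum]
    _ ≤ lam * (Real.sqrt (∑ i, |co x i| ^ 2) * Real.sqrt (∑ i, |co y i| ^ 2)) :=
        mul_le_mul_of_nonneg_left (Real.sum_mul_le_sqrt_mul_sqrt _ _ _) h0.le
    _ = _ := by rw [hsq x, hsq y]; simp only [sq_abs]

end Spectral

section LocalLemma
open Finset
open scoped Classical

theorem card_mul_card_of_independent {ι κ : Type} [Fintype ι] [Fintype κ] (S : Finset ι)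
    (P Q : (ι → κ) → Prop) (hP : ∀ a b : ι → κ, (∀ i ∈ S, a i = b i) → P a → P b)
    (hQ : ∀ a b : ι → κ, (∀ i ∉ S, a i = b i) → Q a → Q b) :
    (univ.filter (fun a : ι → κ => P a ∧ Q a)).card * Fintype.card (ι → κ)
      = (univ.filter P).card * (univ.filter Q).card := by
  rw [← Finset.card_univ, ← Finset.card_product, ← Finset.card_product]
  let σ : (ι → κ) × (ι → κ) → (ι → κ) × (ι → κ) :=
    fun x => (S.piecewise x.1 x.2, S.piecewise x.2 x.1)
  have hσ : ∀ x, σ (σ x) = x := by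
    rintro ⟨a, b⟩
    simp only [σ, Prod.mk.injEq]
    constructor <;> · ext i; by_cases h : i ∈ S <;> simp [h]
  refine Finset.card_nbij' σ σ ?_ ?_ (fun x _ => hσ x) (fun x _ => hσ x)
  · rintro ⟨a, b⟩ h
    simp only [coe_product, Set.mem_prod, mem_coe, mem_filter, mem_univ, true_and, and_true] at h ⊢
    exact ⟨hP a _ (fun i hi => by simp [σ, hi]) h.1, hQ a _ (fun i hi => by simp [σ, hi]) h.2⟩
  · rintro ⟨a, b⟩ h
    simp only [coe_product, Set.mem_prod, mem_coe, mem_filter, mem_univ, true_and, and_true] at h ⊢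
    exact ⟨hP a _ (fun i hi => by simp [σ, hi]) h.1, hQ b _ (fun i hi => by simp [σ, hi]) h.2⟩

/-- The symmetric Lovász local lemma for uniformly random colourings. -/
theorem exists_colouring_avoiding {V κ : Type} [Fintype V] [Fintype κ] [Nonempty κ]
    (S : V → Finset V) (B : V → (V → κ) → Prop)
    (hB : ∀ v a b, (∀ i ∈ S v, a i = b i) → B v a → B v b) (p : ℝ) (D : ℕ)
    (hp : ∀ v, ((univ.filter (B v)).card : ℝ) ≤ p * Fintype.card (V → κ))
    (hD : ∀ v, (univ.filter (fun w => ¬ Disjoint (S v) (S w))).card ≤ D)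
    (hpD : 4 * p * D ≤ 1) (hp0 : 0 ≤ p) (hp1 : 4 * p ≤ 1) :
    ∃ a : V → κ, ∀ v, ¬ B v a := by
  let E : Finset V → (V → κ) → Prop := fun I a => ∀ w ∈ I, ¬ B w a
  have hNpos : (0 : ℝ) < Fintype.card (V → κ) := by exact_mod_cast Fintype.card_pos
  have key : ∀ k : ℕ, ∀ I : Finset V, I.card = k → ∀ v,
      ((univ.filter (fun a => B v a ∧ E I a)).card : ℝ) ≤ 2 * p * (univ.filter (E I)).card ∨
        v ∈ I := by
    intro k
    induction k using Nat.strong_induction_on with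
    | _ k ih =>
    intro I hI v
    by_cases hv : v ∈ I
    · exact Or.inr hv
    left
    set I1 := I.filter (fun w => ¬ Disjoint (S v) (S w)) with hI1
    set I2 := I.filter (fun w => Disjoint (S v) (S w)) with hI2
    have hind := card_mul_card_of_independent (S v) (B v) (E I2) (hB v) (by
      intro a b hab h w hw hBw
      refine h w hw (hB w b a (fun i hi => (hab i ?_).symm) hBw)
      have := (mem_filter.mp hw).2
      exact fun hiv => Finset.disjoint_left.mp this hiv hi)
    have hind' : ((univ.filter (fun a => B v a ∧ E I2 a)).card : ℝ) ≤
        p * (univ.filter (E I2)).card := by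
      have h1 : ((univ.filter (fun a => B v a ∧ E I2 a)).card : ℝ) * Fintype.card (V → κ)
        = ((univ.filter (B v)).card : ℝ) * (univ.filter (E I2)).card := by
        rw [← Nat.cast_mul, ← Nat.cast_mul, Nat.cast_inj]
        convert hind
      have h2 := mul_le_mul_of_nonneg_right (hp v) (Nat.cast_nonneg (univ.filter (E I2)).card)
      have h3 : ((univ.filter (fun a => B v a ∧ E I2 a)).card : ℝ) * Fintype.card (V → κ)
        ≤ (p * (univ.filter (E I2)).card) * Fintype.card (V → κ) := by rw [h1]; linarith
      exact le_of_mul_le_mul_right h3 hNpos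
    have hmono : ((univ.filter (fun a => B v a ∧ E I a)).card : ℝ) ≤
        (univ.filter (fun a => B v a ∧ E I2 a)).card := by
      exact_mod_cast Finset.card_le_card (fun a ha => by
        simp only [mem_filter, mem_univ, true_and] at ha ⊢
        exact ⟨ha.1, fun w hw => ha.2 w (mem_filter.mp hw).1⟩)
    have hhalf : ((univ.filter (E I2)).card : ℝ) ≤ 2 * (univ.filter (E I)).card := by
      rcases I1.eq_empty_or_nonempty with h0 | h0
      · have : I2 = I := by
          ext w; simp only [hI2, mem_filter, and_iff_left_iff_imp]
          intro hw; by_contra hc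
          have : w ∈ I1 := mem_filter.mpr ⟨hw, hc⟩
          rw [h0] at this; simp at this
        rw [this]
        have : (0:ℝ) ≤ (univ.filter (E I)).card := Nat.cast_nonneg _
        linarith
      · have hlt : I2.card < k := by
          rw [← hI]
          apply Finset.card_lt_card
          refine ⟨filter_subset _ _, fun hsub => ?_⟩
          obtain ⟨w, hw⟩ := h0
          have hw' := mem_filter.mp hw
          exact hw'.2 (mem_filter.mp (hsub hw'.1)).2
        have hsub : univ.filter (E I2) ⊆ univ.filter (E I) ∪
            I1.biUnion (fun w => univ.filter (fun a => B w a ∧ E I2 a)) := by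
          intro a ha
          simp only [mem_filter, mem_univ, true_and, mem_union, mem_biUnion] at ha ⊢
          by_cases hE : E I a
          · exact Or.inl hE
          · right
            simp only [E, not_forall, not_not] at hE
            obtain ⟨w, hw, hBw⟩ := hE
            refine ⟨w, ?_, hBw, ha⟩
            by_contra hc
            have : w ∈ I2 := by
              simp only [hI1, mem_filter, not_and, not_not] at hc
              exact mem_filter.mpr ⟨hw, hc hw⟩
            exact ha w this hBw
        have hle : ((univ.filter (E I2)).card : ℝ) ≤ (univ.filter (E I)).card +
            ∑ w ∈ I1, ((univ.filter (fun a => B w a ∧ E I2 a)).card : ℝ) := by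
          have := (Finset.card_le_card hsub).trans
            ((Finset.card_union_le _ _).trans (Nat.add_le_add_left Finset.card_biUnion_le _))
          exact_mod_cast this
        have hs : ∑ w ∈ I1, ((univ.filter (fun a => B w a ∧ E I2 a)).card : ℝ) ≤
            ∑ w ∈ I1, 2 * p * (univ.filter (E I2)).card := by
          refine Finset.sum_le_sum fun w hw => ?_
          rcases ih _ hlt I2 rfl w with h | h
          · exact h
          · exact absurd (mem_filter.mp h).2 (mem_filter.mp hw).2
        rw [Finset.sum_const, nsmul_eq_mul] at hs
        have hc1 : (I1.card : ℝ) ≤ D := by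
          exact_mod_cast (Finset.card_le_card (Finset.filter_subset_filter _ (subset_univ I))).trans
            (hD v)
        have hX : (0:ℝ) ≤ (univ.filter (E I2)).card := Nat.cast_nonneg _
        have h7 : (I1.card : ℝ) * (2 * p * (univ.filter (E I2)).card) ≤
            (univ.filter (E I2)).card / 2 := by
          have : (I1.card : ℝ) * (2 * p * (univ.filter (E I2)).card) ≤
            D * (2 * p * (univ.filter (E I2)).card) :=
            mul_le_mul_of_nonneg_right hc1 (by positivity)
          nlinarith
        linarith
    have := mul_le_mul_of_nonneg_left hhalf hp0
    linarith
  have pos : ∀ I : Finset V, (0:ℝ) < (univ.filter (E I)).card := by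
    intro I
    induction I using Finset.induction_on with
    | empty =>
      have : univ.filter (E ∅) = univ := by ext a; simp [E]
      rw [this, Finset.card_univ]; exact hNpos
    | insert v I hv ih =>
      have h1 := (key _ I rfl v).resolve_right hv
      have h2 : ((univ.filter (E I)).card : ℝ) ≤ (univ.filter (E (insert v I))).card +
          (univ.filter (fun a => B v a ∧ E I a)).card := by
        have : univ.filter (E I) ⊆ univ.filter (E (insert v I)) ∪
            univ.filter (fun a => B v a ∧ E I a) := by
          intro a ha
          simp only [mem_filter, mem_univ, true_and, mem_union] at ha ⊢
          by_cases h : B v a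
          · exact Or.inr ⟨h, ha⟩
          · refine Or.inl (fun w hw => ?_)
            rcases mem_insert.mp hw with rfl | hw
            · exact h
            · exact ha w hw
        exact_mod_cast (Finset.card_le_card this).trans (Finset.card_union_le _ _)
      nlinarith
  have := pos univ
  have h2 : 0 < (univ.filter (E univ)).card := by exact_mod_cast this
  obtain ⟨a, ha⟩ := Finset.card_pos.mp h2
  exact ⟨a, fun v => (mem_filter.mp ha).2 v (mem_univ v)⟩

theorem card_few_of_colour_le {V : Type} [Fintype V] (N : Finset V) (c : Fin 5) (k : ℕ)
    (hk : 32 * k ≤ N.card) :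
    ((univ.filter (fun χ : V → Fin 5 => (N.filter (fun u => χ u = c)).card < k)).card : ℝ)
      ≤ (1 / 10) ^ k * Fintype.card (V → Fin 5) := by
  let g : V → Fin 5 → ℝ := fun u i => if u ∈ N ∧ i = c then 1 / 2 else 1
  have hprod : ∏ u : V, ∑ i : Fin 5, g u i = ∑ χ : V → Fin 5, ∏ u, g u (χ u) :=
    Fintype.prod_sum g
  have hsum : ∀ u, ∑ i : Fin 5, g u i = if u ∈ N then 9 / 2 else 5 := by
    intro u
    by_cases hu : u ∈ N
    · simp only [g, hu, true_and, if_true]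
      rw [Finset.sum_ite]
      have h1 : (univ.filter (fun i : Fin 5 => i = c)).card = 1 := by
        rw [Finset.filter_eq' univ c]; simp
      have h2 : (univ.filter (fun i : Fin 5 => ¬ i = c)).card = 4 := by
        rw [Finset.filter_ne' univ c, Finset.card_erase_of_mem (mem_univ _)]; simp
      simp only [Finset.sum_const, h1, h2]; norm_num
    · simp [g, hu]
  have hL : ∏ u : V, ∑ i : Fin 5, g u i = (9 / 10 : ℝ) ^ N.card * Fintype.card (V → Fin 5) := by
    simp only [hsum]
    have : ∀ u : V, (if u ∈ N then (9 / 2 : ℝ) else 5) = (if u ∈ N then 9 / 10 else 1) * 5 := by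
      intro u; split_ifs <;> norm_num
    simp only [this]
    rw [Finset.prod_mul_distrib, Finset.prod_ite_mem]
    simp [div_pow]
  have hterm : ∀ χ : V → Fin 5, ∏ u, g u (χ u)
      = (1 / 2 : ℝ) ^ (N.filter (fun u => χ u = c)).card := by
    intro χ
    simp only [g]
    rw [← Finset.prod_const, ← Finset.prod_filter]
    apply Finset.prod_congr _ (fun _ _ => rfl)
    ext u; simp
  have h9 : (9 / 10 : ℝ) ^ N.card ≤ ((9 / 10) ^ 32) ^ k := by
    rw [← pow_mul]; exact pow_le_pow_of_le_one (by norm_num) (by norm_num) hk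
  set W : ℝ := (Fintype.card (V → Fin 5) : ℝ)
  have hW : 0 ≤ W := Nat.cast_nonneg _
  have hlow : ((univ.filter (fun χ : V → Fin 5 =>
      (N.filter (fun u => χ u = c)).card < k)).card : ℝ) * (1 / 2) ^ k ≤ (9 / 10) ^ N.card * W := by
    rw [← hL, hprod, ← nsmul_eq_mul, ← Finset.sum_const]
    refine (Finset.sum_le_sum (fun χ hχ => ?_)).trans
      (Finset.sum_le_sum_of_subset_of_nonneg (Finset.subset_univ _) ?_)
    · rw [hterm]
      exact pow_le_pow_of_le_one (by norm_num) (by norm_num) (mem_filter.mp hχ).2.le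
    · intro χ _ _; rw [hterm]; positivity
  have hpow : (9 / 10 : ℝ) ^ N.card ≤ (1 / 10) ^ k * (1 / 2) ^ k := by
    refine h9.trans ?_
    rw [← mul_pow]
    exact pow_le_pow_left₀ (by norm_num) (by norm_num) k
  have hh : (0:ℝ) < (1 / 2) ^ k := by positivity
  refine le_of_mul_le_mul_right (hlow.trans ?_) hh
  nlinarith [mul_le_mul_of_nonneg_right hpow hW]

theorem exists_balanced_colouring {V : Type} [Fintype V] (G : SimpleGraph V) (d : ℕ)
    (hreg : ∀ u, (nb G u).card = d) (hd : 320 ≤ d) :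
    ∃ χ : V → Fin 5, ∀ v c, d / 32 ≤ ((nb G v).filter (fun u => χ u = c)).card := by
  set k := d / 32 with hk
  have hk10 : 10 ≤ k := by omega
  have hsum : ∀ k : ℕ, 10 ≤ k → (20 : ℝ) * (32 * (k + 1)) ^ 2 ≤ 10 ^ k := by
    intro k hk
    induction k, hk using Nat.le_induction with
    | base => norm_num
    | succ k hk ih =>
      rw [pow_succ (10:ℝ)]; push_cast
      have : (10:ℝ) ≤ k := by exact_mod_cast hk
      nlinarith
  have h10 := hsum k hk10
  have hdk : (d:ℝ) ≤ 32 * (k + 1) := by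
    have : d ≤ 32 * (k + 1) := by omega
    exact_mod_cast this
  have hsq : (d:ℝ) ^ 2 ≤ (32 * (k + 1)) ^ 2 := pow_le_pow_left₀ (by positivity) hdk 2
  have h1 : (1 / 10 : ℝ) ^ k * 10 ^ k = 1 := by rw [← mul_pow]; norm_num
  have hpos : (0:ℝ) < (1 / 10) ^ k := by positivity
  have hkk : (10:ℝ) ≤ k := by exact_mod_cast hk10
  obtain ⟨χ, hχ⟩ := exists_colouring_avoiding (κ := Fin 5) (fun v => nb G v)
    (fun v χ => ∃ c, ((nb G v).filter (fun u => χ u = c)).card < k) (by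
      rintro v a b hab ⟨c, hc⟩
      refine ⟨c, ?_⟩
      have : (nb G v).filter (fun u => b u = c) = (nb G v).filter (fun u => a u = c) :=
        Finset.filter_congr (fun u hu => by rw [hab u hu])
      rw [this]; exact hc) (5 * (1 / 10) ^ k) (d ^ 2) (by
      intro v
      have hsub : (univ.filter (fun χ : V → Fin 5 =>
          ∃ c, ((nb G v).filter (fun u => χ u = c)).card < k)) ⊆
          univ.biUnion (fun c => univ.filter (fun χ : V → Fin 5 =>
          ((nb G v).filter (fun u => χ u = c)).card < k)) := by
        intro χ h; simpa using h
      have h2 : ((univ.filter (fun χ : V → Fin 5 =>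
          ∃ c, ((nb G v).filter (fun u => χ u = c)).card < k)).card : ℝ) ≤
          ∑ c, ((univ.filter (fun χ : V → Fin 5 =>
          ((nb G v).filter (fun u => χ u = c)).card < k)).card : ℝ) := by
        exact_mod_cast (Finset.card_le_card hsub).trans Finset.card_biUnion_le
      refine (le_of_eq (by congr!)).trans (h2.trans ?_)
      refine (Finset.sum_le_sum (fun c _ => card_few_of_colour_le (nb G v) c k
        (by rw [hreg]; omega))).trans ?_
      simp; linarith) (by
      intro v
      have : univ.filter (fun w => ¬ Disjoint (nb G v) (nb G w)) ⊆
          (nb G v).biUnion (fun u => nb G u) := by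
        intro w hw
        simp only [mem_filter, mem_univ, true_and, Finset.not_disjoint_iff, mem_nb, mem_biUnion]
          at hw ⊢
        obtain ⟨u, h1, h2⟩ := hw
        exact ⟨u, h1, h2.symm⟩
      refine (Finset.card_le_card this).trans (Finset.card_biUnion_le.trans ?_)
      simp [hreg, sq]) (by push_cast; nlinarith) (by positivity) (by nlinarith)
  refine ⟨χ, fun v c => ?_⟩
  have := hχ v
  push Not at this
  exact this c

end LocalLemma

section Mixing
open Finset
open scoped Classical

variable {V : Type} [Fintype V] {G : SimpleGraph V} {d : ℕ} {lam : ℝ}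

theorem Pseudorandom.abs_edges_sub_le (P : Pseudorandom G d lam) (S Y : Finset V) :
    |((∑ u ∈ S, (nb G u ∩ Y).card : ℕ) : ℝ) - (d : ℝ) / Fintype.card V * (S.card * Y.card)|
      ≤ lam * Real.sqrt (S.card * Y.card) := by
  have h := P.mix (fun u => if u ∈ S then 1 else 0) (fun u => if u ∈ Y then 1 else 0)
  have h1 : ∀ S : Finset V, ∑ u, (if u ∈ S then (1:ℝ) else 0) = S.card := by
    intro S; simp
  have h2 : ∀ S : Finset V, ∑ u, (if u ∈ S then (1:ℝ) else 0) ^ 2 = S.card := by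
    intro S; simp
  rw [h1, h1, h2, h2, ← Real.sqrt_mul (Nat.cast_nonneg _)] at h
  have h3 : ∑ u, ∑ v ∈ nb G u, (if u ∈ S then (1:ℝ) else 0) * (if v ∈ Y then 1 else 0)
      = ((∑ u ∈ S, (nb G u ∩ Y).card : ℕ) : ℝ) := by
    push_cast
    rw [← Finset.sum_filter_add_sum_filter_not univ (fun u => u ∈ S)]
    rw [Finset.sum_eq_zero (s := univ.filter (fun u => ¬ u ∈ S)), add_zero]
    · rw [Finset.filter_univ_mem]
      refine Finset.sum_congr rfl fun u hu => ?_
      simp [hu]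
    · intro u hu
      simp only [mem_filter, mem_univ, true_and] at hu
      simp [hu]
  rw [h3] at h
  exact h

/-- Two sets of vertices without edges between them cannot both be large. -/
theorem Pseudorandom.joined (P : Pseudorandom G d lam) {C : ℕ} (hC : lam * C ≤ d) (h0 : 0 < lam)
    (S T : Finset V) (h : Fintype.card V ^ 2 < C ^ 2 * (S.card * T.card)) :
    ∃ s ∈ S, ∃ t ∈ T, G.Adj s t := by
  by_contra! hno
  have hz : (∑ u ∈ S, (nb G u ∩ T).card : ℕ) = 0 := by
    refine Finset.sum_eq_zero fun u hu => ?_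
    rw [Finset.card_eq_zero, Finset.eq_empty_iff_forall_notMem]
    intro v hv
    rw [mem_inter, mem_nb] at hv
    exact hno u hu v hv.2 hv.1
  have h1 := P.abs_edges_sub_le S T
  rw [hz, Nat.cast_zero, zero_sub, abs_neg] at h1
  have hpos : 0 < S.card * T.card := by
    rcases Nat.eq_zero_or_pos (S.card * T.card) with h3 | h3
    · rw [h3] at h; simp at h
    · exact h3
  obtain ⟨s, hs⟩ := Finset.card_pos.mp (Nat.pos_of_mul_pos_right hpos)
  have hn : (0:ℝ) < Fintype.card V := by exact_mod_cast Fintype.card_pos_iff.mpr ⟨s⟩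
  have hr : (Fintype.card V:ℝ) ^ 2 < C ^ 2 * ((S.card : ℝ) * T.card) := by exact_mod_cast h
  set n : ℝ := (Fintype.card V : ℝ)
  set q : ℝ := (S.card : ℝ) * T.card with hq
  have hqpos : 0 < q := by rw [hq]; exact_mod_cast hpos
  have hs1 : Real.sqrt q * Real.sqrt q = q := Real.mul_self_sqrt hqpos.le
  have hs0 : 0 < Real.sqrt q := Real.sqrt_pos.mpr hqpos
  have h2 : (d:ℝ) * q ≤ lam * Real.sqrt q * n := by
    have := (le_abs_self _).trans h1
    rw [div_mul_eq_mul_div, div_le_iff₀ hn] at this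
    exact this
  have h3 : (d:ℝ) * Real.sqrt q ≤ lam * n := by
    refine le_of_mul_le_mul_right ?_ hs0
    nlinarith
  have h4 : C * Real.sqrt q ≤ n := by
    refine le_of_mul_le_mul_left ?_ h0
    nlinarith
  have h5 : (C * Real.sqrt q) ^ 2 ≤ n ^ 2 := pow_le_pow_left₀ (by positivity) h4 2
  nlinarith

/-- Sets with many neighbours in `Y` are much smaller than `Y`. -/
theorem Pseudorandom.expand (P : Pseudorandom G d lam) {C : ℕ} (hC : lam * C ≤ d) (h0 : 0 < lam)
    (hC0 : 0 < C) (S Y : Finset V) (κ K : ℕ) (hκ : d ≤ K * κ)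
    (h : ∀ u ∈ S, κ ≤ (nb G u ∩ Y).card) (hY : 2 * K * Y.card ≤ Fintype.card V) :
    C ^ 2 * S.card ≤ 4 * K ^ 2 * Y.card := by
  rcases S.eq_empty_or_nonempty with rfl | ⟨s, hs⟩
  · simp
  have hn : (0:ℝ) < Fintype.card V := by exact_mod_cast Fintype.card_pos_iff.mpr ⟨s⟩
  have h1 := (abs_le.mp (P.abs_edges_sub_le S Y)).2
  have h2 : (S.card : ℝ) * κ ≤ ((∑ u ∈ S, (nb G u ∩ Y).card : ℕ) : ℝ) := by
    have := Finset.card_nsmul_le_sum S (fun u => (nb G u ∩ Y).card) κ h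
    rw [smul_eq_mul] at this
    exact_mod_cast this
  have hS : (0:ℝ) < S.card := by exact_mod_cast Finset.card_pos.mpr ⟨s, hs⟩
  have hC0' : (0:ℝ) < C := by exact_mod_cast hC0
  have hdpos : (0:ℝ) < d := lt_of_lt_of_le (by positivity) hC
  have hκ' : (d:ℝ) ≤ K * κ := by exact_mod_cast hκ
  have hYr : 2 * (K:ℝ) * Y.card ≤ Fintype.card V := by exact_mod_cast hY
  set n : ℝ := (Fintype.card V : ℝ)
  set a : ℝ := (S.card : ℝ)
  set b : ℝ := (Y.card : ℝ)
  have hb : 0 ≤ b := Nat.cast_nonneg _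
  have hKr : (0:ℝ) ≤ K := Nat.cast_nonneg _
  have h3 : K * (d / n * (a * b)) ≤ d * a / 2 := by
    have : K * (d / n * (a * b)) = (d * a / 2) * ((2 * K * b) / n) := by field_simp
    rw [this]
    have h4 : (2 * K * b) / n ≤ 1 := (div_le_one hn).mpr hYr
    have : 0 ≤ d * a / 2 := by positivity
    nlinarith
  have h5 : d * a ≤ 2 * K * (lam * Real.sqrt (a * b)) := by nlinarith
  have hs : Real.sqrt (a * b) ^ 2 = a * b := Real.sq_sqrt (by positivity)
  have h6 : lam * (C * a) ≤ lam * (2 * K * Real.sqrt (a * b)) := by nlinarith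
  have h7 := le_of_mul_le_mul_left h6 h0
  have h8 : (C * a) ^ 2 ≤ (2 * K * Real.sqrt (a * b)) ^ 2 :=
    pow_le_pow_left₀ (by positivity) h7 2
  have h9 : a * (C ^ 2 * a) ≤ a * (4 * K ^ 2 * b) := by
    have : (2 * K * Real.sqrt (a * b)) ^ 2 = 4 * K ^ 2 * (a * b) := by rw [mul_pow, hs]; ring
    nlinarith
  have h10 := le_of_mul_le_mul_left h9 hS
  have h11 : ((C ^ 2 * S.card : ℕ) : ℝ) ≤ ((4 * K ^ 2 * Y.card : ℕ) : ℝ) := by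
    push_cast; exact h10
  exact Nat.cast_le.mp h11

theorem Pseudorandom.card_class (P : Pseudorandom G d lam) (Y : Finset V) (κ K : ℕ)
    (hκ : d ≤ K * κ) (hd : 0 < d) (h : ∀ u, κ ≤ (nb G u ∩ Y).card) :
    Fintype.card V ≤ K * Y.card := by
  have h1 : Fintype.card V * κ ≤ Y.card * d := by
    calc Fintype.card V * κ = ∑ u : V, κ := by simp
      _ ≤ ∑ u : V, (nb G u ∩ Y).card := Finset.sum_le_sum fun u _ => h u
      _ = ∑ y ∈ Y, (nb G y).card := by
          have : ∀ u, (nb G u ∩ Y).card = (Y.filter (fun y => G.Adj u y)).card := by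
            intro u; congr 1; ext y; simp [mem_nb, and_comm]
          simp only [this]
          refine (Finset.sum_card_bipartiteAbove_eq_sum_card_bipartiteBelow
            (s := Y) (t := univ) (fun y u => G.Adj u y)).symm.trans ?_
          · refine Finset.sum_congr rfl fun y _ => ?_
            congr 1; ext u; simp [bipartiteAbove, mem_nb, G.adj_comm]
      _ = Y.card * d := by simp [P.card_nb]
  have h2 : Fintype.card V * d ≤ (K * Y.card) * d := by
    calc Fintype.card V * d ≤ Fintype.card V * (K * κ) := Nat.mul_le_mul_left _ hκ
      _ = K * (Fintype.card V * κ) := by ring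
      _ ≤ K * (Y.card * d) := Nat.mul_le_mul_left _ h1
      _ = _ := by ring
  exact Nat.le_of_mul_le_mul_right h2 hd

end Mixing

section Extendability
open Finset
open scoped Classical

variable {V : Type} [Fintype V]

/-- The neighbourhood of a set of vertices. -/
noncomputable def nbs (G : SimpleGraph V) (U : Finset V) : Finset V := U.biUnion (nb G)

/-- Every small set `U` has at least `∑ u ∈ U, δ u` neighbours among the unused vertices `A`. -/
def Extendable (G : SimpleGraph V) (A : Finset V) (m : ℕ) (δ : V → ℕ) : Prop :=
  ∀ U : Finset V, U.card ≤ 2 * m → ∑ u ∈ U, δ u ≤ (nbs G U ∩ A).card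

variable {G : SimpleGraph V}

theorem nbs_union (U W : Finset V) : nbs G (U ∪ W) = nbs G U ∪ nbs G W := by
  ext v; simp [nbs, or_and_right, exists_or]

theorem nbs_mono {U W : Finset V} (h : U ⊆ W) : nbs G U ⊆ nbs G W :=
  Finset.biUnion_subset_biUnion_of_subset_left _ h

theorem Extendable.mono {A : Finset V} {m : ℕ} {δ δ' : V → ℕ} (h : Extendable G A m δ)
    (hle : ∀ u, δ' u ≤ δ u) : Extendable G A m δ' :=
  fun U hU => (Finset.sum_le_sum fun u _ => hle u).trans (h U hU)

theorem Extendable.add {A : Finset V} {m : ℕ} {δ : V → ℕ} (h : Extendable G A m δ)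
    (hslack : ∀ U : Finset V, m ≤ U.card → U.card ≤ 2 * m → ∑ u ∈ U, δ u < (nbs G U ∩ A).card)
    (hm : 1 ≤ m) (s : V) (hs : 1 ≤ δ s) :
    ∃ y ∈ A, G.Adj s y ∧ Extendable G (A.erase y) m (Function.update δ s (δ s - 1)) := by
  by_contra! hcon
  set δ' := Function.update δ s (δ s - 1) with hδ'
  have hle : ∀ u, δ' u ≤ δ u := by
    intro u
    by_cases hu : u = s
    · subst hu; simp [hδ']
    · simp [hδ', hu]
  have htight : ∀ y ∈ nb G s ∩ A, ∃ U : Finset V, U.card ≤ m ∧ s ∉ U ∧ y ∈ nbs G U ∧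
      (nbs G U ∩ A).card ≤ ∑ u ∈ U, δ u := by
    intro y hy
    rw [mem_inter, mem_nb] at hy
    have := hcon y hy.2 hy.1
    simp only [Extendable, not_forall, not_le] at this
    obtain ⟨U, hU, hlt⟩ := this
    have hsub : (nbs G U ∩ A).card ≤ (nbs G U ∩ A.erase y).card + 1 := by
      rw [Finset.inter_erase]
      have := Finset.pred_card_le_card_erase (s := nbs G U ∩ A) (a := y)
      omega
    have hEU := h U hU
    have hsU : s ∉ U := by
      intro hsU
      have h1 : ∑ u ∈ U, δ' u + 1 ≤ ∑ u ∈ U, δ u := by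
        rw [← Finset.add_sum_erase _ _ hsU, ← Finset.add_sum_erase _ _ hsU]
        have : ∑ u ∈ U.erase s, δ' u ≤ ∑ u ∈ U.erase s, δ u := Finset.sum_le_sum fun u _ => hle u
        have h2 : δ' s = δ s - 1 := by simp [hδ']
        omega
      omega
    have hyU : y ∈ nbs G U := by
      by_contra hy'
      have : nbs G U ∩ A.erase y = nbs G U ∩ A := by
        rw [Finset.inter_erase, Finset.erase_eq_of_notMem]
        exact fun hc => hy' (mem_inter.mp hc).1
      rw [this] at hlt
      have : ∑ u ∈ U, δ' u ≤ ∑ u ∈ U, δ u := Finset.sum_le_sum fun u _ => hle u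
      omega
    have hT : (nbs G U ∩ A).card ≤ ∑ u ∈ U, δ u := by
      have : ∑ u ∈ U, δ' u ≤ ∑ u ∈ U, δ u := Finset.sum_le_sum fun u _ => hle u
      omega
    refine ⟨U, ?_, hsU, hyU, hT⟩
    by_contra hm'
    have := hslack U (by omega) hU
    omega
  have hunion : ∀ Y : Finset V, Y ⊆ nb G s ∩ A → ∃ U : Finset V, U.card + 1 ≤ m ∧ s ∉ U ∧
      Y ⊆ nbs G U ∧ (nbs G U ∩ A).card ≤ ∑ u ∈ U, δ u := by
    intro Y
    induction Y using Finset.induction_on with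
    | empty => intro _; exact ⟨∅, by simpa using hm, by simp, by simp, by simp [nbs]⟩
    | insert y Y hy ih =>
      intro hsub
      obtain ⟨U, h1, h2, h3, h4⟩ := ih ((Finset.subset_insert _ _).trans hsub)
      obtain ⟨W, g1, g2, g3, g4⟩ := htight y (hsub (Finset.mem_insert_self _ _))
      have hcard : (U ∪ W).card ≤ 2 * m := (Finset.card_union_le _ _).trans (by omega)
      have hi := h (U ∩ W) ((Finset.card_le_card Finset.inter_subset_left).trans (by omega))
      have hsum := Finset.sum_union_inter (s₁ := U) (s₂ := W) (f := δ)
      have hci := Finset.card_union_add_card_inter (nbs G U ∩ A) (nbs G W ∩ A)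
      have e1 : nbs G (U ∪ W) ∩ A = (nbs G U ∩ A) ∪ (nbs G W ∩ A) := by
        rw [nbs_union, Finset.union_inter_distrib_right]
      have e2 : (nbs G (U ∩ W) ∩ A).card ≤ ((nbs G U ∩ A) ∩ (nbs G W ∩ A)).card := by
        apply Finset.card_le_card
        intro v hv
        rw [mem_inter] at hv
        simp only [mem_inter]
        exact ⟨⟨nbs_mono Finset.inter_subset_left hv.1, hv.2⟩,
          nbs_mono Finset.inter_subset_right hv.1, hv.2⟩
      have hT : (nbs G (U ∪ W) ∩ A).card ≤ ∑ u ∈ U ∪ W, δ u := by rw [e1]; omega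
      refine ⟨U ∪ W, ?_, ?_, ?_, hT⟩
      · by_contra hc
        have := hslack (U ∪ W) (by omega) hcard
        omega
      · simp [h2, g2]
      · rw [nbs_union]
        intro v hv
        rcases mem_insert.mp hv with rfl | hv
        · exact mem_union_right _ g3
        · exact mem_union_left _ (h3 hv)
  obtain ⟨U, h1, h2, h3, h4⟩ := hunion _ subset_rfl
  have h5 := h (insert s U) (by rw [Finset.card_insert_of_notMem h2]; omega)
  rw [Finset.sum_insert h2] at h5
  have h6 : nbs G (insert s U) ∩ A ⊆ nbs G U ∩ A := by
    intro v hv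
    rw [mem_inter] at hv
    have h7 := hv.1
    simp only [nbs, mem_biUnion, mem_insert] at h7
    obtain ⟨u, hu, huv⟩ := h7
    rcases hu with rfl | hu
    · exact mem_inter.mpr ⟨h3 (mem_inter.mpr ⟨huv, hv.2⟩), hv.2⟩
    · exact mem_inter.mpr ⟨mem_biUnion.mpr ⟨u, hu, huv⟩, hv.2⟩
  have := Finset.card_le_card h6
  omega

theorem Extendable.prune {A Q K : Finset V} {m : ℕ} {δ δ' : V → ℕ} {par : V → V}
    (h : Extendable G (A \ Q) m δ') (hQ : Q ⊆ A) (hK : K ⊆ Q) (hpar : ∀ q ∈ Q, G.Adj (par q) q)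
    (hδ : ∀ u, δ u ≤ δ' u + (Q.filter (fun q => par q = u)).card) :
    Extendable G (A \ K) m (fun u => δ u - (K.filter (fun q => par q = u)).card) := by
  intro U hU
  have h1 := h U hU
  have h2 : ∀ u, δ u - (K.filter (fun q => par q = u)).card ≤
      δ' u + ((Q \ K).filter (fun q => par q = u)).card := by
    intro u
    have := hδ u
    have e : (Q.filter (fun q => par q = u)).card = (K.filter (fun q => par q = u)).card +
        ((Q \ K).filter (fun q => par q = u)).card := by
      rw [← Finset.card_union_of_disjoint]
      · rw [← Finset.filter_union, Finset.union_sdiff_of_subset hK]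
      · exact Finset.disjoint_filter_filter Finset.disjoint_sdiff
    omega
  have h3 : ∑ u ∈ U, ((Q \ K).filter (fun q => par q = u)).card =
      ((Q \ K).filter (fun q => par q ∈ U)).card := by
    rw [Finset.card_eq_sum_card_fiberwise (f := par) (t := U)]
    · refine Finset.sum_congr rfl fun u hu => ?_
      congr 1; ext q
      simp only [mem_filter]
      constructor
      · rintro ⟨a, rfl⟩; exact ⟨⟨a, hu⟩, rfl⟩
      · rintro ⟨⟨a, _⟩, b⟩; exact ⟨a, b⟩
    · intro q hq; simpa using (mem_filter.mp hq).2
  calc ∑ u ∈ U, (δ u - (K.filter (fun q => par q = u)).card)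
      ≤ ∑ u ∈ U, (δ' u + ((Q \ K).filter (fun q => par q = u)).card) :=
        Finset.sum_le_sum fun u _ => h2 u
    _ = ∑ u ∈ U, δ' u + ((Q \ K).filter (fun q => par q ∈ U)).card := by
        rw [Finset.sum_add_distrib, h3]
    _ ≤ (nbs G U ∩ (A \ Q)).card + ((Q \ K).filter (fun q => par q ∈ U)).card := by omega
    _ = ((nbs G U ∩ (A \ Q)) ∪ ((Q \ K).filter (fun q => par q ∈ U))).card := by
        rw [Finset.card_union_of_disjoint]
        rw [Finset.disjoint_left]
        intro v hv hv'
        simp only [mem_inter, mem_sdiff, mem_filter] at hv hv'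
        exact hv.2.2 hv'.1.1
    _ ≤ _ := by
        apply Finset.card_le_card
        intro v hv
        simp only [mem_union, mem_inter, mem_sdiff, mem_filter] at hv ⊢
        rcases hv with hv | hv
        · exact ⟨hv.1, hv.2.1, fun hc => hv.2.2 (hK hc)⟩
        · exact ⟨mem_biUnion.mpr ⟨par v, hv.2, mem_nb.mpr (hpar v hv.1.1)⟩, hQ hv.1.1, hv.1.2⟩

end Extendability

section Connecting
open Finset
open scoped Classical

variable {V : Type} [Fintype V] {G : SimpleGraph V}

/-- Sets of size between `m` and `2 * m` have so many neighbours in `R` that the extension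
property cannot be tight on them while at most `M` vertices of `R` are used. -/
def HasSlack (G : SimpleGraph V) (R : Finset V) (m M : ℕ) : Prop :=
  ∀ U : Finset V, m ≤ U.card → U.card ≤ 2 * m → 16 * m + M < (nbs G U ∩ R).card

theorem HasSlack.lt {R A : Finset V} {m M : ℕ} (h : HasSlack G R m M) (hA : (R \ A).card ≤ M)
    {δ : V → ℕ} (hδ : ∀ u, δ u ≤ 8) (U : Finset V) (h1 : m ≤ U.card) (h2 : U.card ≤ 2 * m) :
    ∑ u ∈ U, δ u < (nbs G U ∩ A).card := by
  have h3 := h U h1 h2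
  have h4 : ∑ u ∈ U, δ u ≤ 16 * m := by
    calc ∑ u ∈ U, δ u ≤ ∑ u ∈ U, 8 := Finset.sum_le_sum fun u _ => hδ u
      _ ≤ 16 * m := by simp; omega
  have h5 : (nbs G U ∩ R).card ≤ (nbs G U ∩ A).card + (R \ A).card := by
    refine (Finset.card_le_card ?_).trans (Finset.card_union_le _ _)
    intro v hv
    simp only [mem_union, mem_inter, mem_sdiff] at hv ⊢
    tauto
  omega

theorem Extendable.add_many {R : Finset V} {m M : ℕ} (hs : HasSlack G R m M) (hm : 1 ≤ m) (k : ℕ) :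
    ∀ (A : Finset V) (δ c : V → ℕ), Extendable G A m δ → A ⊆ R → (∀ u, δ u ≤ 8) →
      (∀ u, c u ≤ δ u) → ∑ u, c u = k → (R \ A).card + k ≤ M →
      ∃ (Q : Finset V) (par : V → V), Q ⊆ A ∧ (∀ q ∈ Q, G.Adj (par q) q) ∧
        (∀ u, (Q.filter (fun q => par q = u)).card = c u) ∧
        Extendable G (A \ Q) m (fun u => δ u - c u) := by
  induction k with
  | zero =>
    intro A δ c hE _ _ _ hc _
    have hc0 : ∀ u, c u = 0 := fun u => (Finset.sum_eq_zero_iff.mp hc) u (mem_univ u)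
    exact ⟨∅, id, by simp, by simp, by simp [hc0], by simpa [hc0] using hE⟩
  | succ k ih =>
    intro A δ c hE hAR hδ hcδ hc hM
    obtain ⟨s, hsc⟩ : ∃ s, 1 ≤ c s := by
      by_contra! hno
      have : ∑ u, c u = 0 := Finset.sum_eq_zero fun u _ => by have := hno u; omega
      omega
    obtain ⟨y, hyA, hsy, hE'⟩ := hE.add (fun U => hs.lt (by omega) hδ U) hm s
      (hsc.trans (hcδ s))
    have hle : ∀ u, Function.update δ s (δ s - 1) u ≤ δ u := by
      intro u
      by_cases hu : u = s
      · subst hu; simp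
      · simp [hu]
    obtain ⟨Q, par, h1, h2, h3, h4⟩ := ih (A.erase y) (Function.update δ s (δ s - 1))
      (Function.update c s (c s - 1)) hE' ((Finset.erase_subset _ _).trans hAR)
      (fun u => (hle u).trans (hδ u)) (by
        intro u
        by_cases hu : u = s
        · subst hu; simp; have := hcδ u; omega
        · simpa [hu] using hcδ u) (by
        rw [Finset.sum_update_of_mem (mem_univ s)]
        have := Finset.sum_sdiff (f := c) (Finset.subset_univ {s})
        have h5 : c s ≤ ∑ u, c u := Finset.single_le_sum (fun u _ => Nat.zero_le _) (mem_univ s)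
        simp only [Finset.sum_singleton] at this
        omega) (by
        have : R \ A.erase y ⊆ insert y (R \ A) := by
          intro v hv; simp only [mem_sdiff, mem_erase, mem_insert] at hv ⊢; tauto
        have := (Finset.card_le_card this).trans (Finset.card_insert_le _ _)
        omega)
    have hyQ : y ∉ Q := fun hc => by simpa using h1 hc
    refine ⟨insert y Q, Function.update par y s, ?_, ?_, ?_, ?_⟩
    · intro v hv
      rcases mem_insert.mp hv with rfl | hv
      · exact hyA
      · exact Finset.erase_subset _ _ (h1 hv)
    · intro q hq
      by_cases hqy : q = y
      · subst hqy; simpa using hsy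
      · rw [Function.update_of_ne hqy]
        exact h2 q ((mem_insert.mp hq).resolve_left hqy)
    · intro u
      have hcongr : Q.filter (fun q => Function.update par y s q = u) =
          Q.filter (fun q => par q = u) := by
        refine Finset.filter_congr fun q hq => ?_
        rw [Function.update_of_ne (fun h => hyQ (by rwa [h] at hq))]
      rw [Finset.filter_insert, hcongr]
      have h3u := h3 u
      by_cases hu : u = s
      · subst hu
        rw [if_pos (by simp), Finset.card_insert_of_notMem (fun h => hyQ (mem_filter.mp h).1), h3u]
        simp; omega
      · rw [if_neg (by simpa using fun h => hu h.symm), h3u]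
        simp [hu]
    · have e : A \ insert y Q = A.erase y \ Q := by
        ext v; simp only [mem_sdiff, mem_insert, mem_erase]; tauto
      rw [e]
      refine h4.mono fun u => ?_
      by_cases hu : u = s
      · subst hu; simp; omega
      · simp [hu]

/-- `Q` carries a family of parent chains from `s` to the leaves in `L`, all of depth `j`. -/
structure LeafChains (par : V → V) (s : V) (Q L : Finset V) (j : ℕ) : Prop where
  sub : L ⊆ Q
  card : L.card = 2 ^ j
  chain : ∀ x ∈ L, ∃ l : List V, l.length = j + 1 ∧ (∀ y ∈ l, y ∈ Q) ∧ (s :: l).Nodup ∧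
    List.IsChain (fun a b => par b = a) (s :: l) ∧ l.getLast? = some x

theorem List.IsChain.imp_of_mem_tail {α : Type} {r r' : α → α → Prop} {a : α} {l : List α}
    (h : ∀ x, ∀ y ∈ l, r x y → r' x y) (hc : List.IsChain r (a :: l)) :
    List.IsChain r' (a :: l) := by
  induction l generalizing a with
  | nil => simp
  | cons b l ih =>
    rw [List.isChain_cons_cons] at hc ⊢
    exact ⟨h _ _ (by simp) hc.1, ih (fun x y hy => h x y (by simp [hy])) hc.2⟩

theorem LeafChains.step {par par' : V → V} {s : V} {Q L Q' : Finset V} {j : ℕ}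
    (h : LeafChains par s Q L j) (hs : s ∉ Q') (hdisj : Disjoint Q Q')
    (hc : ∀ u ∈ L, (Q'.filter (fun q => par' q = u)).card = 2) :
    LeafChains (fun q => if q ∈ Q' then par' q else par q) s
      (Q ∪ Q'.filter (fun q => par' q ∈ L)) (Q'.filter (fun q => par' q ∈ L)) (j + 1) := by
  refine ⟨Finset.subset_union_right, ?_, ?_⟩
  · rw [Finset.card_eq_sum_card_fiberwise (f := par') (t := L)
      (fun q hq => by simpa using (mem_filter.mp hq).2)]
    have : ∀ u ∈ L, ((Q'.filter (fun q => par' q ∈ L)).filter (fun q => par' q = u)).card = 2 := by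
      intro u hu
      rw [← hc u hu]
      congr 1; ext q
      simp only [mem_filter]
      constructor
      · rintro ⟨⟨a, _⟩, b⟩; exact ⟨a, b⟩
      · rintro ⟨a, rfl⟩; exact ⟨⟨a, hu⟩, rfl⟩
    rw [Finset.sum_congr rfl this, Finset.sum_const, h.card, smul_eq_mul, pow_succ]
  · intro x hx
    obtain ⟨hxQ, hxL⟩ := mem_filter.mp hx
    obtain ⟨l, h1, h2, h3, h4, h5⟩ := h.chain _ hxL
    have hlQ' : ∀ y ∈ l, y ∉ Q' := fun y hy => Finset.disjoint_left.mp hdisj (h2 y hy)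
    refine ⟨l ++ [x], by simp [h1], ?_, ?_, ?_, by simp⟩
    · intro y hy
      rcases List.mem_append.mp hy with hy | hy
      · exact mem_union_left _ (h2 y hy)
      · rw [List.mem_singleton] at hy; subst hy; exact mem_union_right _ hx
    · rw [← List.cons_append, List.nodup_append]
      refine ⟨h3, by simp, ?_⟩
      intro a ha b hb
      rw [List.mem_singleton] at hb; subst hb
      rintro rfl
      rcases List.mem_cons.mp ha with rfl | ha
      · exact hs hxQ
      · exact hlQ' _ ha hxQ
    · rw [← List.cons_append, List.isChain_append]
      refine ⟨h4.imp_of_mem_tail (fun a b hb hab => by rw [if_neg (hlQ' b hb)]; exact hab), by simp,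
        ?_⟩
      intro a ha b hb
      simp only [List.head?_cons, Option.mem_def, Option.some.injEq] at hb
      subst hb
      rw [if_pos hxQ]
      have : (s :: l).getLast? = some (par' x) := by
        rw [List.getLast?_cons, h5]; simp
      rw [this] at ha
      simpa using ha

theorem exists_two_trees {R : Finset V} {m M : ℕ} (hsl : HasSlack G R m M) (hm : 1 ≤ m)
    {A : Finset V} {δ : V → ℕ} (hE : Extendable G A m δ) (hAR : A ⊆ R) (hδ : ∀ u, δ u ≤ 8)
    {s s' : V} (hss : s ≠ s') (hsA : s ∉ A) (hsA' : s' ∉ A) (h1 : 1 ≤ δ s) (h1' : 1 ≤ δ s')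
    (hA2 : ∀ a ∈ A, 2 ≤ δ a) (j : ℕ) (hM : (R \ A).card + 4 * 2 ^ j ≤ M) :
    ∃ (Q Q' L L' : Finset V) (par : V → V) (δ' : V → ℕ), Q ⊆ A ∧ Q' ⊆ A ∧ Disjoint Q Q' ∧
      (Q ∪ Q').card + 2 ≤ 4 * 2 ^ j ∧
      (∀ q ∈ Q ∪ Q', G.Adj (par q) q) ∧ Extendable G (A \ (Q ∪ Q')) m δ' ∧
      (∀ u, δ u ≤ δ' u + ((Q ∪ Q').filter (fun q => par q = u)).card) ∧ (∀ u, δ' u ≤ 8) ∧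
      (∀ u ∈ A \ (Q ∪ Q'), 2 ≤ δ' u) ∧ (∀ u ∈ L ∪ L', 2 ≤ δ' u) ∧
      LeafChains par s Q L j ∧ LeafChains par s' Q' L' j := by
  induction j with
  | zero =>
    obtain ⟨Q, par, g1, g2, g3, g4⟩ := hE.add_many hsl hm 2 A δ
      (fun u => if u = s ∨ u = s' then 1 else 0) hAR hδ (by
        intro u; split_ifs with h
        · rcases h with rfl | rfl <;> assumption
        · exact Nat.zero_le _) (by
        rw [Finset.sum_ite]; simp only [Finset.sum_const, smul_eq_mul, mul_one, mul_zero, add_zero]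
        have : univ.filter (fun u => u = s ∨ u = s') = {s, s'} := by ext u; simp
        rw [this, Finset.card_pair hss]) (by omega)
    have hcard : ∀ x, (x = s ∨ x = s') → ∃ y, Q.filter (fun q => par q = x) = {y} := by
      intro x hx
      apply Finset.card_eq_one.mp
      rw [g3 x, if_pos hx]
    have hQall : ∀ q ∈ Q, par q = s ∨ par q = s' := by
      intro q hq
      by_contra hc
      have := g3 (par q)
      rw [if_neg hc, Finset.card_eq_zero] at this
      have h2 : q ∈ Q.filter (fun q' => par q' = par q) := by simp [hq]
      rw [this] at h2; simp at h2
    have hun : Q.filter (fun q => par q = s) ∪ Q.filter (fun q => par q = s') = Q := by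
      ext q; simp only [mem_union, mem_filter]
      constructor
      · tauto
      · intro hq; have := hQall q hq; tauto
    have hleaf : ∀ x, (x = s ∨ x = s') → x ∉ A → LeafChains par x (Q.filter (fun q => par q = x))
        (Q.filter (fun q => par q = x)) 0 := by
      intro x hx hxA
      refine ⟨subset_rfl, by rw [g3 x, if_pos hx]; rfl, ?_⟩
      intro y hy
      refine ⟨[y], rfl, ?_, ?_, ?_, rfl⟩
      · intro z hz; rw [List.mem_singleton] at hz; subst hz; exact hy
      · simp only [List.nodup_cons, List.mem_singleton, List.not_mem_nil, not_false_eq_true,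
          List.nodup_nil, and_true]
        rintro rfl
        exact hxA (g1 (mem_filter.mp hy).1)
      · simpa using (mem_filter.mp hy).2
    refine ⟨Q.filter (fun q => par q = s), Q.filter (fun q => par q = s'),
      Q.filter (fun q => par q = s), Q.filter (fun q => par q = s'), par,
      fun u => δ u - (if u = s ∨ u = s' then 1 else 0),
      (Finset.filter_subset _ _).trans g1, (Finset.filter_subset _ _).trans g1, ?_, ?_, ?_, ?_,
      ?_, ?_, ?_, ?_, hleaf s (Or.inl rfl) hsA, hleaf s' (Or.inr rfl) hsA'⟩
    · rw [Finset.disjoint_left]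
      intro q hq hq'
      exact hss ((mem_filter.mp hq).2.symm.trans (mem_filter.mp hq').2)
    · have := Finset.card_union_le (Q.filter (fun q => par q = s)) (Q.filter (fun q => par q = s'))
      rw [g3, g3, if_pos (Or.inl rfl), if_pos (Or.inr rfl)] at this
      omega
    · rw [hun]; exact g2
    · rw [hun]; exact g4
    · intro u; rw [hun, g3 u]; dsimp only; omega
    · intro u; have := hδ u; dsimp only; omega
    · intro u hu
      rw [mem_sdiff] at hu
      have := hA2 u hu.1
      dsimp only
      rw [if_neg]
      · omega
      · rintro (rfl | rfl) <;> tauto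
    · intro u hu
      rw [hun] at hu
      have huA := g1 hu
      have := hA2 u huA
      dsimp only
      rw [if_neg]
      · omega
      · rintro (rfl | rfl) <;> tauto
  | succ j ih =>
    obtain ⟨Q, Q', L, L', par, δ', i1, i2, i3, i4, i5, i6, i7, i8, i9, i10, i11, i12⟩ :=
      ih (by rw [pow_succ] at hM; omega)
    have hLL : Disjoint L L' := Finset.disjoint_of_subset_left i11.sub
      (Finset.disjoint_of_subset_right i12.sub i3)
    have hRA : (R \ (A \ (Q ∪ Q'))).card ≤ (R \ A).card + (Q ∪ Q').card := by
      refine (Finset.card_le_card ?_).trans (Finset.card_union_le _ _)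
      intro v hv; simp only [mem_sdiff, mem_union] at hv ⊢; tauto
    obtain ⟨N, pn, g1, g2, g3, g4⟩ := i6.add_many hsl hm (4 * 2 ^ j) (A \ (Q ∪ Q')) δ'
      (fun u => if u ∈ L ∪ L' then 2 else 0) (Finset.sdiff_subset.trans hAR) i8 (by
        intro u; split_ifs with h
        · exact i10 u h
        · exact Nat.zero_le _) (by
        rw [Finset.sum_ite_mem, Finset.univ_inter, Finset.sum_const,
          Finset.card_union_of_disjoint hLL, i11.card, i12.card, smul_eq_mul]; ring) (by
        rw [pow_succ] at hM; omega)
    have hNall : ∀ q ∈ N, pn q ∈ L ∪ L' := by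
      intro q hq
      by_contra hc
      have := g3 (pn q)
      rw [if_neg hc, Finset.card_eq_zero] at this
      have h2 : q ∈ N.filter (fun q' => pn q' = pn q) := by simp [hq]
      rw [this] at h2; simp at h2
    have hNA : ∀ q ∈ N, q ∈ A ∧ q ∉ Q ∪ Q' := fun q hq => mem_sdiff.mp (g1 hq)
    have hun : (Q ∪ N.filter (fun q => pn q ∈ L)) ∪ (Q' ∪ N.filter (fun q => pn q ∈ L')) =
        (Q ∪ Q') ∪ N := by
      ext q; simp only [mem_union, mem_filter]
      constructor
      · tauto
      · intro hq
        rcases hq with hq | hq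
        · tauto
        · have := hNall q hq; rw [mem_union] at this; tauto
    have hdQ : Disjoint Q N := by
      rw [Finset.disjoint_left]; intro q hq hqN
      exact (hNA q hqN).2 (mem_union_left _ hq)
    have hdQ' : Disjoint Q' N := by
      rw [Finset.disjoint_left]; intro q hq hqN
      exact (hNA q hqN).2 (mem_union_right _ hq)
    have hcardN : N.card = 4 * 2 ^ j := by
      rw [Finset.card_eq_sum_card_fiberwise (f := pn) (t := L ∪ L') (fun q hq => hNall q hq)]
      rw [Finset.sum_congr rfl (fun u hu => by rw [g3 u, if_pos hu]), Finset.sum_const,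
        Finset.card_union_of_disjoint hLL, i11.card, i12.card, smul_eq_mul]; ring
    refine ⟨Q ∪ N.filter (fun q => pn q ∈ L), Q' ∪ N.filter (fun q => pn q ∈ L'),
      N.filter (fun q => pn q ∈ L), N.filter (fun q => pn q ∈ L'),
      fun q => if q ∈ N then pn q else par q,
      fun u => δ' u - (if u ∈ L ∪ L' then 2 else 0), ?_, ?_, ?_, ?_, ?_, ?_, ?_, ?_, ?_, ?_,
      i11.step (fun h => hsA (hNA _ h).1) hdQ (fun u hu => by
        rw [g3 u, if_pos (mem_union_left _ hu)]),
      i12.step (fun h => hsA' (hNA _ h).1) hdQ' (fun u hu => by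
        rw [g3 u, if_pos (mem_union_right _ hu)])⟩
    · intro q hq
      rcases mem_union.mp hq with hq | hq
      · exact i1 hq
      · exact (hNA q (mem_filter.mp hq).1).1
    · intro q hq
      rcases mem_union.mp hq with hq | hq
      · exact i2 hq
      · exact (hNA q (mem_filter.mp hq).1).1
    · rw [Finset.disjoint_left]
      intro q hq hq'
      rcases mem_union.mp hq with hq | hq <;> rcases mem_union.mp hq' with hq' | hq'
      · exact Finset.disjoint_left.mp i3 hq hq'
      · exact Finset.disjoint_left.mp hdQ hq (mem_filter.mp hq').1
      · exact Finset.disjoint_left.mp hdQ' hq' (mem_filter.mp hq).1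
      · exact Finset.disjoint_left.mp hLL (mem_filter.mp hq).2 (mem_filter.mp hq').2
    · rw [hun]
      have := Finset.card_union_le (Q ∪ Q') N
      rw [pow_succ]; omega
    · intro q hq
      rw [hun] at hq
      dsimp only
      by_cases hqN : q ∈ N
      · rw [if_pos hqN]; exact g2 q hqN
      · rw [if_neg hqN]; exact i5 q ((mem_union.mp hq).resolve_right hqN)
    · have e : A \ (Q ∪ Q' ∪ N) = (A \ (Q ∪ Q')) \ N := by
        ext v; simp only [mem_union, mem_sdiff]; tauto
      rw [hun, e]
      exact g4
    · intro u
      rw [hun, Finset.filter_union, Finset.card_union_of_disjoint]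
      · have e1 : (Q ∪ Q').filter (fun q => (if q ∈ N then pn q else par q) = u) =
            (Q ∪ Q').filter (fun q => par q = u) := by
          refine Finset.filter_congr fun q hq => ?_
          rw [if_neg (fun hqN => (hNA q hqN).2 hq)]
        have e2 : N.filter (fun q => (if q ∈ N then pn q else par q) = u) =
            N.filter (fun q => pn q = u) := by
          refine Finset.filter_congr fun q hq => ?_
          rw [if_pos hq]
        rw [e1, e2, g3 u]
        have := i7 u
        dsimp only
        omega
      · apply Finset.disjoint_filter_filter
        rw [Finset.disjoint_left]
        intro q hq hqN
        exact (hNA q hqN).2 hq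
    · intro u; have := i8 u; dsimp only; omega
    · intro u hu
      rw [hun] at hu
      simp only [mem_sdiff, mem_union, not_or] at hu
      have := i9 u (by simp only [mem_sdiff, mem_union, not_or]; tauto)
      dsimp only
      rw [if_neg]
      · omega
      · rw [mem_union]
        rintro (h | h)
        · exact hu.2.1.1 (i11.sub h)
        · exact hu.2.1.2 (i12.sub h)
    · intro u hu
      have huN : u ∈ N := by
        rcases mem_union.mp hu with h | h <;> exact (mem_filter.mp h).1
      have := i9 u (g1 huN)
      dsimp only
      rw [if_neg]
      · omega
      · intro h
        refine (hNA u huN).2 ?_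
        rcases mem_union.mp h with h | h
        · exact mem_union_left _ (i11.sub h)
        · exact mem_union_right _ (i12.sub h)

theorem card_filter_par_le {par : V → V} {a : V} {l : List V}
    (hc : List.IsChain (fun a b => par b = a) (a :: l)) (hn : (a :: l).Nodup) (u : V) :
    (l.toFinset.filter (fun q => par q = u)).card ≤ if u ∈ a :: l then 1 else 0 := by
  induction l generalizing a with
  | nil => simp
  | cons b l ih =>
    rw [List.isChain_cons_cons] at hc
    have hn' := List.nodup_cons.mp hn
    have h1 := ih hc.2 hn'.2
    rw [List.toFinset_cons, Finset.filter_insert]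
    by_cases hu : u = a
    · subst hu
      rw [if_neg hn'.1] at h1
      rw [if_pos hc.1, if_pos (by simp)]
      exact (Finset.card_insert_le _ _).trans (by omega)
    · rw [if_neg (by rw [hc.1]; exact fun h => hu h.symm)]
      refine h1.trans (le_of_eq ?_)
      congr 1
      simp [hu]

/-- Two vertices outside the reservoir can be connected by a path of prescribed length through the
unused part of the reservoir, keeping the rest of the reservoir extendable. -/
theorem Extendable.connect {R : Finset V} {m M k : ℕ} (hsl : HasSlack G R m M) (hm : 1 ≤ m)
    (hjoin : ∀ S T : Finset V, m ≤ S.card → m ≤ T.card → ∃ s ∈ S, ∃ t ∈ T, G.Adj s t)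
    (hk : m ≤ 2 ^ k) {A : Finset V} {δ : V → ℕ} (hE : Extendable G A m δ) (hAR : A ⊆ R)
    (hδ : ∀ u, δ u ≤ 8) {s s' : V} (hss : s ≠ s') (hsA : s ∉ A) (hsA' : s' ∉ A) (h1 : 1 ≤ δ s)
    (h1' : 1 ≤ δ s') (hA2 : ∀ a ∈ A, 2 ≤ δ a) (hM : (R \ A).card + 4 * 2 ^ k ≤ M) :
    ∃ w : List V, w.length = 2 * (k + 1) ∧ w.Nodup ∧ (∀ x ∈ w, x ∈ A) ∧
      List.IsChain G.Adj (s :: (w ++ [s'])) ∧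
      Extendable G (A \ w.toFinset) m
        (fun u => δ u - if u ∈ s :: s' :: w then 1 else 0) := by
  obtain ⟨Q, Q', L, L', par, δ', i1, i2, i3, i4, i5, i6, i7, i8, i9, i10, i11, i12⟩ :=
    exists_two_trees hsl hm hE hAR hδ hss hsA hsA' h1 h1' hA2 k hM
  obtain ⟨x, hx, y, hy, hxy⟩ := hjoin L L' (by rw [i11.card]; exact hk) (by rw [i12.card]; exact hk)
  obtain ⟨l, a1, a2, a3, a4, a5⟩ := i11.chain x hx
  obtain ⟨l', b1, b2, b3, b4, b5⟩ := i12.chain y hy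
  have hll : ∀ v ∈ l, v ∉ l' := fun v hv hv' =>
    Finset.disjoint_left.mp i3 (a2 v hv) (b2 v hv')
  have hadj : List.IsChain G.Adj (s :: l) := a4.imp_of_mem_tail (fun a b hb hab => by
    rw [← hab]; exact i5 b (mem_union_left _ (a2 b hb)))
  have hadj' : List.IsChain G.Adj (s' :: l') := b4.imp_of_mem_tail (fun a b hb hab => by
    rw [← hab]; exact i5 b (mem_union_right _ (b2 b hb)))
  have hmem : ∀ v, v ∈ l ++ l'.reverse ↔ v ∈ l ∨ v ∈ l' := by simp
  refine ⟨l ++ l'.reverse, by simp [a1, b1]; ring, ?_, ?_, ?_, ?_⟩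
  · rw [List.nodup_append]
    refine ⟨(List.nodup_cons.mp a3).2, List.nodup_reverse.mpr (List.nodup_cons.mp b3).2, ?_⟩
    intro a ha b hb
    rintro rfl
    exact hll a ha (List.mem_reverse.mp hb)
  · intro v hv
    rcases (hmem v).mp hv with hv | hv
    · exact i1 (a2 v hv)
    · exact i2 (b2 v hv)
  · have e : s :: (l ++ l'.reverse ++ [s']) = (s :: l) ++ (s' :: l').reverse := by simp
    rw [e, List.isChain_append]
    refine ⟨hadj, ?_, ?_⟩
    · rw [List.isChain_reverse]
      exact hadj'.imp (fun a b h => h.symm)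
    · intro u hu v hv
      rw [List.head?_reverse] at hv
      rw [List.getLast?_cons, a5] at hu
      rw [List.getLast?_cons, b5] at hv
      simp at hu hv
      subst hu hv; exact hxy
  · have hK : (l ++ l'.reverse).toFinset = l.toFinset ∪ l'.toFinset := by ext v; simp
    have hsub : (l ++ l'.reverse).toFinset ⊆ Q ∪ Q' := by
      intro v hv
      rw [List.mem_toFinset, hmem] at hv
      rcases hv with hv | hv
      · exact mem_union_left _ (a2 v hv)
      · exact mem_union_right _ (b2 v hv)
    refine (i6.prune (Finset.union_subset i1 i2) hsub i5 i7).mono fun u => ?_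
    refine Nat.sub_le_sub_left ?_ _
    rw [hK, Finset.filter_union]
    refine (Finset.card_union_le _ _).trans ?_
    have c1 := card_filter_par_le a4 a3 u
    have c2 := card_filter_par_le b4 b3 u
    by_cases hu : u ∈ s :: l
    · rw [if_neg] at c2
      · rw [if_pos hu] at c1
        rw [if_pos]
        · omega
        · simp only [List.mem_cons, hmem] at hu ⊢; tauto
      · simp only [List.mem_cons, not_or] at hu ⊢
        rcases hu with rfl | hu
        · exact ⟨hss, fun h => hsA (i2 (b2 _ h))⟩
        · exact ⟨fun h => hsA' (h ▸ i1 (a2 _ hu)), hll u hu⟩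
    · rw [if_neg hu] at c1
      by_cases hu' : u ∈ s' :: l'
      · rw [if_pos hu'] at c2
        rw [if_pos]
        · omega
        · simp only [List.mem_cons, hmem] at hu' ⊢; tauto
      · rw [if_neg hu'] at c2
        omega

end Connecting

section ReservoirParameters
open Finset
open scoped Classical

variable {V : Type} [Fintype V] {G : SimpleGraph V} {d : ℕ} {lam : ℝ}

theorem Pseudorandom.joined_of_le (P : Pseudorandom G d lam) {C : ℕ} (hC : lam * C ≤ d)
    (h0 : 0 < lam) {a : ℕ} (ha : Fintype.card V < C * a) (S T : Finset V) (hS : a ≤ S.card)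
    (hT : a ≤ T.card) : ∃ s ∈ S, ∃ t ∈ T, G.Adj s t := by
  apply P.joined hC h0
  calc Fintype.card V ^ 2 < (C * a) ^ 2 := Nat.pow_lt_pow_left ha (by norm_num)
    _ = C ^ 2 * (a * a) := by ring
    _ ≤ _ := Nat.mul_le_mul_left _ (Nat.mul_le_mul hS hT)

theorem Pseudorandom.hasSlack (P : Pseudorandom G d lam) {C : ℕ} (hC : lam * C ≤ d) (h0 : 0 < lam)
    (hC1 : 2 ^ 40 ≤ C) (R : Finset V) (κ : ℕ) (hκ : d ≤ 64 * κ) (hd : 0 < d)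
    (h : ∀ u, κ ≤ (nb G u ∩ R).card) (hn : 2 ^ 20 ≤ Fintype.card V) :
    HasSlack G R (Fintype.card V / 2 ^ 20) (Fintype.card V / 128) := by
  set n := Fintype.card V
  intro U hU1 _
  have hR := P.card_class R κ 64 hκ hd h
  have hY : (R \ nbs G U).card < n / 2 ^ 12 := by
    by_contra! hc
    obtain ⟨s, hs, t, ht, hst⟩ := P.joined_of_le hC h0 (a := n / 2 ^ 20) (by
      have : n < 2 ^ 40 * (n / 2 ^ 20) := by omega
      exact this.trans_le (Nat.mul_le_mul_right _ hC1)) U (R \ nbs G U) hU1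
        (le_trans (by omega) hc)
    exact (mem_sdiff.mp ht).2 (mem_biUnion.mpr ⟨s, hs, mem_nb.mpr hst⟩)
  have h5 : R.card ≤ (nbs G U ∩ R).card + (R \ nbs G U).card := by
    refine (Finset.card_le_card ?_).trans (Finset.card_union_le _ _)
    intro v hv
    simp only [mem_union, mem_inter, mem_sdiff]
    tauto
  change n ≤ 64 * R.card at hR
  omega

theorem Pseudorandom.extendable (P : Pseudorandom G d lam) {C : ℕ} (hC : lam * C ≤ d)
    (h0 : 0 < lam) (hC1 : 2 ^ 40 ≤ C) (R : Finset V) (κ : ℕ) (hκ : d ≤ 64 * κ)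
    (h : ∀ u, κ ≤ (nb G u ∩ R).card) :
    Extendable G R (Fintype.card V / 2 ^ 20) (fun _ => 8) := by
  intro U hU
  by_contra! hc
  simp only [Finset.sum_const, smul_eq_mul] at hc
  have h1 := P.expand hC h0 (by omega) U (nbs G U ∩ R) κ 64 hκ (by
    intro u hu
    refine (h u).trans (Finset.card_le_card ?_)
    intro v hv
    rw [mem_inter] at hv ⊢
    exact ⟨hv.1, mem_inter.mpr ⟨mem_biUnion.mpr ⟨u, hu, hv.1⟩, hv.2⟩⟩) (by omega)
  have h2 : 2 ^ 80 * U.card ≤ C ^ 2 * U.card := by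
    refine Nat.mul_le_mul_right _ ?_
    calc 2 ^ 80 = (2 ^ 40) ^ 2 := by norm_num
      _ ≤ C ^ 2 := Nat.pow_le_pow_left hC1 2
  omega

end ReservoirParameters

section ShortCycles
open Finset
open scoped Classical

variable {V : Type}

/-- There is a walk of length at most `ℓ` from `a` to `b`. -/
def Near (K : SimpleGraph V) (ℓ : ℕ) (a b : V) : Prop := ∃ w : K.Walk a b, w.length ≤ ℓ

namespace Near

variable {K K' : SimpleGraph V} {ℓ ℓ' : ℕ} {a b c : V}

theorem refl (K : SimpleGraph V) (ℓ : ℕ) (a : V) : Near K ℓ a a := ⟨.nil, by simp⟩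

theorem symm (h : Near K ℓ a b) : Near K ℓ b a := by
  obtain ⟨w, hw⟩ := h; exact ⟨w.reverse, by simpa using hw⟩

theorem trans (h : Near K ℓ a b) (h' : Near K ℓ' b c) : Near K (ℓ + ℓ') a c := by
  obtain ⟨w, hw⟩ := h; obtain ⟨w', hw'⟩ := h'
  exact ⟨w.append w', by rw [Walk.length_append]; omega⟩

theorem mono (h : Near K ℓ a b) (hle : ℓ ≤ ℓ') : Near K ℓ' a b := by
  obtain ⟨w, hw⟩ := h; exact ⟨w, hw.trans hle⟩

theorem graph_mono (h : Near K ℓ a b) (hle : K ≤ K') : Near K' ℓ a b := by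
  obtain ⟨w, hw⟩ := h; exact ⟨w.mapLe hle, by simpa using hw⟩

theorem of_adj (h : K.Adj a b) : Near K 1 a b := ⟨h.toWalk, by simp⟩

theorem of_mem_support {w : K.Walk a b} {x y : V} (hx : x ∈ w.support) (hy : y ∈ w.support) :
    Near K w.length x y := by
  induction w with
  | nil => simp at hx hy; subst hx hy; exact refl _ _ _
  | cons h p ih =>
    rename_i u v w
    rw [Walk.support_cons, List.mem_cons] at hx hy
    have key : ∀ z ∈ p.support, Near K (p.length + 1) u z := by
      intro z hz
      have := (of_adj h).trans (⟨p.takeUntil z hz, p.length_takeUntil_le_length hz⟩ : Near K p.length v z)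
      exact this.mono (by omega)
    rw [Walk.length_cons]
    rcases hx with rfl | hx <;> rcases hy with rfl | hy
    · exact refl _ _ _
    · exact key _ hy
    · exact (key _ hx).symm
    · exact (ih hx hy).mono (by omega)

/-- How short walks can use a newly added edge. -/
theorem sup_edge {s t : V} (h : Near (K ⊔ edge s t) ℓ a b) : Near K ℓ a b ∨
    ∃ i j, i + j + 1 ≤ ℓ ∧ ((Near K i a s ∧ Near K j t b) ∨ (Near K i a t ∧ Near K j s b)) := by
  obtain ⟨w, hw⟩ := h
  induction w generalizing ℓ with
  | nil => exact Or.inl (refl _ _ _)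
  | cons h p ih =>
    rename_i u v w
    rw [Walk.length_cons] at hw
    obtain ⟨ℓ, rfl⟩ : ∃ m, ℓ = m + 1 := ⟨ℓ - 1, by omega⟩
    have ih := ih (ℓ := ℓ) (by omega)
    rw [sup_adj, edge_adj] at h
    rcases h with h | ⟨(⟨rfl, rfl⟩ | ⟨rfl, rfl⟩), _⟩
    · rcases ih with ih | ⟨i, j, hij, ih⟩
      · exact Or.inl (((of_adj h).trans ih).mono (by omega))
      · right
        refine ⟨i + 1, j, by omega, ?_⟩
        rcases ih with ⟨ih1, ih2⟩ | ⟨ih1, ih2⟩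
        · exact Or.inl ⟨((of_adj h).trans ih1).mono (by omega), ih2⟩
        · exact Or.inr ⟨((of_adj h).trans ih1).mono (by omega), ih2⟩
    · rcases ih with ih | ⟨i, j, hij, ⟨ih1, ih2⟩ | ⟨ih1, ih2⟩⟩
      · exact Or.inr ⟨0, ℓ, by omega, Or.inl ⟨refl _ _ _, ih⟩⟩
      · exact Or.inr ⟨0, j, by omega, Or.inl ⟨refl _ _ _, ih2⟩⟩
      · exact Or.inl (ih2.mono (by omega))
    · rcases ih with ih | ⟨i, j, hij, ⟨ih1, ih2⟩ | ⟨ih1, ih2⟩⟩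
      · exact Or.inr ⟨0, ℓ, by omega, Or.inr ⟨refl _ _ _, ih⟩⟩
      · exact Or.inl (ih2.mono (by omega))
      · exact Or.inr ⟨0, j, by omega, Or.inr ⟨refl _ _ _, ih2⟩⟩

end Near

/-- `K` has no cycle of length at most `g + 1`. -/
def ShortFree (K : SimpleGraph V) (g : ℕ) : Prop :=
  ∀ a b, K.Adj a b → ¬ Near (K.deleteEdges {s(a, b)}) g a b

theorem ShortFree.anti {K K' : SimpleGraph V} {g : ℕ} (h : ShortFree K g) (hle : K' ≤ K) :
    ShortFree K' g := by
  intro a b hab hn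
  refine h a b (hle hab) (hn.graph_mono ?_)
  exact deleteEdges_mono hle

theorem ShortFree.sup_edge {K : SimpleGraph V} {g : ℕ} (h : ShortFree K g) {s t : V}
    (hst : ¬ Near K g s t) : ShortFree (K ⊔ edge s t) g := by
  intro a b hab hn
  by_cases he : s(a, b) = s(s, t)
  · rw [he] at hn
    have hle : (K ⊔ edge s t).deleteEdges {s(s, t)} ≤ K := by
      intro x y hxy
      rw [deleteEdges_adj, sup_adj, edge_adj] at hxy
      rcases hxy with ⟨h1 | ⟨h1, _⟩, h2⟩
      · exact h1
      · exfalso; apply h2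
        rcases h1 with ⟨rfl, rfl⟩ | ⟨rfl, rfl⟩ <;> simp [Sym2.eq_swap]
    have h1 := hn.graph_mono hle
    rw [Sym2.eq_iff] at he
    rcases he with ⟨rfl, rfl⟩ | ⟨rfl, rfl⟩
    · exact hst h1
    · exact hst h1.symm
  · have hK : K.Adj a b := by
      rw [sup_adj, edge_adj] at hab
      rcases hab with h1 | ⟨h1, _⟩
      · exact h1
      · exfalso; apply he
        rcases h1 with ⟨rfl, rfl⟩ | ⟨rfl, rfl⟩ <;> simp [Sym2.eq_swap]
    have hle : (K ⊔ edge s t).deleteEdges {s(a, b)} ≤ K.deleteEdges {s(a, b)} ⊔ edge s t := by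
      intro x y hxy
      rw [deleteEdges_adj, sup_adj] at hxy
      rw [sup_adj, deleteEdges_adj]
      tauto
    have hd : K.deleteEdges {s(a, b)} ≤ K := deleteEdges_le _
    rcases (hn.graph_mono hle).sup_edge with h1 | ⟨i, j, hij, ⟨h1, h2⟩ | ⟨h1, h2⟩⟩
    · exact h a b hK h1
    · refine hst (Near.mono ?_ hij)
      have := ((h1.graph_mono hd).symm.trans (Near.of_adj hK)).trans (h2.graph_mono hd).symm
      exact this.mono (by omega)
    · refine hst (Near.mono ?_ hij)
      have := ((h2.graph_mono hd).trans (Near.of_adj hK).symm).trans (h1.graph_mono hd)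
      exact this.mono (by omega)

theorem SimpleGraph.Reachable.mem_of_closed {K : SimpleGraph V} {a b : V} (h : K.Reachable a b)
    {Z : Set V} (ha : a ∈ Z) (hZ : ∀ x ∈ Z, ∀ y, K.Adj x y → y ∈ Z) : b ∈ Z := by
  obtain ⟨w⟩ := h
  induction w with
  | nil => exact ha
  | cons h p ih => exact ih (hZ _ ha _ h)

variable [Fintype V]

theorem eq_of_adj_of_card_le_two {K : SimpleGraph V} {x a b w : V} (h2 : (nb K x).card ≤ 2)
    (ha : K.Adj x a) (hb : K.Adj x b) (hab : a ≠ b) (hw : K.Adj x w) : w = a ∨ w = b := by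
  by_contra! hc
  have : ({a, b, w} : Finset V) ⊆ nb K x := by
    intro v hv
    simp only [mem_insert, mem_singleton] at hv
    rw [mem_nb]
    rcases hv with rfl | rfl | rfl <;> assumption
  have h3 := Finset.card_le_card this
  rw [Finset.card_eq_three.mpr ⟨a, b, w, hab, hc.1.symm, hc.2.symm, rfl⟩] at h3
  omega

theorem eq_of_adj_of_card_le_one {K : SimpleGraph V} {x a w : V} (h2 : (nb K x).card ≤ 1)
    (ha : K.Adj x a) (hw : K.Adj x w) : w = a :=
  Finset.card_le_one.mp h2 w (mem_nb.mpr hw) a (mem_nb.mpr ha)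

theorem SimpleGraph.Walk.IsPath.adj_getVert {K : SimpleGraph V} {a b : V} {p : K.Walk a b}
    (hp : p.IsPath) {i : ℕ} (hi0 : 0 < i) (hi : i < p.length)
    (h2 : (nb K (p.getVert i)).card ≤ 2) {w : V} (hw : K.Adj (p.getVert i) w) :
    w = p.getVert (i - 1) ∨ w = p.getVert (i + 1) := by
  refine eq_of_adj_of_card_le_two h2 ?_ (p.adj_getVert_succ hi) ?_ hw
  · have := p.adj_getVert_succ (i := i - 1) (by omega)
    rw [Nat.sub_add_cancel hi0] at this
    exact this.symm
  · intro he
    have := hp.getVert_injOn (by simp; omega) (by simp; omega) he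
    omega

/-- In a graph of maximum degree two, one of the two ways of breaking at `v` detaches `v` from
the end `s`. -/
theorem exists_break {H : SimpleGraph V} (h2 : ∀ v, (nb H v).card ≤ 2) {s v : V}
    (hs : (nb H s).card ≤ 1) (hvs : v ≠ s) (hadj : ¬ H.Adj s v) (hv : (nb H v).Nonempty) :
    ∃ u ∈ nb H v, ¬ (H.deleteEdges {s(v, u)}).Reachable s v := by
  by_cases hr : H.Reachable s v
  swap
  · obtain ⟨u, hu⟩ := hv
    exact ⟨u, hu, fun h => hr (h.mono (deleteEdges_le _))⟩
  obtain ⟨p, hp⟩ := hr.exists_isPath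
  have hlen : 1 < p.length := by
    rcases Nat.lt_or_ge 1 p.length with h | h
    · exact h
    · exfalso
      interval_cases hl : p.length
      · exact hvs (Walk.eq_of_length_eq_zero hl).symm
      · exact hadj (Walk.adj_of_length_eq_one hl)
  set ℓ := p.length with hℓ
  have hend : p.getVert ℓ = v := p.getVert_length
  have hpen : H.Adj (p.getVert (ℓ - 1)) v := by
    have := p.adj_getVert_succ (i := ℓ - 1) (by omega)
    rwa [Nat.sub_add_cancel (by omega), hend] at this
  refine ⟨p.getVert (ℓ - 1), mem_nb.mpr hpen.symm, fun hre => ?_⟩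
  have := hre.mem_of_closed (Z := {x | ∃ i < ℓ, p.getVert i = x}) ⟨0, by omega, by simp⟩ (by
    rintro x ⟨i, hi, rfl⟩ y hxy
    rw [deleteEdges_adj] at hxy
    rcases Nat.eq_zero_or_pos i with rfl | hi0
    · refine ⟨1, hlen, ?_⟩
      have h1 := p.adj_getVert_succ (i := 0) (by omega)
      rw [Walk.getVert_zero] at h1
      exact (eq_of_adj_of_card_le_one hs h1 (by simpa using hxy.1)).symm
    · rcases hp.adj_getVert hi0 hi (h2 _) hxy.1 with h | h
      · exact ⟨i - 1, by omega, h.symm⟩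
      · by_cases hil : i + 1 < ℓ
        · exact ⟨i + 1, hil, h.symm⟩
        · exfalso
          have e : i = ℓ - 1 := by omega
          subst e
          rw [Nat.sub_add_cancel (by omega), hend] at h
          apply hxy.2
          rw [h]
          simp [Sym2.eq_swap])
  obtain ⟨i, hi, hiv⟩ := this
  have := hp.getVert_injOn (by simp; omega) (by simp; omega) (hiv.trans hend.symm)
  omega

end ShortCycles

section Rotations
open Finset
open scoped Classical

variable {V : Type} [Fintype V] {F K : SimpleGraph V} {g : ℕ}

theorem card_nb_sup_edge {H : SimpleGraph V} {s t : V} (hne : s ≠ t) (h : ¬ H.Adj s t) (w : V) :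
    (nb (H ⊔ edge s t) w).card
      = (nb H w).card + (if w = s then 1 else 0) + (if w = t then 1 else 0) := by
  have key : ∀ s t : V, s ≠ t → ¬ H.Adj s t →
      (nb (H ⊔ edge s t) s).card = (nb H s).card + 1 := by
    intro s t hne h
    have : nb (H ⊔ edge s t) s = insert t (nb H s) := by
      ext x
      rw [mem_nb, mem_insert, mem_nb, sup_adj, edge_adj]
      constructor
      · rintro (h1 | ⟨⟨-, h1⟩ | ⟨h1, -⟩, -⟩)
        · exact Or.inr h1
        · exact Or.inl h1
        · exact absurd h1 hne
      · rintro (rfl | h1)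
        · exact Or.inr ⟨Or.inl ⟨rfl, rfl⟩, hne⟩
        · exact Or.inl h1
    rw [this, card_insert_of_notMem (by simpa [mem_nb] using h)]
  by_cases hs : w = s
  · subst hs
    simp only [if_true, if_neg hne, add_zero]
    exact key _ _ hne h
  · by_cases ht : w = t
    · subst ht
      simp only [if_true, if_neg hs, add_zero]
      rw [edge_comm]
      exact key _ _ hne.symm (fun h' => h h'.symm)
    · simp only [if_neg hs, if_neg ht, add_zero]
      congr 1
      ext x
      simp [mem_nb, edge_adj, hs, ht]

theorem card_nb_deleteEdges {H : SimpleGraph V} {v u : V} (h : H.Adj v u) (w : V) :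
    (nb (H.deleteEdges {s(v, u)}) w).card + (if w = v then 1 else 0) + (if w = u then 1 else 0)
      = (nb H w).card := by
  rw [← card_nb_sup_edge h.ne (by simp) w]
  congr 2
  ext a b
  simp only [sup_adj, deleteEdges_adj, Set.mem_singleton_iff, edge_adj]
  constructor
  · rintro (⟨h1, -⟩ | ⟨⟨rfl, rfl⟩ | ⟨rfl, rfl⟩, -⟩)
    · exact h1
    · exact h
    · exact h.symm
  · intro h1
    by_cases he : s(a, b) = s(v, u)
    · rw [Sym2.eq_iff] at he
      right
      refine ⟨?_, h1.ne⟩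
      tauto
    · exact Or.inl ⟨h1, he⟩

/-- `F` is a subgraph of `K` of maximum degree at most two without short cycles. -/
def ThinIn (K : SimpleGraph V) (g : ℕ) (F : SimpleGraph V) : Prop :=
  F ≤ K ∧ (∀ w, (nb F w).card ≤ 2) ∧ ShortFree F g

/-- The outcome of a sequence of rotations: a graph, its current end, the set of touched
vertices and the set of all ends so far. -/
structure RotState (V : Type) where
  /-- the rotated graph -/
  H : SimpleGraph V
  /-- the current end -/
  s : V
  /-- the touched vertices -/
  T : Finset V
  /-- the ends of all stages -/
  E : Finset V

structure RotState.Good (F K : SimpleGraph V) (g : ℕ) (x : V) (σ : RotState V) : Prop where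
  le : σ.H ≤ K
  agree : ∀ a b, ¬ (a ∈ σ.T ∧ b ∈ σ.T) → (σ.H.Adj a b ↔ F.Adj a b)
  deg : ∀ w, (nb σ.H w).card + (if w = σ.s then 1 else 0)
    = (nb F w).card + if w = x then 1 else 0
  free : ShortFree σ.H g
  end_mem : σ.s ∈ σ.E
  start_mem : x ∈ σ.T
  sub : σ.E ⊆ σ.T
  sub_nb : ∀ w ∈ σ.T, ∃ p ∈ σ.E, w = p ∨ F.Adj p w

theorem RotState.good_start (hF : ThinIn K g F) (x : V) :
    RotState.Good F K g x ⟨F, x, {x}, {x}⟩ where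
  le := hF.1
  agree _ _ _ := Iff.rfl
  deg _ := rfl
  free := hF.2.2
  end_mem := mem_singleton_self _
  start_mem := mem_singleton_self _
  sub := subset_rfl
  sub_nb w hw := ⟨x, mem_singleton_self _, Or.inl (mem_singleton.mp hw)⟩

namespace RotState.Good

variable {x : V} {σ : RotState V}

theorem deg_end (h : σ.Good F K g x) (hF : ThinIn K g F) (hx : (nb F x).card ≤ 1) :
    (nb σ.H σ.s).card ≤ 1 := by
  have h1 := h.deg σ.s
  rw [if_pos rfl] at h1
  split_ifs at h1 with h2
  · rw [h2] at h1 ⊢; omega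
  · have := hF.2.1 σ.s; omega

theorem deg_le (h : σ.Good F K g x) (hF : ThinIn K g F) (hx : (nb F x).card ≤ 1) (w : V) :
    (nb σ.H w).card ≤ 2 := by
  have h1 := h.deg w
  have := hF.2.1 w
  by_cases h2 : w = x
  · rw [if_pos h2] at h1
    rw [h2] at h1 ⊢; omega
  · rw [if_neg h2] at h1; omega

theorem adj_iff (h : σ.Good F K g x) {w : V} (hw : w ∉ σ.T) (z : V) :
    σ.H.Adj w z ↔ F.Adj w z := h.agree _ _ (fun h' => hw h'.1)

theorem nb_eq (h : σ.Good F K g x) {w : V} (hw : w ∉ σ.T) : nb σ.H w = nb F w := by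
  ext z; rw [mem_nb, mem_nb, h.adj_iff hw]

theorem notMem_of_far (h : σ.Good F K g x) {v : V} (hv : ∀ p ∈ σ.E, v ≠ p ∧ ¬ F.Adj p v) :
    v ∉ σ.T := by
  intro h'
  obtain ⟨p, hp, h1 | h1⟩ := h.sub_nb v h'
  · exact (hv p hp).1 h1
  · exact (hv p hp).2 h1

theorem not_adj_of_far (h : σ.Good F K g x) {v : V} (hv : ∀ p ∈ σ.E, v ≠ p ∧ ¬ F.Adj p v) :
    ¬ σ.H.Adj σ.s v := by
  intro h'
  exact (hv _ h.end_mem).2 ((h.adj_iff (h.notMem_of_far hv) _).mp h'.symm).symm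

theorem step (h : σ.Good F K g x) (hF : ThinIn K g F) (hx : (nb F x).card ≤ 1) {v : V}
    (hsv : K.Adj σ.s v) (hv : ∀ p ∈ σ.E, v ≠ p ∧ ¬ F.Adj p v) (hne : (nb F v).Nonempty) :
    ∃ σ' : RotState V, σ'.Good F K g x ∧ F.Adj v σ'.s ∧ σ'.E = insert σ'.s σ.E := by
  have hvT := h.notMem_of_far hv
  have hadj := h.not_adj_of_far hv
  obtain ⟨u, hu, hr⟩ := exists_break (h.deg_le hF hx) (h.deg_end hF hx) hsv.ne' hadj
    (by rwa [h.nb_eq hvT])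
  rw [mem_nb] at hu
  have huF : F.Adj v u := (h.adj_iff hvT _).mp hu
  have hus : u ≠ σ.s := by rintro rfl; exact hadj hu.symm
  refine ⟨⟨σ.H.deleteEdges {s(v, u)} ⊔ edge σ.s v, u, insert v (insert u σ.T),
    insert u σ.E⟩, ⟨?_, ?_, ?_, ?_, ?_, ?_, ?_, ?_⟩, huF, rfl⟩ <;> dsimp only
  · refine sup_le ((deleteEdges_le _).trans h.le) ?_
    rw [edge_le_iff]
    exact Or.inr hsv
  · intro a b hab
    simp only [mem_insert] at hab
    rw [← h.agree a b (fun h' => hab ⟨Or.inr (Or.inr h'.1), Or.inr (Or.inr h'.2)⟩)]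
    have hsT := h.sub h.end_mem
    simp only [sup_adj, deleteEdges_adj, Set.mem_singleton_iff, edge_adj, Sym2.eq_iff]
    constructor
    · rintro (⟨h1, -⟩ | ⟨⟨rfl, rfl⟩ | ⟨rfl, rfl⟩, -⟩)
      · exact h1
      · exact absurd ⟨Or.inr (Or.inr hsT), Or.inl rfl⟩ hab
      · exact absurd ⟨Or.inl rfl, Or.inr (Or.inr hsT)⟩ hab
    · intro h1
      refine Or.inl ⟨h1, ?_⟩
      rintro (⟨rfl, rfl⟩ | ⟨rfl, rfl⟩)
      · exact hab ⟨Or.inl rfl, Or.inr (Or.inl rfl)⟩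
      · exact hab ⟨Or.inr (Or.inl rfl), Or.inl rfl⟩
  · intro w
    have h1 := h.deg w
    have h2 := card_nb_deleteEdges hu w
    rw [card_nb_sup_edge hsv.ne (fun h' => hadj ((deleteEdges_le _) h'))]
    omega
  · exact (h.free.anti (deleteEdges_le _)).sup_edge (fun h' => hr ⟨h'.choose⟩)
  · exact mem_insert_self _ _
  · exact mem_insert_of_mem (mem_insert_of_mem h.start_mem)
  · exact (insert_subset_insert _ h.sub).trans (subset_insert _ _)
  · intro w hw
    simp only [mem_insert] at hw
    rcases hw with rfl | rfl | hw
    · exact ⟨u, mem_insert_self _ _, Or.inr huF.symm⟩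
    · exact ⟨w, mem_insert_self _ _, Or.inl rfl⟩
    · obtain ⟨p, hp, h1⟩ := h.sub_nb w hw
      exact ⟨p, mem_insert_of_mem hp, h1⟩

end RotState.Good

/-- Replace `F` by `H` inside `T` and by `H'` inside `T'`. -/
def splice (F : SimpleGraph V) (T T' : Finset V) (H H' : SimpleGraph V) : SimpleGraph V where
  Adj a b := if a ∈ T ∧ b ∈ T then H.Adj a b else if a ∈ T' ∧ b ∈ T' then H'.Adj a b
    else F.Adj a b
  symm := ⟨fun a b h => by
    simp only [and_comm (a := b ∈ T), and_comm (a := b ∈ T')]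
    split_ifs at h ⊢ <;> exact h.symm⟩
  loopless := ⟨fun a h => by
    split_ifs at h <;> exact h.ne rfl⟩

theorem Near.of_splice {T T' : Finset V} {H H' : SimpleGraph V} {ℓ : ℕ} {a b : V}
    (hn : Near (splice F T T' H H') ℓ a b) (hb : b ∈ T') :
    (∃ b' ∈ T', Near F ℓ a b') ∨ ∃ a' ∈ T, ∃ b' ∈ T', Near F ℓ a' b' := by
  obtain ⟨w, hw⟩ := hn
  induction w generalizing ℓ with
  | nil => exact Or.inl ⟨_, hb, Near.refl _ _ _⟩
  | cons h p ih =>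
    rename_i u v w
    rw [Walk.length_cons] at hw
    rcases ih hb (ℓ := ℓ - 1) (by omega) with ⟨b', hb', h1⟩ | ⟨a', ha', b', hb', h1⟩
    · simp only [splice] at h
      split_ifs at h with h2 h3
      · exact Or.inr ⟨v, h2.2, b', hb', h1.mono (by omega)⟩
      · exact Or.inl ⟨u, h3.1, Near.refl _ _ _⟩
      · refine Or.inl ⟨b', hb', ?_⟩
        have := (Near.of_adj h).trans h1
        exact this.mono (by omega)
    · exact Or.inr ⟨a', ha', b', hb', h1.mono (by omega)⟩

theorem RotState.Good.exists_larger {x y : V} {σ τ : RotState V} (hσ : σ.Good F K g x)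
    (hτ : τ.Good F K g y) (hF : ThinIn K g F) (hx : (nb F x).card ≤ 1)
    (hy : (nb F y).card ≤ 1) (hst : K.Adj σ.s τ.s)
    (hfar : ∀ p ∈ σ.E, ∀ p' ∈ τ.E, ¬ Near F (g + 2) p p') :
    ∃ F', ThinIn K g F' ∧ (∀ w, (nb F w).card ≤ (nb F' w).card) ∧
      ∑ w, (nb F w).card < ∑ w, (nb F' w).card := by
  have hT : ∀ a ∈ σ.T, ∀ b ∈ τ.T, ¬ Near F g a b := by
    intro a ha b hb hn
    obtain ⟨p, hp, h1⟩ := hσ.sub_nb a ha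
    obtain ⟨p', hp', h2⟩ := hτ.sub_nb b hb
    have h3 : Near F 1 p a := by
      rcases h1 with rfl | h1
      · exact Near.refl _ _ _
      · exact Near.of_adj h1
    have h4 : Near F 1 b p' := by
      rcases h2 with rfl | h2
      · exact Near.refl _ _ _
      · exact Near.of_adj h2.symm
    exact hfar p hp p' hp' (((h3.trans hn).trans h4).mono (by omega))
  have hdisj : ∀ a ∈ σ.T, a ∉ τ.T := fun a ha hb => hT a ha a hb (Near.refl _ _ _)
  set L := splice F σ.T τ.T σ.H τ.H with hL
  have hadjσ : ∀ a b, ¬ (a ∈ τ.T ∧ b ∈ τ.T) → (L.Adj a b ↔ σ.H.Adj a b) := by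
    intro a b h
    simp only [hL, splice, if_neg h]
    split_ifs with h1
    · rfl
    · rw [hσ.agree a b h1]
  have hadjτ : ∀ a b, ¬ (a ∈ σ.T ∧ b ∈ σ.T) → (L.Adj a b ↔ τ.H.Adj a b) := by
    intro a b h
    simp only [hL, splice, if_neg h]
    split_ifs with h1
    · rfl
    · rw [hτ.agree a b h1]
  have hnear : ∀ a ∈ σ.T, ∀ b ∈ τ.T, ¬ Near L g a b := by
    intro a ha b hb hn
    rcases hn.of_splice hb with ⟨b', hb', h1⟩ | ⟨a', ha', b', hb', h1⟩
    · exact hT a ha b' hb' h1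
    · exact hT a' ha' b' hb' h1
  have hLK : L ≤ K := by
    intro a b hab
    by_cases h : a ∈ τ.T ∧ b ∈ τ.T
    · exact hτ.le ((hadjτ a b (fun h' => hdisj _ h'.1 h.1)).mp hab)
    · exact hσ.le ((hadjσ a b h).mp hab)
  have hfree : ShortFree L g := by
    intro a b hab hn
    obtain ⟨w, hw⟩ := hn
    have hLw : L.deleteEdges {s(a, b)} ≤ L := deleteEdges_le _
    by_cases h : ∃ z ∈ w.support, z ∈ τ.T
    · obtain ⟨z, hz, hzT⟩ := h
      have hno : ∀ c ∈ w.support, c ∉ σ.T := fun c hc hcT =>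
        hnear c hcT z hzT (((Near.of_mem_support hc hz).graph_mono hLw).mono hw)
      have hab' := (hadjτ a b (fun h' => hno a w.start_mem_support h'.1)).mp hab
      refine hτ.free a b hab' ⟨w.transfer _ ?_, (Walk.length_transfer _ _).trans_le hw⟩
      intro e he
      have he' := w.edges_subset_edgeSet he
      induction e with
      | h c d =>
        rw [mem_edgeSet, deleteEdges_adj] at he' ⊢
        exact ⟨(hadjτ c d (fun h' => hno c (w.fst_mem_support_of_mem_edges he) h'.1)).mp he'.1,
          he'.2⟩
    · push Not at h
      have hab' := (hadjσ a b (fun h' => h a w.start_mem_support h'.1)).mp hab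
      refine hσ.free a b hab' ⟨w.transfer _ ?_, (Walk.length_transfer _ _).trans_le hw⟩
      intro e he
      have he' := w.edges_subset_edgeSet he
      induction e with
      | h c d =>
        rw [mem_edgeSet, deleteEdges_adj] at he' ⊢
        exact ⟨(hadjσ c d (fun h' => h c (w.fst_mem_support_of_mem_edges he) h'.1)).mp he'.1,
          he'.2⟩
  have hsσ := hσ.sub hσ.end_mem
  have hsτ := hτ.sub hτ.end_mem
  have hLst : ¬ L.Adj σ.s τ.s := by
    intro h
    by_cases hg : g = 0
    · rw [hadjσ _ _ (fun h' => hdisj _ hsσ h'.1),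
        hσ.agree _ _ (fun h' => hdisj _ h'.2 hsτ)] at h
      exact hfar _ hσ.end_mem _ hτ.end_mem ((Near.of_adj h).mono (by omega))
    · exact hnear _ hsσ _ hsτ ((Near.of_adj h).mono (by omega))
  have hdegL : ∀ w, (nb L w).card + (if w = σ.s then 1 else 0) + (if w = τ.s then 1 else 0)
      = (nb F w).card + (if w = x then 1 else 0) + (if w = y then 1 else 0) := by
    intro w
    by_cases hw : w ∈ τ.T
    · have h1 : nb L w = nb τ.H w := by
        ext z
        rw [mem_nb, mem_nb, hadjτ _ _ (fun h' => hdisj _ h'.1 hw)]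
      have h2 : w ≠ σ.s := by rintro rfl; exact hdisj _ hsσ hw
      have h3 : w ≠ x := by rintro rfl; exact hdisj _ hσ.start_mem hw
      have := hτ.deg w
      rw [h1, if_neg h2, if_neg h3]; omega
    · have h1 : nb L w = nb σ.H w := by
        ext z
        rw [mem_nb, mem_nb, hadjσ _ _ (fun h' => hw h'.1)]
      have h2 : w ≠ τ.s := by rintro rfl; exact hw hsτ
      have h3 : w ≠ y := by rintro rfl; exact hw hτ.start_mem
      have := hσ.deg w
      rw [h1, if_neg h2, if_neg h3]; omega
  have hdeg : ∀ w, (nb (L ⊔ edge σ.s τ.s) w).card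
      = (nb F w).card + (if w = x then 1 else 0) + (if w = y then 1 else 0) := by
    intro w
    rw [card_nb_sup_edge hst.ne hLst]
    exact hdegL w
  have hxy : x ≠ y := by rintro rfl; exact hdisj _ hσ.start_mem hτ.start_mem
  refine ⟨L ⊔ edge σ.s τ.s, ⟨sup_le hLK ?_, ?_, hfree.sup_edge (hnear _ hsσ _ hsτ)⟩,
    fun w => by rw [hdeg]; omega, ?_⟩
  · rw [edge_le_iff]; exact Or.inr hst
  · intro w
    rw [hdeg]
    have := hF.2.1 w
    by_cases h1 : w = x
    · rw [if_pos h1, if_neg (fun h => hxy (h1.symm.trans h)), h1]; omega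
    · rw [if_neg h1]
      split_ifs with h2
      · rw [h2]; omega
      · omega
  · apply Finset.sum_lt_sum
    · intro w _; rw [hdeg]; omega
    · exact ⟨x, mem_univ _, by rw [hdeg, if_pos (rfl : x = x)]; omega⟩

end Rotations

section Balls
open Finset
open scoped Classical

variable {V : Type} [Fintype V] {F : SimpleGraph V}

/-- The ball of radius `r` about `p`. -/
noncomputable def nball (F : SimpleGraph V) (r : ℕ) (p : V) : Finset V :=
  univ.filter (fun x => Near F r p x)

theorem mem_nball {r : ℕ} {p x : V} : x ∈ nball F r p ↔ Near F r p x := by simp [nball]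

theorem nball_mono {r r' : ℕ} (h : r ≤ r') (p : V) : nball F r p ⊆ nball F r' p := by
  intro x hx; rw [mem_nball] at hx ⊢; exact hx.mono h

theorem Near.succ_iff {r : ℕ} {p x : V} :
    Near F (r + 1) p x ↔ Near F r p x ∨ ∃ y, Near F r p y ∧ F.Adj y x := by
  constructor
  · rintro ⟨w, hw⟩
    by_cases h : w.length ≤ r
    · exact Or.inl ⟨w, h⟩
    · right
      have h3 := w.adj_getVert_succ (i := r) (by omega)
      have h4 : w.getVert (r + 1) = x := w.getVert_of_length_le (by omega)
      rw [h4] at h3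
      exact ⟨w.getVert r, ⟨w.take r, by simp⟩, h3⟩
  · rintro (h | ⟨y, h, h2⟩)
    · exact h.mono (by omega)
    · exact h.trans (Near.of_adj h2)

theorem card_nball_le (h2 : ∀ v, (nb F v).card ≤ 2) (r : ℕ) (p : V) :
    (nball F r p).card ≤ 2 * r + 1 := by
  have h0 : nball F 0 p = {p} := by
    ext x
    rw [mem_nball, mem_singleton]
    constructor
    · rintro ⟨w, hw⟩
      exact (Walk.eq_of_length_eq_zero (Nat.le_zero.mp hw)).symm
    · rintro rfl; exact Near.refl _ _ _
  have hs : ∀ r, (nball F (r + 1) p \ nball F r p).card ≤ 2 := by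
    intro r
    induction r with
    | zero =>
      refine (card_le_card ?_).trans (h2 p)
      intro x hx
      rw [mem_sdiff, mem_nball, Near.succ_iff, mem_nball] at hx
      rcases hx.1 with h | ⟨y, h, hy⟩
      · exact absurd h hx.2
      · rw [← mem_nball, h0, mem_singleton] at h
        rw [mem_nb, ← h]; exact hy
    | succ r ih =>
      refine le_trans ?_ ih
      have hpar : ∀ x ∈ nball F (r + 1 + 1) p \ nball F (r + 1) p,
          ∃ y ∈ nball F (r + 1) p \ nball F r p, F.Adj y x := by
        intro x hx
        rw [mem_sdiff, mem_nball, Near.succ_iff, mem_nball] at hx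
        rcases hx.1 with h | ⟨y, h, hy⟩
        · exact absurd h hx.2
        · refine ⟨y, ?_, hy⟩
          rw [mem_sdiff, mem_nball, mem_nball]
          exact ⟨h, fun h' => hx.2 (h'.trans (Near.of_adj hy))⟩
      choose! f hf hadj using hpar
      refine card_le_card_of_injOn f (fun x hx => hf x hx) ?_
      intro x hx x' hx' he
      rw [mem_coe] at hx hx'
      have h1 := hf x hx
      rw [mem_sdiff, mem_nball, Near.succ_iff, mem_nball] at h1
      rcases h1.1 with h | ⟨z, hz, hzy⟩
      · exact absurd h h1.2
      have hzx : ∀ x ∈ nball F (r + 1 + 1) p \ nball F (r + 1) p, x ≠ z := by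
        rintro x hx rfl
        rw [mem_sdiff, mem_nball, mem_nball] at hx
        exact hx.2 (hz.mono (by omega))
      by_contra hne
      rcases eq_of_adj_of_card_le_two (h2 (f x)) (hadj x hx) hzy.symm (hzx x hx)
        (he ▸ hadj x' hx') with h | h
      · exact hne h.symm
      · exact hzx x' hx' h
  induction r with
  | zero => rw [h0]; simp
  | succ r ih =>
    have := card_le_card_sdiff_add_card (s := nball F (r + 1) p) (t := nball F r p)
    have := hs r
    omega

theorem nball_subset_of_closed {Z : Finset V} (hZ : ∀ x ∈ Z, ∀ y, F.Adj x y → y ∈ Z) {p : V}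
    (hp : p ∈ Z) (r : ℕ) : nball F r p ⊆ Z := by
  intro x hx
  rw [mem_nball] at hx
  obtain ⟨w, -⟩ := hx
  exact SimpleGraph.Reachable.mem_of_closed (⟨w⟩ : F.Reachable p x) (Z := {z | z ∈ Z}) hp hZ

theorem nball_closed_or_card (r : ℕ) (p : V) :
    (∀ x ∈ nball F r p, ∀ y, F.Adj x y → y ∈ nball F r p) ∨ r + 1 ≤ (nball F r p).card := by
  induction r with
  | zero =>
    right
    exact card_pos.mpr ⟨p, mem_nball.mpr (Near.refl _ _ _)⟩
  | succ r ih =>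
    have hstep : ∀ x ∈ nball F r p, ∀ y, F.Adj x y → y ∈ nball F (r + 1) p := by
      intro x hx y hxy
      rw [mem_nball] at hx ⊢
      exact hx.trans (Near.of_adj hxy)
    rcases ih with h | h
    · left
      have : nball F (r + 1) p = nball F r p :=
        (nball_subset_of_closed h (mem_nball.mpr (Near.refl _ _ _)) _).antisymm
          (nball_mono (by omega) _)
      rw [this]; exact h
    · by_cases he : nball F (r + 1) p = nball F r p
      · left
        intro x hx y hxy
        rw [he] at hx
        exact hstep x hx y hxy
      · right
        have := card_lt_card (Finset.ssubset_iff_subset_ne.mpr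
          ⟨nball_mono (F := F) (by omega : r ≤ r + 1) p, fun h' => he h'.symm⟩)
        omega

theorem card_nball_doubling (h2 : ∀ v, (nb F v).card ≤ 2) {r ℓ : ℕ} {p q : V}
    (hpq : Near F r q p) : (nball F (2 * ℓ) p).card ≤ 5 * (nball F ℓ q).card := by
  rcases nball_closed_or_card (F := F) ℓ q with h | h
  · have hp : p ∈ nball F ℓ q :=
      nball_subset_of_closed h (mem_nball.mpr (Near.refl _ _ _)) r (mem_nball.mpr hpq)
    have := card_le_card (nball_subset_of_closed h hp (2 * ℓ))
    omega
  · have := card_nball_le h2 (2 * ℓ) p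
    omega

/-- A weighted cover by balls of radius `2ℓ` of bounded overlap, in which near vertices
share a ball. -/
theorem exists_ball_weights (h2 : ∀ v, (nb F v).card ≤ 2) (ℓ : ℕ) :
    ∃ w : V → ℝ, (∀ q, 0 ≤ w q) ∧
      (∀ p, ∑ q, (if p ∈ nball F (2 * ℓ) q then w q else 0) ≤ 25) ∧
      ∀ p p', Near F ℓ p p' →
        1 ≤ ∑ q, (if p ∈ nball F (2 * ℓ) q ∧ p' ∈ nball F (2 * ℓ) q then w q else 0) := by
  have hpos : ∀ r q, (0:ℝ) < (nball F r q).card := fun r q => by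
    exact_mod_cast card_pos.mpr ⟨q, mem_nball.mpr (Near.refl _ _ _)⟩
  have hsymm : ∀ r p q, p ∈ nball F r q ↔ q ∈ nball F r p := by
    intro r p q
    rw [mem_nball, mem_nball]
    exact ⟨Near.symm, Near.symm⟩
  refine ⟨fun q => 5 / (nball F ℓ q).card, fun q => by positivity, ?_, ?_⟩
  · intro p
    rw [← Finset.sum_filter]
    have hf : univ.filter (fun q => p ∈ nball F (2 * ℓ) q) = nball F (2 * ℓ) p := by
      ext q; simp [hsymm (2 * ℓ) p q]
    rw [hf]
    have : ∀ q ∈ nball F (2 * ℓ) p,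
        (5:ℝ) / (nball F ℓ q).card ≤ 25 / (nball F (2 * ℓ) p).card := by
      intro q hq
      have h := card_nball_doubling h2 (ℓ := ℓ) (mem_nball.mp hq).symm
      have h' : ((nball F (2 * ℓ) p).card : ℝ) ≤ 5 * (nball F ℓ q).card := by exact_mod_cast h
      rw [div_le_div_iff₀ (hpos _ _) (hpos _ _)]
      linarith
    refine (Finset.sum_le_sum this).trans ?_
    rw [sum_const, nsmul_eq_mul, mul_div_cancel₀ _ (hpos _ _).ne']
  · intro p p' hn
    rw [← Finset.sum_filter]
    have hsub : nball F ℓ p ⊆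
        univ.filter (fun q => p ∈ nball F (2 * ℓ) q ∧ p' ∈ nball F (2 * ℓ) q) := by
      intro q hq
      rw [mem_nball] at hq
      simp only [mem_filter, mem_univ, true_and, mem_nball]
      exact ⟨hq.symm.mono (by omega), (hq.symm.trans hn).mono (by omega)⟩
    refine le_trans ?_ (Finset.sum_le_sum_of_subset_of_nonneg hsub
      (fun q _ _ => by positivity))
    have : ∀ q ∈ nball F ℓ p, (1:ℝ) / (nball F ℓ p).card ≤ 5 / (nball F ℓ q).card := by
      intro q hq
      have h := (card_le_card (nball_mono (F := F) (by omega : ℓ ≤ 2 * ℓ) q)).trans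
        (card_nball_doubling h2 (ℓ := ℓ) (mem_nball.mp hq))
      have h' : ((nball F ℓ q).card : ℝ) ≤ 5 * (nball F ℓ p).card := by exact_mod_cast h
      rw [div_le_div_iff₀ (hpos _ _) (hpos _ _)]
      linarith
    refine le_trans ?_ (Finset.sum_le_sum this)
    rw [sum_const, nsmul_eq_mul, mul_one_div_cancel (hpos _ _).ne']

end Balls

section Operators
open Finset
open scoped Classical

variable {V : Type} [Fintype V] {G F : SimpleGraph V} {d : ℕ} {lam : ℝ}

/-- The Euclidean norm. -/
noncomputable def l2 (x : V → ℝ) : ℝ := Real.sqrt (∑ u, x u ^ 2)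

/-- The adjacency operator. -/
noncomputable def nbSum (G : SimpleGraph V) (x : V → ℝ) (v : V) : ℝ := ∑ s ∈ nb G v, x s

theorem l2_nonneg (x : V → ℝ) : 0 ≤ l2 x := Real.sqrt_nonneg _

theorem l2_sq (x : V → ℝ) : l2 x ^ 2 = ∑ u, x u ^ 2 :=
  Real.sq_sqrt (Finset.sum_nonneg fun _ _ => sq_nonneg _)

theorem l2_mono {x y : V → ℝ} (h0 : ∀ u, 0 ≤ x u) (h : ∀ u, x u ≤ y u) : l2 x ≤ l2 y :=
  Real.sqrt_le_sqrt (Finset.sum_le_sum fun u _ => pow_le_pow_left₀ (h0 u) (h u) 2)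

theorem l2_add_le (x y : V → ℝ) : l2 (fun u => x u + y u) ≤ l2 x + l2 y := by
  have h := norm_add_le (WithLp.toLp 2 x : EuclideanSpace ℝ V) (WithLp.toLp 2 y)
  simpa [EuclideanSpace.norm_eq, l2] using h

theorem sum_le_sqrt_mul_l2 (B : Finset V) {x : V → ℝ} (hx : ∀ u ∉ B, x u = 0) :
    ∑ u, x u ≤ Real.sqrt B.card * l2 x := by
  rw [l2, ← Real.sqrt_mul (Nat.cast_nonneg _)]
  refine Real.le_sqrt_of_sq_le ?_
  have h1 : ∑ u, x u = ∑ u ∈ B, x u :=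
    (Finset.sum_subset (subset_univ _) (fun u _ hu => hx u hu)).symm
  rw [h1]
  refine sq_sum_le_card_mul_sum_sq.trans ?_
  gcongr
  exact subset_univ _

theorem nbSum_nonneg {x : V → ℝ} (h : ∀ u, 0 ≤ x u) (v : V) : 0 ≤ nbSum G x v :=
  Finset.sum_nonneg fun u _ => h u

theorem sum_nb_comm (G : SimpleGraph V) (φ : V → V → ℝ) :
    ∑ u, ∑ v ∈ nb G u, φ u v = ∑ v, ∑ u ∈ nb G v, φ u v := by
  rw [Finset.sum_sigma', Finset.sum_sigma']
  refine Finset.sum_nbij' (fun p => ⟨p.2, p.1⟩) (fun p => ⟨p.2, p.1⟩) ?_ ?_ ?_ ?_ ?_ <;>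
    simp [mem_nb, adj_comm]

theorem Pseudorandom.sum_nbSum (P : Pseudorandom G d lam) (x : V → ℝ) :
    ∑ v, nbSum G x v = d * ∑ v, x v := by
  simp only [nbSum]
  rw [sum_nb_comm G (fun _ v => x v), Finset.mul_sum]
  refine Finset.sum_congr rfl fun v _ => ?_
  rw [sum_const, P.card_nb, nsmul_eq_mul]

theorem Pseudorandom.bilinear_le (P : Pseudorandom G d lam) (x y : V → ℝ) :
    ∑ u, ∑ v ∈ nb G u, x u * y v
      ≤ (d : ℝ) / Fintype.card V * ((∑ u, x u) * ∑ v, y v) + lam * (l2 x * l2 y) := by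
  have h := (abs_le.mp (P.mix x y)).2
  simp only [l2]
  linarith

theorem Pseudorandom.le_bilinear (P : Pseudorandom G d lam) (x y : V → ℝ) :
    (d : ℝ) / Fintype.card V * ((∑ u, x u) * ∑ v, y v) - lam * (l2 x * l2 y)
      ≤ ∑ u, ∑ v ∈ nb G u, x u * y v := by
  have h := (abs_le.mp (P.mix x y)).1
  simp only [l2]
  linarith

theorem Pseudorandom.l2_nbSum_le (P : Pseudorandom G d lam) (hl : 0 ≤ lam) {x : V → ℝ}
    (hx : ∀ u, 0 ≤ x u) :
    l2 (nbSum G x) ≤ d / Real.sqrt (Fintype.card V) * (∑ u, x u) + lam * l2 x := by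
  set n : ℝ := (Fintype.card V : ℝ)
  have hS : 0 ≤ ∑ u, x u := Finset.sum_nonneg fun u _ => hx u
  by_cases h0 : l2 (nbSum G x) = 0
  · rw [h0]
    have := l2_nonneg x
    positivity
  have hpos : 0 < l2 (nbSum G x) := lt_of_le_of_ne (l2_nonneg _) (Ne.symm h0)
  have h1 := P.bilinear_le (nbSum G x) x
  have h2 : ∑ u, ∑ v ∈ nb G u, nbSum G x u * x v = l2 (nbSum G x) ^ 2 := by
    rw [l2_sq]
    refine Finset.sum_congr rfl fun u _ => ?_
    rw [← Finset.mul_sum, sq]; rfl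
  have h3 : ∑ u, nbSum G x u ≤ Real.sqrt n * l2 (nbSum G x) :=
    sum_le_sqrt_mul_l2 univ (fun u hu => absurd (mem_univ u) hu)
  rw [h2] at h1
  have hn : (d : ℝ) / n * (Real.sqrt n) = d / Real.sqrt n := by
    by_cases hn0 : n = 0
    · simp [hn0]
    · have : Real.sqrt n * Real.sqrt n = n := Real.mul_self_sqrt (Nat.cast_nonneg _)
      have hs : Real.sqrt n ≠ 0 := by
        intro h; rw [h] at this; simp at this; exact hn0 this.symm
      field_simp
      rw [sq, this]
  have h4 : (d : ℝ) / n * ((∑ u, nbSum G x u) * ∑ v, x v)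
      ≤ l2 (nbSum G x) * (d / Real.sqrt n * ∑ v, x v) := by
    rw [← hn]
    calc (d : ℝ) / n * ((∑ u, nbSum G x u) * ∑ v, x v)
        ≤ (d : ℝ) / n * ((Real.sqrt n * l2 (nbSum G x)) * ∑ v, x v) := by
          gcongr
      _ = _ := by ring
  refine le_of_mul_le_mul_left ?_ hpos
  nlinarith

theorem l2_nbSum_le_of_card_le_two (hF : ∀ v, (nb F v).card ≤ 2) (x : V → ℝ) :
    l2 (nbSum F x) ≤ 2 * l2 x := by
  have h : ∑ u, nbSum F x u ^ 2 ≤ 4 * ∑ u, x u ^ 2 := by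
    have h1 : ∀ u, nbSum F x u ^ 2 ≤ ∑ v ∈ nb F u, 2 * x v ^ 2 := by
      intro u
      refine sq_sum_le_card_mul_sum_sq.trans ?_
      rw [← Finset.mul_sum]
      have : ((nb F u).card : ℝ) ≤ 2 := by exact_mod_cast hF u
      exact mul_le_mul_of_nonneg_right this (Finset.sum_nonneg fun _ _ => sq_nonneg _)
    refine (Finset.sum_le_sum fun u _ => h1 u).trans ?_
    rw [sum_nb_comm F (fun _ v => 2 * x v ^ 2), Finset.mul_sum]
    refine Finset.sum_le_sum fun v _ => ?_
    rw [sum_const, nsmul_eq_mul]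
    have : ((nb F v).card : ℝ) ≤ 2 := by exact_mod_cast hF v
    nlinarith [sq_nonneg (x v)]
  rw [l2, l2, show (2:ℝ) = Real.sqrt 4 by
    rw [show (4:ℝ) = 2 ^ 2 by norm_num]; exact (Real.sqrt_sq (by norm_num)).symm,
    ← Real.sqrt_mul (by norm_num)]
  exact Real.sqrt_le_sqrt h

theorem sum_nbSum_le_of_card_le_two (hF : ∀ v, (nb F v).card ≤ 2) {x : V → ℝ}
    (hx : ∀ u, 0 ≤ x u) : ∑ v, nbSum F x v ≤ 2 * ∑ v, x v := by
  simp only [nbSum]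
  rw [sum_nb_comm F (fun _ v => x v), Finset.mul_sum]
  refine Finset.sum_le_sum fun v _ => ?_
  rw [sum_const, nsmul_eq_mul]
  have : ((nb F v).card : ℝ) ≤ 2 := by exact_mod_cast hF v
  exact mul_le_mul_of_nonneg_right this (hx v)

/-- One step along `G` followed by one step along `F`. -/
noncomputable def rotOp (G F : SimpleGraph V) (x : V → ℝ) : V → ℝ := nbSum F (nbSum G x)

theorem Pseudorandom.l2_rotOp_le (P : Pseudorandom G d lam) (hl : 0 ≤ lam)
    (hF : ∀ v, (nb F v).card ≤ 2) {x : V → ℝ} (hx : ∀ u, 0 ≤ x u) :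
    l2 (rotOp G F x) ≤ 2 * (d / Real.sqrt (Fintype.card V) * (∑ u, x u) + lam * l2 x) :=
  (l2_nbSum_le_of_card_le_two hF _).trans
    (mul_le_mul_of_nonneg_left (P.l2_nbSum_le hl hx) (by norm_num))

theorem Pseudorandom.sum_rotOp_le (P : Pseudorandom G d lam) (hF : ∀ v, (nb F v).card ≤ 2)
    {x : V → ℝ} (hx : ∀ u, 0 ≤ x u) : ∑ v, rotOp G F x v ≤ 2 * (d * ∑ v, x v) := by
  rw [← P.sum_nbSum]
  exact sum_nbSum_le_of_card_le_two hF (nbSum_nonneg hx)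

end Operators

section Totals
open Finset
open scoped Classical

variable {V : Type} [Fintype V] {St : Type}

/-- The sum of `φ` over all states reachable from `init` by exactly `i` allowed steps, with
multiplicity. -/
noncomputable def total {X : Finset V} (init : X → St) (allowed : St → Finset V)
    (step : St → V → St) : ℕ → (St → ℝ) → ℝ
  | 0, φ => ∑ x, φ (init x)
  | i + 1, φ => total init allowed step i (fun σ => ∑ v ∈ allowed σ, φ (step σ v))

variable {X : Finset V} {init : X → St} {allowed : St → Finset V} {step : St → V → St}

theorem total_mono {φ ψ : St → ℝ} (h : ∀ σ, φ σ ≤ ψ σ) (i : ℕ) :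
    total init allowed step i φ ≤ total init allowed step i ψ := by
  induction i generalizing φ ψ with
  | zero => exact Finset.sum_le_sum fun x _ => h _
  | succ i ih => exact ih fun σ => Finset.sum_le_sum fun v _ => h _

theorem total_sum {ι : Type} (s : Finset ι) (φ : ι → St → ℝ) (i : ℕ) :
    total init allowed step i (fun σ => ∑ j ∈ s, φ j σ)
      = ∑ j ∈ s, total init allowed step i (φ j) := by
  induction i generalizing φ with
  | zero => exact Finset.sum_comm
  | succ i ih =>
    simp only [total]
    rw [← ih]
    congr 1
    ext σ
    exact Finset.sum_comm

theorem total_mul (c : ℝ) (φ : St → ℝ) (i : ℕ) :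
    total init allowed step i (fun σ => c * φ σ) = c * total init allowed step i φ := by
  induction i generalizing φ with
  | zero => simp only [total, Finset.mul_sum]
  | succ i ih =>
    simp only [total]
    rw [← ih]
    congr 1
    ext σ
    rw [Finset.mul_sum]

theorem total_add (φ ψ : St → ℝ) (i : ℕ) :
    total init allowed step i (fun σ => φ σ + ψ σ)
      = total init allowed step i φ + total init allowed step i ψ := by
  induction i generalizing φ ψ with
  | zero => exact Finset.sum_add_distrib
  | succ i ih =>
    simp only [total]
    rw [← ih]
    congr 1
    ext σ
    rw [Finset.sum_add_distrib]

theorem total_nonneg {φ : St → ℝ} (h : ∀ σ, 0 ≤ φ σ) (i : ℕ) :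
    0 ≤ total init allowed step i φ := by
  have := total_mono (init := init) (allowed := allowed) (step := step) h i
  have h0 := total_mul (init := init) (allowed := allowed) (step := step) 0 φ i
  simp only [zero_mul] at h0
  linarith

end Totals

section RotSystems
open Finset
open scoped Classical

variable {V : Type} [Fintype V] {St : Type} {G F : SimpleGraph V} {d κ : ℕ} {lam : ℝ}

/-- An abstract rotation process: states `σ` have a current end `e σ` and a set `E σ` of
all ends so far. -/
structure RotSystem (G F : SimpleGraph V) (κ : ℕ) {X : Finset V} (init : X → St)
    (e : St → V) (E : St → Finset V) (allowed : St → Finset V) (step : St → V → St) : Prop where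
  e_init : ∀ x, e (init x) = x
  E_init : ∀ x, E (init x) = {(x : V)}
  mem_nb : ∀ σ, ∀ v ∈ allowed σ, v ∈ nb G (e σ)
  adj : ∀ σ, ∀ v ∈ allowed σ, F.Adj v (e (step σ v))
  E_step : ∀ σ, ∀ v ∈ allowed σ, E (step σ v) = insert (e (step σ v)) (E σ)
  many : ∀ σ, κ ≤ (allowed σ).card
    + ((nb G (e σ)).filter (fun v => ∃ p ∈ E σ, v = p ∨ F.Adj p v)).card

namespace RotSystem

variable {X : Finset V} {init : X → St} {e : St → V} {E : St → Finset V}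
  {allowed : St → Finset V} {step : St → V → St}

/-- Number of states of level `i` with end `p`. -/
noncomputable def freq (init : X → St) (e : St → V) (allowed : St → Finset V)
    (step : St → V → St) (i : ℕ) (p : V) : ℝ :=
  total init allowed step i (fun σ => if e σ = p then 1 else 0)

/-- Number of pairs of a state of level `i` with end `s` and an earlier end in `B`. -/
noncomputable def hit (init : X → St) (e : St → V) (E : St → Finset V) (allowed : St → Finset V)
    (step : St → V → St) (i : ℕ) (B : Finset V) (s : V) : ℝ :=
  total init allowed step i (fun σ => if e σ = s then ((E σ ∩ B).card : ℝ) else 0)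

/-- Number of states of level `i`. -/
noncomputable def count (init : X → St) (allowed : St → Finset V)
    (step : St → V → St) (i : ℕ) : ℝ := total init allowed step i (fun _ => 1)

/-- The restriction of `freq` to `B`. -/
noncomputable def freqOn (init : X → St) (e : St → V) (allowed : St → Finset V)
    (step : St → V → St) (i : ℕ) (B : Finset V) (p : V) : ℝ :=
  if p ∈ B then freq init e allowed step i p else 0

/-- An upper bound for the norm of `hit`. -/
noncomputable def bd (lam : ℝ) (init : X → St) (e : St → V) (allowed : St → Finset V)
    (step : St → V → St) (B : Finset V) : ℕ → ℝ
  | 0 => l2 (freqOn init e allowed step 0 B)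
  | i + 1 => 2 * lam * bd lam init e allowed step B i + l2 (freqOn init e allowed step (i + 1) B)

theorem freq_nonneg (i : ℕ) (p : V) : 0 ≤ freq init e allowed step i p :=
  total_nonneg (fun σ => by split_ifs <;> norm_num) i

theorem hit_nonneg (i : ℕ) (B : Finset V) (p : V) : 0 ≤ hit init e E allowed step i B p :=
  total_nonneg (fun σ => by split_ifs <;> positivity) i

theorem bd_nonneg (hl : 0 ≤ lam) (B : Finset V) (i : ℕ) :
    0 ≤ bd lam init e allowed step B i := by
  induction i with
  | zero => exact l2_nonneg _
  | succ i ih =>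
    have := l2_nonneg (freqOn init e allowed step (i + 1) B)
    simp only [bd]; positivity

theorem sum_freq (i : ℕ) :
    ∑ p, freq init e allowed step i p = count init allowed step i := by
  unfold freq count
  rw [← total_sum]
  congr 1
  ext σ
  simp

theorem freq_zero (h : RotSystem G F κ init e E allowed step) (p : V) :
    freq init e allowed step 0 p = if p ∈ X then 1 else 0 := by
  simp only [freq, total, h.e_init]
  rw [Finset.sum_coe_sort X (fun x => if x = p then (1:ℝ) else 0)]
  simp

theorem count_zero : count init allowed step 0 = X.card := by
  simp [count, total]

theorem step_le (h : RotSystem G F κ init e E allowed step) (σ : St) (p : V) {c : ℝ}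
    (hc : 0 ≤ c) : ∑ v ∈ allowed σ, (if e (step σ v) = p then c else 0)
      ≤ ∑ v ∈ nb F p, ∑ s ∈ nb G v, (if e σ = s then c else 0) := by
  have h1 : ∀ v, ∑ s ∈ nb G v, (if e σ = s then c else 0) = if v ∈ nb G (e σ) then c else 0 := by
    intro v
    rw [Finset.sum_ite_eq]
    simp [_root_.mem_nb, adj_comm]
  simp only [h1]
  rw [← Finset.sum_filter, ← Finset.sum_filter, sum_const, sum_const]
  refine nsmul_le_nsmul_left hc (card_le_card ?_)
  intro v hv
  rw [mem_filter] at hv ⊢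
  have := h.adj σ v hv.1
  rw [hv.2] at this
  exact ⟨_root_.mem_nb.mpr this.symm, h.mem_nb σ v hv.1⟩

theorem total_rotOp (φ : St → ℝ) (i : ℕ) (p : V) :
    total init allowed step i
      (fun σ => ∑ v ∈ nb F p, ∑ s ∈ nb G v, (if e σ = s then φ σ else 0))
    = rotOp G F (fun s => total init allowed step i (fun σ => if e σ = s then φ σ else 0)) p := by
  rw [total_sum]
  refine Finset.sum_congr rfl fun v _ => ?_
  rw [total_sum]
  rfl

theorem freq_succ (h : RotSystem G F κ init e E allowed step) (i : ℕ) (p : V) :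
    freq init e allowed step (i + 1) p ≤ rotOp G F (freq init e allowed step i) p := by
  unfold freq
  rw [← total_rotOp]
  exact total_mono (fun σ => h.step_le σ p zero_le_one) i

theorem hit_zero (h : RotSystem G F κ init e E allowed step) (B : Finset V) (s : V) :
    hit init e E allowed step 0 B s = freqOn init e allowed step 0 B s := by
  simp only [hit, freqOn, freq, total, h.e_init, h.E_init]
  split_ifs with hs
  · refine Finset.sum_congr rfl fun x _ => ?_
    split_ifs with hx
    · rw [hx, singleton_inter_of_mem hs]; simp
    · rfl
  · refine Finset.sum_eq_zero fun x _ => ?_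
    split_ifs with hx
    · rw [hx, singleton_inter_of_notMem hs]; simp
    · rfl

theorem hit_succ (h : RotSystem G F κ init e E allowed step) (i : ℕ) (B : Finset V) (s : V) :
    hit init e E allowed step (i + 1) B s
      ≤ rotOp G F (hit init e E allowed step i B) s + freqOn init e allowed step (i + 1) B s := by
  have h1 : ∀ σ, ∑ v ∈ allowed σ,
      (if e (step σ v) = s then ((E (step σ v) ∩ B).card : ℝ) else 0)
      ≤ (∑ v ∈ nb F s, ∑ t ∈ nb G v, (if e σ = t then ((E σ ∩ B).card : ℝ) else 0))
        + (if s ∈ B then 1 else 0) * ∑ v ∈ allowed σ, (if e (step σ v) = s then 1 else 0) := by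
    intro σ
    refine le_trans ?_ (add_le_add (h.step_le σ s (c := ((E σ ∩ B).card : ℝ))
      (Nat.cast_nonneg _)) le_rfl)
    rw [Finset.mul_sum, ← Finset.sum_add_distrib]
    refine Finset.sum_le_sum fun v hv => ?_
    by_cases hs : e (step σ v) = s
    · simp only [if_pos hs, mul_one]
      rw [h.E_step σ v hv, hs]
      by_cases hB : s ∈ B
      · rw [if_pos hB, insert_inter_of_mem hB]
        exact_mod_cast card_insert_le _ _
      · rw [if_neg hB, insert_inter_of_notMem hB]; simp
    · simp [hs]
  unfold hit
  rw [← total_rotOp]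
  refine (total_mono h1 i).trans (le_of_eq ?_)
  rw [total_add, total_mul]
  congr 1
  unfold freqOn freq
  split_ifs <;> simp [total]

theorem hit_bounds (h : RotSystem G F κ init e E allowed step) (P : Pseudorandom G d lam)
    (hl : 0 ≤ lam) {C : ℝ} (hC : 1 ≤ C) (hlam : lam * C = d) (hF : ∀ v, (nb F v).card ≤ 2)
    (B : Finset V) (i : ℕ) :
    ∑ s, hit init e E allowed step i B s
      ≤ C ^ i * Real.sqrt B.card * bd lam init e allowed step B i ∧
    l2 (hit init e E allowed step i B)
      ≤ (1 + i * (C ^ i * Real.sqrt B.card / Real.sqrt (Fintype.card V)))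
        * bd lam init e allowed step B i := by
  set b := Real.sqrt B.card
  set m := Real.sqrt (Fintype.card V)
  have hb : 0 ≤ b := Real.sqrt_nonneg _
  have hm : 0 ≤ m := Real.sqrt_nonneg _
  have hon : ∀ i, ∑ s, freqOn init e allowed step i B s
      ≤ b * l2 (freqOn init e allowed step i B) := fun i =>
    sum_le_sqrt_mul_l2 B (fun u hu => by simp [freqOn, hu])
  induction i with
  | zero =>
    have h0 : hit init e E allowed step 0 B = freqOn init e allowed step 0 B := by
      ext s; exact h.hit_zero B s
    rw [h0]
    constructor
    · simpa [bd] using hon 0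
    · simp [bd]
  | succ i ih =>
    set y := bd lam init e allowed step B i with hy
    have hy0 : 0 ≤ y := bd_nonneg hl B i
    set f := l2 (freqOn init e allowed step (i + 1) B) with hf
    have hf0 : 0 ≤ f := l2_nonneg _
    have hbd : bd lam init e allowed step B (i + 1) = 2 * lam * y + f := rfl
    rw [hbd]
    have hCi : 1 ≤ C ^ (i + 1) := one_le_pow₀ hC
    have hCi' : C ^ i ≤ C ^ (i + 1) := pow_le_pow_right₀ hC (Nat.le_succ i)
    have hCp : 0 ≤ C ^ i := by positivity
    constructor
    · have h1 : ∑ s, hit init e E allowed step (i + 1) B s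
          ≤ 2 * (d * (C ^ i * b * y)) + b * f := by
        refine (Finset.sum_le_sum fun s _ => h.hit_succ i B s).trans ?_
        rw [Finset.sum_add_distrib]
        refine add_le_add ((P.sum_rotOp_le hF (hit_nonneg i B)).trans ?_) (hon _)
        have := ih.1
        gcongr
      refine h1.trans ?_
      rw [← hlam]
      have h2 : b * f ≤ C ^ (i + 1) * (b * f) := le_mul_of_one_le_left (by positivity) hCi
      calc 2 * (lam * C * (C ^ i * b * y)) + b * f
          ≤ 2 * (lam * C * (C ^ i * b * y)) + C ^ (i + 1) * (b * f) := by linarith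
        _ = _ := by ring
    · have h1 : l2 (hit init e E allowed step (i + 1) B)
          ≤ 2 * (d / m * (C ^ i * b * y) + lam * ((1 + i * (C ^ i * b / m)) * y)) + f := by
        refine (l2_mono (hit_nonneg _ B) (h.hit_succ i B)).trans ?_
        refine (l2_add_le _ _).trans ?_
        refine add_le_add ((P.l2_rotOp_le hl hF (hit_nonneg i B)).trans ?_) le_rfl
        have h2 := ih.1
        have h3 := ih.2
        gcongr
      refine h1.trans ?_
      rw [← hlam]
      have h4 : 0 ≤ b / m := div_nonneg hb hm
      have e1 : 2 * (lam * C / m * (C ^ i * b * y) + lam * ((1 + i * (C ^ i * b / m)) * y)) + f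
          = 2 * lam * y * (1 + (C ^ (i + 1) + i * C ^ i) * (b / m)) + f := by ring
      have e2 : (1 + ((i + 1 : ℕ) : ℝ) * (C ^ (i + 1) * b / m)) * (2 * lam * y + f)
          = 2 * lam * y * (1 + (C ^ (i + 1) + i * C ^ (i + 1)) * (b / m))
            + f * (1 + ((i + 1 : ℕ) : ℝ) * (C ^ (i + 1) * (b / m))) := by push_cast; ring
      rw [e1, e2]
      refine add_le_add ?_ ?_
      · gcongr
      · refine le_mul_of_one_le_right hf0 ?_
        have : 0 ≤ ((i + 1 : ℕ) : ℝ) * (C ^ (i + 1) * (b / m)) := by positivity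
        linarith

end RotSystem

end RotSystems

section RotGrowth
open Finset
open scoped Classical

variable {V : Type} [Fintype V] {St : Type} {G F : SimpleGraph V} {d κ : ℕ} {lam : ℝ}

namespace RotSystem

variable {X : Finset V} {init : X → St} {e : St → V} {E : St → Finset V}
  {allowed : St → Finset V} {step : St → V → St}

theorem bilinear_total (φ : St → ℝ) (i : ℕ) :
    ∑ s, ∑ t ∈ nb G s, total init allowed step i (fun σ => if e σ = s then φ σ else 0)
        * total init allowed step i (fun σ => if e σ = t then φ σ else 0)
      = total init allowed step i (fun σ => total init allowed step i
          (fun τ => if e τ ∈ nb G (e σ) then φ σ * φ τ else 0)) := by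
  set T := total init allowed step i with hT
  set γ : V → ℝ := fun t => T (fun σ => if e σ = t then φ σ else 0)
  have h1 : ∀ σ, T (fun τ => if e τ ∈ nb G (e σ) then φ σ * φ τ else 0)
      = ∑ s, (∑ t ∈ nb G s, γ t) * (if e σ = s then φ σ else 0) := by
    intro σ
    have h2 : ∀ τ, (if e τ ∈ nb G (e σ) then φ σ * φ τ else 0)
        = φ σ * ∑ t ∈ nb G (e σ), (if e τ = t then φ τ else 0) := by
      intro τ
      rw [Finset.sum_ite_eq]
      split_ifs <;> simp
    simp only [h2]
    rw [hT, total_mul, total_sum]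
    simp [γ, hT, mul_comm]
  simp only [h1]
  rw [hT, total_sum]
  refine Finset.sum_congr rfl fun s _ => ?_
  rw [total_mul, mul_comm, Finset.mul_sum]

theorem hit_bounds_of_le (h : RotSystem G F κ init e E allowed step) (P : Pseudorandom G d lam)
    (hl : 0 ≤ lam) {C : ℝ} (hC : 1 ≤ C) (hlam : lam * C = d) (hF : ∀ v, (nb F v).card ≤ 2)
    {B : Finset V} {b : ℝ} (hB : (B.card : ℝ) ≤ b) {i J : ℕ} (hi : i ≤ J)
    (hsm : (J + 1) * (C ^ (J + 1) * Real.sqrt b) ≤ Real.sqrt (Fintype.card V)) :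
    C * ∑ s, hit init e E allowed step i B s
      ≤ Real.sqrt (Fintype.card V) * bd lam init e allowed step B i ∧
    l2 (hit init e E allowed step i B) ≤ 2 * bd lam init e allowed step B i := by
  obtain ⟨h1, h2⟩ := h.hit_bounds P hl hC hlam hF B i
  have hy := bd_nonneg (init := init) (e := e) (allowed := allowed) (step := step) hl B i
  set m := Real.sqrt (Fintype.card V)
  have hm : 0 ≤ m := Real.sqrt_nonneg _
  have hsb : Real.sqrt B.card ≤ Real.sqrt b := Real.sqrt_le_sqrt hB
  have hC0 : 0 < C := by linarith
  have hpw : C ^ (i + 1) ≤ C ^ (J + 1) := pow_le_pow_right₀ hC (by omega)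
  have hpw' : C ^ i ≤ C ^ (J + 1) := pow_le_pow_right₀ hC (by omega)
  have hX : 0 ≤ C ^ (J + 1) * Real.sqrt b := by positivity
  have hJ : (0:ℝ) ≤ J := Nat.cast_nonneg _
  constructor
  · calc C * ∑ s, hit init e E allowed step i B s
        ≤ C * (C ^ i * Real.sqrt B.card * bd lam init e allowed step B i) := by gcongr
      _ = (C ^ (i + 1) * Real.sqrt B.card) * bd lam init e allowed step B i := by ring
      _ ≤ (C ^ (J + 1) * Real.sqrt b) * bd lam init e allowed step B i := by gcongr
      _ ≤ m * bd lam init e allowed step B i := by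
          refine mul_le_mul_of_nonneg_right ?_ hy
          nlinarith
  · refine h2.trans (mul_le_mul_of_nonneg_right ?_ hy)
    have : i * (C ^ i * Real.sqrt B.card / m) ≤ 1 := by
      have h3 : i * (C ^ i * Real.sqrt B.card) ≤ m := by
        calc i * (C ^ i * Real.sqrt B.card) ≤ (J + 1) * (C ^ (J + 1) * Real.sqrt b) := by
              gcongr
              exact_mod_cast hi.trans (Nat.le_succ _)
          _ ≤ m := hsm
      rw [← mul_div_assoc]
      exact div_le_one_of_le₀ h3 hm
    linarith

theorem sum_bd_singleton_succ (i : ℕ) :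
    ∑ p, bd lam init e allowed step {p} (i + 1)
      = 2 * lam * ∑ p, bd lam init e allowed step {p} i + count init allowed step (i + 1) := by
  simp only [bd]
  rw [Finset.sum_add_distrib, ← Finset.mul_sum, ← sum_freq (e := e)]
  congr 1
  refine Finset.sum_congr rfl fun p _ => ?_
  have : ∀ u, freqOn init e allowed step (i + 1) {p} u ^ 2
      = if u = p then freq init e allowed step (i + 1) p ^ 2 else 0 := by
    intro u
    by_cases hu : u = p
    · simp [freqOn, hu]
    · simp [freqOn, hu]
  rw [l2]
  simp only [this, Finset.sum_ite_eq', mem_univ, if_true]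
  exact Real.sqrt_sq (freq_nonneg _ _)

theorem sum_bd_singleton_zero :
    ∑ p, bd lam init e allowed step {p} 0 = count init allowed step 0 := by
  rw [← sum_freq (e := e)]
  refine Finset.sum_congr rfl fun p _ => ?_
  have : ∀ u, freqOn init e allowed step 0 {p} u ^ 2
      = if u = p then freq init e allowed step 0 p ^ 2 else 0 := by
    intro u
    by_cases hu : u = p
    · simp [freqOn, hu]
    · simp [freqOn, hu]
  rw [bd, l2]
  simp only [this, Finset.sum_ite_eq', mem_univ, if_true]
  exact Real.sqrt_sq (freq_nonneg _ _)

/-- The number of steps lost because they hit the neighbourhood of earlier ends. -/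
theorem total_blocked_le (h : RotSystem G F κ init e E allowed step) (P : Pseudorandom G d lam)
    (hl : 0 ≤ lam) {C : ℝ} (hC : 1 ≤ C) (hlam : lam * C = d) (hF : ∀ v, (nb F v).card ≤ 2)
    {i J : ℕ} (hi : i ≤ J) (hn : 0 < Fintype.card V)
    (hsm : (J + 1) * (C ^ (J + 1) * Real.sqrt 1) ≤ Real.sqrt (Fintype.card V)) :
    total init allowed step i (fun σ =>
      (((nb G (e σ)).filter (fun v => ∃ p ∈ E σ, v = p ∨ F.Adj p v)).card : ℝ))
      ≤ 7 * lam * ∑ p, bd lam init e allowed step {p} i := by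
  let z : V → V → ℝ := fun p v => if v ∈ insert p (nb F p) then 1 else 0
  have hz : ∀ p, ∑ v, z p v ≤ 3 := by
    intro p
    simp only [z, Finset.sum_boole, Finset.filter_univ_mem]
    have := (card_insert_le p (nb F p)).trans (Nat.succ_le_succ (hF p))
    exact_mod_cast this
  have hz0 : ∀ p, 0 ≤ ∑ v, z p v := fun p => Finset.sum_nonneg fun v _ => by
    simp only [z]; split_ifs <;> norm_num
  have hzl : ∀ p, l2 (z p) ≤ 2 := by
    intro p
    refine Real.sqrt_le_iff.mpr ⟨by norm_num, ?_⟩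
    have : ∑ v, z p v ^ 2 = ∑ v, z p v := by
      refine Finset.sum_congr rfl fun v _ => ?_
      simp only [z]; split_ifs <;> norm_num
    rw [this]; linarith [hz p]
  have h1 : ∀ σ, (((nb G (e σ)).filter (fun v => ∃ p ∈ E σ, v = p ∨ F.Adj p v)).card : ℝ)
      ≤ ∑ p, ∑ s, (∑ v ∈ nb G s, z p v)
          * (if e σ = s then ((E σ ∩ {p}).card : ℝ) else 0) := by
    intro σ
    have h2 : ∀ p, ∑ s, (∑ v ∈ nb G s, z p v)
          * (if e σ = s then ((E σ ∩ {p}).card : ℝ) else 0)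
        = if p ∈ E σ then ∑ v ∈ nb G (e σ), z p v else 0 := by
      intro p
      rw [Finset.sum_eq_single (e σ)]
      · rw [if_pos rfl]
        by_cases hp : p ∈ E σ
        · rw [if_pos hp, inter_singleton_of_mem hp]; simp
        · rw [if_neg hp, inter_singleton_of_notMem hp]; simp
      · intro s _ hs; rw [if_neg (Ne.symm hs), mul_zero]
      · intro hs; exact absurd (mem_univ _) hs
    simp only [h2]
    rw [← Finset.sum_filter, Finset.filter_univ_mem]
    have h3 : ((nb G (e σ)).filter (fun v => ∃ p ∈ E σ, v = p ∨ F.Adj p v))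
        ⊆ (E σ).biUnion (fun p => (nb G (e σ)).filter (fun v => v ∈ insert p (nb F p))) := by
      intro v hv
      rw [mem_filter] at hv
      obtain ⟨hv, p, hp, h4⟩ := hv
      rw [mem_biUnion]
      refine ⟨p, hp, ?_⟩
      refine mem_filter.mpr ⟨hv, ?_⟩
      rcases h4 with rfl | h4
      · exact mem_insert_self _ _
      · exact mem_insert_of_mem (_root_.mem_nb.mpr h4)
    have h4 := (card_le_card h3).trans card_biUnion_le
    refine (Nat.cast_le.mpr h4).trans ?_
    push_cast
    refine Finset.sum_le_sum fun p _ => le_of_eq ?_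
    simp only [z, Finset.sum_boole]
  refine (total_mono h1 i).trans ?_
  rw [total_sum, Finset.mul_sum]
  refine Finset.sum_le_sum fun p _ => ?_
  rw [total_sum]
  have h5 : ∀ s, total init allowed step i (fun σ => (∑ v ∈ nb G s, z p v)
      * (if e σ = s then ((E σ ∩ {p}).card : ℝ) else 0))
      = ∑ v ∈ nb G s, hit init e E allowed step i {p} s * z p v := by
    intro s
    rw [total_mul, mul_comm, Finset.mul_sum]; rfl
  simp only [h5]
  refine (P.bilinear_le _ _).trans ?_
  obtain ⟨hb1, hb2⟩ := h.hit_bounds_of_le P hl hC hlam hF (B := {p}) (b := 1) (by simp) hi hsm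
  have hS0 : 0 ≤ ∑ s, hit init e E allowed step i {p} s :=
    Finset.sum_nonneg fun s _ => hit_nonneg _ _ _
  set S := ∑ s, hit init e E allowed step i {p} s
  set y := bd lam init e allowed step {p} i
  have hy : 0 ≤ y := bd_nonneg hl _ _
  set n : ℝ := (Fintype.card V : ℝ)
  have hn1 : (1:ℝ) ≤ n := by simp only [n]; exact_mod_cast hn
  have hsq : Real.sqrt n ≤ n := by
    rw [Real.sqrt_le_left (by linarith)]; nlinarith
  have h6 : (d : ℝ) / n * (S * ∑ v, z p v) ≤ 3 * lam * y := by
    have h7 : C * S ≤ n * y := hb1.trans (mul_le_mul_of_nonneg_right hsq hy)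
    calc (d : ℝ) / n * (S * ∑ v, z p v) ≤ (d : ℝ) / n * (S * 3) := by
          gcongr; exact hz p
      _ = 3 * lam * (C * S) / n := by rw [← hlam]; ring
      _ ≤ 3 * lam * (n * y) / n := by gcongr
      _ = 3 * lam * y := by field_simp
  have h8 : lam * (l2 (hit init e E allowed step i {p}) * l2 (z p)) ≤ lam * ((2 * y) * 2) := by
    have := hzl p
    have := l2_nonneg (z p)
    gcongr
  linarith

theorem growth (h : RotSystem G F κ init e E allowed step) (P : Pseudorandom G d lam)
    (hl : 0 ≤ lam) {C : ℝ} (hC : 2 ^ 40 ≤ C) (hlam : lam * C = d) (hd : 0 < d)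
    (hF : ∀ v, (nb F v).card ≤ 2) (hκ : d ≤ 128 * κ)
    {J : ℕ} (hn : 0 < Fintype.card V)
    (hsm : (J + 1) * (C ^ (J + 1) * Real.sqrt 1) ≤ Real.sqrt (Fintype.card V)) :
    ∀ i ≤ J, (∑ p, bd lam init e allowed step {p} i ≤ 2 * count init allowed step i) ∧
      (d : ℝ) * count init allowed step i ≤ 256 * count init allowed step (i + 1) := by
  have hN0 : ∀ i, 0 ≤ count init allowed step i := fun i => total_nonneg (fun _ => zero_le_one) i
  have hd' : (0:ℝ) < d := by exact_mod_cast hd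
  have hlam' : lam * 2 ^ 40 ≤ d := by rw [← hlam]; gcongr
  have hmany : ∀ i, (κ : ℝ) * count init allowed step i ≤ count init allowed step (i + 1)
      + total init allowed step i (fun σ =>
      (((nb G (e σ)).filter (fun v => ∃ p ∈ E σ, v = p ∨ F.Adj p v)).card : ℝ)) := by
    intro i
    simp only [count, total]
    rw [← total_mul, ← total_add]
    refine total_mono (fun σ => ?_) i
    rw [mul_one, sum_const, nsmul_eq_mul, mul_one]
    exact_mod_cast h.many σ
  have hκ' : (d : ℝ) ≤ 128 * κ := by exact_mod_cast hκ
  have hgrow : ∀ i ≤ J, (∑ p, bd lam init e allowed step {p} i ≤ 2 * count init allowed step i) →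
      (d : ℝ) * count init allowed step i ≤ 256 * count init allowed step (i + 1) := by
    intro i hi hy
    have h1 := h.total_blocked_le P hl (by linarith [show (1:ℝ) ≤ 2 ^ 40 by norm_num]) hlam hF hi
      hn hsm
    have h2 := hmany i
    have h3 : 7 * lam * ∑ p, bd lam init e allowed step {p} i
        ≤ 7 * lam * (2 * count init allowed step i) := by gcongr
    have h4 : (d : ℝ) * count init allowed step i ≤ 128 * κ * count init allowed step i :=
      mul_le_mul_of_nonneg_right hκ' (hN0 i)
    have h5 : lam * 2 ^ 40 * count init allowed step i ≤ d * count init allowed step i :=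
      mul_le_mul_of_nonneg_right hlam' (hN0 i)
    have h6 := mul_nonneg hl (hN0 i)
    nlinarith
  intro i
  induction i with
  | zero =>
    intro hi
    have h0 : ∑ p, bd lam init e allowed step {p} 0 ≤ 2 * count init allowed step 0 := by
      rw [sum_bd_singleton_zero]; linarith [hN0 0]
    exact ⟨h0, hgrow 0 hi h0⟩
  | succ i ih =>
    intro hi
    obtain ⟨h1, h2⟩ := ih (by omega)
    have h0 : ∑ p, bd lam init e allowed step {p} (i + 1)
        ≤ 2 * count init allowed step (i + 1) := by
      rw [sum_bd_singleton_succ]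
      have h3 : 2 * lam * ∑ p, bd lam init e allowed step {p} i
        ≤ 2 * lam * (2 * count init allowed step i) := by gcongr
      have h5 : lam * 2 ^ 40 * count init allowed step i ≤ d * count init allowed step i :=
        mul_le_mul_of_nonneg_right hlam' (hN0 i)
      have h6 := mul_nonneg hl (hN0 i)
      nlinarith
    exact ⟨h0, hgrow _ hi h0⟩

theorem sq_l2_rotOp_le (P : Pseudorandom G d lam) (hl : 0 ≤ lam)
    (hF : ∀ v, (nb F v).card ≤ 2) {x : V → ℝ} (hx : ∀ u, 0 ≤ x u) :
    Fintype.card V * l2 (rotOp G F x) ^ 2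
      ≤ 8 * (d ^ 2 * (∑ u, x u) ^ 2 + lam ^ 2 * (Fintype.card V * l2 x ^ 2)) := by
  have h := P.l2_rotOp_le hl hF hx
  set n : ℝ := (Fintype.card V : ℝ)
  have hn0 : 0 ≤ n := Nat.cast_nonneg _
  have hS : 0 ≤ ∑ u, x u := Finset.sum_nonneg fun u _ => hx u
  have h1 := pow_le_pow_left₀ (l2_nonneg _) h 2
  have h2 : n * (d / Real.sqrt n) ^ 2 ≤ d ^ 2 := by
    rw [div_pow, Real.sq_sqrt hn0]
    by_cases h0 : n = 0
    · rw [h0]; simp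
    · rw [mul_div_cancel₀ _ h0]
  have h3 : ∀ a b : ℝ, (2 * (a + b)) ^ 2 ≤ 8 * (a ^ 2 + b ^ 2) := fun a b => by
    nlinarith [sq_nonneg (a - b)]
  have h4 := h1.trans (h3 _ _)
  calc n * l2 (rotOp G F x) ^ 2
      ≤ n * (8 * ((d / Real.sqrt n * ∑ u, x u) ^ 2 + (lam * l2 x) ^ 2)) := by gcongr
    _ = 8 * ((n * (d / Real.sqrt n) ^ 2) * (∑ u, x u) ^ 2 + lam ^ 2 * (n * l2 x ^ 2)) := by ring
    _ ≤ _ := by gcongr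

end RotSystem

end RotGrowth

section RotPairs
open Finset
open scoped Classical

variable {V : Type} [Fintype V] {St : Type} {G F : SimpleGraph V} {d κ : ℕ} {lam : ℝ}

namespace RotSystem

variable {X : Finset V} {init : X → St} {e : St → V} {E : St → Finset V}
  {allowed : St → Finset V} {step : St → V → St}

theorem sq_l2_freq_le (h : RotSystem G F κ init e E allowed step) (P : Pseudorandom G d lam)
    (hl : 0 ≤ lam) {C : ℝ} (hC : 2 ^ 40 ≤ C) (hlam : lam * C = d)
    (hF : ∀ v, (nb F v).card ≤ 2) {J : ℕ} {q : ℝ} (hq : (Fintype.card V : ℝ) ≤ q * X.card)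
    (hq0 : 0 ≤ q)
    (hgrow : ∀ i ≤ J, (d : ℝ) * count init allowed step i ≤ 256 * count init allowed step (i + 1)) :
    ∀ i ≤ J, Fintype.card V * l2 (freq init e allowed step i) ^ 2
      ≤ (2 ^ 20 + (2 ^ 20 / C ^ 2) ^ i * q) * count init allowed step i ^ 2 := by
  have hN0 : ∀ i, 0 ≤ count init allowed step i := fun i => total_nonneg (fun _ => zero_le_one) i
  have hC0 : 0 < C := by linarith [show (0:ℝ) < 2 ^ 40 by norm_num]
  have hψ : (2:ℝ) ^ 20 / C ^ 2 ≤ 1 := by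
    rw [div_le_one (by positivity)]
    nlinarith
  intro i
  induction i with
  | zero =>
    intro _
    have h1 : l2 (freq init e allowed step 0) ^ 2 = X.card := by
      rw [l2_sq]
      simp only [h.freq_zero]
      simp
    rw [h1, count_zero]
    have : (0:ℝ) ≤ X.card := Nat.cast_nonneg _
    nlinarith
  | succ i ih =>
    intro hi
    have h1 := ih (by omega)
    have h2 := hgrow i (by omega)
    set n : ℝ := (Fintype.card V : ℝ)
    set N := count init allowed step i
    set N' := count init allowed step (i + 1)
    have hN : 0 ≤ N := hN0 i
    have hN' : 0 ≤ N' := hN0 (i + 1)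
    have h3 : n * l2 (freq init e allowed step (i + 1)) ^ 2
        ≤ n * l2 (rotOp G F (freq init e allowed step i)) ^ 2 := by
      have h4 := l2_mono (freq_nonneg (init := init) (e := e) (allowed := allowed) (step := step)
        (i + 1)) (h.freq_succ i)
      have h5 := l2_nonneg (freq init e allowed step (i + 1))
      gcongr
    refine h3.trans ((sq_l2_rotOp_le P hl hF (freq_nonneg i)).trans ?_)
    rw [sum_freq]
    have h6 : ((d : ℝ) * N) ^ 2 ≤ 2 ^ 16 * N' ^ 2 := by
      have := pow_le_pow_left₀ (by positivity) h2 2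
      calc _ ≤ _ := this
        _ = _ := by ring
    have h7 : lam ^ 2 * (n * l2 (freq init e allowed step i) ^ 2)
        ≤ lam ^ 2 * ((2 ^ 20 + (2 ^ 20 / C ^ 2) ^ i * q) * N ^ 2) := by gcongr
    have h8 : lam = d / C := by field_simp; exact hlam
    have h9 : lam ^ 2 * ((2 ^ 20 + (2 ^ 20 / C ^ 2) ^ i * q) * N ^ 2)
        = (2 ^ 20 + (2 ^ 20 / C ^ 2) ^ i * q) / C ^ 2 * (d * N) ^ 2 := by rw [h8]; ring
    have h10 : (2 ^ 20 + (2 ^ 20 / C ^ 2) ^ i * q) / C ^ 2 * (d * N) ^ 2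
        ≤ (2 ^ 20 + (2 ^ 20 / C ^ 2) ^ i * q) / C ^ 2 * (2 ^ 16 * N' ^ 2) := by gcongr
    have h11 : 8 * ((2 ^ 20 + (2 ^ 20 / C ^ 2) ^ i * q) / C ^ 2 * (2 ^ 16 * N' ^ 2))
        = (2 ^ 19 * (2 ^ 20 / C ^ 2) + 1 / 2 * ((2 ^ 20 / C ^ 2) ^ (i + 1) * q)) * N' ^ 2 := by
      rw [pow_succ]; ring
    have h12 : 0 ≤ (2 ^ 20 / C ^ 2) ^ (i + 1) * q := by positivity
    have h13 : (2 ^ 19 * (2 ^ 20 / C ^ 2) + 1 / 2 * ((2 ^ 20 / C ^ 2) ^ (i + 1) * q)) * N' ^ 2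
        ≤ (2 ^ 19 + (2 ^ 20 / C ^ 2) ^ (i + 1) * q) * N' ^ 2 := by
      refine mul_le_mul_of_nonneg_right ?_ (sq_nonneg _)
      nlinarith
    have h14 : (0:ℝ) ≤ N' ^ 2 := sq_nonneg _
    nlinarith

theorem sum_ball_sq_bd_le (h : RotSystem G F κ init e E allowed step)
    (P : Pseudorandom G d lam)
    (hl : 0 ≤ lam) {C : ℝ} (hC : 2 ^ 40 ≤ C) (hlam : lam * C = d)
    (hF : ∀ v, (nb F v).card ≤ 2) {J : ℕ} {q : ℝ} (hq : (Fintype.card V : ℝ) ≤ q * X.card)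
    (hq0 : 0 ≤ q)
    (hgrow : ∀ i ≤ J, (d : ℝ) * count init allowed step i ≤ 256 * count init allowed step (i + 1))
    {B : V → Finset V} {w : V → ℝ} (hw0 : ∀ a, 0 ≤ w a)
    (hw : ∀ p, ∑ a, (if p ∈ B a then w a else 0) ≤ 25) :
    ∀ i ≤ J, Fintype.card V * ∑ a, w a * bd lam init e allowed step (B a) i ^ 2
      ≤ 50 * (2 ^ 21 + 2 * ((2 ^ 20 / C ^ 2) ^ i * q)) * count init allowed step i ^ 2 := by
  have hA := h.sq_l2_freq_le P hl hC hlam hF hq hq0 hgrow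
  have hN0 : ∀ i, 0 ≤ count init allowed step i := fun i => total_nonneg (fun _ => zero_le_one) i
  have hC0 : 0 < C := by linarith [show (0:ℝ) < 2 ^ 40 by norm_num]
  have hψ : (2:ℝ) ^ 20 / C ^ 2 ≤ 1 := by
    rw [div_le_one (by positivity)]
    nlinarith
  have hon : ∀ i, ∑ a, w a * l2 (freqOn init e allowed step i (B a)) ^ 2
      ≤ 25 * l2 (freq init e allowed step i) ^ 2 := by
    intro i
    have h1 : ∀ a, w a * l2 (freqOn init e allowed step i (B a)) ^ 2
        = ∑ p, (if p ∈ B a then w a else 0) * freq init e allowed step i p ^ 2 := by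
      intro a
      rw [l2_sq, Finset.mul_sum]
      refine Finset.sum_congr rfl fun p _ => ?_
      unfold freqOn
      split_ifs <;> simp
    simp only [h1]
    rw [Finset.sum_comm, l2_sq, Finset.mul_sum]
    refine Finset.sum_le_sum fun p _ => ?_
    rw [← Finset.sum_mul]
    exact mul_le_mul_of_nonneg_right (hw p) (sq_nonneg _)
  intro i
  set n : ℝ := (Fintype.card V : ℝ)
  have hn : 0 ≤ n := Nat.cast_nonneg _
  induction i with
  | zero =>
    intro hi
    have h1 := hA 0 hi
    have h2 := mul_le_mul_of_nonneg_left (hon 0) hn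
    simp only [bd]
    have h3 : 0 ≤ (2 ^ 20 + (2 ^ 20 / C ^ 2) ^ 0 * q) * count init allowed step 0 ^ 2 := by
      positivity
    nlinarith
  | succ i ih =>
    intro hi
    have h1 := ih (by omega)
    have h2 := hgrow i (by omega)
    have h3 := hA (i + 1) hi
    have h4 := mul_le_mul_of_nonneg_left (hon (i + 1)) hn
    set N := count init allowed step i
    set N' := count init allowed step (i + 1)
    have hN : 0 ≤ N := hN0 i
    set z := ∑ a, w a * bd lam init e allowed step (B a) i ^ 2
    have h5 : ∑ a, w a * bd lam init e allowed step (B a) (i + 1) ^ 2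
        ≤ 8 * lam ^ 2 * z + 2 * ∑ a, w a * l2 (freqOn init e allowed step (i + 1) (B a)) ^ 2 := by
      simp only [z]
      rw [Finset.mul_sum, Finset.mul_sum, ← Finset.sum_add_distrib]
      refine Finset.sum_le_sum fun a _ => ?_
      simp only [bd]
      set y := bd lam init e allowed step (B a) i
      set f := l2 (freqOn init e allowed step (i + 1) (B a))
      have : (2 * lam * y + f) ^ 2 ≤ 8 * lam ^ 2 * y ^ 2 + 2 * f ^ 2 := by
        nlinarith [sq_nonneg (2 * lam * y - f)]
      have := mul_le_mul_of_nonneg_left this (hw0 a)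
      linarith
    have h6 := mul_le_mul_of_nonneg_left h5 hn
    have h7 : ((d : ℝ) * N) ^ 2 ≤ 2 ^ 16 * N' ^ 2 := by
      have := pow_le_pow_left₀ (by positivity) h2 2
      calc _ ≤ _ := this
        _ = _ := by ring
    have h8 : lam = d / C := by field_simp; exact hlam
    have h9 : 8 * lam ^ 2 * (n * z)
        ≤ 8 * lam ^ 2 * (50 * (2 ^ 21 + 2 * ((2 ^ 20 / C ^ 2) ^ i * q)) * N ^ 2) := by gcongr
    have h10 : 8 * lam ^ 2 * (50 * (2 ^ 21 + 2 * ((2 ^ 20 / C ^ 2) ^ i * q)) * N ^ 2)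
        = 8 * (50 * (2 ^ 21 + 2 * ((2 ^ 20 / C ^ 2) ^ i * q))) / C ^ 2 * (d * N) ^ 2 := by
      rw [h8]; ring
    have h11 : 8 * (50 * (2 ^ 21 + 2 * ((2 ^ 20 / C ^ 2) ^ i * q))) / C ^ 2 * (d * N) ^ 2
        ≤ 8 * (50 * (2 ^ 21 + 2 * ((2 ^ 20 / C ^ 2) ^ i * q))) / C ^ 2 * (2 ^ 16 * N' ^ 2) := by
      gcongr
    have h12 : 8 * (50 * (2 ^ 21 + 2 * ((2 ^ 20 / C ^ 2) ^ i * q))) / C ^ 2 * (2 ^ 16 * N' ^ 2)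
        = 50 * (2 ^ 20 * (2 ^ 20 / C ^ 2) + (2 ^ 20 / C ^ 2) ^ (i + 1) * q) * N' ^ 2 := by
      rw [pow_succ]; ring
    have h13 : 50 * (2 ^ 20 * (2 ^ 20 / C ^ 2) + (2 ^ 20 / C ^ 2) ^ (i + 1) * q) * N' ^ 2
        ≤ 50 * (2 ^ 20 + (2 ^ 20 / C ^ 2) ^ (i + 1) * q) * N' ^ 2 := by
      refine mul_le_mul_of_nonneg_right ?_ (sq_nonneg _)
      nlinarith
    nlinarith

/-- Two states with adjacent current ends none of whose earlier ends are near. -/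
theorem exists_far_pair (h : RotSystem G F κ init e E allowed step) (P : Pseudorandom G d lam)
    {C : ℝ} (hC : 2 ^ 40 ≤ C) (hlam : lam * C = d) (hd : 0 < d)
    (hF : ∀ v, (nb F v).card ≤ 2) (hκ : d ≤ 128 * κ) (hX : X.Nonempty) {J ℓ : ℕ}
    {q : ℝ} (hq : (Fintype.card V : ℝ) ≤ q * X.card) (hq0 : 0 ≤ q)
    (hqJ : (2 ^ 20 / C ^ 2) ^ J * q ≤ 1)
    (hsm : (J + 1) * (C ^ (J + 1) * Real.sqrt (4 * ℓ + 1)) ≤ Real.sqrt (Fintype.card V)) :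
    ∃ σ τ, G.Adj (e σ) (e τ) ∧ ∀ p ∈ E σ, ∀ p' ∈ E τ, ¬ Near F ℓ p p' := by
  have hd' : (0:ℝ) < d := by exact_mod_cast hd
  have hC0 : 0 < C := by linarith [show (0:ℝ) < 2 ^ 40 by norm_num]
  have hC1 : 1 ≤ C := by linarith [show (1:ℝ) ≤ 2 ^ 40 by norm_num]
  have hlam0 : 0 < lam := by
    by_contra hc
    have : lam * C ≤ 0 := mul_nonpos_of_nonpos_of_nonneg (not_lt.mp hc) hC0.le
    linarith
  have hl := hlam0.le
  have hn : 0 < Fintype.card V := Fintype.card_pos_iff.mpr ⟨hX.choose⟩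
  have hsm1 : (J + 1) * (C ^ (J + 1) * Real.sqrt 1) ≤ Real.sqrt (Fintype.card V) := by
    refine le_trans ?_ hsm
    gcongr
    have : (0:ℝ) ≤ ℓ := Nat.cast_nonneg _
    linarith
  have hg := h.growth P hl hC hlam hd hF hκ hn hsm1
  have hgrow := fun i hi => (hg i hi).2
  obtain ⟨w, hw0, hw1, hw2⟩ := exists_ball_weights hF ℓ
  have hA := h.sq_l2_freq_le P hl hC hlam hF hq hq0 hgrow J le_rfl
  have hZ := h.sum_ball_sq_bd_le P hl hC hlam hF hq hq0 hgrow hw0 hw1 J le_rfl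
  have hNpos : ∀ i ≤ J + 1, 0 < count init allowed step i := by
    intro i
    induction i with
    | zero => intro _; rw [count_zero]; exact_mod_cast hX.card_pos
    | succ i ih =>
      intro hi
      have h1 := hgrow i (by omega)
      have h2 := mul_pos hd' (ih (by omega))
      linarith
  have hN := hNpos J (by omega)
  by_contra hcon
  push Not at hcon
  set B : V → Finset V := fun a => nball F (2 * ℓ) a
  have hBc : ∀ a, ((B a).card : ℝ) ≤ 4 * ℓ + 1 := by
    intro a
    have := card_nball_le hF (2 * ℓ) a
    have h2 : (B a).card ≤ 4 * ℓ + 1 := by simp only [B]; omega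
    exact_mod_cast h2
  let Φ : (St → ℝ) → ℝ := fun φ => total init allowed step J (fun σ => total init allowed step J
          (fun τ => if e τ ∈ nb G (e σ) then φ σ * φ τ else 0))
  have hpt : ∀ σ τ, (if e τ ∈ nb G (e σ) then (1:ℝ) * 1 else 0)
      ≤ ∑ a, w a * (if e τ ∈ nb G (e σ) then ((E σ ∩ B a).card : ℝ) * (E τ ∩ B a).card else 0) := by
    intro σ τ
    by_cases hst : e τ ∈ nb G (e σ)
    · simp only [if_pos hst]
      obtain ⟨p, hp, p', hp', hnear⟩ := hcon σ τ (_root_.mem_nb.mp hst)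
      refine (mul_one (1:ℝ)).le.trans ((hw2 p p' hnear).trans (Finset.sum_le_sum fun a _ => ?_))
      split_ifs with ha
      · refine le_mul_of_one_le_right (hw0 a) ?_
        have h1 : 1 ≤ (E σ ∩ B a).card := card_pos.mpr ⟨p, mem_inter.mpr ⟨hp, ha.1⟩⟩
        have h2 : 1 ≤ (E τ ∩ B a).card := card_pos.mpr ⟨p', mem_inter.mpr ⟨hp', ha.2⟩⟩
        exact_mod_cast Nat.mul_le_mul h1 h2
      · have := hw0 a; positivity
    · simp [if_neg hst]
  have hle : Φ (fun _ => 1) ≤ ∑ a, w a * Φ (fun σ => ((E σ ∩ B a).card : ℝ)) := by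
    have h1 : Φ (fun _ => 1) ≤ total init allowed step J (fun σ => total init allowed step J
        (fun τ => ∑ a, w a * (if e τ ∈ nb G (e σ) then
          ((E σ ∩ B a).card : ℝ) * (E τ ∩ B a).card else 0))) :=
      total_mono (fun σ => total_mono (fun τ => hpt σ τ) J) J
    refine h1.trans (le_of_eq ?_)
    simp only [total_sum, total_mul]
    rfl
  have hmain : Φ (fun _ => 1) = ∑ s, ∑ t ∈ nb G s, freq init e allowed step J s
      * freq init e allowed step J t := (bilinear_total (fun _ => 1) J).symm
  have hconf : ∀ a, Φ (fun σ => ((E σ ∩ B a).card : ℝ))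
      = ∑ s, ∑ t ∈ nb G s, hit init e E allowed step J (B a) s
      * hit init e E allowed step J (B a) t := fun a => (bilinear_total _ J).symm
  have hlow := P.le_bilinear (freq init e allowed step J) (freq init e allowed step J)
  rw [sum_freq, ← hmain] at hlow
  set n : ℝ := (Fintype.card V : ℝ)
  have hn' : 0 < n := by simp only [n]; exact_mod_cast hn
  have hup : ∀ a, Φ (fun σ => ((E σ ∩ B a).card : ℝ))
      ≤ 5 * lam * bd lam init e allowed step (B a) J ^ 2 := by
    intro a
    rw [hconf]
    refine (P.bilinear_le _ _).trans ?_
    obtain ⟨hb1, hb2⟩ := h.hit_bounds_of_le P hl hC1 hlam hF (hBc a) le_rfl hsm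
    have hS0 : 0 ≤ ∑ s, hit init e E allowed step J (B a) s :=
      Finset.sum_nonneg fun s _ => hit_nonneg _ _ _
    set S := ∑ s, hit init e E allowed step J (B a) s
    set y := bd lam init e allowed step (B a) J
    have hy : 0 ≤ y := bd_nonneg hl _ _
    have h1 : (C * S) ^ 2 ≤ n * y ^ 2 := by
      have := pow_le_pow_left₀ (by positivity) hb1 2
      rw [mul_pow (Real.sqrt _) y, Real.sq_sqrt hn'.le] at this
      exact this
    have h2 : (d : ℝ) / n * (S * S) ≤ lam * y ^ 2 := by
      have e1 : (d : ℝ) / n * (S * S) = lam / C * ((C * S) ^ 2 / n) := by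
        rw [← hlam]; field_simp
      rw [e1]
      have h3 : (C * S) ^ 2 / n ≤ y ^ 2 := by rw [div_le_iff₀ hn']; linarith
      have h4 : lam / C ≤ lam := div_le_self hl hC1
      have h5 : 0 ≤ lam / C := by positivity
      gcongr
    have h6 : l2 (hit init e E allowed step J (B a)) * l2 (hit init e E allowed step J (B a))
        ≤ (2 * y) * (2 * y) := by
      have := l2_nonneg (hit init e E allowed step J (B a))
      gcongr
    have h7 := mul_le_mul_of_nonneg_left h6 hl
    linarith
  have hup' : Φ (fun _ => 1) ≤ 5 * lam * ∑ a, w a * bd lam init e allowed step (B a) J ^ 2 := by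
    refine hle.trans ?_
    rw [Finset.mul_sum]
    refine Finset.sum_le_sum fun a _ => ?_
    have := mul_le_mul_of_nonneg_left (hup a) (hw0 a)
    linarith
  have hfin := mul_le_mul_of_nonneg_left (hlow.trans hup') hn'.le
  set N := count init allowed step J
  set f := l2 (freq init e allowed step J)
  set z := ∑ a, w a * bd lam init e allowed step (B a) J ^ 2
  set r := (2 ^ 20 / C ^ 2) ^ J * q
  have e2 : n * (d / n * (N * N) - lam * (f * f)) = lam * C * N ^ 2 - lam * (n * f ^ 2) := by
    rw [hlam]; field_simp
  rw [e2] at hfin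
  have hN2 : 0 < N ^ 2 := by positivity
  have h8 : n * f ^ 2 ≤ (2 ^ 20 + 1) * N ^ 2 := hA.trans (by gcongr)
  have h9 : n * z ≤ 50 * (2 ^ 21 + 2 * 1) * N ^ 2 := hZ.trans (by gcongr)
  have h10 : lam * C * N ^ 2 ≤ lam * (((2 ^ 20 + 1) + 250 * (2 ^ 21 + 2)) * N ^ 2) := by
    have a1 := mul_le_mul_of_nonneg_left h8 hl
    have a2 := mul_le_mul_of_nonneg_left h9 hl
    nlinarith
  have h11 : lam * 2 ^ 40 * N ^ 2 ≤ lam * C * N ^ 2 := by gcongr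
  have h12 : 0 < lam * N ^ 2 := by positivity
  nlinarith

end RotSystem

end RotPairs

section StartGraph
open Finset
open scoped Classical

variable {V : Type} [Fintype V] {G : SimpleGraph V} {d κ : ℕ} {lam : ℝ}

/-- The subgraph of `G` formed by the edges inside `U`. -/
def within (G : SimpleGraph V) (U : Finset V) : SimpleGraph V where
  Adj a b := G.Adj a b ∧ a ∈ U ∧ b ∈ U
  symm := ⟨fun _ _ h => ⟨h.1.symm, h.2.2, h.2.1⟩⟩
  loopless := ⟨fun _ h => h.1.ne rfl⟩

theorem within_le (G : SimpleGraph V) (U : Finset V) : within G U ≤ G := fun _ _ h => h.1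

theorem Pseudorandom.exists_injective_nbr (P : Pseudorandom G d lam) {C : ℕ}
    (hC : lam * C ≤ d) (h0 : 0 < lam) (hC1 : 2 ^ 40 ≤ C) (U : Finset V) (hκ : d ≤ 128 * κ)
    (hU : ∀ u ∈ U, κ ≤ (nb G u ∩ U).card) :
    ∃ f : U → V, Function.Injective f ∧ ∀ u : U, (within G U).Adj u (f u) := by
  have hC0 : 0 < C := by omega
  have hCC : 16777216 ≤ C ^ 2 := by
    calc 16777216 ≤ (2 ^ 40) ^ 2 := by norm_num
      _ ≤ C ^ 2 := Nat.pow_le_pow_left hC1 2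
  clear hC1
  have key : ∀ S Y : Finset V, S ⊆ U → (∀ u ∈ S, nb G u ∩ U ⊆ Y) →
      Y.card * 256 ≤ Fintype.card V → S.card ≤ Y.card := by
    intro S Y hS hY hn
    have h1 := P.expand hC h0 hC0 S Y κ 128 hκ
      (fun u hu => (hU u (hS hu)).trans (card_le_card (fun v hv => mem_inter.mpr
        ⟨(mem_inter.mp hv).1, hY u hu hv⟩))) (by omega)
    nlinarith
  obtain ⟨f, hf, hf'⟩ := (Finset.all_card_le_biUnion_card_iff_exists_injective
    (fun u : U => nb G u ∩ U)).mp (by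
      intro s
      set S : Finset V := s.map ⟨Subtype.val, Subtype.val_injective⟩ with hS
      have hSc : S.card = s.card := card_map _
      set Y : Finset V := s.biUnion (fun u : U => nb G u ∩ U) with hY
      have hSU : S ⊆ U := by
        intro v hv
        obtain ⟨u, -, rfl⟩ := mem_map.mp hv
        exact u.2
      have hYU : Y ⊆ U := by
        intro v hv
        obtain ⟨u, -, hu⟩ := mem_biUnion.mp hv
        exact (mem_inter.mp hu).2
      have hSY : ∀ u ∈ S, nb G u ∩ U ⊆ Y := by
        intro v hv w hw
        obtain ⟨u, hu, rfl⟩ := mem_map.mp hv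
        exact mem_biUnion.mpr ⟨u, hu, hw⟩
      rw [← hSc]
      by_contra! hlt
      have hYbig : Fintype.card V < Y.card * 256 := by
        by_contra! hh
        exact absurd (key S Y hSU hSY hh) (by omega)
      have hno : ∀ a ∈ S, ∀ z ∈ U \ Y, ¬ G.Adj a z := by
        intro a ha z hz hadj
        exact (mem_sdiff.mp hz).2 (hSY a ha (mem_inter.mpr
          ⟨mem_nb.mpr hadj, (mem_sdiff.mp hz).1⟩))
      have hc1 := card_sdiff_add_card_eq_card hYU
      have hc2 := card_sdiff_add_card_eq_card hSU
      have hZ : (U \ Y).card ≤ (U \ S).card := by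
        by_cases hbig : (U \ S).card * 256 ≤ Fintype.card V
        · refine key _ _ sdiff_subset ?_ hbig
          intro z hz w hw
          rw [mem_inter, mem_nb] at hw
          exact mem_sdiff.mpr ⟨hw.2, fun hwS => hno w hwS z hz hw.1.symm⟩
        · by_contra! hcon
          have h1 : Fintype.card V < S.card * 256 := by linarith
          have h2 : Fintype.card V < (U \ Y).card * 256 := by linarith
          obtain ⟨a, ha, z, hz, hadj⟩ := P.joined hC h0 S (U \ Y) (by
            have h3 : Fintype.card V ^ 2 ≤ (S.card * 256) * ((U \ Y).card * 256) := by
              rw [sq]; exact Nat.mul_le_mul h1.le h2.le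
            nlinarith [Nat.mul_pos (show 0 < S.card by linarith) (show 0 < (U \ Y).card by linarith)])
          exact hno a ha z hz hadj
      omega)
  exact ⟨f, hf, fun u => ⟨mem_nb.mp (mem_inter.mp (hf' u)).1, u.2, (mem_inter.mp (hf' u)).2⟩⟩

theorem exists_starlike {U : Finset V} {K : SimpleGraph V} {f : U → V}
    (hf : Function.Injective f) (hK : ∀ u : U, K.Adj u (f u)) (g : ℕ) :
    ∃ F, ThinIn K g F ∧ ∀ u ∈ U, 1 ≤ (nb F u).card := by
  let P : SimpleGraph V → Prop := fun F => F ≤ K ∧ (∀ w, (nb F w).card ≤ 2) ∧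
    ∀ u ∈ U, 1 ≤ (nb F u).card
  have hne : ∃ F, P F := by
    refine ⟨SimpleGraph.fromRel (fun a b => ∃ h : a ∈ U, f ⟨a, h⟩ = b), ?_, ?_, ?_⟩
    · rintro a b ⟨-, ⟨h, rfl⟩ | ⟨h, rfl⟩⟩
      · exact hK ⟨a, h⟩
      · exact (hK ⟨b, h⟩).symm
    · intro w
      have hsub : nb (SimpleGraph.fromRel (fun a b => ∃ h : a ∈ U, f ⟨a, h⟩ = b)) w ⊆
          (univ.filter fun b => ∃ h : w ∈ U, f ⟨w, h⟩ = b) ∪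
          (univ.filter fun b => ∃ h : b ∈ U, f ⟨b, h⟩ = w) := by
        intro v hv
        rw [mem_nb, SimpleGraph.fromRel_adj] at hv
        simp only [mem_union, mem_filter, mem_univ, true_and]
        exact hv.2
      refine (card_le_card hsub).trans ((card_union_le _ _).trans ?_)
      have h1 : (univ.filter fun b => ∃ h : w ∈ U, f ⟨w, h⟩ = b).card ≤ 1 := by
        rw [card_le_one]
        simp only [mem_filter, mem_univ, true_and]
        rintro a ⟨h, rfl⟩ b ⟨h', rfl⟩; rfl
      have h2 : (univ.filter fun b => ∃ h : b ∈ U, f ⟨b, h⟩ = w).card ≤ 1 := by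
        rw [card_le_one]
        simp only [mem_filter, mem_univ, true_and]
        rintro a ⟨h, rfl⟩ b ⟨h', he⟩
        exact (congrArg Subtype.val (hf he)).symm
      omega
    · intro u hu
      rw [Nat.one_le_iff_ne_zero, ← Nat.pos_iff_ne_zero, card_pos]
      refine ⟨f ⟨u, hu⟩, mem_nb.mpr ?_⟩
      rw [SimpleGraph.fromRel_adj]
      exact ⟨(hK ⟨u, hu⟩).ne, Or.inl ⟨hu, rfl⟩⟩
  obtain ⟨F, hF⟩ := (Set.toFinite {F | P F}).exists_minimal hne
  obtain ⟨⟨hFK, h2, h1⟩, hmin⟩ := hF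
  refine ⟨F, ⟨hFK, h2, ?_⟩, h1⟩
  intro a b hab hn
  have hone : (nb F a).card ≤ 1 ∨ (nb F b).card ≤ 1 := by
    by_contra! hcon
    have hle : F ≤ F.deleteEdges {s(a, b)} := by
      refine hmin ⟨(deleteEdges_le _).trans hFK, ?_, ?_⟩ (deleteEdges_le _)
      · intro w
        have := card_nb_deleteEdges hab w
        have := h2 w
        omega
      · intro w hw
        have := card_nb_deleteEdges hab w
        have h3 := h1 w hw
        by_cases e1 : w = a
        · have e2 : w ≠ b := e1 ▸ hab.ne
          rw [if_pos e1, if_neg e2] at this; subst e1; omega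
        · rw [if_neg e1] at this
          split_ifs at this with e2
          · subst e2; omega
          · omega
    have := hle hab
    rw [deleteEdges_adj] at this
    exact this.2 rfl
  have iso : ∀ x y : V, F.Adj x y → (nb F x).card ≤ 1 →
      ¬ (F.deleteEdges {s(x, y)}).Reachable x y := by
    intro x y hxy hc hr
    have := hr.mem_of_closed (Z := {x}) rfl (by
      rintro z rfl w hw
      rw [deleteEdges_adj] at hw
      exact absurd (by rw [eq_of_adj_of_card_le_one hc hxy hw.1]; rfl) hw.2)
    exact hxy.ne this.symm
  obtain ⟨w, -⟩ := hn
  rcases hone with h | h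
  · exact iso a b hab h ⟨w⟩
  · refine iso b a hab.symm h ?_
    rw [Sym2.eq_swap]
    exact ⟨w.reverse⟩

end StartGraph

section FewEnds
open Finset
open scoped Classical

variable {V : Type} [Fintype V] {G : SimpleGraph V} {d κ : ℕ} {lam : ℝ}

theorem Pseudorandom.exists_thin (P : Pseudorandom G d lam) {C : ℕ}
    (hlam : lam * C = d) (h0 : 0 < lam) (hd : 0 < d) (hC1 : 2 ^ 40 ≤ C) (U : Finset V)
    (hκ : d ≤ 128 * κ) (hU : ∀ u ∈ U, κ ≤ (nb G u ∩ U).card) {J g : ℕ} {q : ℝ} (hq0 : 0 ≤ q)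
    (hqJ : (2 ^ 20 / (C : ℝ) ^ 2) ^ J * q ≤ 1)
    (hsm : (J + 1) * ((C : ℝ) ^ (J + 1) * Real.sqrt (4 * (g + 2 : ℕ) + 1))
      ≤ Real.sqrt (Fintype.card V)) :
    ∃ F, ThinIn (within G U) g F ∧ (∀ u ∈ U, 1 ≤ (nb F u).card) ∧
      q * (U.filter fun u => (nb F u).card ≤ 1).card ≤ Fintype.card V := by
  set K := within G U with hK
  obtain ⟨f, hf, hfK⟩ := P.exists_injective_nbr hlam.le h0 hC1 U hκ hU
  let Q : Set (SimpleGraph V) := {F | ThinIn K g F ∧ ∀ u ∈ U, 1 ≤ (nb F u).card}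
  obtain ⟨F, ⟨hF, hF1⟩, hmax⟩ := Set.exists_max_image Q (fun F => ∑ w, (nb F w).card)
    (Set.toFinite Q) (exists_starlike hf hfK g)
  refine ⟨F, hF, hF1, ?_⟩
  set X := U.filter fun u => (nb F u).card ≤ 1 with hX
  by_contra! hlt
  have hXne : X.Nonempty := by
    rw [nonempty_iff_ne_empty]
    rintro he
    rw [he] at hlt
    simp at hlt
    exact absurd hlt (by have := Nat.cast_nonneg (α := ℝ) (Fintype.card V); linarith)
  let St := {p : V × RotState V // p.1 ∈ X ∧ p.2.Good F K g p.1 ∧ p.2.s ∈ U}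
  let allowed : St → Finset V := fun σ =>
    (nb K σ.1.2.s).filter fun v => ∀ p ∈ σ.1.2.E, v ≠ p ∧ ¬ F.Adj p v
  have hstep : ∀ (σ : St) (v : V), ∃ τ : St, v ∈ allowed σ →
      F.Adj v τ.1.2.s ∧ τ.1.2.E = insert τ.1.2.s σ.1.2.E := by
    intro σ v
    by_cases hv : v ∈ allowed σ
    · obtain ⟨hv1, hv2⟩ := mem_filter.mp hv
      rw [mem_nb] at hv1
      obtain ⟨⟨x, σ'⟩, hx, hgood, hs⟩ := σ
      obtain ⟨τ, h1, h2, h3⟩ := hgood.step hF (mem_filter.mp hx).2 hv1 hv2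
        (card_pos.mp (hF1 v hv1.2.2))
      exact ⟨⟨⟨x, τ⟩, hx, h1, (hF.1 h2).2.2⟩, fun _ => ⟨h2, h3⟩⟩
    · exact ⟨σ, fun h => absurd h hv⟩
  choose step hstep using hstep
  have hrot : RotSystem G F κ
      (fun x : X => (⟨⟨x, ⟨F, x, {(x : V)}, {(x : V)}⟩⟩, x.2, RotState.good_start hF x,
        (mem_filter.mp x.2).1⟩ : St))
      (fun σ => σ.1.2.s) (fun σ => σ.1.2.E) allowed step := by
    refine ⟨fun x => rfl, fun x => rfl, ?_, ?_, ?_, ?_⟩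
    · intro σ v hv
      have := (mem_filter.mp hv).1
      rw [mem_nb] at this ⊢
      exact this.1
    · intro σ v hv
      exact (hstep σ v hv).1
    · intro σ v hv
      exact (hstep σ v hv).2
    · intro σ
      refine (hU _ σ.2.2.2).trans ?_
      refine (card_le_card (t := allowed σ ∪ (nb G σ.1.2.s).filter
        (fun v => ∃ p ∈ σ.1.2.E, v = p ∨ F.Adj p v)) ?_).trans (card_union_le _ _)
      intro v hv
      rw [mem_inter, mem_nb] at hv
      rw [mem_union, mem_filter, mem_filter, mem_nb, mem_nb]
      by_cases hc : ∀ p ∈ σ.1.2.E, v ≠ p ∧ ¬ F.Adj p v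
      · exact Or.inl ⟨⟨hv.1, σ.2.2.2, hv.2⟩, hc⟩
      · push Not at hc
        obtain ⟨p, hp, h⟩ := hc
        refine Or.inr ⟨hv.1, p, hp, ?_⟩
        by_cases e : v = p
        · exact Or.inl e
        · exact Or.inr (h e)
  obtain ⟨σ, τ, hadj, hfar⟩ := hrot.exists_far_pair P (C := (C : ℝ)) (by exact_mod_cast hC1) hlam hd
    hF.2.1 hκ hXne hlt.le hq0 hqJ hsm
  obtain ⟨F', h1, h2, h3⟩ := σ.2.2.1.exists_larger τ.2.2.1 hF (mem_filter.mp σ.2.1).2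
    (mem_filter.mp τ.2.1).2 ⟨hadj, σ.2.2.2, τ.2.2.2⟩ hfar
  exact absurd (hmax F' ⟨h1, fun u hu => (hF1 u hu).trans (h2 u)⟩) (by simpa using h3)

end FewEnds

section LinearForests
open Finset
open scoped Classical

variable {V : Type} [Fintype V] {G F : SimpleGraph V} {d κ : ℕ} {lam : ℝ}

theorem one_le_card_nb {F : SimpleGraph V} {a b : V} (h : F.Adj a b) : 1 ≤ (nb F a).card :=
  card_pos.mpr ⟨b, mem_nb.mpr h⟩

theorem one_le_card_nb_of_reachable {F : SimpleGraph V} {a b : V} (h : F.Reachable a b)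
    (hab : a ≠ b) : 1 ≤ (nb F a).card := by
  obtain ⟨w⟩ := h
  cases w with
  | nil => exact absurd rfl hab
  | cons h _ => exact one_le_card_nb h

/-- A component of maximum degree two has at most two vertices of degree one. -/
theorem eq_or_eq_of_deg_le_one (h2 : ∀ v, (nb F v).card ≤ 2) {a b c : V} (hab : a ≠ b)
    (ha : (nb F a).card ≤ 1) (hb : (nb F b).card ≤ 1) (hr : F.Reachable a b)
    (hc : (nb F c).card ≤ 1) (hrc : F.Reachable a c) : c = a ∨ c = b := by
  obtain ⟨p, hp⟩ := hr.exists_isPath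
  have hl : p.length ≠ 0 := fun h => hab (Walk.eq_of_length_eq_zero h)
  have hsupp : c ∈ p.support := by
    refine hrc.mem_of_closed (Z := {x | x ∈ p.support}) p.start_mem_support ?_
    intro x hx y hxy
    obtain ⟨i, rfl, hi⟩ := Walk.mem_support_iff_exists_getVert.mp hx
    rcases Nat.eq_zero_or_pos i with rfl | hi0
    · rw [Walk.getVert_zero] at hxy
      have h1 := p.adj_getVert_succ (i := 0) (by omega)
      rw [Walk.getVert_zero] at h1
      rw [eq_of_adj_of_card_le_one ha h1 hxy]
      exact p.getVert_mem_support _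
    · rcases hi.eq_or_lt with rfl | hi
      · have h1 := p.adj_getVert_succ (i := p.length - 1) (by omega)
        rw [Nat.sub_add_cancel (by omega), Walk.getVert_length] at h1
        rw [Walk.getVert_length] at hxy
        rw [eq_of_adj_of_card_le_one hb h1.symm hxy]
        exact p.getVert_mem_support _
      · rcases hp.adj_getVert hi0 hi (h2 _) hxy with rfl | rfl <;> exact p.getVert_mem_support _
  obtain ⟨i, rfl, hi⟩ := Walk.mem_support_iff_exists_getVert.mp hsupp
  rcases Nat.eq_zero_or_pos i with rfl | hi0
  · exact Or.inl (Walk.getVert_zero _)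
  · rcases hi.eq_or_lt with rfl | hi
    · exact Or.inr (Walk.getVert_length _)
    · exfalso
      have h1 := p.adj_getVert_succ (i := i - 1) (by omega)
      have h3 := p.adj_getVert_succ hi
      rw [Nat.sub_add_cancel hi0] at h1
      have h4 := eq_of_adj_of_card_le_one hc h1.symm h3
      have := hp.getVert_injOn (by simpa using by omega) (by simpa using by omega) h4
      omega

theorem ThinIn.exists_acyclic {K : SimpleGraph V} {g : ℕ} (hF : ThinIn K g F)
    {U : Finset V} (hU : ∀ u ∈ U, 1 ≤ (nb F u).card) :
    ∃ F', F' ≤ F ∧ F'.IsAcyclic ∧ (∀ u ∈ U, 1 ≤ (nb F' u).card) ∧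
      g * (U.filter fun u => (nb F' u).card ≤ 1).card ≤
        g * (U.filter fun u => (nb F u).card ≤ 1).card + 2 * Fintype.card V := by
  obtain ⟨F', hmax⟩ := (Set.toFinite {H : SimpleGraph V | H ≤ F ∧ H.IsAcyclic}).exists_maximal
    ⟨⊥, bot_le, isAcyclic_bot⟩
  obtain ⟨hle, hac⟩ := hmax.1
  have hreach := reachable_eq_of_maximal_isAcyclic F' hmax
  have h2 : ∀ v, (nb F' v).card ≤ 2 := fun v => (card_le_card (fun w hw =>
    mem_nb.mpr (hle (mem_nb.mp hw)))).trans (hF.2.1 v)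
  set Y := univ.filter fun a => ∃ b, F.Adj a b ∧ ¬ F'.Adj a b with hY
  have hY1 : ∀ a ∈ Y, (nb F' a).card = 1 ∧ g + 1 ≤ (nball F' g a).card := by
    intro a ha
    obtain ⟨b, hb, hb'⟩ := (mem_filter.mp ha).2
    have hr : F'.Reachable a b := by rw [hreach]; exact hb.reachable
    have h1 := one_le_card_nb_of_reachable hr hb.ne
    have hlt : (nb F' a).card < (nb F a).card := by
      refine card_lt_card ((ssubset_iff_of_subset fun w hw =>
        mem_nb.mpr (hle (mem_nb.mp hw))).mpr ⟨b, mem_nb.mpr hb, fun h => hb' (mem_nb.mp h)⟩)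
    have := hF.2.1 a
    refine ⟨by omega, ?_⟩
    obtain ⟨p, hp⟩ := hr.exists_isPath
    have hlen : g < p.length := by
      by_contra! hcon
      refine hF.2.2 a b hb (Near.graph_mono (K := F') ⟨p, hcon⟩ ?_)
      intro x y hxy
      rw [deleteEdges_adj]
      refine ⟨hle hxy, fun he => hb' ?_⟩
      rw [Set.mem_singleton_iff, Sym2.eq_iff] at he
      rcases he with ⟨rfl, rfl⟩ | ⟨rfl, rfl⟩
      · exact hxy
      · exact hxy.symm
    have hinj : Set.InjOn p.getVert (range (g + 1) : Finset ℕ) := by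
      intro i hi j hj hij
      simp only [coe_range, Set.mem_Iio] at hi hj
      exact hp.getVert_injOn (by simpa using by omega) (by simpa using by omega) hij
    rw [← card_range (g + 1), ← card_image_of_injOn hinj]
    refine card_le_card ?_
    intro x hx
    obtain ⟨i, hi, rfl⟩ := mem_image.mp hx
    rw [mem_range] at hi
    rw [mem_nball]
    exact ⟨p.take i, by rw [Walk.take_length]; omega⟩
  refine ⟨F', hle, hac, ?_, ?_⟩
  · intro u hu
    obtain ⟨b, hb⟩ := card_pos.mp (hU u hu)
    rw [mem_nb] at hb
    by_cases h : F'.Adj u b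
    · exact one_le_card_nb h
    · exact (hY1 u (mem_filter.mpr ⟨mem_univ _, b, hb, h⟩)).1.ge
  · have hsub : (U.filter fun u => (nb F' u).card ≤ 1) ⊆
        (U.filter fun u => (nb F u).card ≤ 1) ∪ Y := by
      intro u hu
      rw [mem_filter] at hu
      rw [mem_union, mem_filter]
      by_cases h : u ∈ Y
      · exact Or.inr h
      · refine Or.inl ⟨hu.1, le_trans (card_le_card ?_) hu.2⟩
        intro w hw
        rw [mem_nb] at hw ⊢
        by_contra hc
        exact h (mem_filter.mpr ⟨mem_univ _, w, hw, hc⟩)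
    have hYc : (g + 1) * Y.card ≤ 2 * Fintype.card V := by
      calc (g + 1) * Y.card = ∑ a ∈ Y, (g + 1) := by rw [sum_const, smul_eq_mul, mul_comm]
        _ ≤ ∑ a ∈ Y, (nball F' g a).card := sum_le_sum fun a ha => (hY1 a ha).2
        _ = ∑ a ∈ Y, ∑ w, if Near F' g a w then 1 else 0 := by
          refine sum_congr rfl fun a _ => ?_
          rw [nball, card_filter]
        _ = ∑ w, (Y.filter fun a => Near F' g a w).card := by
          rw [sum_comm]
          refine sum_congr rfl fun w _ => ?_
          rw [card_filter]
        _ ≤ ∑ w : V, 2 := by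
          refine sum_le_sum fun w _ => ?_
          by_contra! hcon
          obtain ⟨a, b, c, ha, hb, hc, hab, hac', hbc⟩ := two_lt_card_iff.mp hcon
          rw [mem_filter] at ha hb hc
          obtain ⟨wa, -⟩ := ha.2
          obtain ⟨wb, -⟩ := hb.2
          obtain ⟨wc, -⟩ := hc.2
          rcases eq_or_eq_of_deg_le_one h2 hab (hY1 a ha.1).1.le (hY1 b hb.1).1.le
            ⟨wa.append wb.reverse⟩ (hY1 c hc.1).1.le ⟨wa.append wc.reverse⟩ with h | h
          · exact hac' h.symm
          · exact hbc h.symm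
        _ = 2 * Fintype.card V := by simp [mul_comm]
    calc _ ≤ g * ((U.filter fun u => (nb F u).card ≤ 1).card + Y.card) :=
          Nat.mul_le_mul_left _ ((card_le_card hsub).trans (card_union_le _ _))
      _ ≤ _ := by nlinarith

/-- A set in which all vertices have many neighbours is spanned by few paths. -/
theorem Pseudorandom.exists_path_cover (P : Pseudorandom G d lam) {C : ℕ}
    (hlam : lam * C = d) (h0 : 0 < lam) (hd : 0 < d) (hC1 : 2 ^ 40 ≤ C) (U : Finset V)
    (hκ : d ≤ 128 * κ) (hU : ∀ u ∈ U, κ ≤ (nb G u ∩ U).card) {J q : ℕ} (hq0 : 1 ≤ q)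
    (hqJ : (2 ^ 20 / (C : ℝ) ^ 2) ^ J * q ≤ 1)
    (hsm : (J + 1) * ((C : ℝ) ^ (J + 1) * Real.sqrt (4 * (q + 2 : ℕ) + 1))
      ≤ Real.sqrt (Fintype.card V)) :
    ∃ F, F ≤ within G U ∧ F.IsAcyclic ∧ (∀ v, (nb F v).card ≤ 2) ∧
      (∀ u ∈ U, 1 ≤ (nb F u).card) ∧
      q * (U.filter fun u => (nb F u).card ≤ 1).card ≤ 3 * Fintype.card V := by
  obtain ⟨F, hF, h1, h2⟩ := P.exists_thin hlam h0 hd hC1 U hκ hU (q := q) (by positivity) hqJ hsm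
  obtain ⟨F', hle, hac, h3, h4⟩ := hF.exists_acyclic h1
  refine ⟨F', hle.trans hF.1, hac, fun v => (card_le_card (fun w hw =>
    mem_nb.mpr (hle (mem_nb.mp hw)))).trans (hF.2.1 v), h3, ?_⟩
  have : q * (U.filter fun u => (nb F u).card ≤ 1).card ≤ Fintype.card V := by exact_mod_cast h2
  omega

end LinearForests

section Arenas
open Finset
open scoped Classical

variable {V : Type} [Fintype V] {G F : SimpleGraph V} {d κ : ℕ} {lam : ℝ}

theorem SimpleGraph.Reachable.deleteEdge_cases {H : SimpleGraph V} {w a : V}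
    (h : H.Reachable w a) (v u : V) :
    (H.deleteEdges {s(v, u)}).Reachable w a ∨ (H.deleteEdges {s(v, u)}).Reachable w v ∨
      (H.deleteEdges {s(v, u)}).Reachable w u := by
  obtain ⟨p⟩ := h
  induction p with
  | nil => exact Or.inl (Reachable.refl _)
  | @cons x y z hxy p ih =>
    by_cases he : s(x, y) = s(v, u)
    · rw [Sym2.eq_iff] at he
      rcases he with ⟨rfl, -⟩ | ⟨rfl, -⟩
      · exact Or.inr (Or.inl (Reachable.refl _))
      · exact Or.inr (Or.inr (Reachable.refl _))
    · have h1 : (H.deleteEdges {s(v, u)}).Reachable x y :=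
        Adj.reachable (by rw [deleteEdges_adj]; exact ⟨hxy, he⟩)
      rcases ih with ih | ih | ih
      · exact Or.inl (h1.trans ih)
      · exact Or.inr (Or.inl (h1.trans ih))
      · exact Or.inr (Or.inr (h1.trans ih))

/-- In an acyclic graph, the first edge of a path from `v` to `a ≠ v` separates `v` from `a`. -/
theorem exists_adj_reachable_deleteEdge {H : SimpleGraph V} {v a : V} (h : H.Reachable v a)
    (hva : v ≠ a) : ∃ u, H.Adj v u ∧ (H.deleteEdges {s(v, u)}).Reachable u a := by
  obtain ⟨p, hp⟩ := h.exists_isPath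
  cases p with
  | nil => exact absurd rfl hva
  | @cons _ u _ hvu p =>
    rw [Walk.cons_isPath_iff] at hp
    refine ⟨u, hvu, ⟨p.transfer _ ?_⟩⟩
    intro e he
    rw [edgeSet_deleteEdges]
    refine ⟨p.edges_subset_edgeSet he, ?_⟩
    rintro rfl
    exact hp.2 (p.fst_mem_support_of_mem_edges he)

theorem not_reachable_deleteEdge_of_isAcyclic {H : SimpleGraph V} (hac : H.IsAcyclic) {v u : V}
    (h : H.Adj v u) : ¬ (H.deleteEdges {s(v, u)}).Reachable v u :=
  isBridge_iff.mp (isAcyclic_iff_forall_isBridge.mp hac (H.mem_edgeSet.mpr h))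

/-- `H` arises from `F` by rotations that start at `x`; the current end is the last argument. -/
inductive Rotated (K F : SimpleGraph V) (A Bl : Finset V) (x : V) : SimpleGraph V → V → Prop
  | start : Rotated K F A Bl x F x
  | step {H : SimpleGraph V} {s v u : V} : Rotated K F A Bl x H s → K.Adj s v → ¬ H.Adj s v →
      v ∉ Bl → H.Adj v u → ¬ (H.deleteEdges {s(v, u)}).Reachable s v →
      (H.Reachable s v ∨ ∃ a ∈ A, (H.deleteEdges {s(v, u)}).Reachable u a) →
      Rotated K F A Bl x (H.deleteEdges {s(v, u)} ⊔ edge s v) u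

/-- `H` is a linear forest in `K` with the degrees of `F`, except that the deficiency of `x` has
moved to `s`; all components of `H` meeting `Y` meet `A`. -/
structure Moved (K F : SimpleGraph V) (Y A : Finset V) (x : V) (H : SimpleGraph V) (s : V) :
    Prop where
  le : H ≤ K
  acyclic : H.IsAcyclic
  deg : ∀ w, (nb H w).card + (if w = s then 1 else 0) = (nb F w).card + if w = x then 1 else 0
  anchor : ∀ w ∈ Y, ∃ a ∈ A, H.Reachable w a

variable {K H : SimpleGraph V} {Y A Bl : Finset V} {x s : V}

theorem Rotated.moved (h : Rotated K F A Bl x H s) (hKY : ∀ a b, K.Adj a b → a ∈ Y)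
    (hF : Moved K F Y A x F x) (hx : x ∈ Y) : Moved K F Y A x H s ∧ s ∈ Y := by
  induction h with
  | start => exact ⟨hF, hx⟩
  | @step H s v u _ hsv hnadj _ hvu hsep hanch ih =>
    obtain ⟨ih, hs⟩ := ih
    refine ⟨⟨?_, ?_, ?_, ?_⟩, hKY u v (ih.le hvu.symm)⟩
    · refine sup_le ((deleteEdges_le _).trans ih.le) ?_
      rw [edge_le_iff]
      exact Or.inr hsv
    · exact (ih.acyclic.anti (deleteEdges_le _)).sup_edge_of_not_reachable hsep
    · intro w
      have h1 := ih.deg w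
      have h2 := card_nb_deleteEdges hvu w
      rw [card_nb_sup_edge hsv.ne (fun h' => hnadj ((deleteEdges_le _) h'))]
      omega
    · have hmono : ∀ {a b}, (H.deleteEdges {s(v, u)}).Reachable a b →
          (H.deleteEdges {s(v, u)} ⊔ edge s v).Reachable a b := fun h => h.mono le_sup_left
      have hsv' : (H.deleteEdges {s(v, u)} ⊔ edge s v).Reachable s v :=
        Adj.reachable (Or.inr (by rw [edge_adj]; exact ⟨Or.inl ⟨rfl, rfl⟩, hsv.ne⟩))
      intro w hw
      obtain ⟨a, ha, hwa⟩ := ih.anchor w hw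
      by_cases hr : H.Reachable s v
      · have hsu : (H.deleteEdges {s(v, u)}).Reachable s u := by
          rcases hr.deleteEdge_cases v u with h | h | h
          · exact absurd h hsep
          · exact absurd h hsep
          · exact h
        have huv := (hmono hsu).symm.trans hsv'
        refine ⟨a, ha, ?_⟩
        rcases hwa.deleteEdge_cases v u with h | h | h
        · exact hmono h
        · rcases hwa.symm.deleteEdge_cases v u with h' | h' | h'
          · exact (hmono h').symm
          · exact (hmono h).trans (hmono h').symm
          · exact (hmono h).trans (huv.symm.trans (hmono h').symm)
        · rcases hwa.symm.deleteEdge_cases v u with h' | h' | h'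
          · exact (hmono h').symm
          · exact (hmono h).trans (huv.trans (hmono h').symm)
          · exact (hmono h).trans (hmono h').symm
      · obtain ⟨a', ha', hua'⟩ := hanch.resolve_left hr
        obtain ⟨a'', ha'', hsa⟩ := ih.anchor s hs
        have hs' : ∃ b ∈ A, (H.deleteEdges {s(v, u)}).Reachable s b := by
          rcases hsa.deleteEdge_cases v u with h | h | h
          · exact ⟨a'', ha'', h⟩
          · exact absurd h hsep
          · exact ⟨a', ha', h.trans hua'⟩
        obtain ⟨b, hb, hsb⟩ := hs'
        rcases hwa.deleteEdge_cases v u with h | h | h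
        · exact ⟨a, ha, hmono h⟩
        · exact ⟨b, hb, (hmono h).trans (hsv'.symm.trans (hmono hsb))⟩
        · exact ⟨a', ha', (hmono h).trans (hmono hua')⟩

/-- Pósa's lemma: rotations do not change the neighbourhoods of vertices that are neither ends nor
`F`-neighbours of ends. -/
theorem Rotated.nb_eq (h : Rotated K F A Bl x H s) {w : V}
    (hw : ∀ H' p, Rotated K F A Bl x H' p → w ≠ p ∧ ¬ F.Adj p w) : nb H w = nb F w := by
  induction h with
  | start => rfl
  | @step H s v u hr hsv hnadj hvB hvu hsep hanch ih =>
    have hu := hw _ _ (hr.step hsv hnadj hvB hvu hsep hanch)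
    have hs := hw _ _ hr
    have hwv : w ≠ v := by
      rintro rfl
      have : u ∈ nb F w := by rw [← ih]; exact mem_nb.mpr hvu
      exact hu.2 (mem_nb.mp this).symm
    rw [← ih]
    ext z
    rw [mem_nb, mem_nb, sup_adj, deleteEdges_adj, edge_adj, Set.mem_singleton_iff, Sym2.eq_iff]
    have := hu.1
    have := hs.1
    tauto

theorem exists_ends (hKY : ∀ a b, K.Adj a b → a ∈ Y) (hF : Moved K F Y A x F x) (hx : x ∈ Y)
    (hpos : ∀ w ∈ Y, w ≠ x → 1 ≤ (nb F w).card)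
    (hBl : ∀ v ∈ Y, v ∉ Bl → v ∉ A ∨ nb F v ⊆ A) :
    ∃ S : Finset V, x ∈ S ∧ S ⊆ Y ∧ (∀ s ∈ S, ∃ H, Moved K F Y A x H s) ∧
      ∀ s ∈ S, ∀ v, K.Adj s v → v ∈ S ∨ (∃ p ∈ S, F.Adj p v) ∨ v ∈ Bl := by
  refine ⟨univ.filter fun s => ∃ H, Rotated K F A Bl x H s,
    mem_filter.mpr ⟨mem_univ _, F, .start⟩, ?_, ?_, ?_⟩
  · intro s hs
    obtain ⟨-, H, h⟩ := mem_filter.mp hs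
    exact (h.moved hKY hF hx).2
  · intro s hs
    obtain ⟨-, H, h⟩ := mem_filter.mp hs
    exact ⟨H, (h.moved hKY hF hx).1⟩
  · intro s hs v hsv
    obtain ⟨-, H, h⟩ := mem_filter.mp hs
    by_contra! hcon
    simp only [mem_filter, mem_univ, true_and, not_exists, forall_exists_index] at hcon
    obtain ⟨h1, h2, h3⟩ := hcon
    have hw : ∀ H' p, Rotated K F A Bl x H' p → v ≠ p ∧ ¬ F.Adj p v := by
      intro H' p hp
      exact ⟨fun e => h1 H' (e ▸ hp), h2 p H' hp⟩
    obtain ⟨hm, hsY⟩ := h.moved hKY hF hx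
    have hnb := h.nb_eq hw
    have hvY : v ∈ Y := hKY v s hsv.symm
    have hnadj : ¬ H.Adj s v := by
      intro hadj
      have : s ∈ nb F v := by rw [← hnb]; exact mem_nb.mpr hadj.symm
      exact (hw H s h).2 (mem_nb.mp this).symm
    suffices hu : ∃ u, H.Adj v u ∧ ¬ (H.deleteEdges {s(v, u)}).Reachable s v ∧
        (H.Reachable s v ∨ ∃ a ∈ A, (H.deleteEdges {s(v, u)}).Reachable u a) by
      obtain ⟨u, hvu, hsep, hanch⟩ := hu
      have := (hw _ _ (h.step hsv hnadj h3 hvu hsep hanch)).2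
      have hu : u ∈ nb F v := by rw [← hnb]; exact mem_nb.mpr hvu
      exact this (mem_nb.mp hu).symm
    by_cases hr : H.Reachable s v
    · obtain ⟨u, hvu, hus⟩ := exists_adj_reachable_deleteEdge hr.symm hsv.ne'
      exact ⟨u, hvu, fun h' => not_reachable_deleteEdge_of_isAcyclic hm.acyclic hvu
        (hus.trans h').symm, Or.inl hr⟩
    · have hsep : ∀ u, ¬ (H.deleteEdges {s(v, u)}).Reachable s v :=
        fun u h' => hr (h'.mono (deleteEdges_le _))
      rcases hBl v hvY h3 with hvA | hvA
      · obtain ⟨a, ha, hva⟩ := hm.anchor v hvY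
        obtain ⟨u, hvu, hua⟩ := exists_adj_reachable_deleteEdge hva
          (fun e => hvA (e ▸ ha))
        exact ⟨u, hvu, hsep u, Or.inr ⟨a, ha, hua⟩⟩
      · obtain ⟨u, hu⟩ := card_pos.mp (hpos v hvY (hw F x .start).1)
        have huA := hvA hu
        rw [← hnb, mem_nb] at hu
        exact ⟨u, hu, hsep u, Or.inr ⟨u, huA, Reachable.refl _⟩⟩

end Arenas

section ArenaEnds
open Finset
open scoped Classical

variable {V : Type} [Fintype V] {G F : SimpleGraph V} {d κ : ℕ} {lam : ℝ}

theorem within_mono (G : SimpleGraph V) {U U' : Finset V} (h : U ⊆ U') :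
    within G U ≤ within G U' := fun _ _ hab => ⟨hab.1, h hab.2.1, h hab.2.2⟩

/-- Every `G`-neighbour in `Y` of a vertex of `S` lies in `S`, in `Bl`, or is an `F`-neighbour
of a vertex of `S`. -/
def RotClosed (G F : SimpleGraph V) (Y Bl S : Finset V) : Prop :=
  ∀ s ∈ S, ∀ v ∈ Y, G.Adj s v → v ∈ S ∨ (∃ p ∈ S, F.Adj p v) ∨ v ∈ Bl

theorem RotClosed.union {Y Bl S S' : Finset V} (h : RotClosed G F Y Bl S)
    (h' : RotClosed G F Y Bl S') : RotClosed G F Y Bl (S ∪ S') := by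
  intro s hs v hv hsv
  rcases mem_union.mp hs with hs | hs
  · rcases h s hs v hv hsv with h1 | ⟨p, hp, h1⟩ | h1
    · exact Or.inl (mem_union_left _ h1)
    · exact Or.inr (Or.inl ⟨p, mem_union_left _ hp, h1⟩)
    · exact Or.inr (Or.inr h1)
  · rcases h' s hs v hv hsv with h1 | ⟨p, hp, h1⟩ | h1
    · exact Or.inl (mem_union_right _ h1)
    · exact Or.inr (Or.inl ⟨p, mem_union_right _ hp, h1⟩)
    · exact Or.inr (Or.inr h1)

theorem Pseudorandom.card_rotClosed (P : Pseudorandom G d lam) {C : ℕ}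
    (hC : lam * C ≤ d) (h0 : 0 < lam) (hC1 : 2 ^ 40 ≤ C) (hκ : d ≤ 128 * κ)
    (h2 : ∀ v, (nb F v).card ≤ 2) {Y Bl S : Finset V} (hS : ∀ s ∈ S, κ ≤ (nb G s ∩ Y).card)
    (h : RotClosed G F Y Bl S) :
    Fintype.card V < 256 * (3 * S.card + Bl.card) ∨ 2 * S.card ≤ Bl.card := by
  by_contra! hcon
  obtain ⟨hc1, hc2⟩ := hcon
  set Z := S ∪ S.biUnion (nb F) ∪ Bl with hZ
  have hZc : Z.card ≤ 3 * S.card + Bl.card := by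
    have h3 : (S.biUnion (nb F)).card ≤ S.card * 2 := card_biUnion_le_card_mul _ _ _ fun v _ => h2 v
    have h4 := card_union_le (S ∪ S.biUnion (nb F)) Bl
    have h5 := card_union_le S (S.biUnion (nb F))
    rw [hZ]
    omega
  have h1 := P.expand hC h0 (by omega) S Z κ 128 hκ (fun u hu => (hS u hu).trans
    (card_le_card (fun v hv => by
      rw [mem_inter, mem_nb] at hv
      rw [mem_inter, mem_nb]
      refine ⟨hv.1, ?_⟩
      rcases h u hu v hv.2 hv.1 with h' | ⟨p, hp, h'⟩ | h'
      · exact mem_union_left _ (mem_union_left _ h')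
      · exact mem_union_left _ (mem_union_right _ (mem_biUnion.mpr ⟨p, hp, mem_nb.mpr h'⟩))
      · exact mem_union_right _ h'))) (by omega)
  have hCC : 16777216 ≤ C ^ 2 := by
    calc 16777216 ≤ (2 ^ 40) ^ 2 := by norm_num
      _ ≤ C ^ 2 := Nat.pow_le_pow_left hC1 2
  have h6 := Nat.mul_le_mul_right S.card hCC
  clear hC1
  omega

/-- A linear forest in `G` that spans `Y` and all of whose components meet `A`. -/
structure Arena (G : SimpleGraph V) (Y A : Finset V) (F : SimpleGraph V) : Prop where
  le : F ≤ within G Y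
  acyclic : F.IsAcyclic
  deg_le : ∀ w, (nb F w).card ≤ 2
  one_le : ∀ w ∈ Y, 1 ≤ (nb F w).card
  anchor : ∀ w ∈ Y, ∃ a ∈ A, F.Reachable w a

theorem Moved.arena {Y A : Finset V} {x s : V} {H : SimpleGraph V}
    (hm : Moved (within G Y) F Y A x H s) (h2 : ∀ w, (nb F w).card ≤ 2)
    (hx : (nb F x).card ≤ 1) (hs : (nb F s).card = 2)
    (hpos : ∀ w ∈ Y, w ≠ x → 1 ≤ (nb F w).card) : Arena G Y A H where
  le := hm.le
  acyclic := hm.acyclic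
  deg_le w := by
    have := hm.deg w
    have := h2 w
    by_cases h : w = x
    · subst h; split_ifs at * <;> omega
    · split_ifs at * <;> omega
  one_le w hw := by
    have := hm.deg w
    by_cases h : w = s
    · subst h; split_ifs at * <;> omega
    · by_cases h' : w = x
      · rw [if_neg h, if_pos h'] at this; omega
      · have := hpos w hw h'
        split_ifs at * ; omega
  anchor := hm.anchor

theorem nb_eq_empty_of_le_within {Y : Finset V} (hle : F ≤ within G Y) {p : V} (hp : p ∉ Y) :
    nb F p = ∅ := by
  rw [eq_empty_iff_forall_notMem]
  intro v hv
  exact hp (hle (mem_nb.mp hv)).2.1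

theorem Arena.exists_ends_of_mem (P : Pseudorandom G d lam) {C : ℕ}
    (hC : lam * C ≤ d) (h0 : 0 < lam) (hC1 : 2 ^ 40 ≤ C) (hκ : d ≤ 128 * κ) {Y : Finset V}
    (hY : ∀ u ∈ Y, κ ≤ (nb G u ∩ Y).card) (hF : Arena G Y Y F) {x : V} (hx : x ∈ Y)
    (hdx : (nb F x).card ≤ 1) :
    ∃ S ⊆ Y, Fintype.card V < 768 * (S.card + (Y.filter fun w => (nb F w).card ≤ 1).card) ∧
      ∀ s ∈ S, (nb F s).card = 2 ∧ ∃ H, Arena G Y Y H ∧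
        ∀ w, (nb H w).card + (if w = s then 1 else 0) = (nb F w).card + if w = x then 1 else 0 := by
  obtain ⟨S, hxS, hSY, h1, h2⟩ := exists_ends (K := within G Y) (Bl := ∅) (fun a b hab => hab.2.1)
    ⟨hF.le, hF.acyclic, fun _ => rfl, hF.anchor⟩ hx (fun w hw _ => hF.one_le w hw)
    (fun v _ _ => Or.inr fun u hu => (hF.le (mem_nb.mp hu)).2.2)
  have h3 := P.card_rotClosed (Bl := ∅) hC h0 hC1 hκ hF.deg_le (fun s hs => hY s (hSY hs))
    (fun s hs v hv hsv => h2 s hs v ⟨hsv, hSY hs, hv⟩)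
  have h4 : 0 < S.card := card_pos.mpr ⟨x, hxS⟩
  rw [card_empty] at h3
  refine ⟨S.filter fun s => (nb F s).card = 2, (filter_subset _ _).trans hSY, ?_, ?_⟩
  · have h5 : S.card ≤ (S.filter fun s => (nb F s).card = 2).card +
        (Y.filter fun w => (nb F w).card ≤ 1).card := by
      rw [← card_filter_add_card_filter_not (s := S) (fun s => (nb F s).card = 2)]
      refine Nat.add_le_add_left (card_le_card fun w hw => ?_) _
      rw [mem_filter] at hw ⊢
      have := hF.deg_le w
      exact ⟨hSY hw.1, by omega⟩
    omega
  · intro s hs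
    obtain ⟨hs1, hs2⟩ := mem_filter.mp hs
    obtain ⟨H, hH⟩ := h1 s hs1
    exact ⟨hs2, H, hH.arena hF.deg_le hdx hs2 (fun w hw _ => hF.one_le w hw), hH.deg⟩

theorem Arena.exists_ends_of_notMem (P : Pseudorandom G d lam) {C : ℕ}
    (hC : lam * C ≤ d) (h0 : 0 < lam) (hC1 : 2 ^ 40 ≤ C) (hκ : d ≤ 128 * κ) {Y A : Finset V}
    (hY : ∀ u, κ ≤ (nb G u ∩ Y).card) (hF : Arena G Y A F) (Q : Finset V)
    (hQ : ∀ p ∈ Q, p ∉ Y) (hA : 2048 * A.card ≤ Fintype.card V) :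
    ∃ Bad ⊆ Q, 2 * Bad.card ≤ A.card ∧ ∀ p ∈ Q, p ∉ Bad →
      ∃ S ⊆ Y, Fintype.card V <
          768 * (S.card + (Y.filter fun w => (nb F w).card ≤ 1).card + A.card + 1) ∧
        ∀ s ∈ S, (nb F s).card = 2 ∧ ∃ H, Arena G (insert p Y) (insert p A) H ∧
          ∀ w, (nb H w).card + (if w = s then 1 else 0) =
            (nb F w).card + if w = p then 1 else 0 := by
  have hends : ∀ p ∈ Q, ∃ S : Finset V, p ∈ S ∧ S ⊆ insert p Y ∧ RotClosed G F Y A S ∧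
      (∀ s ∈ S, ∃ H, Moved (within G (insert p Y)) F (insert p Y) (insert p A) p H s) := by
    intro p hp
    obtain ⟨S, hpS, hSY, h1, h2⟩ := exists_ends (K := within G (insert p Y)) (Y := insert p Y)
      (A := insert p A) (x := p) (Bl := insert p A) (F := F) (fun a b hab => hab.2.1)
      ⟨hF.le.trans (within_mono G (subset_insert _ _)), hF.acyclic, fun _ => rfl, fun w hw => by
        rcases mem_insert.mp hw with rfl | hw
        · exact ⟨w, mem_insert_self _ _, Reachable.refl _⟩
        · obtain ⟨a, ha, h⟩ := hF.anchor w hw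
          exact ⟨a, mem_insert_of_mem ha, h⟩⟩ (mem_insert_self _ _)
      (fun w hw hwp => hF.one_le w ((mem_insert.mp hw).resolve_left hwp))
      (fun v _ hv => Or.inl hv)
    refine ⟨S, hpS, hSY, ?_, h1⟩
    intro s hs v hv hsv
    rcases h2 s hs v ⟨hsv, hSY hs, mem_insert_of_mem hv⟩ with h | h | h
    · exact Or.inl h
    · exact Or.inr (Or.inl h)
    · rcases mem_insert.mp h with rfl | h
      · exact Or.inl hpS
      · exact Or.inr (Or.inr h)
  choose! S hpS hSY hcl hmov using hends
  refine ⟨Q.filter fun p => 2 * (S p).card ≤ A.card, filter_subset _ _, ?_, ?_⟩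
  · have key : ∀ B : Finset V, B ⊆ (Q.filter fun p => 2 * (S p).card ≤ A.card) →
        RotClosed G F Y A (B.biUnion S) ∧ 2 * (B.biUnion S).card ≤ A.card := by
      intro B
      induction B using Finset.induction_on with
      | empty => intro _; simp [RotClosed]
      | insert p B hpB ih =>
        intro hB
        obtain ⟨ih1, ih2⟩ := ih ((subset_insert _ _).trans hB)
        obtain ⟨hpQ, hp2⟩ := mem_filter.mp (hB (mem_insert_self _ _))
        rw [biUnion_insert]
        have hc := (hcl p hpQ).union ih1
        refine ⟨hc, ?_⟩
        rcases P.card_rotClosed hC h0 hC1 hκ hF.deg_le (fun s _ => hY s) hc with h | h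
        · have := card_union_le (S p) (B.biUnion S)
          omega
        · exact h
    refine le_trans ?_ (key _ subset_rfl).2
    refine Nat.mul_le_mul_left _ (card_le_card fun p hp => ?_)
    exact mem_biUnion.mpr ⟨p, hp, hpS p (mem_filter.mp hp).1⟩
  · intro p hpQ hpB
    have hgood : ¬ 2 * (S p).card ≤ A.card := fun h => hpB (mem_filter.mpr ⟨hpQ, h⟩)
    have hcard := (P.card_rotClosed hC h0 hC1 hκ hF.deg_le (fun s _ => hY s)
      (hcl p hpQ)).resolve_right hgood
    have hnbp : nb F p = ∅ := nb_eq_empty_of_le_within hF.le (hQ p hpQ)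
    refine ⟨(S p).filter fun s => (nb F s).card = 2, ?_, ?_, ?_⟩
    · intro s hs
      obtain ⟨hs1, hs2⟩ := mem_filter.mp hs
      refine (mem_insert.mp (hSY p hpQ hs1)).resolve_left ?_
      rintro rfl
      rw [hnbp] at hs2
      simp at hs2
    · have h5 : (S p).card ≤ ((S p).filter fun s => (nb F s).card = 2).card +
          ((Y.filter fun w => (nb F w).card ≤ 1).card + 1) := by
        rw [← card_filter_add_card_filter_not (s := S p) (fun s => (nb F s).card = 2)]
        refine Nat.add_le_add_left (le_trans (card_le_card (t := insert p
          (Y.filter fun w => (nb F w).card ≤ 1)) fun w hw => ?_) (card_insert_le _ _)) _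
        rw [mem_filter] at hw
        have := hF.deg_le w
        rcases mem_insert.mp (hSY p hpQ hw.1) with rfl | hwY
        · exact mem_insert_self _ _
        · exact mem_insert_of_mem (mem_filter.mpr ⟨hwY, by omega⟩)
      omega
    · intro s hs
      obtain ⟨hs1, hs2⟩ := mem_filter.mp hs
      obtain ⟨H, hH⟩ := hmov p hpQ s hs1
      exact ⟨hs2, H, hH.arena hF.deg_le (by rw [hnbp]; simp) hs2
        (fun w hw hwp => hF.one_le w ((mem_insert.mp hw).resolve_left hwp)), hH.deg⟩

end ArenaEnds

section Stages
open Finset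
open scoped Classical

variable {V : Type} [Fintype V] {G L E : SimpleGraph V} {d κ : ℕ} {lam : ℝ} {a b : V}
  {Y A : Fin 3 → Finset V} {F : Fin 3 → SimpleGraph V} {Core W D : Finset V}

/-- Linear forests `F i` on three disjoint sets `Y i`, together with a graph `E` of further edges,
such that all degrees on `W` are two except for a deficiency of one at the vertices of `D`. -/
structure Stage (G L : SimpleGraph V) (a b : V) (Core W : Finset V) (Y A : Fin 3 → Finset V)
    (F : Fin 3 → SimpleGraph V) (E : SimpleGraph V) (D : Finset V) : Prop where
  disj : ∀ i j, i ≠ j → Disjoint (Y i) (Y j)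
  core : ∀ i, Disjoint (Y i) Core
  arena : ∀ i, Arena G (Y i) (A i) (F i)
  anchor_zero : A 0 = Y 0
  anchor_adj : ∀ i, i ≠ 0 → ∀ v ∈ A i, ∃ c ∈ Core, L.Adj v c
  out : ∀ i u v, E.Adj u v → u ∈ Y i → v ∉ Y i
  deg : ∀ v, (nb (F 0) v).card + (nb (F 1) v).card + (nb (F 2) v).card + (nb E v).card +
    (if v ∈ D then 1 else 0) = if v ∈ W then 2 else 0
  le : E ≤ G ⊔ edge a b
  ge : L ≤ E

theorem Stage.deg_add_le (h : Stage G L a b Core W Y A F E D) (i : Fin 3) (v : V) :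
    (nb (F i) v).card + (nb E v).card + (if v ∈ D then 1 else 0) ≤ 2 := by
  have := h.deg v
  fin_cases i <;> simp only [Fin.zero_eta, Fin.mk_one, Fin.reduceFinMk] <;>
    split_ifs at * <;> omega

/-- Linking the deficient vertex `x` of `Y 0` with the deficient vertex `p` through the
forests `F 0` and `F i`. -/
theorem Stage.link (h : Stage G L a b Core W Y A F E D) {i : Fin 3} (hi : i ≠ 0) {x p c : V}
    (hxD : x ∈ D) (hx : x ∈ Y 0) (hpD : p ∈ D) (hp : ∀ j, p ∉ Y j) (hpc : p ∉ Core)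
    (hc : c ∈ Core) (hL : L.Adj p c) (hpE : ∀ v, E.Adj p v → v = c) {s t : V} (hst : G.Adj s t)
    (hs : s ∈ Y 0) (ht : t ∈ Y i) (hs2 : (nb (F 0) s).card = 2)
    {F₀ F₁ : SimpleGraph V} (h₀ : Arena G (Y 0) (Y 0) F₀)
    (h₀d : ∀ w, (nb F₀ w).card + (if w = s then 1 else 0) =
      (nb (F 0) w).card + if w = x then 1 else 0)
    (h₁ : Arena G (insert p (Y i)) (insert p (A i)) F₁)
    (h₁d : ∀ w, (nb F₁ w).card + (if w = t then 1 else 0) =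
      (nb (F i) w).card + if w = p then 1 else 0) :
    Stage G L a b Core W (Function.update Y i (insert p (Y i)))
      (Function.update A i (insert p (A i)))
      (Function.update (Function.update F 0 F₀) i F₁) (E ⊔ edge s t) ((D.erase x).erase p) := by
  have hEs : ∀ v, ¬ E.Adj s v := by
    intro v hv
    have := h.deg_add_le 0 s
    have := one_le_card_nb hv
    omega
  have hxp : x ≠ p := fun e => hp 0 (e ▸ hx)
  have hsp : s ≠ p := fun e => hp 0 (e ▸ hs)
  have hmem : ∀ j v, v ∈ Function.update Y i (insert p (Y i)) j ↔
      v ∈ Y j ∨ (j = i ∧ v = p) := by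
    intro j v
    by_cases hj : j = i
    · subst hj; simp [or_comm]
    · simp [hj]
  have h0i : (0 : Fin 3) ≠ i := fun e => hi e.symm
  have hcY : ∀ j, c ∉ Y j := fun j hj => Finset.disjoint_left.mp (h.core j) hj hc
  refine ⟨?_, ?_, ?_, ?_, ?_, ?_, ?_, ?_, ?_⟩
  · intro j k hjk
    rw [Finset.disjoint_left]
    intro v hv hv'
    rw [hmem] at hv hv'
    rcases hv with hv | ⟨hji, rfl⟩ <;> rcases hv' with hv' | ⟨hki, h'⟩
    · exact Finset.disjoint_left.mp (h.disj j k hjk) hv hv'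
    · exact hp _ (h' ▸ hv)
    · exact hp _ hv'
    · exact hjk (hji.trans hki.symm)
  · intro j
    rw [Finset.disjoint_left]
    intro v hv
    rw [hmem] at hv
    rcases hv with hv | ⟨-, rfl⟩
    · exact Finset.disjoint_left.mp (h.core j) hv
    · exact hpc
  · intro j
    by_cases hj : j = i
    · subst hj; simpa using h₁
    · by_cases hj0 : j = 0
      · subst hj0
        simp only [Function.update_of_ne hj, Function.update_self]
        rw [h.anchor_zero]; exact h₀
      · simpa [hj, hj0] using h.arena j
  · simp [Function.update_of_ne h0i, h.anchor_zero]
  · intro j hj v hv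
    by_cases hji : j = i
    · subst hji
      simp only [Function.update_self, mem_insert] at hv
      rcases hv with rfl | hv
      · exact ⟨c, hc, hL⟩
      · exact h.anchor_adj j hj v hv
    · rw [Function.update_of_ne hji] at hv
      exact h.anchor_adj j hj v hv
  · have hone : ∀ j u v, E.Adj u v → (u ∈ Y j ∨ (j = i ∧ u = p)) →
        ¬ (v ∈ Y j ∨ (j = i ∧ v = p)) := by
      intro j u v huv hu hv
      rcases hu with hu | ⟨hji, rfl⟩ <;> rcases hv with hv | ⟨hji', h'⟩
      · exact h.out j u v huv hu hv
      · rw [h'] at huv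
        rw [hpE u huv.symm] at hu
        exact hcY _ hu
      · rw [hpE v huv] at hv
        exact hcY _ hv
      · exact huv.ne h'.symm
    have hdis : ∀ j, s ∈ Y j ∨ (j = i ∧ s = p) → ¬ (t ∈ Y j ∨ (j = i ∧ t = p)) := by
      rintro j (hsj | ⟨-, rfl⟩)
      · have hj0 : j = 0 := by
          by_contra hne
          exact Finset.disjoint_left.mp (h.disj j 0 hne) hsj hs
        subst hj0
        rintro (h' | ⟨h', -⟩)
        · exact Finset.disjoint_left.mp (h.disj 0 i h0i) h' ht
        · exact h0i h'
      · exact absurd rfl hsp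
    intro j u v huv hu
    rw [hmem] at hu ⊢
    rcases huv with huv | huv
    · exact hone j u v huv hu
    · rw [edge_adj] at huv
      rcases huv.1 with ⟨rfl, rfl⟩ | ⟨rfl, rfl⟩
      · exact hdis j hu
      · exact fun h' => hdis j h' hu
  · intro v
    have hd := h.deg v
    have h1 := h₀d v
    have h2 := h₁d v
    have h3 := card_nb_sup_edge hst.ne (hEs t) v
    have h4 : (if v ∈ D then 1 else 0) = (if v ∈ (D.erase x).erase p then 1 else 0) +
        (if v = x then 1 else 0) + (if v = p then 1 else 0) := by
      by_cases e1 : v = x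
      · subst e1; simp [hxD, hxp]
      · by_cases e2 : v = p
        · subst e2; simp [hpD, e1]
        · simp [e1, e2]
    have h5 : i = 1 ∨ i = 2 := by omega
    rw [h4] at hd
    rcases h5 with rfl | rfl
    · simp only [Function.update_self, ne_eq, h0i, not_false_eq_true, Function.update_of_ne,
        show (2 : Fin 3) ≠ 1 by decide, show (2 : Fin 3) ≠ 0 by decide]
      omega
    · simp only [Function.update_self, ne_eq, h0i, not_false_eq_true, Function.update_of_ne,
        show (1 : Fin 3) ≠ 2 by decide, show (1 : Fin 3) ≠ 0 by decide]
      omega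
  · refine sup_le h.le ?_
    rw [edge_le_iff]
    exact Or.inr (Or.inl hst)
  · exact h.ge.trans le_sup_left

end Stages

section Rounds
open Finset
open scoped Classical

variable {V : Type} [Fintype V] {G L E : SimpleGraph V} {d κ : ℕ} {lam : ℝ} {a b : V}
  {Y A : Fin 3 → Finset V} {F : Fin 3 → SimpleGraph V} {Core W D : Finset V}

/-- The vertices of `Y` of degree at most one in `F`. -/
noncomputable def lowSet (F : SimpleGraph V) (Y : Finset V) : Finset V :=
  Y.filter fun w => (nb F w).card ≤ 1

theorem card_lowSet_le {F H : SimpleGraph V} {s x : V} {Y : Finset V}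
    (h : ∀ w, (nb H w).card + (if w = s then 1 else 0) = (nb F w).card + if w = x then 1 else 0) :
    (lowSet H (insert x Y)).card ≤ (lowSet F Y).card + 2 := by
  have : lowSet H (insert x Y) ⊆ lowSet F Y ∪ {s, x} := by
    intro w hw
    rw [lowSet, mem_filter, mem_insert] at hw
    rw [mem_union, lowSet, mem_filter, mem_insert, mem_singleton]
    by_contra hne
    push Not at hne
    have h1 := h w
    rw [if_neg hne.2.1, if_neg hne.2.2] at h1
    have h2 := hne.1 (hw.1.resolve_left hne.2.2)
    omega
  refine (card_le_card this).trans ((card_union_le _ _).trans (Nat.add_le_add_left ?_ _))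
  exact card_le_two

/-- A deficient vertex `p` can be absorbed by the forest `F` at many places. -/
def AbsorbsAt (G F : SimpleGraph V) (Y A : Finset V) (p : V) : Prop :=
  ∃ S ⊆ Y, Fintype.card V < 768 * (S.card + (lowSet F Y).card + A.card + 1) ∧
    ∀ s ∈ S, (nb F s).card = 2 ∧ ∃ H, Arena G (insert p Y) (insert p A) H ∧
      ∀ w, (nb H w).card + (if w = s then 1 else 0) = (nb F w).card + if w = p then 1 else 0

theorem Stage.exists_link (P : Pseudorandom G d lam) {C : ℕ}
    (hC : lam * C ≤ d) (h0 : 0 < lam) (hC1 : 2 ^ 40 ≤ C) (hn : 2 ^ 20 ≤ Fintype.card V)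
    (hκ : d ≤ 128 * κ) (hY : ∀ u ∈ Y 0, κ ≤ (nb G u ∩ Y 0).card)
    (h : Stage G L a b Core W Y A F E D) {i : Fin 3} (hi : i ≠ 0) {x p c : V}
    (hxD : x ∈ D) (hx : x ∈ Y 0) (hpD : p ∈ D) (hp : ∀ j, p ∉ Y j) (hpc : p ∉ Core)
    (hc : c ∈ Core) (hL : L.Adj p c) (hpE : ∀ v, E.Adj p v → v = c)
    (hab : AbsorbsAt G (F i) (Y i) (A i) p)
    (hs0 : 2048 * (lowSet (F 0) (Y 0)).card ≤ Fintype.card V)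
    (hsi : 2048 * ((lowSet (F i) (Y i)).card + (A i).card + 1) ≤ Fintype.card V) :
    ∃ F' E', Stage G L a b Core W (Function.update Y i (insert p (Y i)))
      (Function.update A i (insert p (A i))) F' E' ((D.erase x).erase p) ∧
      (∀ j, j ≠ 0 → j ≠ i → F' j = F j) ∧
      (lowSet (F' 0) (Y 0)).card ≤ (lowSet (F 0) (Y 0)).card + 2 ∧
      (lowSet (F' i) (insert p (Y i))).card ≤ (lowSet (F i) (Y i)).card + 2 ∧
      E ≤ E' ∧ ∀ u, (∀ j, u ∉ Y j) → ∀ v, E'.Adj u v → E.Adj u v := by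
  have hx1 : (nb (F 0) x).card ≤ 1 := by
    have := h.deg_add_le 0 x
    rw [if_pos hxD] at this
    omega
  have ha0 := h.arena 0
  rw [h.anchor_zero] at ha0
  obtain ⟨S, hSY, hSc, hS⟩ := ha0.exists_ends_of_mem P hC h0 hC1 hκ hY hx hx1
  obtain ⟨T, hTY, hTc, hT⟩ := hab
  change _ < 768 * (_ + (lowSet (F 0) (Y 0)).card) at hSc
  have hnC : Fintype.card V < C * (Fintype.card V / 1536) := by
    have h1 : Fintype.card V < 2 ^ 40 * (Fintype.card V / 1536) := by omega
    exact h1.trans_le (Nat.mul_le_mul_right _ hC1)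
  clear hC1
  obtain ⟨s, hs, t, ht, hst⟩ := P.joined_of_le hC h0 hnC S T (by omega) (by omega)
  obtain ⟨hs2, F₀, hF₀, hd₀⟩ := hS s hs
  obtain ⟨-, F₁, hF₁, hd₁⟩ := hT t ht
  refine ⟨_, _, h.link hi hxD hx hpD hp hpc hc hL hpE hst (hSY hs) (hTY ht) hs2 hF₀ hd₀ hF₁ hd₁,
    ?_, ?_, ?_, le_sup_left, ?_⟩
  · intro j h1 h2
    rw [Function.update_of_ne h2, Function.update_of_ne h1]
  · rw [Function.update_of_ne hi.symm, Function.update_self]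
    have := card_lowSet_le (Y := Y 0) hd₀
    rwa [insert_eq_of_mem hx] at this
  · rw [Function.update_self]
    exact card_lowSet_le hd₁
  · intro u hu v huv
    rcases huv with huv | huv
    · exact huv
    · rw [edge_adj] at huv
      rcases huv.1 with ⟨rfl, rfl⟩ | ⟨rfl, rfl⟩
      · exact absurd (hSY hs) (hu 0)
      · exact absurd (hTY ht) (hu i)

/-- Edges `p j, p' j` of `E`, whose ends are attached to `Core`, held in supply. -/
structure Supply {ι : Type} (L : SimpleGraph V) (Core : Finset V) (Y : Fin 3 → Finset V)
    (E : SimpleGraph V) (J : Finset ι) (p p' : ι → V) : Prop where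
  notMem : ∀ j ∈ J, ∀ i, p j ∉ Y i ∧ p' j ∉ Y i
  notCore : ∀ j ∈ J, p j ∉ Core ∧ p' j ∉ Core
  adj : ∀ j ∈ J, E.Adj (p j) (p' j)
  notAdj : ∀ j ∈ J, ¬ L.Adj (p j) (p' j)
  left : ∀ j ∈ J, ∃ c ∈ Core, L.Adj (p j) c ∧ ∀ v, E.Adj (p j) v → v = p' j ∨ v = c
  right : ∀ j ∈ J, ∃ c ∈ Core, L.Adj (p' j) c ∧ ∀ v, E.Adj (p' j) v → v = p j ∨ v = c
  inj : ∀ j ∈ J, ∀ k ∈ J, j ≠ k → p j ≠ p k ∧ p j ≠ p' k ∧ p' j ≠ p' k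

theorem Stage.free {p p' : V} (h : Stage G L a b Core W Y A F E D) (hpp : E.Adj p p')
    (hL : ¬ L.Adj p p') (hp : p ∉ D) (hp' : p' ∉ D) :
    Stage G L a b Core W Y A F (E.deleteEdges {s(p, p')}) (insert p (insert p' D)) where
  disj := h.disj
  core := h.core
  arena := h.arena
  anchor_zero := h.anchor_zero
  anchor_adj := h.anchor_adj
  out i u v huv := h.out i u v (deleteEdges_le _ huv)
  deg v := by
    rw [← h.deg v, ← card_nb_deleteEdges hpp v]
    have hne := hpp.ne
    by_cases h1 : v = p
    · subst h1; simp [hp, hne]; ring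
    · by_cases h2 : v = p'
      · subst h2; simp [hp', h1]; ring
      · simp [h1, h2]
  le := (deleteEdges_le _).trans h.le
  ge u v huv := by
    rw [deleteEdges_adj]
    refine ⟨h.ge huv, ?_⟩
    simp only [Set.mem_singleton_iff, Sym2.eq_iff]
    rintro (⟨rfl, rfl⟩ | ⟨rfl, rfl⟩)
    · exact hL huv
    · exact hL huv.symm

theorem Stage.exists_absorbing {ι : Type} (P : Pseudorandom G d lam) {C : ℕ}
    (hC : lam * C ≤ d) (h0 : 0 < lam) (hC1 : 2 ^ 40 ≤ C) (hκ : d ≤ 128 * κ)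
    (h : Stage G L a b Core W Y A F E D)
    (hY : ∀ i, i ≠ 0 → ∀ u, κ ≤ (nb G u ∩ Y i).card) {J : Finset ι} {p p' : ι → V}
    (hJ : Supply L Core Y E J p p')
    (hA1 : 2048 * (A 1).card ≤ Fintype.card V) (hA2 : 2048 * (A 2).card ≤ Fintype.card V)
    (hJc : (A 1).card + (A 2).card < 2 * J.card) :
    ∃ j ∈ J, AbsorbsAt G (F 1) (Y 1) (A 1) (p j) ∧ AbsorbsAt G (F 2) (Y 2) (A 2) (p' j) := by
  obtain ⟨B1, -, hB1, h1⟩ := (h.arena 1).exists_ends_of_notMem P hC h0 hC1 hκ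
    (hY 1 (by decide)) (J.image p) (by
      intro q hq
      obtain ⟨j, hj, rfl⟩ := mem_image.mp hq
      exact (hJ.notMem j hj 1).1) hA1
  obtain ⟨B2, -, hB2, h2⟩ := (h.arena 2).exists_ends_of_notMem P hC h0 hC1 hκ
    (hY 2 (by decide)) (J.image p') (by
      intro q hq
      obtain ⟨j, hj, rfl⟩ := mem_image.mp hq
      exact (hJ.notMem j hj 2).2) hA2
  have c1 : (J.filter fun j => p j ∈ B1).card ≤ B1.card := by
    refine card_le_card_of_injOn p (fun j hj => (mem_filter.mp hj).2) ?_
    intro j hj k hk e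
    by_contra hne
    exact (hJ.inj j (mem_filter.mp hj).1 k (mem_filter.mp hk).1 hne).1 e
  have c2 : (J.filter fun j => p' j ∈ B2).card ≤ B2.card := by
    refine card_le_card_of_injOn p' (fun j hj => (mem_filter.mp hj).2) ?_
    intro j hj k hk e
    by_contra hne
    exact (hJ.inj j (mem_filter.mp hj).1 k (mem_filter.mp hk).1 hne).2.2 e
  obtain ⟨j, hj, hj'⟩ : ∃ j ∈ J, j ∉ (J.filter fun j => p j ∈ B1) ∪ J.filter fun j => p' j ∈ B2 := by
    by_contra hne
    push Not at hne
    have h3 := (card_le_card (show J ⊆ _ from hne)).trans (card_union_le _ _)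
    clear hC1
    omega
  simp only [mem_union, mem_filter, not_or, not_and] at hj'
  exact ⟨j, hj, h1 _ (mem_image_of_mem _ hj) (hj'.1 hj), h2 _ (mem_image_of_mem _ hj) (hj'.2 hj)⟩

theorem Stage.exists_round {ι : Type} (P : Pseudorandom G d lam) {C : ℕ}
    (hC : lam * C ≤ d) (h0 : 0 < lam) (hC1 : 2 ^ 40 ≤ C) (hn : 2 ^ 20 ≤ Fintype.card V)
    (hκ : d ≤ 128 * κ) (hY0 : ∀ u ∈ Y 0, κ ≤ (nb G u ∩ Y 0).card)
    (hY : ∀ i, i ≠ 0 → ∀ u, κ ≤ (nb G u ∩ Y i).card)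
    (h : Stage G L a b Core W Y A F E D) (hD : D ⊆ Y 0) {J : Finset ι} {p p' : ι → V}
    (hJ : Supply L Core Y E J p p') {β : ℕ} (hβ : 2048 * β ≤ Fintype.card V)
    (hl0 : (lowSet (F 0) (Y 0)).card + 2 * D.card ≤ β)
    (hl : ∀ i, i ≠ 0 → (lowSet (F i) (Y i)).card + (A i).card + 2 * D.card ≤ β)
    (hJc : β + D.card ≤ J.card) {x x' : V} (hx : x ∈ D) (hx' : x' ∈ D) (hne : x ≠ x') :
    ∃ Y' A' F' E' J', Stage G L a b Core W Y' A' F' E' ((D.erase x).erase x') ∧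
      Supply L Core Y' E' J' p p' ∧ Y' 0 = Y 0 ∧ (∀ i, Y i ⊆ Y' i) ∧
      (lowSet (F' 0) (Y' 0)).card ≤ (lowSet (F 0) (Y 0)).card + 4 ∧
      (∀ i, i ≠ 0 → (lowSet (F' i) (Y' i)).card + (A' i).card ≤
        (lowSet (F i) (Y i)).card + (A i).card + 3) ∧
      J.card ≤ J'.card + 1 := by
  have hD2 : 2 ≤ D.card := by
    have : ({x, x'} : Finset V) ⊆ D := by
      intro v hv
      rw [mem_insert, mem_singleton] at hv
      rcases hv with rfl | rfl <;> assumption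
    simpa [card_pair hne] using card_le_card this
  have hl1 := hl 1 (by decide)
  have hl2 := hl 2 (by decide)
  obtain ⟨j, hj, hab, hab'⟩ := h.exists_absorbing P hC h0 hC1 hκ hY hJ (by omega) (by omega)
    (by omega)
  obtain ⟨c, hc, hcL, hcE⟩ := hJ.left j hj
  obtain ⟨c', hc', hcL', hcE'⟩ := hJ.right j hj
  have hpY : ∀ i, p j ∉ Y i := fun i => (hJ.notMem j hj i).1
  have hpY' : ∀ i, p' j ∉ Y i := fun i => (hJ.notMem j hj i).2
  have hpp := hJ.adj j hj
  have hxY := hD hx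
  have hxY' := hD hx'
  have hst := h.free hpp (hJ.notAdj j hj) (fun e => hpY 0 (hD e)) (fun e => hpY' 0 (hD e))
  obtain ⟨F1, E1, hst1, hF1, hlow0, hlow1, hEE, hE1⟩ := hst.exists_link P hC h0 hC1 hn hκ hY0
    (i := 1) (by decide) (x := x) (p := p j) (c := c) (by simp [hx]) hxY (by simp) hpY
    (hJ.notCore j hj).1 hc hcL (by
      intro v hv
      rw [deleteEdges_adj] at hv
      refine (hcE v hv.1).resolve_left ?_
      rintro rfl
      exact hv.2 rfl) hab (by omega) (by omega)
  have hD1 : ((insert (p j) (insert (p' j) D)).erase x).erase (p j) = insert (p' j) (D.erase x) := by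
    have e1 : p j ≠ x := fun e => hpY 0 (e ▸ hxY)
    have e2 : p' j ≠ x := fun e => hpY' 0 (e ▸ hxY)
    have e3 : p j ∉ D := fun e => hpY 0 (hD e)
    have e4 := hpp.ne
    ext v
    simp only [mem_erase, mem_insert]
    constructor
    · rintro ⟨h1, h2, h3⟩
      rcases h3 with h3 | h3 | h3
      · exact absurd h3 h1
      · exact Or.inl h3
      · exact Or.inr ⟨h2, h3⟩
    · rintro (rfl | ⟨h2, h3⟩)
      · exact ⟨e4.symm, e2, by simp⟩
      · exact ⟨fun e => e3 (e ▸ h3), h2, by simp [h3]⟩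
  rw [hD1] at hst1
  set Y1 := Function.update Y 1 (insert (p j) (Y 1)) with hY1
  set A1 := Function.update A 1 (insert (p j) (A 1)) with hA1
  have y0 : Y1 0 = Y 0 := Function.update_of_ne (by decide) _ _
  have y1 : Y1 1 = insert (p j) (Y 1) := Function.update_self _ _ _
  have y2 : Y1 2 = Y 2 := Function.update_of_ne (by decide) _ _
  have a1 : A1 1 = insert (p j) (A 1) := Function.update_self _ _ _
  have a2 : A1 2 = A 2 := Function.update_of_ne (by decide) _ _
  have f2 : F1 2 = F 2 := hF1 2 (by decide) (by decide)
  have hpY1 : ∀ i, p' j ∉ Y1 i := by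
    intro i
    by_cases hi : i = 1
    · subst hi; rw [y1, mem_insert]; rintro (e | e)
      · exact hpp.ne e.symm
      · exact hpY' _ e
    · rw [hY1, Function.update_of_ne hi]; exact hpY' i
  rw [← f2, ← y2, ← a2] at hab'
  rw [← y0] at hlow0
  rw [← y1] at hlow1
  obtain ⟨F2, E2, hst2, hF2, hlow0', hlow2, hEE', hE2⟩ := hst1.exists_link P hC h0 hC1 hn hκ
    (by rw [y0]; exact hY0) (i := 2) (by decide) (x := x') (p := p' j) (c := c')
    (by simp [hne.symm, hx']) (by rw [y0]; exact hxY') (by simp) hpY1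
    (hJ.notCore j hj).2 hc' hcL' (by
      intro v hv
      have hv := hE1 _ hpY' v hv
      rw [deleteEdges_adj] at hv
      refine (hcE' v hv.1).resolve_left ?_
      rintro rfl
      exact hv.2 (by simp [Sym2.eq_swap])) hab' (by rw [y0] at hlow0 ⊢; omega) (by rw [y2, f2, a2]; omega)
  have hD2' : ((insert (p' j) (D.erase x)).erase x').erase (p' j) = (D.erase x).erase x' := by
    have e2 : p' j ≠ x' := fun e => hpY' 0 (e ▸ hxY')
    have e3 : p' j ∉ D := fun e => hpY' 0 (hD e)
    ext v
    simp only [mem_erase, mem_insert]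
    constructor
    · rintro ⟨h1, h2, h3⟩
      exact ⟨h2, h3.resolve_left h1⟩
    · rintro ⟨h2, h3, h4⟩
      exact ⟨fun e => e3 (e ▸ h4), h2, Or.inr ⟨h3, h4⟩⟩
  rw [hD2'] at hst2
  set Y2 := Function.update Y1 2 (insert (p' j) (Y1 2)) with hY2
  set A2 := Function.update A1 2 (insert (p' j) (A1 2)) with hA2
  have z0 : Y2 0 = Y 0 := (Function.update_of_ne (by decide) _ _).trans y0
  have z1 : Y2 1 = insert (p j) (Y 1) := (Function.update_of_ne (by decide) _ _).trans y1
  have z2 : Y2 2 = insert (p' j) (Y 2) := by rw [hY2, Function.update_self, y2]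
  have b1 : A2 1 = insert (p j) (A 1) := (Function.update_of_ne (by decide) _ _).trans a1
  have b2 : A2 2 = insert (p' j) (A 2) := by rw [hA2, Function.update_self, a2]
  have g1 : F2 1 = F1 1 := hF2 1 (by decide) (by decide)
  refine ⟨Y2, A2, F2, E2, J.erase j, hst2, ?_, z0, ?_, ?_, ?_, ?_⟩
  · have hout : ∀ k ∈ J.erase j, ∀ i, p k ∉ Y2 i ∧ p' k ∉ Y2 i := by
      intro k hk i
      obtain ⟨hkj, hkJ⟩ := mem_erase.mp hk
      have h1 := hJ.inj k hkJ j hj hkj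
      have h2 := hJ.inj j hj k hkJ hkj.symm
      have h3 := hJ.notMem k hkJ i
      fin_cases i
      · simpa [z0] using h3
      · simp only [Fin.mk_one, z1, mem_insert, not_or]
        exact ⟨⟨h1.1, h3.1⟩, h2.2.1.symm, h3.2⟩
      · simp only [Fin.reduceFinMk, z2, mem_insert, not_or]
        exact ⟨⟨h1.2.1, h3.1⟩, h1.2.2, h3.2⟩
    have hback : ∀ u, (∀ i, u ∉ Y2 i) → ∀ v, E2.Adj u v → E.Adj u v := by
      intro u hu v huv
      have hu0 : u ∉ Y 0 := z0 ▸ hu 0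
      have hu1 : u ∉ Y1 1 := by rw [y1, ← z1]; exact hu 1
      have hu2 : u ∉ Y 2 := fun e => hu 2 (by rw [z2]; exact mem_insert_of_mem e)
      have hu1' : u ∉ Y 1 := fun e => hu1 (by rw [y1]; exact mem_insert_of_mem e)
      refine deleteEdges_le _ (hE1 u ?_ v (hE2 u ?_ v huv))
      · intro i; fin_cases i <;> assumption
      · intro i; fin_cases i
        · simpa [y0] using hu0
        · exact hu1
        · simpa [y2] using hu2
    refine ⟨hout, fun k hk => hJ.notCore k (mem_of_mem_erase hk), ?_,
      fun k hk => hJ.notAdj k (mem_of_mem_erase hk), ?_, ?_,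
      fun k hk l hl => hJ.inj k (mem_of_mem_erase hk) l (mem_of_mem_erase hl)⟩
    · intro k hk
      obtain ⟨hkj, hkJ⟩ := mem_erase.mp hk
      refine hEE' (hEE ?_)
      rw [deleteEdges_adj]
      refine ⟨hJ.adj k hkJ, ?_⟩
      have h1 := hJ.inj k hkJ j hj hkj
      simp only [Set.mem_singleton_iff, Sym2.eq_iff]
      rintro (⟨e, -⟩ | ⟨e, -⟩)
      · exact h1.1 e
      · exact h1.2.1 e
    · intro k hk
      obtain ⟨c, hc, h1, h2⟩ := hJ.left k (mem_of_mem_erase hk)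
      exact ⟨c, hc, h1, fun v hv => h2 v (hback _ (fun i => (hout k hk i).1) v hv)⟩
    · intro k hk
      obtain ⟨c, hc, h1, h2⟩ := hJ.right k (mem_of_mem_erase hk)
      exact ⟨c, hc, h1, fun v hv => h2 v (hback _ (fun i => (hout k hk i).2) v hv)⟩
  · intro i
    fin_cases i
    · simp [z0]
    · simp [z1]
    · simp [z2]
  · rw [z0]; rw [y0] at hlow0 hlow0'; omega
  · intro i hi
    have h5 : i = 1 ∨ i = 2 := by omega
    rcases h5 with rfl | rfl
    · rw [g1, z1, ← y1, b1]
      have := card_insert_le (p j) (A 1)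
      omega
    · rw [z2, ← y2, b2]
      rw [f2] at hlow2
      rw [y2] at hlow2 ⊢
      have := card_insert_le (p' j) (A 2)
      omega
  · rw [card_erase_of_mem hj]; omega

/-- All deficiencies can be removed, two at a time. -/
theorem Stage.exists_complete {ι : Type} (P : Pseudorandom G d lam) {C : ℕ}
    (hC : lam * C ≤ d) (h0 : 0 < lam) (hC1 : 2 ^ 40 ≤ C) (hn : 2 ^ 20 ≤ Fintype.card V)
    (hκ : d ≤ 128 * κ) {p p' : ι → V} {β : ℕ} (hβ : 2048 * β ≤ Fintype.card V) (r : ℕ) :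
    ∀ {Y A : Fin 3 → Finset V} {F : Fin 3 → SimpleGraph V} {E : SimpleGraph V} {D : Finset V}
      {J : Finset ι}, (∀ u ∈ Y 0, κ ≤ (nb G u ∩ Y 0).card) →
      (∀ i, i ≠ 0 → ∀ u, κ ≤ (nb G u ∩ Y i).card) →
      Stage G L a b Core W Y A F E D → D ⊆ Y 0 → Supply L Core Y E J p p' →
      (lowSet (F 0) (Y 0)).card + 2 * D.card ≤ β →
      (∀ i, i ≠ 0 → (lowSet (F i) (Y i)).card + (A i).card + 2 * D.card ≤ β) →
      β + D.card ≤ J.card → D.card = 2 * r →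
      ∃ Y' A' F' E', Stage G L a b Core W Y' A' F' E' ∅ ∧ ∀ i, Y i ⊆ Y' i := by
  induction r with
  | zero =>
    intro Y A F E D J _ _ h _ _ _ _ _ hr
    rw [Nat.mul_zero, card_eq_zero] at hr
    exact ⟨Y, A, F, E, hr ▸ h, fun i => Subset.rfl⟩
  | succ r ih =>
    intro Y A F E D J hY0 hY h hD hJ hl0 hl hJc hr
    obtain ⟨x, hx, x', hx', hne⟩ := one_lt_card.mp (show 1 < D.card by omega)
    obtain ⟨Y', A', F', E', J', h', hJ', hY0', hYY, hl0', hl', hJc'⟩ :=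
      h.exists_round P hC h0 hC1 hn hκ hY0 hY hD hJ hβ hl0 hl hJc hx hx' hne
    have hDc : ((D.erase x).erase x').card + 2 = D.card := by
      rw [card_erase_of_mem (mem_erase.mpr ⟨hne.symm, hx'⟩), card_erase_of_mem hx]
      omega
    obtain ⟨Y'', A'', F'', E'', h'', hYY'⟩ := ih (by rw [hY0']; exact hY0)
      (fun i hi u => (hY i hi u).trans (card_le_card (inter_subset_inter_left (hYY i)))) h'
      (by rw [hY0']; exact ((erase_subset _ _).trans (erase_subset _ _)).trans hD) hJ'
      (by omega)
      (fun i hi => by have := hl i hi; have := hl' i hi; omega) (by omega) (by omega)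
    exact ⟨Y'', A'', F'', E'', h'', fun i => (hYY i).trans (hYY' i)⟩

end Rounds

section Completed
open Finset
open scoped Classical

variable {V : Type} [Fintype V] {G L E H : SimpleGraph V} {a b : V}
  {Y A : Fin 3 → Finset V} {F : Fin 3 → SimpleGraph V} {Core W D : Finset V}

theorem degree_eq_card_nb (H : SimpleGraph V) (v : V) : H.degree v = (nb H v).card := by
  rw [← card_neighborFinset_eq_degree]
  congr 1
  ext u
  rw [mem_neighborFinset, mem_nb]

/-- If all degrees in the component of the edge `yz` are even then `yz` is not a bridge. -/
theorem reachable_deleteEdges_of_even {y z : V} (hyz : H.Adj y z)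
    (hev : ∀ w, H.Reachable y w → Even (nb H w).card) :
    (H.deleteEdges {s(y, z)}).Reachable y z := by
  by_contra hno
  set H1 := H.deleteEdges {s(y, z)} with hH1
  set Z : Finset V := univ.filter fun w => H1.Reachable y w with hZ
  have hdeg : ∀ w ∈ Z, nb (within H1 Z) w = nb H1 w := by
    intro w hw
    ext u
    rw [mem_nb, mem_nb]
    refine ⟨fun h => h.1, fun h => ⟨h, hw, ?_⟩⟩
    simp only [hZ, mem_filter, mem_univ, true_and] at hw ⊢
    exact hw.trans h.reachable
  have hout : ∀ w, w ∉ Z → nb (within H1 Z) w = ∅ := by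
    intro w hw
    ext u
    simp only [mem_nb, notMem_empty, iff_false]
    exact fun h => hw h.2.1
  have hyZ : y ∈ Z := by simp [hZ]
  have hodd : Odd ((within H1 Z).degree y) := by
    rw [degree_eq_card_nb, hdeg y hyZ]
    have h1 := card_nb_deleteEdges hyz y
    rw [if_pos rfl, if_neg hyz.ne, ← hH1] at h1
    have h2 := hev y (Reachable.refl _)
    rw [← h1] at h2
    exact (Nat.even_add_one.mp h2 |> Nat.not_even_iff_odd.mp)
  obtain ⟨w, hwy, hw⟩ := (within H1 Z).exists_ne_odd_degree_of_exists_odd_degree y hodd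
  rw [degree_eq_card_nb] at hw
  by_cases hwZ : w ∈ Z
  · rw [hdeg w hwZ] at hw
    have hwz : w ≠ z := by
      rintro rfl
      exact hno (by simpa [hZ] using hwZ)
    have h1 := card_nb_deleteEdges hyz w
    rw [if_neg hwy, if_neg hwz, ← hH1] at h1
    have h2 : H.Reachable y w := by
      have : H1.Reachable y w := by simpa [hZ] using hwZ
      exact this.mono (deleteEdges_le _)
    have h3 := hev w h2
    rw [← h1] at h3
    exact (Nat.not_even_iff_odd.mpr hw) h3
  · rw [hout w hwZ] at hw
    simp at hw

theorem exists_reachable_odd_of_isAcyclic (hH : H.IsAcyclic) {v : V} (hv : 1 ≤ (nb H v).card) :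
    ∃ w, H.Reachable v w ∧ Odd (nb H w).card := by
  by_contra hne
  push Not at hne
  obtain ⟨u, hu⟩ := card_pos.mp hv
  have h1 := reachable_deleteEdges_of_even (mem_nb.mp hu) fun w hw => Nat.not_odd_iff_even.mp (hne w hw)
  exact isBridge_iff.mp (isAcyclic_iff_forall_isBridge.mp hH (e := s(v, u)) (mem_nb.mp hu)) h1

theorem card_nb_sup {H K : SimpleGraph V} (h : ∀ u v, H.Adj u v → ¬ K.Adj u v) (v : V) :
    (nb (H ⊔ K) v).card = (nb H v).card + (nb K v).card := by
  rw [← card_union_of_disjoint]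
  · congr 1
    ext u
    simp [mem_nb]
  · rw [Finset.disjoint_left]
    intro u hu hu'
    exact h v u (mem_nb.mp hu) (mem_nb.mp hu')

theorem Stage.exists_two_factor (h : Stage G L a b Core W Y A F E ∅)
    (hcover : ∀ v ∈ W, (∃ i, v ∈ Y i) ∨ v ∈ Core ∨ ∃ c ∈ Core, L.Adj v c) :
    ∃ H, L ≤ H ∧ H ≤ G ⊔ edge a b ∧ (∀ v, (nb H v).card = if v ∈ W then 2 else 0) ∧
      ∀ v ∈ W, ∃ c ∈ Core, H.Reachable v c := by
  have hF : ∀ i j, i ≠ j → ∀ u v, (F i).Adj u v → ¬ (F j).Adj u v := by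
    intro i j hij u v h1 h2
    exact Finset.disjoint_left.mp (h.disj i j hij) ((h.arena i).le h1).2.1 ((h.arena j).le h2).2.1
  have hE : ∀ i u v, (F i).Adj u v → ¬ E.Adj u v := by
    intro i u v h1 h2
    exact h.out i u v h2 ((h.arena i).le h1).2.1 ((h.arena i).le h1).2.2
  set H := F 0 ⊔ F 1 ⊔ F 2 ⊔ E with hH
  have hdeg : ∀ v, (nb H v).card = if v ∈ W then 2 else 0 := by
    intro v
    have h1 := h.deg v
    rw [if_neg (notMem_empty _), add_zero] at h1
    rw [← h1, hH, card_nb_sup, card_nb_sup, card_nb_sup]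
    · exact hF 0 1 (by decide)
    · rintro u v (h1 | h1)
      · exact hF 0 2 (by decide) u v h1
      · exact hF 1 2 (by decide) u v h1
    · rintro u v ((h1 | h1) | h1)
      · exact hE 0 u v h1
      · exact hE 1 u v h1
      · exact hE 2 u v h1
  have hFH : ∀ i, F i ≤ H := by
    intro i u v huv
    fin_cases i
    · exact Or.inl (Or.inl (Or.inl huv))
    · exact Or.inl (Or.inl (Or.inr huv))
    · exact Or.inl (Or.inr huv)
  have hEH : E ≤ H := le_sup_right
  have hLH : L ≤ H := h.ge.trans hEH
  have hanc : ∀ i, i ≠ 0 → ∀ v ∈ Y i, ∃ c ∈ Core, H.Reachable v c := by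
    intro i hi v hv
    obtain ⟨w, hw, hr⟩ := (h.arena i).anchor v hv
    obtain ⟨c, hc, hL⟩ := h.anchor_adj i hi w hw
    exact ⟨c, hc, (hr.mono (hFH i)).trans (hLH hL).reachable⟩
  have hnot0 : ∀ v ∈ W, v ∉ Y 0 → ∃ c ∈ Core, H.Reachable v c := by
    intro v hv hv0
    rcases hcover v hv with ⟨i, hi⟩ | hc | ⟨c, hc, hL⟩
    · exact hanc i (fun e => hv0 (e ▸ hi)) v hi
    · exact ⟨v, hc, Reachable.refl _⟩
    · exact ⟨c, hc, (hLH hL).reachable⟩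
  have hW : ∀ u v, H.Adj u v → u ∈ W := by
    intro u v huv
    by_contra hu
    have h1 := hdeg u
    rw [if_neg hu] at h1
    have := one_le_card_nb huv
    omega
  refine ⟨H, hLH, ?_, hdeg, ?_⟩
  · have : ∀ i, F i ≤ G ⊔ edge a b := fun i =>
      ((h.arena i).le.trans (within_le G _)).trans le_sup_left
    exact sup_le (sup_le (sup_le (this 0) (this 1)) (this 2)) h.le
  · intro v hv
    by_cases hv0 : v ∈ Y 0
    · obtain ⟨w, hvw, hodd⟩ := exists_reachable_odd_of_isAcyclic (h.arena 0).acyclic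
        ((h.arena 0).one_le v hv0)
      have hw2 := (h.arena 0).deg_le w
      have hw1 : (nb (F 0) w).card = 1 := by
        obtain ⟨k, hk⟩ := hodd
        omega
      have hw0 : w ∈ Y 0 := by
        obtain ⟨u, hu⟩ := card_pos.mp (by omega : 0 < (nb (F 0) w).card)
        exact ((h.arena 0).le (mem_nb.mp hu)).2.1
      have hz : ∀ i, i ≠ 0 → nb (F i) w = ∅ := fun i hi =>
        nb_eq_empty_of_le_within (h.arena i).le fun hwi =>
          Finset.disjoint_left.mp (h.disj i 0 hi) hwi hw0
      have h1 := h.deg w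
      rw [hz 1 (by decide), hz 2 (by decide), hw1, if_neg (notMem_empty _)] at h1
      simp only [card_empty] at h1
      have hE1 : 0 < (nb E w).card := by
        split_ifs at h1 <;> omega
      obtain ⟨u, hu⟩ := card_pos.mp hE1
      have hwu := mem_nb.mp hu
      obtain ⟨c, hc, hr⟩ := hnot0 u (hW u w (hEH hwu.symm)) (h.out 0 w u hwu hw0)
      exact ⟨c, hc, (hvw.mono (hFH 0)).trans ((hEH hwu).reachable.trans hr)⟩
    · exact hnot0 v hv hv0

end Completed

section ListGraphs
open Finset
open scoped Classical

variable {V : Type} [Fintype V] {G H K : SimpleGraph V}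

/-- The path with the given sequence of vertices. -/
def listGraph : List V → SimpleGraph V
  | [] => ⊥
  | [_] => ⊥
  | x :: y :: l => listGraph (y :: l) ⊔ edge x y

theorem listGraph_le {l : List V} (h : l.IsChain H.Adj) : listGraph l ≤ H := by
  induction l with
  | nil => exact bot_le
  | cons x l ih =>
    cases l with
    | nil => exact bot_le
    | cons y l =>
      rw [List.isChain_cons_cons] at h
      exact sup_le (ih h.2) ((edge_le_iff _).mpr (Or.inr h.1))

theorem isChain_of_listGraph_le {l : List V} (hl : l.Nodup) (h : listGraph l ≤ H) :
    l.IsChain H.Adj := by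
  induction l with
  | nil => simp
  | cons x l ih =>
    cases l with
    | nil => simp
    | cons y l =>
      rw [List.isChain_cons_cons]
      have hxy : x ≠ y := fun e => by simp [e] at hl
      refine ⟨h (Or.inr ?_), ih (List.nodup_cons.mp hl).2 (le_sup_left.trans h)⟩
      rw [edge_adj]
      exact ⟨Or.inl ⟨rfl, rfl⟩, hxy⟩

theorem mem_of_listGraph_adj {l : List V} {u v : V} (h : (listGraph l).Adj u v) : u ∈ l ∧ v ∈ l := by
  induction l with
  | nil => exact h.elim
  | cons x l ih =>
    cases l with
    | nil => exact h.elim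
    | cons y l =>
      rcases h with h | h
      · exact ⟨List.mem_cons_of_mem _ (ih h).1, List.mem_cons_of_mem _ (ih h).2⟩
      · rw [edge_adj] at h
        rcases h.1 with ⟨rfl, rfl⟩ | ⟨rfl, rfl⟩ <;> simp

theorem card_nb_listGraph {l : List V} (hl : l.Nodup) (v : V) :
    (nb (listGraph l) v).card =
      (if v ∈ l.tail then 1 else 0) + (if v ∈ l.dropLast then 1 else 0) := by
  induction l with
  | nil => simp [listGraph, nb]
  | cons x l ih =>
    cases l with
    | nil => simp [listGraph, nb]
    | cons y l =>
      have hxy : x ≠ y := fun e => by simp [e] at hl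
      rw [List.nodup_cons] at hl
      rw [listGraph, card_nb_sup_edge hxy (fun h => hl.1 (mem_of_listGraph_adj h).1), ih hl.2]
      have hy : y ∉ l := (List.nodup_cons.mp hl.2).1
      have hx : x ∉ (y :: l).dropLast := fun h => hl.1 (List.mem_of_mem_dropLast h)
      simp only [List.tail_cons, List.dropLast_cons_cons, List.mem_cons]
      by_cases h1 : v = x
      · subst h1
        have : v ∉ l := fun h => hl.1 (List.mem_cons_of_mem _ h)
        simp [hxy, hx, this]
      · by_cases h2 : v = y
        · subst h2
          simp [hy, h1]; ring
        · simp only [h1, h2, false_or, if_false, add_zero]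
          congr

theorem reachable_of_isChain {l : List V} (h : l.IsChain H.Adj) {u v : V} (hu : u ∈ l)
    (hv : v ∈ l) : H.Reachable u v := by
  induction l generalizing u v with
  | nil => simp at hu
  | cons x l ih =>
    have key : ∀ w ∈ x :: l, H.Reachable x w := by
      intro w hw
      rcases List.mem_cons.mp hw with rfl | hw
      · exact Reachable.refl _
      · cases l with
        | nil => simp at hw
        | cons y l =>
          rw [List.isChain_cons_cons] at h
          exact h.1.reachable.trans (ih h.2 (by simp) hw)
    exact (key u hu).symm.trans (key v hv)

/-- A connected graph with two vertices of degree one and all other degrees two is a path. -/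
theorem exists_hamilton_list {W : Finset V} {a b : V} (hab : a ≠ b)
    (ha : (nb H a).card = 1) (hb : (nb H b).card = 1)
    (h2 : ∀ v, (nb H v).card ≤ 2) (hbW : b ∈ W) (hr : ∀ v ∈ W, H.Reachable a v) :
    ∃ w : List V, (a :: (w ++ [b])).Nodup ∧ (a :: (w ++ [b])).IsChain H.Adj ∧
      ∀ v ∈ W, v ∈ a :: (w ++ [b]) := by
  let Q : ℕ → Prop := fun n => ∃ l : List V, l.Nodup ∧ l.IsChain H.Adj ∧ l.getLast? = some a ∧
    l.length = n
  have hQ1 : Q 1 := ⟨[a], by simp, by simp, by simp, by simp⟩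
  have hc : 1 ≤ Fintype.card V := Fintype.card_pos_iff.mpr ⟨a⟩
  obtain ⟨l, hl, hch, hla, hlen⟩ := Nat.findGreatest_spec (P := Q) hc hQ1
  have hmax : ∀ x, l.head? = some x → ∀ u, H.Adj x u → u ∈ l := by
    intro x hx u hxu
    by_contra hu
    have hQ : Q (l.length + 1) := by
      refine ⟨u :: l, List.nodup_cons.mpr ⟨hu, hl⟩, ?_, ?_, by simp⟩
      · rw [List.isChain_cons]
        refine ⟨fun y hy => ?_, hch⟩
        rw [hx] at hy
        obtain rfl : x = y := by simpa using hy
        exact hxu.symm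
      · rw [List.getLast?_cons, hla]; rfl
    have h3 : l.length + 1 ≤ Fintype.card V := by
      obtain ⟨l', h', -, -, h''⟩ := hQ
      rw [← h'']
      exact h'.length_le_card
    have := Nat.le_findGreatest (P := Q) h3 hQ
    omega
  have hne : l ≠ [] := by rintro rfl; simp at hla
  obtain ⟨x, r, rfl⟩ := List.exists_cons_of_ne_nil hne
  have hlast : (x :: r).getLast hne = a := by
    rw [List.getLast?_eq_getLast_of_ne_nil hne] at hla
    simpa using hla
  have hsplit := List.dropLast_append_getLast hne
  rw [hlast] at hsplit
  have hdrop : ∀ v ∈ x :: r, v ≠ a → v ∈ (x :: r).dropLast := by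
    intro v hv hva
    rw [← hsplit, List.mem_append] at hv
    exact hv.resolve_right (by simpa using hva)
  have hsub : ∀ v, nb (listGraph (x :: r)) v ⊆ nb H v := by
    intro v u hu
    exact mem_nb.mpr (listGraph_le hch (mem_nb.mp hu))
  have hclosed : ∀ v ∈ x :: r, ∀ u, H.Adj v u → u ∈ x :: r := by
    intro v hv u huv
    by_cases hvx : v = x
    · exact hmax x (by simp) u (hvx ▸ huv)
    · have hd := card_nb_listGraph hl v
      have htail : v ∈ (x :: r).tail := by simpa [hvx] using hv
      rw [if_pos htail] at hd
      have heq : nb (listGraph (x :: r)) v = nb H v := by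
        refine eq_of_subset_of_card_le (hsub v) ?_
        by_cases hva : v = a
        · rw [hva] at hd ⊢; omega
        · rw [if_pos (hdrop v hv hva)] at hd
          have := h2 v
          omega
      have hu : u ∈ nb (listGraph (x :: r)) v := by rw [heq]; exact mem_nb.mpr huv
      exact (mem_of_listGraph_adj (mem_nb.mp hu)).2
  have hal : a ∈ x :: r := by rw [← hlast]; exact List.getLast_mem hne
  have hall : ∀ v, H.Reachable a v → v ∈ x :: r := by
    intro v hv
    have := hv.mem_of_closed (Z := {u | u ∈ x :: r}) hal (fun u hu w huw => hclosed u hu w huw)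
    exact this
  have hbx : b = x := by
    by_contra hbx
    have hbl := hall b (hr b hbW)
    have h3 := card_nb_listGraph hl b
    rw [if_pos (hdrop b hbl hab.symm), if_pos (by simpa [hbx] using hbl)] at h3
    have := card_le_card (hsub b)
    omega
  subst hbx
  have hr' : (b :: r).dropLast = b :: r.dropLast := by
    cases r with
    | nil => exact absurd (by simpa using hlast) hab.symm
    | cons y r => rfl
  rw [hr'] at hsplit
  have hrev : (b :: r).reverse = a :: (r.dropLast.reverse ++ [b]) := by
    rw [← hsplit]; simp
  refine ⟨r.dropLast.reverse, ?_, ?_, ?_⟩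
  · rw [← hrev]; exact List.nodup_reverse.mpr hl
  · rw [← hrev, List.isChain_reverse]
    exact hch.imp fun _ _ h => h.symm
  · intro v hv
    rw [← hrev, List.mem_reverse]
    exact hall v (hr v hv)

end ListGraphs

section Toggles
open Finset
open scoped Classical

variable {V : Type} [Fintype V] {G H K : SimpleGraph V}

/-- The data of a switch: the path `p, l, q` and the edge `y z` can be replaced with the
path `y, l', q` and the edge `z p`. -/
structure Toggle (V : Type) where
  (y z p q r : V)
  (l l' : List V)

/-- The edges removed by a switch. -/
def Toggle.old (T : Toggle V) : SimpleGraph V := listGraph (T.p :: (T.l ++ [T.q])) ⊔ edge T.y T.z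

/-- The edges added by a switch. -/
def Toggle.new (T : Toggle V) : SimpleGraph V := listGraph (T.y :: (T.l' ++ [T.q])) ⊔ edge T.z T.p

/-- The edges present before a switch. -/
def Toggle.base (T : Toggle V) : SimpleGraph V := T.old ⊔ edge T.p T.r

structure Toggle.Valid (T : Toggle V) (G : SimpleGraph V) : Prop where
  perm : T.l.Perm T.l'
  ne_nil : T.l ≠ []
  nodup : (T.p :: (T.l ++ [T.q])).Nodup
  y_ne : T.y ≠ T.z
  y_notMem : T.y ∉ T.p :: (T.l ++ [T.q])
  z_notMem : T.z ∉ T.p :: (T.l ++ [T.q])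
  r_notMem : T.r ∉ T.p :: (T.l ++ [T.q])
  r_ne : T.r ≠ T.z
  chain : (T.y :: (T.l' ++ [T.q])).IsChain G.Adj
  adj : G.Adj T.z T.p

namespace Toggle
variable {T : Toggle V}

theorem Valid.nodup' (h : T.Valid G) : (T.y :: (T.l' ++ [T.q])).Nodup := by
  have h1 := h.nodup
  have h2 := h.y_notMem
  rw [List.nodup_cons] at h1 ⊢
  have hp : (T.l ++ [T.q]).Perm (T.l' ++ [T.q]) := h.perm.append_right _
  exact ⟨fun e => h2 (List.mem_cons_of_mem _ (hp.mem_iff.mpr e)), hp.nodup_iff.mp h1.2⟩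

theorem dropLast_cons_append (x q : V) (l : List V) : (x :: (l ++ [q])).dropLast = x :: l := by
  rw [← List.cons_append, List.dropLast_concat]

theorem not_listGraph_adj {l : List V} {u v : V} (h : u ∉ l) : ¬ (listGraph l).Adj u v :=
  fun h' => h (mem_of_listGraph_adj h').1

theorem Valid.card_nb_old (h : T.Valid G) (v : V) : (nb T.old v).card =
    (if v ∈ T.l ++ [T.q] then 1 else 0) + (if v ∈ T.p :: T.l then 1 else 0) +
      (if v = T.y then 1 else 0) + (if v = T.z then 1 else 0) := by
  rw [old, card_nb_sup_edge h.y_ne (not_listGraph_adj h.y_notMem), card_nb_listGraph h.nodup,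
    List.tail_cons, dropLast_cons_append]

theorem Valid.z_notMem' (h : T.Valid G) : T.z ∉ T.y :: (T.l' ++ [T.q]) := by
  have h1 := h.z_notMem
  have h2 := h.y_ne
  simp only [List.mem_cons, List.mem_append, not_or, h.perm.mem_iff] at h1 ⊢
  exact ⟨h2.symm, h1.2⟩

theorem Valid.card_nb_new (h : T.Valid G) (v : V) : (nb T.new v).card = (nb T.old v).card := by
  have hzp : T.z ≠ T.p := fun e => h.z_notMem (by simp [e])
  have hpy : T.p ≠ T.y := fun e => h.y_notMem (by simp [e])
  have hp : T.p ∉ T.l := fun e => (List.nodup_cons.mp h.nodup).1 (by simp [e])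
  have hy : T.y ∉ T.l := fun e => h.y_notMem (by simp [e])
  rw [h.card_nb_old, new, card_nb_sup_edge hzp (not_listGraph_adj h.z_notMem'),
    card_nb_listGraph h.nodup', List.tail_cons, dropLast_cons_append]
  simp only [List.mem_cons, List.mem_append, ← h.perm.mem_iff]
  by_cases h1 : v = T.p
  · have h2 : v ∉ T.l := h1 ▸ hp
    simp [h1, hpy, hp]; ring
  · by_cases h2 : v = T.y
    · simp [h2, hpy.symm, hy]
    · simp [h1, h2]

theorem card_nb_sdiff_sup {D N : SimpleGraph V} (hD : D ≤ H) (hN : ∀ u v, N.Adj u v → H.Adj u v →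
    D.Adj u v) (v : V) :
    (nb ((H \ D) ⊔ N) v).card + (nb D v).card = (nb H v).card + (nb N v).card := by
  rw [card_nb_sup]
  · have h1 : (nb (H \ D) v).card + (nb D v).card = (nb H v).card := by
      rw [← card_nb_sup (fun u v (h : (H \ D).Adj u v) => h.2), sdiff_sup_cancel hD]
    omega
  · rintro u v h h'
    exact h.2 (hN u v h' h.1)

theorem Valid.adj_old (h : T.Valid G) (hB : T.base ≤ H) (h2 : ∀ v, (nb H v).card ≤ 2) {u v : V}
    (hu : u ∈ T.l) (huv : H.Adj u v) : T.old.Adj u v := by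
  have h1 : nb T.old u ⊆ nb H u := fun w hw => mem_nb.mpr (hB (Or.inl (mem_nb.mp hw)))
  have h3 : nb T.old u = nb H u := by
    refine eq_of_subset_of_card_le h1 ?_
    rw [h.card_nb_old, if_pos (by simp [hu]), if_pos (by simp [hu])]
    have := h2 u
    omega
  rw [← mem_nb, h3, mem_nb]
  exact huv

theorem Valid.new_old (h : T.Valid G) (hB : T.base ≤ H) (h2 : ∀ v, (nb H v).card ≤ 2) {u v : V}
    (hN : T.new.Adj u v) (huv : H.Adj u v) : T.old.Adj u v := by
  have hsym : ∀ {u v}, v ∈ T.l → H.Adj u v → T.old.Adj u v := fun hv huv =>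
    (h.adj_old hB h2 hv huv.symm).symm
  have hpath : ∀ {u v}, (listGraph (T.y :: (T.l' ++ [T.q]))).Adj u v → u ∈ T.l ∨ v ∈ T.l := by
    intro u v huv
    by_contra hne
    push Not at hne
    have hnd := h.nodup'
    have hyq : T.y ≠ T.q := fun e => h.y_notMem (by simp [e])
    have hl' : T.l' ≠ [] := fun e => h.ne_nil (by have := h.perm; rw [e] at this; exact this.eq_nil)
    have hm := mem_of_listGraph_adj huv
    have hnl : u ∉ T.l' ∧ v ∉ T.l' := ⟨fun e => hne.1 (h.perm.mem_iff.mpr e),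
      fun e => hne.2 (h.perm.mem_iff.mpr e)⟩
    have key : ¬ (listGraph (T.y :: (T.l' ++ [T.q]))).Adj T.y T.q := by
      intro hyq'
      obtain ⟨x, l, hxl⟩ := List.exists_cons_of_ne_nil hl'
      have hd := card_nb_listGraph hnd T.y
      rw [List.tail_cons, if_neg (List.nodup_cons.mp hnd).1, dropLast_cons_append,
        if_pos (by simp)] at hd
      have hx : (listGraph (T.y :: (T.l' ++ [T.q]))).Adj T.y x := by
        rw [hxl, List.cons_append, listGraph]
        refine Or.inr ?_
        rw [edge_adj]
        exact ⟨Or.inl ⟨rfl, rfl⟩, fun e => (List.nodup_cons.mp hnd).1 (by simp [hxl, e])⟩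
      obtain ⟨w, hw⟩ := card_eq_one.mp (hd.trans (by simp))
      have e1 : x = w := by simpa [hw] using mem_nb.mpr hx
      have e2 : T.q = w := by simpa [hw] using mem_nb.mpr hyq'
      rw [hxl, e1, ← e2] at hnd
      simp at hnd
    simp only [List.mem_cons, List.mem_append, hnl.1, hnl.2, false_or, List.not_mem_nil,
      or_false] at hm
    rcases hm.1 with rfl | rfl <;> rcases hm.2 with rfl | rfl
    · exact huv.ne rfl
    · exact key huv
    · exact key huv.symm
    · exact huv.ne rfl
  have hzp : ¬ H.Adj T.z T.p := by
    intro hzp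
    have hpr : T.p ≠ T.r := fun e => h.r_notMem (by simp [← e])
    obtain ⟨x, l, hxl⟩ := List.exists_cons_of_ne_nil h.ne_nil
    have hpx : H.Adj T.p x := by
      refine hB (Or.inl (Or.inl ?_))
      rw [hxl, List.cons_append, listGraph]
      refine Or.inr ?_
      rw [edge_adj]
      exact ⟨Or.inl ⟨rfl, rfl⟩, fun e => (List.nodup_cons.mp h.nodup).1 (by simp [hxl, e])⟩
    have hr : H.Adj T.p T.r := hB (Or.inr (by rw [edge_adj]; exact ⟨Or.inl ⟨rfl, rfl⟩, hpr⟩))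
    have h3 : ({T.z, x, T.r} : Finset V) ⊆ nb H T.p := by
      intro w hw
      simp only [mem_insert, mem_singleton] at hw
      rcases hw with rfl | rfl | rfl
      · exact mem_nb.mpr hzp.symm
      · exact mem_nb.mpr hpx
      · exact mem_nb.mpr hr
    have h4 := card_le_card h3
    have hzx : T.z ≠ x := fun e => h.z_notMem (by simp [e, hxl])
    have hxr : x ≠ T.r := fun e => h.r_notMem (by simp [← e, hxl])
    have h5 : ({T.z, x, T.r} : Finset V).card = 3 :=
      card_eq_three.mpr ⟨_, _, _, hzx, h.r_ne.symm, hxr, rfl⟩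
    have := h2 T.p
    omega
  rcases hN with hN | hN
  · rcases hpath hN with h1 | h1
    · exact h.adj_old hB h2 h1 huv
    · exact hsym h1 huv
  · rw [edge_adj] at hN
    rcases hN.1 with ⟨rfl, rfl⟩ | ⟨rfl, rfl⟩
    · exact absurd huv hzp
    · exact absurd huv.symm hzp

theorem Valid.new_le (h : T.Valid G) : T.new ≤ G :=
  sup_le (listGraph_le h.chain) ((edge_le_iff _).mpr (Or.inr h.adj))

/-- A switch can be used to connect `y` with `p`. -/
theorem Valid.exists_switch (h : T.Valid G) (hB : T.base ≤ H) (h2 : ∀ v, (nb H v).card ≤ 2)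
    (hev : ∀ v, Even (nb H v).card) : ∃ H', (∀ v, (nb H' v).card = (nb H v).card) ∧ H' ≤ H ⊔ G ∧
      H \ T.old ≤ H' ∧ (∀ u v, H.Reachable u v → H'.Reachable u v) ∧ H'.Reachable T.y T.p := by
  by_cases hyp : H.Reachable T.y T.p
  · exact ⟨H, fun _ => rfl, le_sup_left, sdiff_le, fun _ _ h => h, hyp⟩
  have hold : T.old ≤ H := le_sup_left.trans hB
  set H' := (H \ T.old) ⊔ T.new with hH'
  have hyz : H.Adj T.y T.z := hold (Or.inr (by rw [edge_adj]; exact ⟨Or.inl ⟨rfl, rfl⟩, h.y_ne⟩))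
  have hpc : (T.p :: (T.l ++ [T.q])).IsChain H.Adj :=
    isChain_of_listGraph_le h.nodup (le_sup_left.trans hold)
  have hyz' : H'.Reachable T.y T.z := by
    have h1 := reachable_deleteEdges_of_even hyz (fun w _ => hev w)
    have h3 : ∀ {u v}, (H.deleteEdges {s(T.y, T.z)}).Reachable u v → H.Reachable T.y u →
        H'.Reachable u v := by
      rintro u v ⟨w⟩ hu
      induction w with
      | nil => exact Reachable.refl _
      | @cons u x v hux w ih =>
        rw [deleteEdges_adj] at hux
        refine Reachable.trans (Adj.reachable ?_) (ih (hu.trans hux.1.reachable))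
        refine Or.inl ⟨hux.1, ?_⟩
        rintro (h4 | h4)
        · exact hyp (hu.trans (reachable_of_isChain hpc (mem_of_listGraph_adj h4).1 (by simp)))
        · rw [edge_adj] at h4
          refine hux.2 ?_
          rw [Set.mem_singleton_iff, Sym2.eq_iff]
          exact h4.1
    exact h3 h1 (Reachable.refl _)
  have hzp' : H'.Adj T.z T.p := Or.inr (Or.inr (by
    rw [edge_adj]
    exact ⟨Or.inl ⟨rfl, rfl⟩, fun e => h.z_notMem (by simp [e])⟩))
  have hyc : (T.y :: (T.l' ++ [T.q])).IsChain H'.Adj :=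
    isChain_of_listGraph_le h.nodup' (le_sup_left.trans (le_sup_right : T.new ≤ H'))
  have hyp' : H'.Reachable T.y T.p := hyz'.trans hzp'.reachable
  have hall : ∀ v ∈ T.p :: (T.l ++ [T.q]), H'.Reachable T.y v := by
    intro v hv
    rcases List.mem_cons.mp hv with rfl | hv
    · exact hyp'
    · refine reachable_of_isChain hyc (by simp) ?_
      rw [List.mem_cons]
      exact Or.inr ((h.perm.append_right [T.q]).mem_iff.mp hv)
  refine ⟨H', fun v => ?_, sup_le (sdiff_le.trans le_sup_left) (h.new_le.trans le_sup_right),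
    le_sup_left, ?_, hyp'⟩
  · have h3 := card_nb_sdiff_sup hold (fun u v => h.new_old hB h2 (u := u) (v := v)) v
    rw [h.card_nb_new] at h3
    exact Nat.add_right_cancel h3
  · rintro u v ⟨w⟩
    induction w with
    | nil => exact Reachable.refl _
    | @cons u x v hux w ih =>
      refine Reachable.trans ?_ ih
      by_cases hD : T.old.Adj u x
      · rcases hD with hD | hD
        · obtain ⟨hu, hx⟩ := mem_of_listGraph_adj hD
          exact (hall u hu).symm.trans (hall x hx)
        · rw [edge_adj] at hD
          rcases hD.1 with ⟨rfl, rfl⟩ | ⟨rfl, rfl⟩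
          · exact hyz'
          · exact hyz'.symm
      · exact Adj.reachable (Or.inl ⟨hux, hD⟩)

theorem exists_switch_all {ι : Type} [Fintype ι] {T : ι → Toggle V} (hT : ∀ i, (T i).Valid G)
    (hB : ∀ i, (T i).base ≤ H) (hdis : ∀ i j, i ≠ j → Disjoint (T i).base (T j).old)
    (h2 : ∀ v, (nb H v).card ≤ 2) (hev : ∀ v, Even (nb H v).card) :
    ∃ H', (∀ v, (nb H' v).card = (nb H v).card) ∧ H' ≤ H ⊔ G ∧
      (∀ K ≤ H, (∀ i, Disjoint K (T i).old) → K ≤ H') ∧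
      (∀ u v, H.Reachable u v → H'.Reachable u v) ∧ ∀ i, H'.Reachable (T i).y (T i).p := by
  suffices hs : ∀ J : Finset ι, ∃ H', (∀ v, (nb H' v).card = (nb H v).card) ∧ H' ≤ H ⊔ G ∧
      (∀ K ≤ H, (∀ i ∈ J, Disjoint K (T i).old) → K ≤ H') ∧
      (∀ u v, H.Reachable u v → H'.Reachable u v) ∧ ∀ i ∈ J, H'.Reachable (T i).y (T i).p by
    simpa using hs univ
  intro J
  induction J using Finset.induction_on with
  | empty => exact ⟨H, fun _ => rfl, le_sup_left, fun K h _ => h, fun _ _ h => h, by simp⟩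
  | insert i J hi ih =>
    obtain ⟨H', hd, hle, hK, hr, hJ⟩ := ih
    obtain ⟨H'', hd', hle', hK', hr', hy⟩ := (hT i).exists_switch
      (hK _ (hB i) fun j hj => hdis i j fun e => hi (e ▸ hj)) (fun v => hd v ▸ h2 v)
      (fun v => hd v ▸ hev v)
    refine ⟨H'', fun v => (hd' v).trans (hd v), hle'.trans (sup_le hle le_sup_right), ?_,
      fun u v h => hr' u v (hr u v h), ?_⟩
    · intro K hKH hKJ
      refine le_trans ?_ hK'
      rw [le_sdiff]
      exact ⟨hK K hKH fun j hj => hKJ j (mem_insert_of_mem hj), hKJ i (mem_insert_self _ _)⟩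
    · intro j hj
      rcases mem_insert.mp hj with rfl | hj
      · exact hy
      · exact hr' _ _ (hJ j hj)

end Toggle
end Toggles

section HamiltonPath
open Finset
open scoped Classical

variable {V : Type} [Fintype V] {G L H : SimpleGraph V} {a b : V} {W Core : Finset V}

theorem exists_hamilton_path (hLH : L ≤ H) (hHG : H ≤ G ⊔ edge a b)
    (hdeg : ∀ v, (nb H v).card = if v ∈ W then 2 else 0)
    (hreach : ∀ v ∈ W, ∃ c ∈ Core, H.Reachable v c) {N : ℕ} {T : Fin (N + 1) → Toggle V}
    (hT : ∀ i, (T i).Valid G) (hB : ∀ i, (T i).base ≤ L)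
    (hdis : ∀ i j, i ≠ j → Disjoint (T i).base (T j).old) (hne : a ≠ b) (hab : edge a b ≤ L)
    (hab' : ∀ i, Disjoint (edge a b) (T i).old) {core : Fin (N + 1) → Finset V}
    (hconn : ∀ i, ∀ u ∈ core i, ∀ v ∈ core i, L.Reachable u v)
    (hcore : ∀ c ∈ Core, ∃ i, c ∈ core i) (hp : ∀ i, (T i).p ∈ core i)
    (hy : ∀ i, (T i).y ∈ core (i + 1)) :
    ∃ w : List V, (a :: (w ++ [b])).Nodup ∧ (a :: (w ++ [b])).IsChain G.Adj ∧
      ∀ v, v ∈ W ↔ v ∈ a :: (w ++ [b]) := by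
  have h2 : ∀ v, (nb H v).card ≤ 2 := fun v => by rw [hdeg]; split_ifs <;> omega
  have hev : ∀ v, Even (nb H v).card := fun v => by rw [hdeg]; split_ifs <;> decide
  obtain ⟨H', hd', hle', hK', hr', hyp⟩ := Toggle.exists_switch_all hT
    (fun i => (hB i).trans hLH) hdis h2 hev
  have habH : H'.Adj a b := hK' _ (hab.trans hLH) hab' (by
    rw [edge_adj]; exact ⟨Or.inl ⟨rfl, rfl⟩, hne⟩)
  have hconn' : ∀ i, ∀ u ∈ core i, ∀ v ∈ core i, H'.Reachable u v := fun i u hu v hv =>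
    hr' u v ((hconn i u hu v hv).mono hLH)
  have hall : ∀ i, H'.Reachable (T 0).p (T i).p := by
    intro i
    induction i using Fin.induction with
    | zero => exact Reachable.refl _
    | succ i ih =>
      refine ih.trans ((hyp i.castSucc).symm.trans (hconn' i.succ _ ?_ _ (hp _)))
      have := hy i.castSucc
      rwa [Fin.coeSucc_eq_succ] at this
  have hWp : ∀ v ∈ W, H'.Reachable (T 0).p v := by
    intro v hv
    obtain ⟨c, hc, hvc⟩ := hreach v hv
    obtain ⟨i, hi⟩ := hcore c hc
    exact (hall i).trans ((hconn' i _ (hp i) c hi).trans (hr' v c hvc).symm)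
  have hW : ∀ u v, H'.Adj u v → u ∈ W := by
    intro u v huv
    by_contra hu
    have h1 := (hd' u).trans (hdeg u)
    rw [if_neg hu] at h1
    have := one_le_card_nb huv
    omega
  have haW := hW a b habH
  have hbW := hW b a habH.symm
  have hdel := reachable_deleteEdges_of_even habH (fun w _ => by rw [hd']; exact hev w)
  have hreach' : ∀ {u v}, H'.Reachable u v → (H'.deleteEdges {s(a, b)}).Reachable u v := by
    rintro u v ⟨w⟩
    induction w with
    | nil => exact Reachable.refl _
    | @cons u x v hux w ih =>
      refine Reachable.trans ?_ ih
      by_cases he : s(u, x) = s(a, b)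
      · rw [Sym2.eq_iff] at he
        rcases he with ⟨rfl, rfl⟩ | ⟨rfl, rfl⟩
        · exact hdel
        · exact hdel.symm
      · refine Adj.reachable ?_
        rw [deleteEdges_adj]
        exact ⟨hux, he⟩
  have hdd := fun w => card_nb_deleteEdges habH w
  have hWc : ∀ v ∈ W, (nb H' v).card = 2 := fun v hv => by rw [hd', hdeg, if_pos hv]
  obtain ⟨w, hw1, hw2, hw3⟩ := exists_hamilton_list (H := H'.deleteEdges {s(a, b)}) (W := W) hne
    (by have := hdd a; rw [if_pos rfl, if_neg hne, hWc a haW] at this; omega)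
    (by have := hdd b; rw [if_pos rfl, if_neg hne.symm, hWc b hbW] at this; omega)
    (fun v => by have := hdd v; have := hd' v; have := h2 v; omega) hbW
    (fun v hv => hreach' ((hWp a haW).symm.trans (hWp v hv)))
  refine ⟨w, hw1, hw2.imp ?_, fun v => ⟨hw3 v, fun hv => ?_⟩⟩
  · intro u v huv
    rw [deleteEdges_adj] at huv
    rcases hle' huv.1 with h | h
    · rcases hHG h with h | h
      · exact h
      · rw [edge_adj] at h
        refine absurd ?_ huv.2
        rw [Set.mem_singleton_iff, Sym2.eq_iff]
        exact h.1
    · exact h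
  · have h4 := reachable_of_isChain hw2 (u := a) (v := v) (by simp) hv
    refine h4.mem_of_closed (Z := {v | v ∈ W}) haW fun x _ y hxy => ?_
    exact hW y x (deleteEdges_le _ hxy).symm

end HamiltonPath

section ConnectMany
open Finset
open scoped Classical

variable {V : Type} [Fintype V] {G : SimpleGraph V}

/-- Many pairs of distinct vertices can be connected by disjoint paths. -/
theorem Extendable.connect_many {R : Finset V} {m M k : ℕ} (hsl : HasSlack G R m M) (hm : 1 ≤ m)
    (hjoin : ∀ S T : Finset V, m ≤ S.card → m ≤ T.card → ∃ s ∈ S, ∃ t ∈ T, G.Adj s t)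
    (hk : m ≤ 2 ^ k) {A : Finset V} {c : ℕ} (hE : Extendable G A m fun _ => c) (hAR : A ⊆ R)
    (hc2 : 2 ≤ c) (hc8 : c ≤ 8) {ι : Type} [Fintype ι] {s s' : ι → V} (hsA : ∀ i, s i ∉ A)
    (hsA' : ∀ i, s' i ∉ A) (hss : ∀ i j, s i ≠ s' j) (hs : Function.Injective s)
    (hs' : Function.Injective s')
    (hM : (R \ A).card + Fintype.card ι * (2 * (k + 1)) + 4 * 2 ^ k ≤ M) :
    ∃ P : ι → List V, (∀ i, (P i).length = 2 * (k + 1)) ∧ (∀ i, (P i).Nodup) ∧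
      (∀ i, ∀ x ∈ P i, x ∈ A) ∧ (∀ i, (s i :: (P i ++ [s' i])).IsChain G.Adj) ∧
      (∀ i j, i ≠ j → ∀ x ∈ P i, x ∉ P j) ∧
      ∃ A' ⊆ A, (∀ i, ∀ x ∈ P i, x ∉ A') ∧ Extendable G A' m (fun _ => c - 1) ∧
        (R \ A').card ≤ (R \ A).card + Fintype.card ι * (2 * (k + 1)) := by
  suffices h : ∀ J : Finset ι, ∃ P : ι → List V, (∀ i ∈ J, (P i).length = 2 * (k + 1)) ∧
      (∀ i ∈ J, (P i).Nodup) ∧ (∀ i ∈ J, ∀ x ∈ P i, x ∈ A) ∧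
      (∀ i ∈ J, (s i :: (P i ++ [s' i])).IsChain G.Adj) ∧
      (∀ i ∈ J, ∀ j ∈ J, i ≠ j → ∀ x ∈ P i, x ∉ P j) ∧
      ∃ A' ⊆ A, (∀ i ∈ J, ∀ x ∈ P i, x ∉ A') ∧
        Extendable G A' m (fun u => c - if u ∈ A' ∨ ∃ i ∉ J, u = s i ∨ u = s' i then 0 else 1) ∧
        (R \ A').card ≤ (R \ A).card + J.card * (2 * (k + 1)) by
    obtain ⟨P, h1, h2, h3, h4, h5, A', h6, h7, h8, h9⟩ := h univ
    refine ⟨P, fun i => h1 i (mem_univ _), fun i => h2 i (mem_univ _), fun i => h3 i (mem_univ _),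
      fun i => h4 i (mem_univ _), fun i j => h5 i (mem_univ _) j (mem_univ _), A', h6,
      fun i => h7 i (mem_univ _), h8.mono fun u => ?_, h9⟩
    split_ifs <;> omega
  intro J
  induction J using Finset.induction_on with
  | empty =>
    exact ⟨fun _ => [], by simp, by simp, by simp, by simp, by simp, A, Subset.rfl, by simp,
      hE.mono fun u => Nat.sub_le _ _, by simp⟩
  | insert i J hi ih =>
    obtain ⟨P, h1, h2, h3, h4, h5, A', h6, h7, h8, h9⟩ := ih
    have hJ : J.card + 1 ≤ Fintype.card ι := by
      rw [← card_insert_of_notMem hi]; exact card_le_univ _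
    have hJ' : (J.card + 1) * (2 * (k + 1)) ≤ Fintype.card ι * (2 * (k + 1)) :=
      Nat.mul_le_mul_right _ hJ
    rw [add_mul, one_mul] at hJ'
    obtain ⟨w, hw1, hw2, hw3, hw4, hw5⟩ := h8.connect hsl hm hjoin hk (h6.trans hAR)
      (fun u => (Nat.sub_le _ _).trans hc8) (hss i i) (fun h => hsA i (h6 h))
      (fun h => hsA' i (h6 h)) (by split_ifs <;> omega) (by split_ifs <;> omega)
      (fun a ha => by rw [if_pos (Or.inl ha)]; omega) (by omega)
    have hPu : ∀ j ∈ J, Function.update P i w j = P j := fun j hj =>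
      Function.update_of_ne (fun e : j = i => hi (e ▸ hj)) _ _
    have hPi : Function.update P i w i = w := Function.update_self _ _ _
    refine ⟨Function.update P i w, ?_, ?_, ?_, ?_, ?_, A' \ w.toFinset, sdiff_subset.trans h6,
      ?_, ?_, ?_⟩
    · intro j hj
      rcases mem_insert.mp hj with rfl | hj
      · rw [hPi, hw1]
      · rw [hPu j hj, h1 j hj]
    · intro j hj
      rcases mem_insert.mp hj with rfl | hj
      · rwa [hPi]
      · rw [hPu j hj]; exact h2 j hj
    · intro j hj
      rcases mem_insert.mp hj with rfl | hj
      · rw [hPi]; exact fun x hx => h6 (hw3 x hx)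
      · rw [hPu j hj]; exact h3 j hj
    · intro j hj
      rcases mem_insert.mp hj with rfl | hj
      · rwa [hPi]
      · rw [hPu j hj]; exact h4 j hj
    · intro j hj l hl hjl x hx
      rcases mem_insert.mp hj with ej | hj <;> rcases mem_insert.mp hl with el | hl
      · exact absurd (ej.trans el.symm) hjl
      · rw [hPu l hl]
        rw [ej, hPi] at hx
        exact fun h => h7 l hl x h (hw3 x hx)
      · rw [el, hPi]
        rw [hPu j hj] at hx
        exact fun h => h7 j hj x hx (hw3 x h)
      · rw [hPu j hj] at hx
        rw [hPu l hl]
        exact h5 j hj l hl hjl x hx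
    · intro j hj x hx
      rw [mem_sdiff, List.mem_toFinset, not_and, not_not]
      rcases mem_insert.mp hj with rfl | hj
      · rw [hPi] at hx; exact fun _ => hx
      · rw [hPu j hj] at hx; exact fun h => absurd h (h7 j hj x hx)
    · refine hw5.mono fun u => ?_
      by_cases hu : u ∈ A' \ w.toFinset ∨ ∃ j ∉ insert i J, u = s j ∨ u = s' j
      · have hA : u ∈ A' ∨ ∃ i ∉ J, u = s i ∨ u = s' i := by
          rcases hu with hu | ⟨j, hj, hu⟩
          · exact Or.inl (mem_sdiff.mp hu).1
          · exact Or.inr ⟨j, fun h => hj (mem_insert_of_mem h), hu⟩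
        have hw : u ∉ s i :: s' i :: w := by
          simp only [List.mem_cons, not_or]
          rcases hu with hu | ⟨j, hj, hu⟩
          · rw [mem_sdiff, List.mem_toFinset] at hu
            exact ⟨fun e => hsA i (e ▸ h6 hu.1), fun e => hsA' i (e ▸ h6 hu.1), hu.2⟩
          · have hji : j ≠ i := fun e => hj (e ▸ mem_insert_self _ _)
            rcases hu with rfl | rfl
            · exact ⟨fun e => hji (hs e), hss _ _, fun e => hsA j (h6 (hw3 _ e))⟩
            · exact ⟨fun e => hss _ _ e.symm, fun e => hji (hs' e), fun e => hsA' j (h6 (hw3 _ e))⟩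
        rw [if_pos hu, if_pos hA, if_neg hw]
        simp
      · rw [if_neg hu]
        by_cases hA : u ∈ A' ∨ ∃ i ∉ J, u = s i ∨ u = s' i
        · rw [if_pos hA]; split_ifs <;> omega
        · have hw : u ∉ s i :: s' i :: w := by
            simp only [List.mem_cons, not_or]
            exact ⟨fun e => hA (Or.inr ⟨i, hi, Or.inl e⟩), fun e => hA (Or.inr ⟨i, hi, Or.inr e⟩),
              fun e => hA (Or.inl (hw3 u e))⟩
          rw [if_neg hA, if_neg hw]
          simp
    · rw [card_insert_of_notMem hi]
      have e1 : R \ (A' \ w.toFinset) ⊆ (R \ A') ∪ w.toFinset := by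
        intro x hx
        simp only [mem_sdiff, mem_union, not_and, not_not] at hx ⊢
        tauto
      have e2 := card_le_card e1
      have e3 := card_union_le (R \ A') w.toFinset
      have e4 := List.toFinset_card_le w
      rw [add_mul, one_mul]
      omega
end ConnectMany

section Ladder
open Finset
open scoped Classical

variable {V : Type} [Fintype V] {G : SimpleGraph V}

/-- The end of the `j`-th traversal of a ladder with rails through `w`. -/
def ladderEnd (w : ℕ → V) (j : ℕ) : V := if j = 0 then w 1 else w (2 * j)

/-- The rungs `φ` of a ladder on the path `w` allow the interior to be traversed from either end. -/
theorem exists_ladder (w : ℕ → V) (φ : ℕ → List V) (j : ℕ)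
    (hw : ∀ i < 2 * j + 1, G.Adj (w i) (w (i + 1)))
    (hφ : ∀ i < j, (ladderEnd w i :: (φ i ++ [w (2 * i + 3)])).IsChain G.Adj)
    (hinj : ∀ i ≤ 2 * j + 1, ∀ i' ≤ 2 * j + 1, w i = w i' → i = i')
    (hnd : ∀ i < j, (φ i).Nodup)
    (hdis : ∀ i < j, ∀ i' < j, i ≠ i' → ∀ x ∈ φ i, x ∉ φ i')
    (hwφ : ∀ i ≤ 2 * j + 1, ∀ i' < j, w i ∉ φ i') :
    ∃ l l' : List V, l.Perm l' ∧ (w 0 :: (l ++ [ladderEnd w j])).IsChain G.Adj ∧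
      (∀ y, G.Adj y (w (2 * j + 1)) → (y :: (l' ++ [ladderEnd w j])).IsChain G.Adj) ∧
      (l ++ [ladderEnd w j]).Nodup ∧
      (∀ x ∈ l ++ [ladderEnd w j], (∃ i, 1 ≤ i ∧ i ≤ 2 * j + 1 ∧ x = w i) ∨ ∃ i < j, x ∈ φ i) ∧
      (1 ≤ j → l ≠ []) := by
  induction j with
  | zero =>
    refine ⟨[], [], List.Perm.refl _, ?_, ?_, by simp, ?_, by simp⟩
    · simpa [ladderEnd] using hw 0 (by omega)
    · intro y hy; simpa [ladderEnd] using hy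
    · intro x hx
      left
      exact ⟨1, le_rfl, by omega, by simpa [ladderEnd] using hx⟩
  | succ j ih =>
    obtain ⟨l, l', h1, h2, h3, h4, h5, -⟩ := ih (fun i hi => hw i (by omega))
      (fun i hi => hφ i (by omega)) (fun i hi i' hi' => hinj i (by omega) i' (by omega))
      (fun i hi => hnd i (by omega)) (fun i hi i' hi' => hdis i (by omega) i' (by omega))
      (fun i hi i' hi' => hwφ i (by omega) i' (by omega))
    have he : ladderEnd w (j + 1) = w (2 * j + 2) := by simp [ladderEnd, mul_add]
    have hc := hφ j (by omega)
    have ha1 := hw (2 * j + 1) (by omega)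
    have ha2 := hw (2 * j + 2) (by omega)
    rw [he]
    refine ⟨l ++ ladderEnd w j :: (φ j ++ [w (2 * j + 3)]),
      w (2 * j + 3) :: ((φ j).reverse ++ ladderEnd w j :: l'.reverse), ?_, ?_, ?_, ?_, ?_, by simp⟩
    · rw [List.perm_iff_count] at h1 ⊢
      intro a
      simp only [List.count_append, List.count_cons, List.count_reverse, List.count_nil, h1 a]
      omega
    · have : w 0 :: (l ++ ladderEnd w j :: (φ j ++ [w (2 * j + 3)]) ++ [w (2 * j + 2)]) =
          (w 0 :: l) ++ ladderEnd w j :: (φ j ++ w (2 * j + 3) :: [w (2 * j + 2)]) := by simp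
      rw [this, List.isChain_split]
      refine ⟨by simpa using h2, ?_⟩
      rw [← List.cons_append, List.isChain_append_cons_cons]
      exact ⟨by simpa using hc, ha2.symm, by simp⟩
    · intro y hy
      have h3' := h3 _ ha1.symm
      have hr : ∀ l : List V, l.IsChain G.Adj → l.reverse.IsChain G.Adj := fun l hl => by
        rw [List.isChain_reverse]
        exact hl.imp fun a b => SimpleGraph.Adj.symm
      have h3r := hr _ h3'
      have hcr := hr _ hc
      have : y :: (w (2 * j + 3) :: ((φ j).reverse ++ ladderEnd w j :: l'.reverse) ++
          [w (2 * j + 2)]) = y :: w (2 * j + 3) :: ((φ j).reverse ++ ladderEnd w j ::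
            (l'.reverse ++ [w (2 * j + 2)])) := by simp
      rw [this, List.isChain_cons_cons, ← List.cons_append, List.isChain_split]
      exact ⟨hy, by simpa using hcr, by simpa using h3r⟩
    · have hmem : ∀ x, x ∈ l ++ [ladderEnd w j] → x ∉ φ j ∧ x ≠ w (2 * j + 3) ∧
          x ≠ w (2 * j + 2) := by
        intro x hx
        rcases h5 x hx with ⟨i, hi1, hi2, hi⟩ | ⟨i, hi, hxi⟩
        · refine ⟨hi ▸ hwφ i (by omega) j (by omega), fun e => ?_, fun e => ?_⟩
          · have := hinj i (by omega) (2 * j + 3) (by omega) (hi ▸ e); omega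
          · have := hinj i (by omega) (2 * j + 2) (by omega) (hi ▸ e); omega
        · exact ⟨hdis i (by omega) j (by omega) (by omega) x hxi,
            fun e => hwφ (2 * j + 3) (by omega) i (by omega) (e ▸ hxi),
            fun e => hwφ (2 * j + 2) (by omega) i (by omega) (e ▸ hxi)⟩
      have : l ++ ladderEnd w j :: (φ j ++ [w (2 * j + 3)]) ++ [w (2 * j + 2)] =
          (l ++ [ladderEnd w j]) ++ (φ j ++ [w (2 * j + 3), w (2 * j + 2)]) := by simp
      refine this ▸ List.nodup_append.mpr ?_
      have hw1 := hwφ (2 * j + 3) (by omega) j (by omega)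
      have hw2 := hwφ (2 * j + 2) (by omega) j (by omega)
      refine ⟨h4, List.nodup_append.mpr ⟨hnd j (by omega), ?_, ?_⟩, ?_⟩
      · simp only [List.nodup_cons, List.mem_singleton, List.not_mem_nil, not_false_eq_true,
          List.nodup_nil, and_true]
        intro e
        have := hinj _ (by omega) _ (by omega) e
        omega
      · rintro a ha b hb rfl
        simp only [List.mem_cons, List.not_mem_nil, or_false] at hb
        rcases hb with hb | hb
        · exact hw1 (hb ▸ ha)
        · exact hw2 (hb ▸ ha)
      · rintro a ha b hb rfl
        obtain ⟨g1, g2, g3⟩ := hmem a ha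
        simp only [List.mem_append, List.mem_cons, List.not_mem_nil, or_false] at hb
        rcases hb with hb | hb | hb
        exacts [g1 hb, g2 hb, g3 hb]
    · intro x hx
      simp only [List.mem_append, List.mem_cons, List.not_mem_nil, or_false] at hx
      rcases hx with (hx | hx | hx | hx) | hx
      · rcases h5 x (by simp [hx]) with ⟨i, hi⟩ | ⟨i, hi, hi'⟩
        · exact Or.inl ⟨i, hi.1, by omega, hi.2.2⟩
        · exact Or.inr ⟨i, by omega, hi'⟩
      · rcases h5 x (by simp [hx]) with ⟨i, hi⟩ | ⟨i, hi, hi'⟩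
        · exact Or.inl ⟨i, hi.1, by omega, hi.2.2⟩
        · exact Or.inr ⟨i, by omega, hi'⟩
      · exact Or.inr ⟨j, by omega, hx⟩
      · exact Or.inl ⟨2 * j + 3, by omega, by omega, hx⟩
      · exact Or.inl ⟨2 * j + 2, by omega, by omega, hx⟩

end Ladder

section Gadget
open Finset
open scoped Classical

variable {V : Type} [Fintype V] {G : SimpleGraph V}

/-- A path through a ladder, two connecting paths and the remains of a path between `α` and `β`. -/
theorem exists_ladder_path {α β y z g h : V} {rest : List V} {K : ℕ} (hK : 2 ≤ K) (w : ℕ → V)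
    (P : ℕ → List V) (hQ : (y :: z :: g :: h :: rest).Nodup)
    (hQc : (α :: (y :: z :: g :: h :: rest ++ [β])).IsChain G.Adj)
    (hwc : ∀ i < 2 * K - 1, G.Adj (w i) (w (i + 1)))
    (hinj : ∀ i < 2 * K, ∀ i' < 2 * K, w i = w i' → i = i')
    (hwQ : ∀ i < 2 * K, w i ∉ y :: z :: g :: h :: rest)
    (hnd : ∀ i ≤ K, (P i).Nodup)
    (hdis : ∀ i ≤ K, ∀ i' ≤ K, i ≠ i' → ∀ x ∈ P i, x ∉ P i')
    (hwP : ∀ i < 2 * K, ∀ i' ≤ K, w i ∉ P i')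
    (hPQ : ∀ i ≤ K, ∀ x ∈ P i, x ∉ y :: z :: g :: h :: rest)
    (hP0 : P 0 ≠ []) (hgp : (g :: (P 0 ++ [w 0])).IsChain G.Adj)
    (hqh : (w (2 * K - 2) :: (P K ++ [h])).IsChain G.Adj)
    (hφ : ∀ i < K - 1, (ladderEnd w i :: (P (i + 1) ++ [w (2 * i + 3)])).IsChain G.Adj) :
    ∃ (l l' : List V) (q r : V) (Cr : List V), l.Perm l' ∧ l ≠ [] ∧ (w 0 :: (l ++ [q])).Nodup ∧
      (∀ y, G.Adj y (w (2 * K - 1)) → (y :: (l' ++ [q])).IsChain G.Adj) ∧ Cr.Nodup ∧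
      (α :: (Cr ++ [β])).IsChain G.Adj ∧
      (∀ x ∈ Cr, x ∈ y :: z :: g :: h :: rest ∨ (∃ i < 2 * K, x = w i) ∨ ∃ j ≤ K, x ∈ P j) ∧
      (∀ x ∈ w 0 :: (l ++ [q]), (∃ i < 2 * K, x = w i) ∨ ∃ j ≤ K, x ∈ P j) ∧
      r ∈ P 0 ∧ r ∉ w 0 :: (l ++ [q]) ∧ (w 0 :: (l ++ [q])) <:+: Cr ∧ [y, z] <:+: Cr ∧
      [r, w 0] <:+: Cr := by
  obtain ⟨l, l', h1, h2, h3, h4, h5, h6⟩ := exists_ladder (G := G) w (fun j => P (j + 1)) (K - 1)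
    (fun i hi => hwc i (by omega)) hφ (fun i hi i' hi' => hinj i (by omega) i' (by omega))
    (fun i hi => hnd _ (by omega))
    (fun i hi i' hi' hne => hdis _ (by omega) _ (by omega) (by omega))
    (fun i hi i' hi' => hwP i (by omega) _ (by omega))
  have hq : ladderEnd w (K - 1) = w (2 * K - 2) := by
    unfold ladderEnd
    rw [if_neg (by omega)]
    congr 1; omega
  have hK1 : 2 * (K - 1) + 1 = 2 * K - 1 := by omega
  rw [hq] at h2 h4 h5
  rw [hq, hK1] at h3
  obtain ⟨pre, r, hr⟩ : ∃ pre r, P 0 = pre ++ [r] :=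
    ⟨_, _, (List.dropLast_append_getLast hP0).symm⟩
  set q := w (2 * K - 2)
  have hM : ∀ x ∈ l ++ [q], (∃ i, 1 ≤ i ∧ i < 2 * K ∧ x = w i) ∨ ∃ i, 1 ≤ i ∧ i < K ∧ x ∈ P i := by
    intro x hx
    rcases h5 x hx with ⟨i, hi⟩ | ⟨i, hi, hxi⟩
    · exact Or.inl ⟨i, hi.1, by omega, hi.2.2⟩
    · exact Or.inr ⟨i + 1, by omega, by omega, hxi⟩
  have hMP : ∀ j, j = 0 ∨ j = K → ∀ x ∈ P j, x ∉ w 0 :: (l ++ [q]) := by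
    intro j hj x hx hx'
    have hjK : j ≤ K := by omega
    rcases List.mem_cons.mp hx' with rfl | hx'
    · exact hwP 0 (by omega) j hjK hx
    · rcases hM x hx' with ⟨i, _, hi2, rfl⟩ | ⟨i, hi1, hi2, hi3⟩
      · exact hwP i hi2 j hjK hx
      · exact hdis i (by omega) j hjK (by omega) x hi3 hx
  have hMQ : ∀ x ∈ w 0 :: (l ++ [q]), x ∉ y :: z :: g :: h :: rest := by
    intro x hx
    rcases List.mem_cons.mp hx with rfl | hx'
    · exact hwQ 0 (by omega)
    · rcases hM x hx' with ⟨i, _, hi2, rfl⟩ | ⟨i, hi1, hi2, hi3⟩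
      · exact hwQ i hi2
      · exact hPQ i (by omega) x hi3
  have hMnd : (w 0 :: (l ++ [q])).Nodup := by
    refine List.nodup_cons.mpr ⟨fun hx => ?_, h4⟩
    rcases hM _ hx with ⟨i, hi1, hi2, hi⟩ | ⟨i, hi1, hi2, hi3⟩
    · have := hinj _ (by omega) _ hi2 hi; omega
    · exact hwP 0 (by omega) i (by omega) hi3
  have hrP : r ∈ P 0 := by simp [hr]
  refine ⟨l, l', q, r, [y, z, g] ++ (P 0 ++ ((w 0 :: (l ++ [q])) ++ (P K ++ h :: rest))), h1,
    h6 (by omega), hMnd, h3, ?_, ?_, ?_, ?_, hrP, hMP 0 (Or.inl rfl) r hrP, ?_, ?_, ?_⟩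
  · have e0 : y :: z :: g :: h :: rest = [y, z, g] ++ (h :: rest) := rfl
    have hQ' := hQ
    rw [e0, List.nodup_append'] at hQ'
    have hmem : ∀ x, x ∉ y :: z :: g :: h :: rest → x ∉ [y, z, g] ∧ x ∉ h :: rest := by
      intro x hx
      rw [e0, List.mem_append, not_or] at hx
      exact hx
    refine List.nodup_append'.mpr ⟨hQ'.1, List.nodup_append'.mpr ⟨hnd 0 (by omega),
      List.nodup_append'.mpr ⟨hMnd, List.nodup_append'.mpr ⟨hnd K le_rfl, hQ'.2.1, ?_⟩, ?_⟩, ?_⟩, ?_⟩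
    · intro x hx hx'; exact (hmem x (hPQ K le_rfl x hx)).2 hx'
    · intro x hx hx'
      rcases List.mem_append.mp hx' with hx' | hx'
      · exact hMP K (Or.inr rfl) x hx' hx
      · exact (hmem x (hMQ x hx)).2 hx'
    · intro x hx hx'
      rcases List.mem_append.mp hx' with hx' | hx'
      · exact hMP 0 (Or.inl rfl) x hx hx'
      rcases List.mem_append.mp hx' with hx' | hx'
      · exact hdis 0 (by omega) K le_rfl (by omega) x hx hx'
      · exact (hmem x (hPQ 0 (by omega) x hx)).2 hx'
    · intro x hx hx'
      rcases List.mem_append.mp hx' with hx' | hx'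
      · exact (hmem x (hPQ 0 (by omega) x hx')).1 hx
      rcases List.mem_append.mp hx' with hx' | hx'
      · exact (hmem x (hMQ x hx')).1 hx
      rcases List.mem_append.mp hx' with hx' | hx'
      · exact (hmem x (hPQ K le_rfl x hx')).1 hx
      · exact hQ'.2.2 hx hx'
  · have e : α :: (([y, z, g] ++ (P 0 ++ ((w 0 :: (l ++ [q])) ++ (P K ++ h :: rest)))) ++ [β]) =
        [α, y, z] ++ g :: (P 0 ++ w 0 :: (l ++ q :: (P K ++ h :: (rest ++ [β])))) := by simp
    have e1 : α :: (y :: z :: g :: h :: rest ++ [β]) =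
      [α, y, z] ++ g :: h :: (rest ++ [β]) := by simp
    rw [e1, List.isChain_append_cons_cons] at hQc
    rw [e]
    refine List.isChain_split.mpr ⟨hQc.1, (List.isChain_split (l₁ := g :: P 0)).mpr
      ⟨by simpa using hgp, (List.isChain_split (l₁ := w 0 :: l)).mpr ⟨by simpa using h2,
        (List.isChain_split (l₁ := q :: P K)).mpr ⟨by simpa using hqh, hQc.2.2⟩⟩⟩⟩
  · intro x hx
    rcases List.mem_append.mp hx with hx | hx
    · left
      have e0 : y :: z :: g :: h :: rest = [y, z, g] ++ (h :: rest) := rfl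
      rw [e0]; exact List.mem_append_left _ hx
    rcases List.mem_append.mp hx with hx | hx
    · exact Or.inr (Or.inr ⟨0, by omega, hx⟩)
    rcases List.mem_append.mp hx with hx | hx
    · rcases List.mem_cons.mp hx with hx | hx
      · exact Or.inr (Or.inl ⟨0, by omega, hx⟩)
      rcases hM x hx with ⟨i, _, hi2, hi⟩ | ⟨i, hi1, hi2, hi3⟩
      · exact Or.inr (Or.inl ⟨i, hi2, hi⟩)
      · exact Or.inr (Or.inr ⟨i, by omega, hi3⟩)
    rcases List.mem_append.mp hx with hx | hx
    · exact Or.inr (Or.inr ⟨K, le_rfl, hx⟩)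
    · left
      have e0 : y :: z :: g :: h :: rest = [y, z, g] ++ (h :: rest) := rfl
      rw [e0]; exact List.mem_append_right _ hx
  · intro x hx
    rcases List.mem_cons.mp hx with hx | hx
    · exact Or.inl ⟨0, by omega, hx⟩
    rcases hM x hx with ⟨i, _, hi2, hi⟩ | ⟨i, hi1, hi2, hi3⟩
    · exact Or.inl ⟨i, hi2, hi⟩
    · exact Or.inr ⟨i, by omega, hi3⟩
  · exact ⟨[y, z, g] ++ P 0, P K ++ h :: rest, by simp⟩
  · exact ⟨[], g :: (P 0 ++ ((w 0 :: (l ++ [q])) ++ (P K ++ h :: rest))), by simp⟩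
  · exact ⟨[y, z, g] ++ pre, l ++ [q] ++ (P K ++ h :: rest), by simp [hr]⟩

end Gadget

section Skeleton
open Finset
open scoped Classical

variable {V : Type} [Fintype V] {G : SimpleGraph V}

theorem exists_fun_of_isChain {a b : V} {W : List V} {n : ℕ} (hn : 1 ≤ n) (hlen : W.length = n)
    (hnd : W.Nodup) (hc : (a :: (W ++ [b])).IsChain G.Adj) : ∃ w : ℕ → V, G.Adj a (w 0) ∧
      G.Adj (w (n - 1)) b ∧ (∀ i < n - 1, G.Adj (w i) (w (i + 1))) ∧
      (∀ i < n, ∀ j < n, w i = w j → i = j) ∧ ∀ i < n, w i ∈ W := by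
  rw [List.isChain_iff_getElem] at hc
  simp only [List.length_cons, List.length_append, hlen, List.length_nil] at hc
  have hget : ∀ i (hi : i < n), W.getD i a = W[i]'(by omega) := fun i hi => by
    rw [List.getD_eq_getElem]
  refine ⟨fun i => W.getD i a, ?_, ?_, ?_, ?_, ?_⟩
  · have := hc 0 (by omega)
    simp only [hget 0 (by omega)]
    simpa [List.getElem_append, hlen, show 0 < n by omega] using this
  · have := hc n (by omega)
    simp only [hget (n - 1) (by omega)]
    obtain ⟨m, rfl⟩ : ∃ m, n = m + 1 := ⟨n - 1, by omega⟩
    simpa [List.getElem_append, hlen] using this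
  · intro i hi
    have := hc (i + 1) (by omega)
    simp only [hget i (by omega), hget (i + 1) (by omega)]
    simpa [List.getElem_append, hlen, show i < n by omega, show i + 1 < n by omega] using this
  · intro i hi j hj h
    simp only [hget i hi, hget j hj] at h
    exact (List.Nodup.getElem_inj_iff hnd).mp h
  · intro i hi
    simp only [hget i hi]
    exact List.getElem_mem _

theorem isChain_of_isInfix {r : V → V → Prop} {l l' : List V} (hl : l'.IsChain r)
    (h : l <:+: l') : l.IsChain r := by
  obtain ⟨a, b, rfl⟩ := h
  exact hl.left_of_append.right_of_append

theorem listGraph_le_of_isInfix {l l' : List V} (hl : l'.Nodup) (h : l <:+: l') :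
    listGraph l ≤ listGraph l' :=
  listGraph_le (isChain_of_isInfix (isChain_of_listGraph_le hl le_rfl) h)

theorem edge_le_listGraph_of_isInfix {u v : V} {l : List V} (hl : l.Nodup) (h : [u, v] <:+: l) :
    edge u v ≤ listGraph l := by
  have := isChain_of_isInfix (isChain_of_listGraph_le hl le_rfl) h
  exact (edge_le_iff _).mpr (Or.inr (by simpa using this))

theorem exists_skeleton {R : Finset V} {m M k : ℕ} (hsl : HasSlack G R m M) (hm : 1 ≤ m)
    (hjoin : ∀ S T : Finset V, m ≤ S.card → m ≤ T.card → ∃ s ∈ S, ∃ t ∈ T, G.Adj s t)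
    (hk : m ≤ 2 ^ k) (hk1 : 1 ≤ k) {A : Finset V} (hE : Extendable G A m fun _ => 7) (hAR : A ⊆ R)
    {N : ℕ} {α β : Fin (N + 1) → V} (hα : ∀ i, α i ∉ A) (hβ : ∀ i, β i ∉ A)
    (hαβ : ∀ i j, α i ≠ β j) (hαi : Function.Injective α) (hβi : Function.Injective β)
    (hM : (R \ A).card + (N + 1) * (2 * (k + 1) * (k + 4)) + 4 * 2 ^ k ≤ M) :
    ∃ (Cr : Fin (N + 1) → List V) (T : Fin (N + 1) → Toggle V),
      (∀ i, ∀ x ∈ Cr i, x ∈ A) ∧ (∀ i, (Cr i).Nodup) ∧ (∀ i j, i ≠ j → ∀ x ∈ Cr i, x ∉ Cr j) ∧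
      (∀ i, (α i :: (Cr i ++ [β i])).IsChain G.Adj) ∧ (∀ i, (T i).Valid G) ∧
      (∀ i, (T i).p ∈ Cr i) ∧ (∀ i, (T i).y ∈ Cr (i + 1)) ∧
      (∀ i j, i ≠ j → Disjoint (T i).base (T j).old) ∧
      ∀ i, (T i).base ≤ listGraph (Cr i) ⊔ listGraph (Cr (i + 1)) := by
  obtain ⟨K, hK⟩ : ∃ K, K = k + 1 := ⟨_, rfl⟩
  have hK2 : 2 ≤ K := by omega
  have hcost : (N + 1) * (2 * (k + 1) * (k + 4)) = (N + 1) * (2 * (k + 1)) +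
    (N + 1) * (2 * (k + 1)) + (N + 1) * (k + 1 + 1) * (2 * (k + 1)) := by ring
  obtain ⟨Q, hQ1, hQ2, hQ3, hQ4, hQ5, A1, hA1, hQA1, hE1, hR1⟩ := hE.connect_many hsl hm hjoin hk hAR
    (by omega) (by omega) hα hβ hαβ hαi hβi (by rw [Fintype.card_fin]; omega)
  rw [Fintype.card_fin] at hR1
  rw [← hK] at hQ1
  have hQe : ∀ i, ∃ y z g h rest, Q i = y :: z :: g :: h :: rest := by
    intro i
    have := hQ1 i
    match hq : Q i with
    | [] => rw [hq] at this; simp at this; omega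
    | [_] => rw [hq] at this; simp at this; omega
    | [_, _] => rw [hq] at this; simp at this; omega
    | [_, _, _] => rw [hq] at this; simp at this; omega
    | a :: b :: c :: d :: r => exact ⟨a, b, c, d, r, rfl⟩
  choose y z g h rest hQe using hQe
  have hQi : ∀ i j x, x ∈ Q i → x ∈ Q j → i = j := by
    intro i j x h1 h2
    by_contra hne
    exact hQ5 i j hne x h1 h2
  have hyQ : ∀ i, y i ∈ Q i := fun i => by simp [hQe]
  have hzQ : ∀ i, z i ∈ Q i := fun i => by simp [hQe]
  have hgQ : ∀ i, g i ∈ Q i := fun i => by simp [hQe]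
  have hhQ : ∀ i, h i ∈ Q i := fun i => by simp [hQe]
  have hQnd : ∀ i, (y i :: z i :: g i :: h i :: rest i).Nodup := fun i => hQe i ▸ hQ2 i
  have hyz : ∀ i, y i ≠ z i := fun i e => by have := hQnd i; simp [e] at this
  have hgh : ∀ i, g i ≠ h i := fun i e => by have := hQnd i; simp [e] at this
  obtain ⟨W, hW1, hW2, hW3, hW4, hW5, A2, hA2, hWA2, hE2, hR2⟩ := hE1.connect_many hsl hm hjoin hk
    (hA1.trans hAR) (by omega) (by omega) (s := fun i => z (i + 1)) (s' := fun i => y (i + 1))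
    (fun i => hQA1 _ _ (hzQ _)) (fun i => hQA1 _ _ (hyQ _))
    (fun i j e => by
      have hij := hQi _ _ (z (i + 1)) (hzQ _) (e ▸ hyQ _)
      simp only [hij] at e
      exact hyz _ e.symm)
    (fun i j e => by
      dsimp only at e
      exact add_left_injective 1 (hQi _ _ (z (i + 1)) (hzQ _) (e ▸ hzQ _)))
    (fun i j e => by
      dsimp only at e
      exact add_left_injective 1 (hQi _ _ (y (i + 1)) (hyQ _) (e ▸ hyQ _)))
    (by rw [Fintype.card_fin]; omega)
  rw [Fintype.card_fin] at hR2
  rw [← hK] at hW1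
  have hw := fun i => exists_fun_of_isChain (by omega) (hW1 i) (hW2 i) (hW4 i)
  choose w hw1 hw2 hw3 hw4 hw5 using hw
  have hWi : ∀ i j x, x ∈ W i → x ∈ W j → i = j := by
    intro i j x h1 h2
    by_contra hne
    exact hW5 i j hne x h1 h2
  have hWQ : ∀ i j x, x ∈ W i → x ∉ Q j := fun i j x hx hx' => hQA1 j x hx' (hW3 i x hx)
  have hwi : ∀ i i' j j', j < 2 * K → j' < 2 * K → w i j = w i' j' → i = i' ∧ j = j' := by
    intro i i' j j' hj hj' e
    have hii := hWi i i' _ (hw5 i j hj) (e ▸ hw5 i' j' hj')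
    subst hii
    exact ⟨rfl, hw4 i j hj j' hj' e⟩
  have hwQ : ∀ i i' j, j < 2 * K → ∀ x ∈ Q i', w i j ≠ x := by
    rintro i i' j hj x hx rfl
    exact hWQ i i' _ (hw5 i j hj) hx
  -- indices of the ends of the rungs
  let f : ℕ → ℕ := fun j => if j = 1 then 1 else 2 * j - 2
  have hf : ∀ i j, 1 ≤ j → ladderEnd (w i) (j - 1) = w i (f j) := by
    intro i j hj
    unfold ladderEnd
    simp only [f]
    split_ifs
    · rfl
    · omega
    · omega
    · congr 1; omega
  let s : Fin (N + 1) × Fin (K + 1) → V := fun x => if x.2.val = 0 then g x.1 else w x.1 (f x.2)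
  let s' : Fin (N + 1) × Fin (K + 1) → V := fun x => if x.2.val = 0 then w x.1 0 else
    if x.2.val = K then h x.1 else w x.1 (2 * x.2 + 1)
  have hsK : ∀ j : Fin (K + 1), f j < 2 * K := by
    intro j; have := j.2; simp only [f]; split_ifs <;> omega
  obtain ⟨P, hP1, hP2, hP3, hP4, hP5, A3, hA3, hPA3, hE3, hR3⟩ := hE2.connect_many hsl hm hjoin hk
    (hA2.trans (hA1.trans hAR)) (by omega) (by omega) (s := s) (s' := s')
    (by
      rintro ⟨i, j⟩
      simp only [s]
      split_ifs
      · exact fun e => hQA1 _ _ (hgQ i) (hA2 e)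
      · exact hWA2 _ _ (hw5 _ _ (hsK _)))
    (by
      rintro ⟨i, j⟩
      simp only [s']
      split_ifs
      · exact hWA2 _ _ (hw5 _ _ (by omega))
      · exact fun e => hQA1 _ _ (hhQ i) (hA2 e)
      · exact hWA2 _ _ (hw5 _ _ (by omega)))
    (by
      rintro ⟨i, j⟩ ⟨i', j'⟩
      have hj := j.2
      have hj' := j'.2
      have := hsK j
      simp only [s, s']
      split_ifs with h1 h2 h3 h4 h5
      · exact (hwQ _ _ _ (by omega) _ (hgQ i)).symm
      · intro e
        have hii := hQi _ _ (g i) (hgQ _) (e ▸ hhQ _)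
        subst hii
        exact hgh _ e
      · exact (hwQ _ _ _ (by omega) _ (hgQ i)).symm
      · intro e
        have := (hwi _ _ _ _ (hsK _) (by omega) e).2
        simp only [f] at this
        split_ifs at this
        omega
      · exact hwQ _ _ _ (hsK _) _ (hhQ _)
      · intro e
        have := (hwi _ _ _ _ (hsK _) (by omega) e).2
        simp only [f] at this
        split_ifs at this <;> omega)
    (by
      rintro ⟨i, j⟩ ⟨i', j'⟩
      simp only [s]
      split_ifs with h1 h2 h3 <;> intro e
      · have hii := hQi i i' (g i) (hgQ _) (e ▸ hgQ _)
        exact Prod.ext hii (Fin.ext (h1.trans h2.symm))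
      · exact absurd e (hwQ _ _ _ (hsK _) _ (hgQ _)).symm
      · exact absurd e (hwQ _ _ _ (hsK _) _ (hgQ _))
      · obtain ⟨e1, e2⟩ := hwi _ _ _ _ (hsK _) (hsK _) e
        refine Prod.ext e1 (Fin.ext ?_)
        simp only [f] at e2
        split_ifs at e2 <;> dsimp only <;> omega)
    (by
      rintro ⟨i, j⟩ ⟨i', j'⟩
      have hj := j.2
      have hj' := j'.2
      simp only [s']
      split_ifs with h1 h2 h3 h4 h5 h6 h7 <;> intro e
      · exact Prod.ext (hwi _ _ _ _ (by omega) (by omega) e).1 (Fin.ext (h1.trans h2.symm))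
      · exact absurd e (hwQ _ _ _ (by omega) _ (hhQ _))
      · have := (hwi _ _ _ _ (by omega) (by omega) e).2
        omega
      · exact absurd e (hwQ _ _ _ (by omega) _ (hhQ _)).symm
      · exact Prod.ext (hQi _ _ (h i) (hhQ _) (e ▸ hhQ _)) (Fin.ext (h4.trans h6.symm))
      · exact absurd e (hwQ _ _ _ (by omega) _ (hhQ _)).symm
      · have := (hwi _ _ _ _ (by omega) (by omega) e).2
        omega
      · exact absurd e (hwQ _ _ _ (by omega) _ (hhQ _))
      · obtain ⟨e1, e2⟩ := hwi _ _ _ _ (by omega) (by omega) e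
        refine Prod.ext e1 (Fin.ext ?_)
        dsimp only
        omega)
    (by rw [Fintype.card_prod, Fintype.card_fin, Fintype.card_fin, hK]; omega)
  let p : Fin (N + 1) → ℕ → List V := fun i j => if hj : j < K + 1 then P (i, ⟨j, hj⟩) else []
  have hp : ∀ i j (hj : j ≤ K), p i j = P (i, ⟨j, by omega⟩) := fun i j hj =>
    dif_pos (by omega)
  have hpA : ∀ i j, j ≤ K → ∀ x ∈ p i j, x ∈ A2 := fun i j hj x hx => by
    rw [hp i j hj] at hx; exact hP3 _ x hx
  have hpi : ∀ i i' j j', j ≤ K → j' ≤ K → ∀ x, x ∈ p i j → x ∈ p i' j' → i = i' ∧ j = j' := by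
    intro i i' j j' hj hj' x hx hx'
    rw [hp i j hj] at hx
    rw [hp i' j' hj'] at hx'
    by_contra hne
    refine hP5 _ _ (fun e => hne ?_) x hx hx'
    exact ⟨congrArg Prod.fst e, congrArg (fun a => a.2.val) e⟩
  have hg := fun i => exists_ladder_path (G := G) (α := α i) (β := β i) hK2 (w i) (p i) (hQnd i)
    (by rw [← hQe]; exact hQ4 i) (hw3 i) (hw4 i)
    (fun j hj => by rw [← hQe]; exact hWQ _ _ _ (hw5 i j hj))
    (fun j hj => by rw [hp i j hj]; exact hP2 _)
    (fun j hj j' hj' hne x hx hx' => hne (hpi i i j j' hj hj' x hx hx').2)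
    (fun j hj j' hj' hx => hWA2 _ _ (hw5 i j hj) (hpA i j' hj' _ hx))
    (fun j hj x hx => by rw [← hQe]; exact fun hx' => hQA1 _ _ hx' (hA2 (hpA i j hj x hx)))
    (by
      rw [hp i 0 (by omega)]
      have := hP1 (i, ⟨0, by omega⟩)
      intro e; rw [e] at this; simp at this)
    (by
      rw [hp i 0 (by omega)]
      simpa [s, s'] using hP4 (i, ⟨0, by omega⟩))
    (by
      rw [hp i K le_rfl]
      have := hP4 (i, ⟨K, by omega⟩)
      have hK0 : K ≠ 0 := by omega
      have hfK : f K = 2 * K - 2 := by simp only [f]; rw [if_neg (by omega)]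
      simpa [s, s', hK0, hfK] using this)
    (fun j hj => by
      rw [hp i (j + 1) (by omega)]
      have := hP4 (i, ⟨j + 1, by omega⟩)
      have h1 := hf i (j + 1) (by omega)
      rw [Nat.add_sub_cancel] at h1
      have h2 : j + 1 ≠ K := by omega
      have h3 : 2 * (j + 1) + 1 = 2 * j + 3 := by omega
      rw [h1]
      simpa [s, s', h2, h3] using this)
  choose l l' q r Cr c1 c2 c3 c4 c5 c6 c7 c8 c9 c10 c11 c12 c13 using hg
  have c7' : ∀ i, ∀ x ∈ Cr i, x ∈ Q i ∨ x ∈ W i ∨ ∃ j ≤ K, x ∈ p i j := by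
    intro i x hx
    rcases c7 i x hx with hx | ⟨j, hj, rfl⟩ | hx
    · rw [← hQe] at hx; exact Or.inl hx
    · exact Or.inr (Or.inl (hw5 i j hj))
    · exact Or.inr (Or.inr hx)
  have c8' : ∀ i, ∀ x ∈ w i 0 :: (l i ++ [q i]), x ∈ A1 := by
    intro i x hx
    rcases c8 i x hx with ⟨j, hj, rfl⟩ | ⟨j, hj, hx⟩
    · exact hW3 _ _ (hw5 i j hj)
    · exact hA2 (hpA i j hj x hx)
  have hCdis : ∀ i j, ∀ x, x ∈ Cr i → x ∈ Cr j → i = j := by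
    intro i j x hx hx'
    rcases c7' i x hx with hx | hx | ⟨a, ha, hx⟩ <;>
      rcases c7' j x hx' with hx' | hx' | ⟨b, hb, hx'⟩
    · exact hQi _ _ x hx hx'
    · exact absurd hx (hWQ _ _ x hx')
    · exact absurd (hA2 (hpA j b hb x hx')) (hQA1 _ _ hx)
    · exact absurd hx' (hWQ _ _ x hx)
    · exact hWi _ _ x hx hx'
    · exact absurd (hpA j b hb x hx') (hWA2 _ _ hx)
    · exact absurd (hA2 (hpA i a ha x hx)) (hQA1 _ _ hx')
    · exact absurd (hpA i a ha x hx) (hWA2 _ _ hx')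
    · exact (hpi _ _ _ _ ha hb x hx hx').1
  have hMC : ∀ i, ∀ x ∈ w i 0 :: (l i ++ [q i]), x ∈ Cr i := fun i x hx => (c11 i).subset hx
  have hyC : ∀ i, y i ∈ Cr i := fun i => (c12 i).subset (by simp)
  have hzC : ∀ i, z i ∈ Cr i := fun i => (c12 i).subset (by simp)
  have hrC : ∀ i, r i ∈ Cr i := fun i => (c13 i).subset (by simp)
  have hpC : ∀ i, w i 0 ∈ Cr i := fun i => hMC i _ (by simp)
  have hrA : ∀ i, r i ∈ A1 := fun i => hA2 (hpA i 0 (by omega) _ (c9 i))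
  have hyM : ∀ i j, y j ∉ w i 0 :: (l i ++ [q i]) := fun i j e => hQA1 _ _ (hyQ j) (c8' i _ e)
  have hzM : ∀ i j, z j ∉ w i 0 :: (l i ++ [q i]) := fun i j e => hQA1 _ _ (hzQ j) (c8' i _ e)
  refine ⟨Cr, fun i => ⟨y (i + 1), z (i + 1), w i 0, q i, r i, l i, l' i⟩, ?_, c5, ?_, c6, ?_, hpC,
    fun i => hyC _, ?_, ?_⟩
  · intro i x hx
    rcases c7' i x hx with hx | hx | ⟨a, ha, hx⟩
    · exact hQ3 _ _ hx
    · exact hA1 (hW3 _ _ hx)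
    · exact hA1 (hA2 (hpA i a ha x hx))
  · exact fun i j hne x hx hx' => hne (hCdis i j x hx hx')
  · intro i
    exact ⟨c1 i, c2 i, c3 i, hyz _, hyM _ _, hzM _ _, c10 i, fun e => hQA1 _ _ (hzQ (i + 1))
      (by dsimp only at e; exact e ▸ hrA i), c4 i _ (hw2 i).symm, hw1 i⟩
  · intro i j hne
    have hb : ∀ u v, (Toggle.base ⟨y (i + 1), z (i + 1), w i 0, q i, r i, l i, l' i⟩).Adj u v →
        (u ∈ Cr i ∧ u ∈ A1 ∧ v ∈ A1) ∨ u ∈ Cr (i + 1) ∧ u ∈ Q (i + 1) ∧ v ∈ Q (i + 1) := by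
      intro u v huv
      simp only [Toggle.base, Toggle.old, sup_adj, edge_adj] at huv
      rcases huv with (huv | ⟨⟨rfl, rfl⟩ | ⟨rfl, rfl⟩, -⟩) | ⟨⟨rfl, rfl⟩ | ⟨rfl, rfl⟩, -⟩
      · have := mem_of_listGraph_adj huv
        exact Or.inl ⟨hMC _ _ this.1, c8' _ _ this.1, c8' _ _ this.2⟩
      · exact Or.inr ⟨hyC _, hyQ _, hzQ _⟩
      · exact Or.inr ⟨hzC _, hzQ _, hyQ _⟩
      · exact Or.inl ⟨hpC _, c8' i _ (by simp), hrA _⟩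
      · exact Or.inl ⟨hrC _, hrA _, c8' i _ (by simp)⟩
    have ho : ∀ u v, (Toggle.old ⟨y (j + 1), z (j + 1), w j 0, q j, r j, l j, l' j⟩).Adj u v →
        (u ∈ Cr j ∧ u ∈ A1 ∧ v ∈ A1) ∨ u ∈ Cr (j + 1) ∧ u ∈ Q (j + 1) ∧ v ∈ Q (j + 1) := by
      intro u v huv
      simp only [Toggle.old, sup_adj, edge_adj] at huv
      rcases huv with huv | ⟨⟨rfl, rfl⟩ | ⟨rfl, rfl⟩, -⟩
      · have := mem_of_listGraph_adj huv
        exact Or.inl ⟨hMC _ _ this.1, c8' _ _ this.1, c8' _ _ this.2⟩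
      · exact Or.inr ⟨hyC _, hyQ _, hzQ _⟩
      · exact Or.inr ⟨hzC _, hzQ _, hyQ _⟩
    refine SimpleGraph.disjoint_left.mpr fun u v huv huv' => ?_
    rcases hb u v huv with ⟨a1, a2, a3⟩ | ⟨a1, a2, a3⟩ <;>
      rcases ho u v huv' with ⟨b1, b2, b3⟩ | ⟨b1, b2, b3⟩
    · exact hne (hCdis _ _ _ a1 b1)
    · exact hQA1 _ _ b2 a2
    · exact hQA1 _ _ a2 b2
    · exact hne (add_left_injective 1 (hCdis _ _ _ a1 b1))
  · intro i
    refine sup_le (sup_le ?_ ?_) ?_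
    · exact (listGraph_le_of_isInfix (c5 i) (c11 i)).trans le_sup_left
    · exact (edge_le_listGraph_of_isInfix (c5 _) (c12 _)).trans le_sup_right
    · dsimp only
      rw [edge_comm]
      exact (edge_le_listGraph_of_isInfix (c5 _) (c13 _)).trans le_sup_left

end Skeleton

section ListWalk
open Finset
open scoped Classical

variable {V : Type} [Fintype V] {G : SimpleGraph V}

theorem exists_walk_of_isChain {a b : V} {l : List V} (h : (a :: (l ++ [b])).IsChain G.Adj) :
    ∃ p : G.Walk a b, p.support = a :: (l ++ [b]) := by
  induction l generalizing a with
  | nil =>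
    have : G.Adj a b := by simpa using h
    exact ⟨this.toWalk, by simp⟩
  | cons c l ih =>
    rw [List.cons_append, List.isChain_cons_cons] at h
    obtain ⟨p, hp⟩ := ih h.2
    exact ⟨p.cons h.1, by simp [hp]⟩

theorem hasSpanningKSubdivision_of_lists {t : ℕ} (ht : 2 ≤ t) {b : Fin t → V}
    (hb : Function.Injective b) (Q : Fin t → Fin t → List V)
    (hnd : ∀ i j, i < j → (Q i j).Nodup)
    (hc : ∀ i j, i < j → (b i :: (Q i j ++ [b j])).IsChain G.Adj)
    (hbQ : ∀ i j k, i < j → b k ∉ Q i j)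
    (hdis : ∀ i j i' j', i < j → i' < j' → ∀ x ∈ Q i j, x ∈ Q i' j' → i = i' ∧ j = j')
    (hcov : ∀ v, (∃ k, v = b k) ∨ ∃ i j, i < j ∧ v ∈ Q i j) : HasSpanningKSubdivision G t := by
  have h := fun i j (hij : i < j) => exists_walk_of_isChain (hc i j hij)
  choose P hP using h
  refine ⟨⟨b, hb⟩, P, ?_, ?_, ?_, ?_⟩
  · intro i j hij
    rw [Walk.isPath_def, hP, List.nodup_cons, List.nodup_append']
    refine ⟨?_, hnd i j hij, by simp, ?_⟩
    · simp only [List.mem_append, List.mem_singleton, not_or]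
      exact ⟨hbQ i j i hij, fun e => hij.ne (hb e)⟩
    · intro x hx hx'
      rw [List.mem_singleton] at hx'
      exact hbQ i j j hij (hx' ▸ hx)
  · intro i j hij k hki hkj
    rw [hP]
    simp only [Function.Embedding.coeFn_mk, List.mem_cons, List.mem_append, List.not_mem_nil,
      or_false, not_or]
    exact ⟨fun e => hki (hb e), hbQ i j k hij, fun e => hkj (hb e)⟩
  · intro i j hij i' j' hij' hne v hv hv'
    rw [hP] at hv hv'
    simp only [Function.Embedding.coeFn_mk, List.mem_cons, List.mem_append, List.not_mem_nil,
      or_false] at hv hv' ⊢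
    rcases hv with hv | hv | hv
    · exact ⟨_, hv⟩
    · rcases hv' with hv' | hv' | hv'
      · exact ⟨_, hv'⟩
      · exact absurd (hdis i j i' j' hij hij' v hv hv') hne
      · exact ⟨_, hv'⟩
    · exact ⟨_, hv⟩
  · intro v
    rcases hcov v with ⟨k, hk⟩ | ⟨i, j, hij, hv⟩
    · by_cases h0 : k.val = 0
      · have : k < ⟨1, by omega⟩ := by rw [Fin.lt_def]; simp [h0]
        exact ⟨k, _, this, by rw [hP]; simp [hk]⟩
      · have : (⟨0, by omega⟩ : Fin t) < k := by rw [Fin.lt_def]; simp; omega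
        exact ⟨_, k, this, by rw [hP]; simp [hk]⟩
    · exact ⟨i, j, hij, by rw [hP]; simp [hv]⟩

end ListWalk

section Stars
open Finset
open scoped Classical

variable {V : Type} [Fintype V] {G : SimpleGraph V}

/-- A regular graph has many disjoint stars inside a set into which all vertices have many
neighbours. -/
theorem Pseudorandom.exists_stars {d κ t : ℕ} {lam : ℝ} (P : Pseudorandom G d lam) (hd : 1 ≤ d) (hκ : d ≤ 64 * κ)
    (X : Finset V) (hX : ∀ v, κ ≤ (nb G v ∩ X).card) (ht : 128 * t ≤ d)
    (htn : 2 ^ 15 * (t * (t + 1)) ≤ Fintype.card V) (ht1 : 1 ≤ t) (s : ℕ) (hs : s ≤ t) :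
    ∃ f : Fin s → Option (Fin t) → V, (∀ i o, f i o ∈ X) ∧
      (∀ i j o o', f i o = f j o' → i = j ∧ o = o') ∧ ∀ i o, G.Adj (f i none) (f i (some o)) := by
  induction s with
  | zero => exact ⟨fun i => i.elim0, fun i => i.elim0, fun i => i.elim0, fun i => i.elim0⟩
  | succ s ih =>
    obtain ⟨f, h1, h2, h3⟩ := ih (by omega)
    set U : Finset V := univ.image fun x : Fin s × Option (Fin t) => f x.1 x.2 with hU
    have hUc : U.card ≤ s * (t + 1) := by
      refine card_image_le.trans ?_
      simp
    have hUc' : 2 ^ 15 * U.card ≤ Fintype.card V :=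
      (Nat.mul_le_mul_left _ (hUc.trans (Nat.mul_le_mul_right _ (by omega)))).trans htn
    have hXc : Fintype.card V ≤ 64 * X.card := P.card_class X κ 64 hκ hd hX
    obtain ⟨v, hv, hvU⟩ : ∃ v ∈ X \ U, 2 * (nb G v ∩ U).card ≤ κ := by
      by_contra! hcon
      have h4 : (X \ U).card * κ ≤ 2 * (U.card * d) := by
        have e1 : ∀ v, (nb G v ∩ U).card = (bipartiteAbove G.Adj U v).card := fun v => by
          congr 1; ext u; simp [mem_nb, and_comm]
        calc (X \ U).card * κ = ∑ v ∈ X \ U, κ := by simp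
          _ ≤ ∑ v ∈ X \ U, 2 * (nb G v ∩ U).card := sum_le_sum fun v hv => (hcon v hv).le
          _ = 2 * ∑ u ∈ U, (bipartiteBelow G.Adj (X \ U) u).card := by
            rw [← mul_sum, ← sum_card_bipartiteAbove_eq_sum_card_bipartiteBelow]
            simp only [e1]
          _ ≤ 2 * ∑ u ∈ U, d := by
            refine Nat.mul_le_mul_left _ (sum_le_sum fun u _ => ?_)
            rw [← P.card_nb u]
            refine card_le_card fun v hv => mem_nb.mpr ?_
            exact (mem_bipartiteBelow _ |>.mp hv).2.symm
          _ = _ := by simp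
      have h5 : (X \ U).card * κ ≤ 128 * U.card * κ :=
        h4.trans (by nlinarith [Nat.zero_le U.card])
      have h6 := Nat.le_of_mul_le_mul_right h5 (by omega)
      have h7 := card_le_card_sdiff_add_card (s := X) (t := U)
      have h8 : 1 * 1 ≤ t * (t + 1) := Nat.mul_le_mul ht1 (by omega)
      omega
    have hfree : t ≤ ((nb G v ∩ X) \ U).card := by
      have h4 := card_sdiff_add_card_inter (nb G v ∩ X) U
      have h5 : ((nb G v ∩ X) ∩ U).card ≤ (nb G v ∩ U).card :=
        card_le_card (inter_subset_inter_right inter_subset_left)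
      have := hX v
      omega
    obtain ⟨S, hS, hSc⟩ := exists_subset_card_eq hfree
    let e : Fin t ≃ S := (S.equivFinOfCardEq hSc).symm
    let g : Option (Fin t) → V := fun o => o.elim v fun i => (e i : V)
    have hgX : ∀ o, g o ∈ X ∧ g o ∉ U := by
      rintro (_ | i)
      · exact mem_sdiff.mp hv
      · have := mem_sdiff.mp (hS (e i).2)
        exact ⟨(mem_inter.mp this.1).2, this.2⟩
    have hadj : ∀ i, G.Adj v (e i) := fun i =>
      mem_nb.mp (mem_inter.mp (mem_sdiff.mp (hS (e i).2)).1).1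
    have hgi : Function.Injective g := by
      rintro (_ | i) (_ | j) h
      · rfl
      · exact absurd h (hadj j).ne
      · exact absurd h (hadj i).ne'
      · exact congrArg some (e.injective (Subtype.ext h))
    refine ⟨Fin.snoc f g, ?_, ?_, ?_⟩
    · intro i o
      refine Fin.lastCases ?_ (fun i => ?_) i
      · rw [Fin.snoc_last]; exact (hgX o).1
      · rw [Fin.snoc_castSucc]; exact h1 i o
    · intro i j o o'
      refine Fin.lastCases ?_ (fun i => ?_) i <;> refine Fin.lastCases ?_ (fun j => ?_) j <;>
        simp only [Fin.snoc_last, Fin.snoc_castSucc] <;> intro h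
      · exact ⟨trivial, hgi h⟩
      · exact absurd (mem_image.mpr ⟨(j, o'), mem_univ _, h.symm⟩) (hgX o).2
      · exact absurd (mem_image.mpr ⟨(i, o), mem_univ _, h⟩) (hgX o').2
      · obtain ⟨e1, e2⟩ := h2 _ _ _ _ h
        exact ⟨e1 ▸ rfl, e2⟩
    · intro i o
      refine Fin.lastCases ?_ (fun i => ?_) i
      · simp only [Fin.snoc_last]; exact hadj o
      · simp only [Fin.snoc_castSucc]; exact h3 i o

end Stars

section GreedyMatching
open Finset
open scoped Classical

variable {V : Type} [Fintype V] {G : SimpleGraph V}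

theorem exists_matching_of_joined {a : ℕ}
    (hj : ∀ S T : Finset V, a ≤ S.card → a ≤ T.card → ∃ s ∈ S, ∃ t ∈ T, G.Adj s t) (s : ℕ)
    (Z : Finset V) (hZ : 2 * s + 2 * a ≤ Z.card) :
    ∃ p p' : Fin s → V, (∀ i, p i ∈ Z) ∧ (∀ i, p' i ∈ Z) ∧ (∀ i, G.Adj (p i) (p' i)) ∧
      Function.Injective p ∧ Function.Injective p' ∧ ∀ i j, p i ≠ p' j := by
  induction s generalizing Z with
  | zero =>
    exact ⟨fun i => i.elim0, fun i => i.elim0, fun i => i.elim0, fun i => i.elim0, fun i => i.elim0,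
      fun i => i.elim0, fun i => i.elim0, fun i => i.elim0⟩
  | succ s ih =>
    obtain ⟨S, hS, hSc⟩ := exists_subset_card_eq (s := Z) (n := a) (by omega)
    have h1 := card_sdiff_of_subset hS
    obtain ⟨u, hu, v, hv, huv⟩ := hj S (Z \ S) hSc.ge (by omega)
    have huZ := hS hu
    have hvZ := (mem_sdiff.mp hv).1
    have hc : ((Z.erase u).erase v).card = Z.card - 1 - 1 := by
      rw [card_erase_of_mem (mem_erase.mpr ⟨huv.ne', hvZ⟩), card_erase_of_mem huZ]
    obtain ⟨p, p', h2, h3, h4, h5, h6, h7⟩ := ih ((Z.erase u).erase v) (by omega)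
    simp only [mem_erase] at h2 h3
    refine ⟨Fin.cons u p, Fin.cons v p', ?_, ?_, ?_, ?_, ?_, ?_⟩
    · exact fun i => Fin.cases huZ (fun i => (h2 i).2.2) i
    · exact fun i => Fin.cases hvZ (fun i => (h3 i).2.2) i
    · exact fun i => Fin.cases huv (fun i => h4 i) i
    · exact Fin.cons_injective_iff.mpr ⟨by rintro ⟨i, rfl⟩; exact (h2 i).2.1 rfl, h5⟩
    · exact Fin.cons_injective_iff.mpr ⟨by rintro ⟨i, rfl⟩; exact (h3 i).1 rfl, h6⟩
    · intro i j
      refine Fin.cases ?_ (fun i => ?_) i <;> refine Fin.cases ?_ (fun j => ?_) j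
      · exact huv.ne
      · exact (h3 j).2.1.symm
      · exact (h2 i).1
      · exact h7 i j

end GreedyMatching

section Skel
open Finset
open scoped Classical

variable {V : Type} [Fintype V] {G : SimpleGraph V}

theorem card_nb_iSup {ι : Type} [Fintype ι] {H : ι → SimpleGraph V}
    (h : ∀ i j u v, (H i).Adj u v → (H j).Adj u v → i = j) (v : V) :
    (nb (⨆ i, H i) v).card = ∑ i, (nb (H i) v).card := by
  rw [← card_biUnion]
  · congr 1
    ext u
    simp [mem_nb]
  · intro i _ j _ hij
    rw [Function.onFun, Finset.disjoint_left]
    intro u hu hu'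
    exact hij (h i j v u (mem_nb.mp hu) (mem_nb.mp hu'))

theorem sum_ite_eq_exists {ι : Type} [Fintype ι] {p : ι → Prop} [DecidablePred p]
    [Decidable (∃ i, p i)]
    (h : ∀ i j, p i → p j → i = j) (n : ℕ) :
    (∑ i, if p i then n else 0) = if ∃ i, p i then n else 0 := by
  split_ifs with hp
  · obtain ⟨i, hi⟩ := hp
    rw [Finset.sum_eq_single i, if_pos hi]
    · exact fun j _ hji => if_neg fun hj => hji (h j i hj hi)
    · exact fun hh => absurd (mem_univ _) hh
  · exact Finset.sum_eq_zero fun i _ => if_neg fun hi => hp ⟨i, hi⟩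

/-- The paths with interiors `Cr i` and ends `α i` and `β i`. -/
def pathsGraph {ι : Type} (α β : ι → V) (Cr : ι → List V) : SimpleGraph V :=
  ⨆ i, listGraph (α i :: (Cr i ++ [β i]))

structure DisjointPaths {ι : Type} (α β : ι → V) (Cr : ι → List V) : Prop where
  ne_nil : ∀ i, Cr i ≠ []
  nodup : ∀ i, (Cr i).Nodup
  disj : ∀ i j x, x ∈ Cr i → x ∈ Cr j → i = j
  left_notMem : ∀ i j, α i ∉ Cr j
  right_notMem : ∀ i j, β i ∉ Cr j
  ends_ne : ∀ i j, α i ≠ β j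
  left_inj : Function.Injective α
  right_inj : Function.Injective β

namespace DisjointPaths

variable {ι : Type} [Fintype ι] {α β : ι → V} {Cr : ι → List V}

theorem nodup' (h : DisjointPaths α β Cr) (i : ι) : (α i :: (Cr i ++ [β i])).Nodup := by
  rw [List.nodup_cons, List.nodup_append']
  refine ⟨?_, h.nodup i, by simp, fun x hx hx' => h.right_notMem i i ?_⟩
  · simp only [List.mem_append, List.mem_singleton, not_or]
    exact ⟨h.left_notMem i i, h.ends_ne i i⟩
  · rw [List.mem_singleton] at hx'; exact hx' ▸ hx

theorem mem_of_adj (h : DisjointPaths α β Cr) {i : ι} {u v : V}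
    (huv : (listGraph (α i :: (Cr i ++ [β i]))).Adj u v) : u ∈ Cr i ∨ v ∈ Cr i := by
  obtain ⟨c, l, hc⟩ := List.exists_cons_of_ne_nil (h.ne_nil i)
  have hcm : c ∈ Cr i := by simp [hc]
  have huv' : (listGraph (Cr i ++ [β i]) ⊔ edge (α i) c).Adj u v := by
    rw [hc] at huv ⊢
    exact huv
  rw [sup_adj, edge_adj] at huv'
  rcases huv' with h1 | ⟨⟨rfl, rfl⟩ | ⟨rfl, rfl⟩, -⟩
  · obtain ⟨h2, h3⟩ := mem_of_listGraph_adj h1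
    simp only [List.mem_append, List.mem_singleton] at h2 h3
    rcases h2 with h2 | h2
    · exact Or.inl h2
    rcases h3 with h3 | h3
    · exact Or.inr h3
    · exact absurd (h2.trans h3.symm) h1.ne
  · exact Or.inr hcm
  · exact Or.inl hcm

theorem mem_of_adj' (h : DisjointPaths α β Cr) {u v : V} (huv : (pathsGraph α β Cr).Adj u v) :
    (∃ i, u ∈ Cr i) ∨ ∃ i, v ∈ Cr i := by
  obtain ⟨i, hi⟩ := iSup_adj.mp huv
  exact (h.mem_of_adj hi).imp (fun h => ⟨i, h⟩) fun h => ⟨i, h⟩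

theorem mem_right_of_adj (h : DisjointPaths α β Cr) {u v : V}
    (huv : (pathsGraph α β Cr).Adj u v) (hu : ∀ i, u ∉ Cr i) : ∃ i, v ∈ Cr i :=
  (h.mem_of_adj' huv).resolve_left fun ⟨i, hi⟩ => hu i hi

theorem card_nb (h : DisjointPaths α β Cr) (v : V) : (nb (pathsGraph α β Cr) v).card =
    (if ∃ i, v ∈ Cr i then 2 else 0) + (if ∃ i, v = α i then 1 else 0) +
      if ∃ i, v = β i then 1 else 0 := by
  rw [pathsGraph, card_nb_iSup]
  · have : ∀ i, (nb (listGraph (α i :: (Cr i ++ [β i]))) v).card =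
        (if v ∈ Cr i then 2 else 0) + (if v = α i then 1 else 0) + if v = β i then 1 else 0 := by
      intro i
      rw [card_nb_listGraph (h.nodup' i), List.tail_cons, Toggle.dropLast_cons_append]
      simp only [List.mem_append, List.mem_cons, List.not_mem_nil, or_false]
      have h1 := h.left_notMem i i
      have h2 := h.right_notMem i i
      have h3 := h.ends_ne i i
      by_cases h4 : v = α i
      · subst h4; simp [h1, h3]
      by_cases h5 : v = β i
      · subst h5; simp [h2, h4]
      by_cases h6 : v ∈ Cr i <;> simp [h4, h5, h6]
    simp only [this, sum_add_distrib]
    rw [sum_ite_eq_exists (fun i j h1 h2 => h.disj i j v h1 h2),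
      sum_ite_eq_exists (fun i j h1 h2 => h.left_inj (h1.symm.trans h2)),
      sum_ite_eq_exists (fun i j h1 h2 => h.right_inj (h1.symm.trans h2))]
  · intro i j u v h1 h2
    obtain ⟨h3, h4⟩ := mem_of_listGraph_adj h2
    have key : ∀ u, u ∈ α j :: (Cr j ++ [β j]) → u ∈ Cr i → i = j := by
      intro u hu hu'
      simp only [List.mem_append, List.mem_cons, List.not_mem_nil, or_false] at hu
      rcases hu with hu | hu | hu
      · exact absurd (hu ▸ hu') (h.left_notMem j i)
      · exact h.disj i j u hu' hu
      · exact absurd (hu ▸ hu') (h.right_notMem j i)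
    rcases h.mem_of_adj h1 with h5 | h5
    · exact key u h3 h5
    · exact key v h4 h5

theorem isChain (h : DisjointPaths α β Cr) (i : ι) :
    (α i :: (Cr i ++ [β i])).IsChain (pathsGraph α β Cr).Adj :=
  isChain_of_listGraph_le (h.nodup' i) (le_iSup (fun i => listGraph (α i :: (Cr i ++ [β i]))) i)

theorem exists_left (h : DisjointPaths α β Cr) (i : ι) :
    ∃ c ∈ Cr i, (pathsGraph α β Cr).Adj (α i) c := by
  obtain ⟨c, l, hc⟩ := List.exists_cons_of_ne_nil (h.ne_nil i)
  have := h.isChain i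
  rw [hc, List.cons_append, List.isChain_cons_cons] at this
  exact ⟨c, by simp [hc], this.1⟩

theorem exists_right (h : DisjointPaths α β Cr) (i : ι) :
    ∃ c ∈ Cr i, (pathsGraph α β Cr).Adj (β i) c := by
  have hc := List.dropLast_append_getLast (h.ne_nil i)
  have := h.isChain i
  rw [← hc, List.append_assoc, ← List.cons_append, List.singleton_append,
    List.isChain_append_cons_cons] at this
  exact ⟨_, List.getLast_mem _, this.2.1.symm⟩

end DisjointPaths

/-- The graph with edges `p j` to `p' j`. -/
def pairGraph {ι : Type} (p p' : ι → V) : SimpleGraph V := ⨆ j, edge (p j) (p' j)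

theorem pairGraph_adj {ι : Type} {p p' : ι → V} (h : ∀ i j, p i ≠ p' j) {u v : V} :
    (pairGraph p p').Adj u v ↔ ∃ j, (u = p j ∧ v = p' j) ∨ (u = p' j ∧ v = p j) := by
  rw [pairGraph, iSup_adj]
  refine exists_congr fun j => ?_
  rw [edge_adj]
  have := h j j
  grind

theorem card_nb_pairGraph {ι : Type} [Fintype ι] {p p' : ι → V} (h : ∀ i j, p i ≠ p' j)
    (hp : Function.Injective p) (hp' : Function.Injective p') (v : V) :
    (nb (pairGraph p p') v).card =
      (if ∃ j, v = p j then 1 else 0) + if ∃ j, v = p' j then 1 else 0 := by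
  rw [pairGraph, card_nb_iSup]
  · have : ∀ j, (nb (edge (p j) (p' j)) v).card =
        (if v = p j then 1 else 0) + if v = p' j then 1 else 0 := by
      intro j
      have := card_nb_sup_edge (H := (⊥ : SimpleGraph V)) (h j j) (by simp) v
      rw [bot_sup_eq] at this
      rw [this]
      simp [nb]
    simp only [this, sum_add_distrib]
    rw [sum_ite_eq_exists (fun i j h1 h2 => hp (h1.symm.trans h2)),
      sum_ite_eq_exists (fun i j h1 h2 => hp' (h1.symm.trans h2))]
  · intro i j u v h1 h2
    rw [edge_adj] at h1 h2
    rcases h1.1 with ⟨e1, e2⟩ | ⟨e1, e2⟩ <;> rcases h2.1 with ⟨e3, e4⟩ | ⟨e3, e4⟩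
    · exact hp (e1.symm.trans e3)
    · exact absurd (e1.symm.trans e3) (h _ _)
    · exact absurd (e2.symm.trans e4) (h _ _)
    · exact hp (e2.symm.trans e4)

theorem exists_pairing {A : Finset V} {r : ℕ} (hA : A.card = 2 * r) :
    ∃ q q' : Fin r → V, Function.Injective q ∧ Function.Injective q' ∧ (∀ i j, q i ≠ q' j) ∧
      ∀ v, v ∈ A ↔ (∃ j, v = q j) ∨ ∃ j, v = q' j := by
  have e : (Fin r ⊕ Fin r) ≃ A :=
    (finSumFinEquiv.trans (finCongr (by omega))).trans (A.equivFinOfCardEq hA).symm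
  refine ⟨fun j => e (.inl j), fun j => e (.inr j), fun i j h => ?_, fun i j h => ?_,
    fun i j h => ?_, fun v => ⟨fun hv => ?_, ?_⟩⟩
  · exact Sum.inl.inj (e.injective (Subtype.ext h))
  · exact Sum.inr.inj (e.injective (Subtype.ext h))
  · exact absurd (e.injective (Subtype.ext h)) (by simp)
  · obtain ⟨x, hx⟩ := e.surjective ⟨v, hv⟩
    rcases x with x | x
    · exact Or.inl ⟨x, by simp [hx]⟩
    · exact Or.inr ⟨x, by simp [hx]⟩
  · rintro (⟨j, rfl⟩ | ⟨j, rfl⟩)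
    · exact (e _).2
    · exact (e _).2

theorem Arena.mk' {F : SimpleGraph V} {U : Finset V} (h1 : F ≤ within G U) (h2 : F.IsAcyclic)
    (h3 : ∀ v, (nb F v).card ≤ 2) (h4 : ∀ u ∈ U, 1 ≤ (nb F u).card) :
    Arena G U (lowSet F U) F ∧ Even (lowSet F U).card ∧
      ∀ v, (nb F v).card + (if v ∈ lowSet F U then 1 else 0) = if v ∈ U then 2 else 0 := by
  have hdeg : ∀ v, (nb F v).card + (if v ∈ lowSet F U then 1 else 0) = if v ∈ U then 2 else 0 := by
    intro v
    have h5 := h3 v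
    by_cases hv : v ∈ U
    · have h6 := h4 v hv
      simp only [lowSet, mem_filter, hv, true_and, if_true]
      split_ifs <;> omega
    · simp [lowSet, hv, nb_eq_empty_of_le_within h1 hv]
  have hodd : ∀ v, Odd (nb F v).card ↔ v ∈ lowSet F U := by
    intro v
    have := hdeg v
    by_cases hv : v ∈ lowSet F U
    · have hvU := (mem_filter.mp hv).1
      rw [if_pos hv, if_pos hvU] at this
      have h : (nb F v).card = 1 := by omega
      simp [h, hv]
    · rw [if_neg hv] at this
      simp only [hv, iff_false, Nat.not_odd_iff_even]
      have h : (nb F v).card = if v ∈ U then 2 else 0 := by omega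
      rw [h]; split_ifs <;> decide
  refine ⟨⟨h1, h2, h3, h4, ?_⟩, ?_, hdeg⟩
  · intro w hw
    obtain ⟨u, hu, ho⟩ := exists_reachable_odd_of_isAcyclic h2 (h4 w hw)
    exact ⟨u, (hodd u).mp ho, hu⟩
  · have := F.even_card_odd_degree_vertices
    convert this using 2
    ext v
    rw [mem_filter, degree_eq_card_nb, hodd]
    simp

end Skel

section Framework
open Finset
open scoped Classical

variable {V : Type} [Fintype V] {G : SimpleGraph V}

/-- The vertices with colour `c`. -/
noncomputable def colourClass (χ : V → Fin 5) (c : Fin 5) : Finset V := univ.filter fun v => χ v = c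

theorem mem_colourClass {χ : V → Fin 5} {c : Fin 5} {v : V} : v ∈ colourClass χ c ↔ χ v = c := by
  simp [colourClass]

/-- Disjoint paths joining `a` to `b`, the vertices `p j` to `p' j`, and the vertices of `B₁` and
of `B₂` in pairs. -/
structure Framework {ι : Type} (G : SimpleGraph V) (χ : V → Fin 5) (W B₁ B₂ : Finset V) (a b : V)
    {s : ℕ} (p p' : Fin s → V) (α β : ι → V) (Cr : ι → List V) : Prop where
  paths : DisjointPaths α β Cr
  le : pathsGraph α β Cr ≤ G
  mem_W : ∀ v, χ v ≠ 3 → χ v ≠ 4 → v ∈ W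
  interior : ∀ i, ∀ v ∈ Cr i, χ v = 4 ∧ v ∈ W
  left : χ a = 3 ∧ a ∈ W
  right : χ b = 3 ∧ b ∈ W
  ne : a ≠ b
  pair_left : ∀ j, χ (p j) = 3 ∧ p j ∈ W ∧ p j ≠ a ∧ p j ≠ b
  pair_right : ∀ j, χ (p' j) = 3 ∧ p' j ∈ W ∧ p' j ≠ a ∧ p' j ≠ b
  pair_ne : ∀ i j, p i ≠ p' j
  pair_inj : Function.Injective p
  pair_inj' : Function.Injective p'
  adj : ∀ j, G.Adj (p j) (p' j)
  colour_one : ∀ v ∈ B₁, χ v = 1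
  colour_two : ∀ v ∈ B₂, χ v = 2
  left_cases : ∀ v, (∃ i, v = α i) → v = a ∨ (∃ j, v = p j) ∨ v ∈ B₁ ∨ v ∈ B₂
  right_cases : ∀ v, (∃ i, v = β i) → v = b ∨ (∃ j, v = p' j) ∨ v ∈ B₁ ∨ v ∈ B₂
  left_mem : ∃ i, a = α i
  right_mem : ∃ i, b = β i
  pair_mem : ∀ j, ∃ i, p j = α i
  pair_mem' : ∀ j, ∃ i, p' j = β i
  low_mem : ∀ v, v ∈ B₁ ∨ v ∈ B₂ → (∃ i, v = α i) ∨ ∃ i, v = β i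

namespace Framework

variable {ι : Type} [Fintype ι] {χ : V → Fin 5} {W B₁ B₂ : Finset V} {a b : V} {s : ℕ}
  {p p' : Fin s → V} {α β : ι → V} {Cr : ι → List V}

/-- The vertices inside the paths. -/
noncomputable def core (Cr : ι → List V) : Finset V := univ.filter fun v => ∃ i, v ∈ Cr i

theorem mem_core {v : V} : v ∈ core Cr ↔ ∃ i, v ∈ Cr i := by simp [core]

/-- The vertices that are in no path and have none of the colours one and two. -/
noncomputable def rest (χ : V → Fin 5) (W : Finset V) (a b : V) (p p' : Fin s → V)
    (Cr : ι → List V) : Finset V :=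
  W.filter fun v => χ v ≠ 1 ∧ χ v ≠ 2 ∧ v ∉ core Cr ∧ v ≠ a ∧ v ≠ b ∧ (∀ j, v ≠ p j) ∧
    ∀ j, v ≠ p' j

/-- The paths and the edge `a b`. -/
def base (a b : V) (α β : ι → V) (Cr : ι → List V) : SimpleGraph V := pathsGraph α β Cr ⊔ edge a b

/-- The paths, the edge `a b` and the edges `p j` to `p' j`. -/
def edges (a b : V) (p p' : Fin s → V) (α β : ι → V) (Cr : ι → List V) : SimpleGraph V :=
  base a b α β Cr ⊔ pairGraph p p'

theorem colour_core (h : Framework G χ W B₁ B₂ a b p p' α β Cr) {v : V} (hv : v ∈ core Cr) :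
    χ v = 4 ∧ v ∈ W := by
  obtain ⟨i, hi⟩ := mem_core.mp hv
  exact h.interior i v hi

theorem notMem_core (h : Framework G χ W B₁ B₂ a b p p' α β Cr) {v : V} (hv : χ v ≠ 4) :
    v ∉ core Cr := fun h' => hv (h.colour_core h').1

theorem mem_core_of_adj (h : Framework G χ W B₁ B₂ a b p p' α β Cr) {u v : V}
    (huv : (pathsGraph α β Cr).Adj u v) (hu : χ u ≠ 4) : v ∈ core Cr :=
  mem_core.mpr (h.paths.mem_right_of_adj huv fun i hi => hu (h.interior i u hi).1)

theorem not_base_adj (h : Framework G χ W B₁ B₂ a b p p' α β Cr) (i j : Fin s) :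
    ¬ (base a b α β Cr).Adj (p i) (p' j) := by
  rw [base, sup_adj, edge_adj]
  rintro (h' | ⟨⟨e, -⟩ | ⟨e, -⟩, -⟩)
  · have := (h.colour_core (h.mem_core_of_adj h' (by rw [(h.pair_left i).1]; decide))).1
    rw [(h.pair_right j).1] at this
    exact absurd this (by decide)
  all_goals
    have h1 := h.pair_left i
    simp_all

theorem card_nb_edges (h : Framework G χ W B₁ B₂ a b p p' α β Cr) (v : V) :
    (nb (edges a b p p' α β Cr) v).card = ((if v ∈ core Cr then 2 else 0) +
      (if ∃ i, v = α i then 1 else 0) + (if ∃ i, v = β i then 1 else 0) +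
      (if v = a then 1 else 0) + (if v = b then 1 else 0)) +
      ((if ∃ j, v = p j then 1 else 0) + if ∃ j, v = p' j then 1 else 0) := by
  rw [edges, card_nb_sup, card_nb_pairGraph h.pair_ne h.pair_inj h.pair_inj', base,
    card_nb_sup_edge h.ne, h.paths.card_nb]
  · simp only [mem_core]; congr!
  · intro h'
    have := (h.colour_core (h.mem_core_of_adj h' (by rw [h.left.1]; decide))).1
    rw [h.right.1] at this
    exact absurd this (by decide)
  · intro u v huv huv'
    obtain ⟨j, ⟨rfl, rfl⟩ | ⟨rfl, rfl⟩⟩ := (pairGraph_adj h.pair_ne).mp huv'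
    · exact h.not_base_adj _ _ huv
    · exact h.not_base_adj _ _ huv.symm

theorem left_iff (h : Framework G χ W B₁ B₂ a b p p' α β Cr) {v : V} (hv : χ v = 3) :
    (∃ i, v = α i) ↔ v = a ∨ ∃ j, v = p j := by
  constructor
  · intro h'
    rcases h.left_cases v h' with h1 | h1 | h1 | h1
    · exact Or.inl h1
    · exact Or.inr h1
    · have := h.colour_one v h1; rw [hv] at this; exact absurd this (by decide)
    · have := h.colour_two v h1; rw [hv] at this; exact absurd this (by decide)
  · rintro (rfl | ⟨j, rfl⟩)
    · exact h.left_mem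
    · exact h.pair_mem j

theorem right_iff (h : Framework G χ W B₁ B₂ a b p p' α β Cr) {v : V} (hv : χ v = 3) :
    (∃ i, v = β i) ↔ v = b ∨ ∃ j, v = p' j := by
  constructor
  · intro h'
    rcases h.right_cases v h' with h1 | h1 | h1 | h1
    · exact Or.inl h1
    · exact Or.inr h1
    · have := h.colour_one v h1; rw [hv] at this; exact absurd this (by decide)
    · have := h.colour_two v h1; rw [hv] at this; exact absurd this (by decide)
  · rintro (rfl | ⟨j, rfl⟩)
    · exact h.right_mem
    · exact h.pair_mem' j

/-- The number of edges at `v` in terms of its role. -/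
theorem card_nb_edges_add (h : Framework G χ W B₁ B₂ a b p p' α β Cr) (v : V) :
    (nb (edges a b p p' α β Cr) v).card + (if v ∈ rest χ W a b p p' Cr then 2 else 0) +
      ((if χ v = 1 ∨ χ v = 2 then 2 else 0)) =
      (if v ∈ W then 2 else 0) + if v ∈ B₁ ∨ v ∈ B₂ then 1 else 0 := by
  rw [h.card_nb_edges]
  have ha := h.left
  have hb := h.right
  by_cases hB : v ∈ B₁ ∨ v ∈ B₂
  · have hχ : χ v = 1 ∨ χ v = 2 := hB.imp (h.colour_one v) (h.colour_two v)
    have hχ3 : χ v ≠ 3 := by rcases hχ with e | e <;> rw [e] <;> decide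
    have hχ4 : χ v ≠ 4 := by rcases hχ with e | e <;> rw [e] <;> decide
    have hva : v ≠ a := fun e => hχ3 (e ▸ ha.1)
    have hvb : v ≠ b := fun e => hχ3 (e ▸ hb.1)
    have hp : ¬ ∃ j, v = p j := fun ⟨j, e⟩ => hχ3 (e ▸ (h.pair_left j).1)
    have hp' : ¬ ∃ j, v = p' j := fun ⟨j, e⟩ => hχ3 (e ▸ (h.pair_right j).1)
    have hr : v ∉ rest χ W a b p p' Cr := by
      intro hr
      have := (mem_filter.mp hr).2
      exact hχ.elim this.1 this.2.1
    have hex : ¬ ((∃ i, v = α i) ∧ ∃ i, v = β i) := by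
      rintro ⟨⟨i, e⟩, j, e'⟩
      exact h.paths.ends_ne i j (e.symm.trans e')
    rw [if_neg (h.notMem_core hχ4), if_neg hva, if_neg hvb, if_neg hp, if_neg hp', if_neg hr,
      if_pos hχ, if_pos (h.mem_W v hχ3 hχ4), if_pos hB]
    rcases h.low_mem v hB with h1 | h1
    · rw [if_pos h1, if_neg fun h2 => hex ⟨h1, h2⟩]
    · rw [if_pos h1, if_neg fun h2 => hex ⟨h2, h1⟩]
  rw [if_neg hB]
  by_cases hχ3 : χ v = 3
  · rw [if_neg (h.notMem_core (by rw [hχ3]; decide)), if_neg (show ¬ (χ v = 1 ∨ χ v = 2) by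
      rw [hχ3]; decide)]
    simp only [h.left_iff hχ3, h.right_iff hχ3]
    by_cases hva : v = a
    · subst hva
      have h1 : ¬ ∃ j, v = p j := fun ⟨j, e⟩ => (h.pair_left j).2.2.1 e.symm
      have h2 : ¬ ∃ j, v = p' j := fun ⟨j, e⟩ => (h.pair_right j).2.2.1 e.symm
      have h3 : v ∉ rest χ W v b p p' Cr := fun hr => (mem_filter.mp hr).2.2.2.2.1 rfl
      simp [h1, h2, h3, ha.2, h.ne]
    by_cases hvb : v = b
    · subst hvb
      have h1 : ¬ ∃ j, v = p j := fun ⟨j, e⟩ => (h.pair_left j).2.2.2 e.symm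
      have h2 : ¬ ∃ j, v = p' j := fun ⟨j, e⟩ => (h.pair_right j).2.2.2 e.symm
      have h3 : v ∉ rest χ W a v p p' Cr := fun hr => (mem_filter.mp hr).2.2.2.2.2.1 rfl
      simp [h1, h2, h3, hb.2, h.ne.symm]
    by_cases hp : ∃ j, v = p j
    · obtain ⟨j, rfl⟩ := hp
      have h1 : ¬ ∃ i, p j = p' i := fun ⟨i, e⟩ => h.pair_ne j i e
      have h3 : p j ∉ rest χ W a b p p' Cr := fun hr => (mem_filter.mp hr).2.2.2.2.2.2.1 j rfl
      have h4 : ∃ i, p j = p i := ⟨j, rfl⟩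
      rw [if_neg hva, if_neg hvb, if_pos (Or.inr h4), if_pos h4, if_neg h1, if_neg h3,
        if_pos (h.pair_left j).2.1, if_neg (by tauto)]
    by_cases hp' : ∃ j, v = p' j
    · obtain ⟨j, rfl⟩ := hp'
      have h3 : p' j ∉ rest χ W a b p p' Cr := fun hr => (mem_filter.mp hr).2.2.2.2.2.2.2 j rfl
      have h4 : ∃ i, p' j = p' i := ⟨j, rfl⟩
      rw [if_neg hva, if_neg hvb, if_pos (Or.inr h4), if_pos h4, if_neg hp, if_neg h3,
        if_pos (h.pair_right j).2.1, if_neg (by tauto)]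
    · have h3 : v ∈ rest χ W a b p p' Cr ↔ v ∈ W := by
        rw [rest, mem_filter, hχ3]
        refine and_iff_left ⟨by decide, by decide, h.notMem_core (by rw [hχ3]; decide), hva, hvb,
          fun j e => hp ⟨j, e⟩, fun j e => hp' ⟨j, e⟩⟩
      simp [hva, hvb, hp, hp', h3]
  have hva : v ≠ a := fun e => hχ3 (e ▸ ha.1)
  have hvb : v ≠ b := fun e => hχ3 (e ▸ hb.1)
  have hp : ¬ ∃ j, v = p j := fun ⟨j, e⟩ => hχ3 (e ▸ (h.pair_left j).1)
  have hp' : ¬ ∃ j, v = p' j := fun ⟨j, e⟩ => hχ3 (e ▸ (h.pair_right j).1)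
  have hα : ¬ ∃ i, v = α i := fun h' => by have := h.left_cases v h'; tauto
  have hβ : ¬ ∃ i, v = β i := fun h' => by have := h.right_cases v h'; tauto
  rw [if_neg hva, if_neg hvb, if_neg hp, if_neg hp', if_neg hα, if_neg hβ]
  by_cases hC : v ∈ core Cr
  · obtain ⟨h1, h2⟩ := h.colour_core hC
    have h3 : v ∉ rest χ W a b p p' Cr := fun hr => (mem_filter.mp hr).2.2.2.1 hC
    rw [if_pos hC, if_neg h3, if_pos h2, if_neg (by rw [h1]; decide)]
  by_cases hχ : χ v = 1 ∨ χ v = 2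
  · have hχ4 : χ v ≠ 4 := by rcases hχ with e | e <;> rw [e] <;> decide
    have hr : v ∉ rest χ W a b p p' Cr := by
      intro hr
      have := (mem_filter.mp hr).2
      exact hχ.elim this.1 this.2.1
    rw [if_neg hC, if_neg hr, if_pos hχ, if_pos (h.mem_W v hχ3 hχ4)]
  · have h3 : v ∈ rest χ W a b p p' Cr ↔ v ∈ W := by
      rw [rest, mem_filter]
      rw [not_or] at hχ
      exact and_iff_left ⟨hχ.1, hχ.2, hC, hva, hvb, fun j e => hp ⟨j, e⟩, fun j e => hp' ⟨j, e⟩⟩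
    simp [hC, hχ, h3]

end Framework

end Framework

section FrameworkStage
open Finset
open scoped Classical

variable {V : Type} [Fintype V] {G : SimpleGraph V}

namespace Framework

variable {ι : Type} [Fintype ι] {χ : V → Fin 5} {W B₁ B₂ : Finset V} {a b : V} {s : ℕ}
  {p p' : Fin s → V} {α β : ι → V} {Cr : ι → List V}

theorem pathsGraph_le_base : pathsGraph α β Cr ≤ base a b α β Cr := le_sup_left

theorem base_le_edges : base a b α β Cr ≤ edges a b p p' α β Cr := le_sup_left

theorem edges_le (h : Framework G χ W B₁ B₂ a b p p' α β Cr) :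
    edges a b p p' α β Cr ≤ G ⊔ edge a b := by
  refine sup_le (sup_le (h.le.trans le_sup_left) le_sup_right) (le_trans ?_ le_sup_left)
  intro u v huv
  obtain ⟨j, ⟨rfl, rfl⟩ | ⟨rfl, rfl⟩⟩ := (pairGraph_adj h.pair_ne).mp huv
  · exact h.adj j
  · exact (h.adj j).symm

theorem not_edges_adj_of_mem_rest (h : Framework G χ W B₁ B₂ a b p p' α β Cr) {u v : V}
    (hu : u ∈ rest χ W a b p p' Cr) : ¬ (edges a b p p' α β Cr).Adj u v := by
  intro huv
  have h1 := h.card_nb_edges_add u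
  have h2 := one_le_card_nb huv
  have h3 : ¬ (u ∈ B₁ ∨ u ∈ B₂) := by
    rintro (h' | h')
    · exact (mem_filter.mp hu).2.1 (h.colour_one u h')
    · exact (mem_filter.mp hu).2.2.1 (h.colour_two u h')
  rw [if_pos hu, if_neg h3, if_pos (mem_filter.mp hu).1] at h1
  omega

theorem colour_of_edges_adj (h : Framework G χ W B₁ B₂ a b p p' α β Cr) {u v : V}
    (hu : χ u = 1 ∨ χ u = 2) (huv : (edges a b p p' α β Cr).Adj u v) : χ v = 4 := by
  have h3 : χ u ≠ 3 := by rcases hu with e | e <;> rw [e] <;> decide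
  have h4 : χ u ≠ 4 := by rcases hu with e | e <;> rw [e] <;> decide
  rw [edges, base, sup_adj, sup_adj] at huv
  rcases huv with (huv | huv) | huv
  · exact (h.colour_core (h.mem_core_of_adj huv h4)).1
  · rw [edge_adj] at huv
    rcases huv.1 with ⟨e, -⟩ | ⟨e, -⟩
    · exact absurd (e ▸ h.left.1) h3
    · exact absurd (e ▸ h.right.1) h3
  · obtain ⟨j, ⟨rfl, rfl⟩ | ⟨rfl, rfl⟩⟩ := (pairGraph_adj h.pair_ne).mp huv
    · exact absurd (h.pair_left j).1 h3
    · exact absurd (h.pair_right j).1 h3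

theorem exists_core_adj (h : Framework G χ W B₁ B₂ a b p p' α β Cr) {v : V}
    (hv : (∃ i, v = α i) ∨ ∃ i, v = β i) : ∃ c ∈ core Cr, (base a b α β Cr).Adj v c := by
  rcases hv with ⟨i, rfl⟩ | ⟨i, rfl⟩
  · obtain ⟨c, hc, h'⟩ := h.paths.exists_left i
    exact ⟨c, mem_core.mpr ⟨i, hc⟩, pathsGraph_le_base h'⟩
  · obtain ⟨c, hc, h'⟩ := h.paths.exists_right i
    exact ⟨c, mem_core.mpr ⟨i, hc⟩, pathsGraph_le_base h'⟩

theorem notMem_rest_of_mem_core {v : V} (hv : v ∈ core Cr) : v ∉ rest χ W a b p p' Cr :=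
  fun h' => (mem_filter.mp h').2.2.2.1 hv

/-- Path covers of the remaining vertices and of the colours one and two complete a framework to
a stage. -/
theorem stage {F₀ F₁ F₂ : SimpleGraph V}
    (h : Framework G χ W (lowSet F₁ (colourClass χ 1)) (lowSet F₂ (colourClass χ 2)) a b p p'
      α β Cr)
    (h₀ : F₀ ≤ within G (rest χ W a b p p' Cr) ∧ F₀.IsAcyclic ∧ (∀ v, (nb F₀ v).card ≤ 2) ∧
      ∀ u ∈ rest χ W a b p p' Cr, 1 ≤ (nb F₀ u).card)
    (h₁ : F₁ ≤ within G (colourClass χ 1) ∧ F₁.IsAcyclic ∧ (∀ v, (nb F₁ v).card ≤ 2) ∧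
      ∀ u ∈ colourClass χ 1, 1 ≤ (nb F₁ u).card)
    (h₂ : F₂ ≤ within G (colourClass χ 2) ∧ F₂.IsAcyclic ∧ (∀ v, (nb F₂ v).card ≤ 2) ∧
      ∀ u ∈ colourClass χ 2, 1 ≤ (nb F₂ u).card) :
    Stage G (base a b α β Cr) a b (core Cr) W
      ![rest χ W a b p p' Cr, colourClass χ 1, colourClass χ 2]
      ![rest χ W a b p p' Cr, lowSet F₁ (colourClass χ 1), lowSet F₂ (colourClass χ 2)]
      ![F₀, F₁, F₂] (edges a b p p' α β Cr) (lowSet F₀ (rest χ W a b p p' Cr)) := by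
  obtain ⟨a₀, -, d₀⟩ := Arena.mk' h₀.1 h₀.2.1 h₀.2.2.1 h₀.2.2.2
  obtain ⟨a₁, -, d₁⟩ := Arena.mk' h₁.1 h₁.2.1 h₁.2.2.1 h₁.2.2.2
  obtain ⟨a₂, -, d₂⟩ := Arena.mk' h₂.1 h₂.2.1 h₂.2.2.1 h₂.2.2.2
  have hr1 : Disjoint (rest χ W a b p p' Cr) (colourClass χ 1) :=
    Finset.disjoint_left.mpr fun v hv hv' => (mem_filter.mp hv).2.1 (mem_colourClass.mp hv')
  have hr2 : Disjoint (rest χ W a b p p' Cr) (colourClass χ 2) :=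
    Finset.disjoint_left.mpr fun v hv hv' => (mem_filter.mp hv).2.2.1 (mem_colourClass.mp hv')
  have h12 : Disjoint (colourClass χ 1) (colourClass χ 2) :=
    Finset.disjoint_left.mpr fun v hv hv' => by
      rw [mem_colourClass] at hv hv'; rw [hv] at hv'; exact absurd hv' (by decide)
  refine ⟨?_, ?_, ?_, rfl, ?_, ?_, ?_, h.edges_le, base_le_edges⟩
  · intro i j hij
    fin_cases i <;> fin_cases j <;> first | exact absurd rfl hij | skip
    exacts [hr1, hr2, hr1.symm, h12, hr2.symm, h12.symm]
  · intro i
    refine Finset.disjoint_left.mpr fun v hv hv' => ?_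
    have h4 := (h.colour_core hv').1
    fin_cases i
    · exact notMem_rest_of_mem_core hv' hv
    · have := mem_colourClass.mp (show v ∈ colourClass χ 1 from hv)
      rw [h4] at this; exact absurd this (by decide)
    · have := mem_colourClass.mp (show v ∈ colourClass χ 2 from hv)
      rw [h4] at this; exact absurd this (by decide)
  · intro i
    fin_cases i
    · exact ⟨a₀.le, a₀.acyclic, a₀.deg_le, a₀.one_le, fun w hw => ⟨w, hw, Reachable.refl _⟩⟩
    · exact a₁
    · exact a₂
  · intro i hi v hv
    refine h.exists_core_adj (h.low_mem v ?_)
    fin_cases i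
    · exact absurd rfl hi
    · exact Or.inl hv
    · exact Or.inr hv
  · intro i u v huv hu hv
    fin_cases i
    · exact h.not_edges_adj_of_mem_rest hu huv
    · have h1 := mem_colourClass.mp (show u ∈ colourClass χ 1 from hu)
      have h2 := mem_colourClass.mp (show v ∈ colourClass χ 1 from hv)
      have := h.colour_of_edges_adj (Or.inl h1) huv
      rw [h2] at this; exact absurd this (by decide)
    · have h1 := mem_colourClass.mp (show u ∈ colourClass χ 2 from hu)
      have h2 := mem_colourClass.mp (show v ∈ colourClass χ 2 from hv)
      have := h.colour_of_edges_adj (Or.inr h1) huv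
      rw [h2] at this; exact absurd this (by decide)
  · intro v
    have e0 := d₀ v
    have e1 := d₁ v
    have e2 := d₂ v
    have e := h.card_nb_edges_add v
    show (nb F₀ v).card + (nb F₁ v).card + (nb F₂ v).card + _ + _ = _
    have hx : (if χ v = 1 ∨ χ v = 2 then 2 else 0) =
        (if v ∈ colourClass χ 1 then 2 else 0) + if v ∈ colourClass χ 2 then 2 else 0 := by
      simp only [mem_colourClass]
      by_cases h1 : χ v = 1
      · rw [if_pos (Or.inl h1), if_pos h1, if_neg (by rw [h1]; decide)]
      · by_cases h2 : χ v = 2 <;> simp [h1, h2]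
    have hy : (if v ∈ lowSet F₁ (colourClass χ 1) ∨ v ∈ lowSet F₂ (colourClass χ 2) then 1 else 0)
        = (if v ∈ lowSet F₁ (colourClass χ 1) then 1 else 0) +
          if v ∈ lowSet F₂ (colourClass χ 2) then 1 else 0 := by
      by_cases h1 : v ∈ lowSet F₁ (colourClass χ 1)
      · have h2 : v ∉ lowSet F₂ (colourClass χ 2) := fun h2 =>
          Finset.disjoint_left.mp h12 (mem_filter.mp h1).1 (mem_filter.mp h2).1
        simp [h1, h2]
      · simp [h1]
    omega

/-- The pairs `p j`, `p' j` of a framework are a supply. -/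
theorem supply {Y : Fin 3 → Finset V}
    (h : Framework G χ W B₁ B₂ a b p p' α β Cr)
    (hY : ∀ i, ∀ v ∈ Y i, χ v = 3 → v ∈ rest χ W a b p p' Cr) :
    Supply (base a b α β Cr) (core Cr) Y (edges a b p p' α β Cr) (univ : Finset (Fin s)) p p' := by
  have hp : ∀ j, p j ∉ rest χ W a b p p' Cr := fun j hr => (mem_filter.mp hr).2.2.2.2.2.2.1 j rfl
  have hp' : ∀ j, p' j ∉ rest χ W a b p p' Cr := fun j hr =>
    (mem_filter.mp hr).2.2.2.2.2.2.2 j rfl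
  have hadj : ∀ j, (edges a b p p' α β Cr).Adj (p j) (p' j) := fun j =>
    Or.inr ((pairGraph_adj h.pair_ne).mpr ⟨j, Or.inl ⟨rfl, rfl⟩⟩)
  have key : ∀ u v c, χ u = 3 → u ∈ W → u ∉ rest χ W a b p p' Cr →
      (edges a b p p' α β Cr).Adj u v → (edges a b p p' α β Cr).Adj u c → v ≠ c →
      ∀ w, (edges a b p p' α β Cr).Adj u w → w = v ∨ w = c := by
    intro u v c h3 hW hr hv hc hvc w hw
    have h1 := h.card_nb_edges_add u
    have hB : ¬ (u ∈ B₁ ∨ u ∈ B₂) := by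
      rintro (h' | h')
      · have := h.colour_one u h'; rw [h3] at this; exact absurd this (by decide)
      · have := h.colour_two u h'; rw [h3] at this; exact absurd this (by decide)
    rw [if_neg hr, if_neg (show ¬ (χ u = 1 ∨ χ u = 2) by rw [h3]; decide), if_pos hW,
      if_neg hB] at h1
    have h2 : ({v, c} : Finset V) = nb (edges a b p p' α β Cr) u := by
      apply Finset.eq_of_subset_of_card_le
      · intro x hx
        rw [mem_insert, mem_singleton] at hx
        rcases hx with rfl | rfl <;> exact mem_nb.mpr ‹_›
      · rw [card_pair hvc]; omega
    have := mem_nb.mpr hw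
    rw [← h2, mem_insert, mem_singleton] at this
    exact this
  refine ⟨fun j _ i => ⟨fun hm => hp j (hY i _ hm (h.pair_left j).1), fun hm =>
    hp' j (hY i _ hm (h.pair_right j).1)⟩, fun j _ => ⟨h.notMem_core ?_, h.notMem_core ?_⟩,
    fun j _ => hadj j, fun j _ => h.not_base_adj j j, fun j _ => ?_, fun j _ => ?_, ?_⟩
  · rw [(h.pair_left j).1]; decide
  · rw [(h.pair_right j).1]; decide
  · obtain ⟨c, hc, hL⟩ := h.exists_core_adj (Or.inl (h.pair_mem j))
    refine ⟨c, hc, hL, key _ _ _ (h.pair_left j).1 (h.pair_left j).2.1 (hp j) (hadj j)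
      (base_le_edges hL) ?_⟩
    rintro rfl
    have := (h.colour_core hc).1
    rw [(h.pair_right j).1] at this; exact absurd this (by decide)
  · obtain ⟨c, hc, hL⟩ := h.exists_core_adj (Or.inr (h.pair_mem' j))
    refine ⟨c, hc, hL, key _ _ _ (h.pair_right j).1 (h.pair_right j).2.1 (hp' j) (hadj j).symm
      (base_le_edges hL) ?_⟩
    rintro rfl
    have := (h.colour_core hc).1
    rw [(h.pair_left j).1] at this; exact absurd this (by decide)
  · exact fun j _ k _ hjk => ⟨fun e => hjk (h.pair_inj e), h.pair_ne j k,
      fun e => hjk (h.pair_inj' e)⟩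

/-- Every vertex of `W` is a remaining vertex, has colour one or two, is in a path, or is adjacent
to a path. -/
theorem cover (h : Framework G χ W B₁ B₂ a b p p' α β Cr) {v : V} (hv : v ∈ W) :
    (∃ i, v ∈ ![rest χ W a b p p' Cr, colourClass χ 1, colourClass χ 2] i) ∨ v ∈ core Cr ∨
      ∃ c ∈ core Cr, (base a b α β Cr).Adj v c := by
  by_cases h1 : χ v = 1
  · exact Or.inl ⟨1, mem_colourClass.mpr h1⟩
  by_cases h2 : χ v = 2
  · exact Or.inl ⟨2, mem_colourClass.mpr h2⟩
  by_cases h3 : v ∈ core Cr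
  · exact Or.inr (Or.inl h3)
  by_cases h4 : (∃ i, v = α i) ∨ ∃ i, v = β i
  · exact Or.inr (Or.inr (h.exists_core_adj h4))
  refine Or.inl ⟨0, mem_filter.mpr ⟨hv, h1, h2, h3, ?_, ?_, ?_, ?_⟩⟩
  · rintro rfl; exact h4 (Or.inl h.left_mem)
  · rintro rfl; exact h4 (Or.inr h.right_mem)
  · rintro j rfl; exact h4 (Or.inl (h.pair_mem j))
  · rintro j rfl; exact h4 (Or.inr (h.pair_mem' j))

end Framework

end FrameworkStage

section Scales
open Finset
open scoped Classical

variable {V : Type} [Fintype V] {G : SimpleGraph V}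

theorem exists_terminals {χ : V → Fin 5} {B₁ B₂ : Finset V} {a b : V} {s : ℕ} {p p' : Fin s → V}
    (he₁ : Even B₁.card) (he₂ : Even B₂.card) (hB₁ : ∀ v ∈ B₁, χ v = 1) (hB₂ : ∀ v ∈ B₂, χ v = 2)
    (ha : χ a = 3) (hb : χ b = 3) (hab : a ≠ b)
    (hp : ∀ j, χ (p j) = 3 ∧ p j ≠ a ∧ p j ≠ b) (hp' : ∀ j, χ (p' j) = 3 ∧ p' j ≠ a ∧ p' j ≠ b)
    (hpp : ∀ i j, p i ≠ p' j) (hpi : Function.Injective p) (hpi' : Function.Injective p') {x : ℕ}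
    (hx₁ : B₁.card ≤ x) (hx₂ : B₂.card ≤ x) :
    ∃ (N : ℕ) (α β : Fin (N + 1) → V), N ≤ s + x ∧ Function.Injective α ∧ Function.Injective β ∧
      (∀ i j, α i ≠ β j) ∧ (∀ i, χ (α i) ≠ 4) ∧ (∀ i, χ (β i) ≠ 4) ∧
      (∀ v, (∃ i, v = α i) → v = a ∨ (∃ j, v = p j) ∨ v ∈ B₁ ∨ v ∈ B₂) ∧
      (∀ v, (∃ i, v = β i) → v = b ∨ (∃ j, v = p' j) ∨ v ∈ B₁ ∨ v ∈ B₂) ∧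
      (∃ i, a = α i) ∧ (∃ i, b = β i) ∧ (∀ j, ∃ i, p j = α i) ∧ (∀ j, ∃ i, p' j = β i) ∧
      ∀ v, v ∈ B₁ ∨ v ∈ B₂ → (∃ i, v = α i) ∨ ∃ i, v = β i := by
  obtain ⟨r₁, hr₁⟩ := he₁
  obtain ⟨r₂, hr₂⟩ := he₂
  obtain ⟨f, f', hf, hf', hff, hfm⟩ := exists_pairing (A := B₁) (r := r₁) (by omega)
  obtain ⟨g, g', hg, hg', hgg, hgm⟩ := exists_pairing (A := B₂) (r := r₂) (by omega)
  have cf : ∀ j, χ (f j) = 1 := fun j => hB₁ _ ((hfm _).mpr (Or.inl ⟨j, rfl⟩))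
  have cf' : ∀ j, χ (f' j) = 1 := fun j => hB₁ _ ((hfm _).mpr (Or.inr ⟨j, rfl⟩))
  have cg : ∀ j, χ (g j) = 2 := fun j => hB₂ _ ((hgm _).mpr (Or.inl ⟨j, rfl⟩))
  have cg' : ∀ j, χ (g' j) = 2 := fun j => hB₂ _ ((hgm _).mpr (Or.inr ⟨j, rfl⟩))
  have hne : ∀ {u v : V} {i j : Fin 5}, χ u = i → χ v = j → i ≠ j → u ≠ v := by
    rintro u v i j hu hv hij rfl
    exact hij (hu.symm.trans hv)
  have e : Unit ⊕ (Fin s ⊕ (Fin r₁ ⊕ Fin r₂)) ≃ Fin (s + r₁ + r₂ + 1) :=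
    Fintype.equivFinOfCardEq (by simp; ring)
  let α₀ : Unit ⊕ (Fin s ⊕ (Fin r₁ ⊕ Fin r₂)) → V :=
    Sum.elim (fun _ => a) (Sum.elim p (Sum.elim f g))
  let β₀ : Unit ⊕ (Fin s ⊕ (Fin r₁ ⊕ Fin r₂)) → V :=
    Sum.elim (fun _ => b) (Sum.elim p' (Sum.elim f' g'))
  have hα : ∀ x, ∃ i, α₀ x = α₀ (e.symm i) := fun x => ⟨e x, by simp⟩
  have hβ : ∀ x, ∃ i, β₀ x = β₀ (e.symm i) := fun x => ⟨e x, by simp⟩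
  have iα : Function.Injective α₀ := by
    refine Function.Injective.sumElim (fun _ _ _ => rfl) (hpi.sumElim (hf.sumElim hg
      fun i j => hne (cf i) (cg j) (by decide)) ?_) ?_
    · rintro i (j | j)
      · exact hne (hp i).1 (cf j) (by decide)
      · exact hne (hp i).1 (cg j) (by decide)
    · rintro - (j | j | j)
      · exact (hp j).2.1.symm
      · exact hne ha (cf j) (by decide)
      · exact hne ha (cg j) (by decide)
  have iβ : Function.Injective β₀ := by
    refine Function.Injective.sumElim (fun _ _ _ => rfl) (hpi'.sumElim (hf'.sumElim hg'
      fun i j => hne (cf' i) (cg' j) (by decide)) ?_) ?_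
    · rintro i (j | j)
      · exact hne (hp' i).1 (cf' j) (by decide)
      · exact hne (hp' i).1 (cg' j) (by decide)
    · rintro - (j | j | j)
      · exact (hp' j).2.2.symm
      · exact hne hb (cf' j) (by decide)
      · exact hne hb (cg' j) (by decide)
  refine ⟨s + r₁ + r₂, α₀ ∘ e.symm, β₀ ∘ e.symm, by omega, iα.comp e.symm.injective,
    iβ.comp e.symm.injective, ?_, ?_, ?_, ?_, ?_, hα (.inl ()), hβ (.inl ()),
    fun j => hα (.inr (.inl j)), fun j => hβ (.inr (.inl j)), ?_⟩
  · intro i j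
    simp only [Function.comp]
    rcases e.symm i with i | i | i | i <;> rcases e.symm j with j | j | j | j <;>
      simp only [α₀, β₀, Sum.elim_inl, Sum.elim_inr]
    · exact hab
    · exact (hp' j).2.1.symm
    · exact hne ha (cf' j) (by decide)
    · exact hne ha (cg' j) (by decide)
    · exact (hp i).2.2
    · exact hpp i j
    · exact hne (hp i).1 (cf' j) (by decide)
    · exact hne (hp i).1 (cg' j) (by decide)
    · exact hne (cf i) hb (by decide)
    · exact hne (cf i) (hp' j).1 (by decide)
    · exact hff i j
    · exact hne (cf i) (cg' j) (by decide)
    · exact hne (cg i) hb (by decide)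
    · exact hne (cg i) (hp' j).1 (by decide)
    · exact hne (cg i) (cf' j) (by decide)
    · exact hgg i j
  · intro i
    simp only [Function.comp]
    rcases e.symm i with i | i | i | i <;> simp only [α₀, Sum.elim_inl, Sum.elim_inr]
    · rw [ha]; decide
    · rw [(hp i).1]; decide
    · rw [cf i]; decide
    · rw [cg i]; decide
  · intro i
    simp only [Function.comp]
    rcases e.symm i with i | i | i | i <;> simp only [β₀, Sum.elim_inl, Sum.elim_inr]
    · rw [hb]; decide
    · rw [(hp' i).1]; decide
    · rw [cf' i]; decide
    · rw [cg' i]; decide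
  · rintro v ⟨i, rfl⟩
    simp only [Function.comp]
    rcases e.symm i with i | i | i | i <;> simp only [α₀, Sum.elim_inl, Sum.elim_inr]
    · simp
    · exact Or.inr (Or.inl ⟨i, rfl⟩)
    · exact Or.inr (Or.inr (Or.inl ((hfm _).mpr (Or.inl ⟨i, rfl⟩))))
    · exact Or.inr (Or.inr (Or.inr ((hgm _).mpr (Or.inl ⟨i, rfl⟩))))
  · rintro v ⟨i, rfl⟩
    simp only [Function.comp]
    rcases e.symm i with i | i | i | i <;> simp only [β₀, Sum.elim_inl, Sum.elim_inr]
    · simp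
    · exact Or.inr (Or.inl ⟨i, rfl⟩)
    · exact Or.inr (Or.inr (Or.inl ((hfm _).mpr (Or.inr ⟨i, rfl⟩))))
    · exact Or.inr (Or.inr (Or.inr ((hgm _).mpr (Or.inr ⟨i, rfl⟩))))
  · rintro v (hv | hv)
    · rcases (hfm v).mp hv with ⟨j, rfl⟩ | ⟨j, rfl⟩
      · exact Or.inl (hα (.inr (.inr (.inl j))))
      · exact Or.inr (hβ (.inr (.inr (.inl j))))
    · rcases (hgm v).mp hv with ⟨j, rfl⟩ | ⟨j, rfl⟩
      · exact Or.inl (hα (.inr (.inr (.inr j))))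
      · exact Or.inr (hβ (.inr (.inr (.inr j))))

/-- Admissible parameters: links have length about `k`, and path covers of `n` vertices have about
`n / q` paths. -/
structure Scale (n C k q J : ℕ) : Prop where
  large : 2 ^ 40 ≤ n
  one_le : 1 ≤ k
  le_pow : n / 2 ^ 20 ≤ 2 ^ k
  pow_le : 4 * 2 ^ k ≤ n / 512
  le_q : 2 ^ 20 * (k + 4) ^ 2 ≤ q
  q_le : q ≤ n
  contract : (2 ^ 20 / (C : ℝ) ^ 2) ^ J * q ≤ 1
  small : (J + 1) * ((C : ℝ) ^ (J + 1) * Real.sqrt (4 * (q + 2 : ℕ) + 1)) ≤ Real.sqrt n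

theorem Scale.cost {n C k q J N : ℕ} (h : Scale n C k q J) (hN : N ≤ 6 * (3 * n / q)) :
    (N + 1) * (2 * (k + 1) * (k + 4)) ≤ n / 1024 := by
  have h1 := h.le_q
  have h2 := h.q_le
  have h3 : 3 * n / q * q ≤ 3 * n := Nat.div_mul_le_self _ _
  set x := 3 * n / q
  have h4 : 2 * (k + 1) * (k + 4) ≤ 2 * (k + 4) ^ 2 := by nlinarith
  have h5 : (N + 1) * (2 * (k + 1) * (k + 4)) ≤ (6 * x + 1) * (2 * (k + 4) ^ 2) :=
    Nat.mul_le_mul (by omega) h4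
  have h6 : x * (2 ^ 20 * (k + 4) ^ 2) ≤ x * q := Nat.mul_le_mul_left _ h1
  rw [Nat.le_div_iff_mul_le (by norm_num)]
  nlinarith

theorem Scale.count {n C k q J : ℕ} (h : Scale n C k q J) : 2 ^ 18 * (3 * n / q) ≤ n := by
  have h3 : 3 * n / q * q ≤ 3 * n := Nat.div_mul_le_self _ _
  have h1 := h.le_q
  have h6 : 3 * n / q * (2 ^ 20 * 1) ≤ 3 * n / q * q := Nat.mul_le_mul_left _
    (le_trans (Nat.mul_le_mul_left _ (Nat.one_le_pow _ _ (by omega))) h1)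
  omega

end Scales

section HamiltonLists
open Finset
open scoped Classical

variable {V : Type} [Fintype V] {G : SimpleGraph V} {d κ : ℕ} {lam : ℝ}

/-- A pseudorandom graph has a path with prescribed ends that covers a given set `W`, provided
that `W` contains all vertices of three colours and enough vertices of two further colours. -/
theorem Pseudorandom.exists_spanning_list (P : Pseudorandom G d lam) {C : ℕ} (hlam : lam * C = d)
    (h0 : 0 < lam) (hd : 0 < d) (hC1 : 2 ^ 40 ≤ C) {k q J : ℕ}
    (hS : Scale (Fintype.card V) C k q J) {χ : V → Fin 5} (hκ : d ≤ 64 * κ)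
    (hχ : ∀ u c, κ ≤ (nb G u ∩ colourClass χ c).card) {W A Z : Finset V}
    (hW : ∀ v, χ v ≠ 3 → χ v ≠ 4 → v ∈ W) (hA : A ⊆ colourClass χ 4) (hAW : A ⊆ W)
    (hAE : Extendable G A (Fintype.card V / 2 ^ 20) fun _ => 7)
    (hAc : (colourClass χ 4 \ A).card ≤ Fintype.card V / 512)
    (hZ : Z ⊆ colourClass χ 3) (hZW : Z ⊆ W) (hZc : Fintype.card V ≤ 2 ^ 8 * Z.card) {a b : V}
    (ha : χ a = 3 ∧ a ∈ W ∧ a ∉ Z) (hb : χ b = 3 ∧ b ∈ W ∧ b ∉ Z) (hab : a ≠ b) :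
    ∃ w : List V, (a :: (w ++ [b])).Nodup ∧ (a :: (w ++ [b])).IsChain G.Adj ∧
      ∀ v, v ∈ W ↔ v ∈ a :: (w ++ [b]) := by
  set n := Fintype.card V with hn
  have hlarge := hS.large
  have hq0 : 1 ≤ q := le_trans (Nat.mul_pos (by norm_num) (pow_pos (by omega) 2)) hS.le_q
  have hκ' : d ≤ 128 * κ := by omega
  have cover : ∀ U : Finset V, (∀ u ∈ U, κ ≤ (nb G u ∩ U).card) → ∃ F, (F ≤ within G U ∧
      F.IsAcyclic ∧ (∀ v, (nb F v).card ≤ 2) ∧ ∀ u ∈ U, 1 ≤ (nb F u).card) ∧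
      (lowSet F U).card ≤ 3 * n / q := by
    intro U hU
    obtain ⟨F, h1, h2, h3, h4, h5⟩ := P.exists_path_cover hlam h0 hd hC1 U hκ' hU hq0 hS.contract
      hS.small
    exact ⟨F, ⟨h1, h2, h3, h4⟩, (Nat.le_div_iff_mul_le hq0).mpr (by rw [mul_comm]; exact h5)⟩
  obtain ⟨F₁, hF₁, hx₁⟩ := cover (colourClass χ 1) fun u _ => hχ u 1
  obtain ⟨F₂, hF₂, hx₂⟩ := cover (colourClass χ 2) fun u _ => hχ u 2
  have hcount := hS.count
  set x := 3 * n / q with hx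
  have hm : 1 ≤ n / 2 ^ 20 := by omega
  have hjoin : ∀ S T : Finset V, n / 2 ^ 20 ≤ S.card → n / 2 ^ 20 ≤ T.card →
      ∃ s ∈ S, ∃ t ∈ T, G.Adj s t := P.joined_of_le hlam.le h0 (by
    have : 2 ^ 40 * (n / 2 ^ 20) ≤ C * (n / 2 ^ 20) := Nat.mul_le_mul_right _ hC1
    clear hC1
    omega)
  obtain ⟨p, p', hpZ, hpZ', hpp, hpi, hpi', hpn⟩ := exists_matching_of_joined hjoin (5 * x) Z
    (by omega)
  have hZ3 : ∀ v ∈ Z, χ v = 3 := fun v hv => mem_colourClass.mp (hZ hv)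
  have hp : ∀ j, χ (p j) = 3 ∧ p j ≠ a ∧ p j ≠ b := fun j => ⟨hZ3 _ (hpZ j),
    fun e => ha.2.2 (e ▸ hpZ j), fun e => hb.2.2 (e ▸ hpZ j)⟩
  have hp' : ∀ j, χ (p' j) = 3 ∧ p' j ≠ a ∧ p' j ≠ b := fun j => ⟨hZ3 _ (hpZ' j),
    fun e => ha.2.2 (e ▸ hpZ' j), fun e => hb.2.2 (e ▸ hpZ' j)⟩
  have hB₁ : ∀ v ∈ lowSet F₁ (colourClass χ 1), χ v = 1 := fun v hv =>
    mem_colourClass.mp (mem_filter.mp hv).1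
  have hB₂ : ∀ v ∈ lowSet F₂ (colourClass χ 2), χ v = 2 := fun v hv =>
    mem_colourClass.mp (mem_filter.mp hv).1
  obtain ⟨N, α, β, hN, iα, iβ, hαβ, cα, cβ, lα, lβ, mα, mβ, mp, mp', mB⟩ := exists_terminals
    (Arena.mk' hF₁.1 hF₁.2.1 hF₁.2.2.1 hF₁.2.2.2).2.1
    (Arena.mk' hF₂.1 hF₂.2.1 hF₂.2.2.1 hF₂.2.2.2).2.1 hB₁ hB₂ ha.1 hb.1 hab hp hp' hpn hpi hpi'
    hx₁ hx₂
  have hA4 : ∀ v ∈ A, χ v = 4 := fun v hv => mem_colourClass.mp (hA hv)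
  have hcost := hS.cost (N := N) (by omega)
  have hpow := hS.pow_le
  obtain ⟨Cr, T, hCA, hCn, hCd, hCc, hTv, hTp, hTy, hTd, hTb⟩ := exists_skeleton
    (P.hasSlack hlam.le h0 hC1 (colourClass χ 4) κ hκ hd (fun u => hχ u 4) (by omega)) hm hjoin
    hS.le_pow hS.one_le hAE hA (fun i h => cα i (hA4 _ h)) (fun i h => cβ i (hA4 _ h)) hαβ iα iβ
    (by rw [← hn]; clear hC1; omega)
  have hne : ∀ i, Cr i ≠ [] := fun i => List.ne_nil_of_mem (hTp i)
  have paths : DisjointPaths α β Cr := ⟨hne, hCn, fun i j y hy hy' => by_contra fun hij =>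
    hCd i j hij y hy hy', fun i j h => cα i (hA4 _ (hCA j _ h)),
    fun i j h => cβ i (hA4 _ (hCA j _ h)), hαβ, iα, iβ⟩
  have frame : Framework G χ W (lowSet F₁ (colourClass χ 1)) (lowSet F₂ (colourClass χ 2)) a b p p'
      α β Cr := ⟨paths, iSup_le fun i => listGraph_le (hCc i), hW,
    fun i v hv => ⟨hA4 v (hCA i v hv), hAW (hCA i v hv)⟩, ⟨ha.1, ha.2.1⟩, ⟨hb.1, hb.2.1⟩, hab,
    fun j => ⟨(hp j).1, hZW (hpZ j), (hp j).2⟩, fun j => ⟨(hp' j).1, hZW (hpZ' j), (hp' j).2⟩, hpn,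
    hpi, hpi', hpp, hB₁, hB₂, lα, lβ, mα, mβ, mp, mp', mB⟩
  set U := Framework.rest χ W a b p p' Cr with hU
  have hUκ : ∀ u, κ ≤ (nb G u ∩ U).card := by
    intro u
    refine (hχ u 0).trans (card_le_card (inter_subset_inter_left fun v hv => ?_))
    have hv0 := mem_colourClass.mp hv
    refine mem_filter.mpr ⟨hW v (by rw [hv0]; decide) (by rw [hv0]; decide), by rw [hv0]; decide,
      by rw [hv0]; decide, frame.notMem_core (by rw [hv0]; decide), ?_, ?_, ?_, ?_⟩
    · rintro rfl; rw [ha.1] at hv0; exact absurd hv0 (by decide)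
    · rintro rfl; rw [hb.1] at hv0; exact absurd hv0 (by decide)
    · rintro j rfl; rw [(hp j).1] at hv0; exact absurd hv0 (by decide)
    · rintro j rfl; rw [(hp' j).1] at hv0; exact absurd hv0 (by decide)
  obtain ⟨F₀, hF₀, hx₀⟩ := cover U fun u _ => hUκ u
  have hstage := frame.stage hF₀ hF₁ hF₂
  obtain ⟨-, ⟨r, hr⟩, -⟩ := Arena.mk' hF₀.1 hF₀.2.1 hF₀.2.2.1 hF₀.2.2.2
  have hcomplete : ∃ Y' A' F' E', Stage G (Framework.base a b α β Cr) a b (Framework.core Cr) W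
      Y' A' F' E' ∅ ∧ ∀ i, ![U, colourClass χ 1, colourClass χ 2] i ⊆ Y' i := by
    refine Stage.exists_complete (κ := κ) P hlam.le h0 hC1 (by rw [← hn]; clear hC1; omega) hκ'
      (β := 4 * x) (by rw [← hn]; clear hC1; omega) r (fun u _ => hUκ u) ?_ hstage
      (filter_subset _ _) (frame.supply ?_) ?_ ?_ ?_ ?_
    · intro i hi u
      fin_cases i
      · exact absurd rfl hi
      · exact hχ u 1
      · exact hχ u 2
    · intro i v hv h3
      fin_cases i
      · exact hv
      · have := mem_colourClass.mp (show v ∈ colourClass χ 1 from hv)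
        rw [h3] at this; exact absurd this (by decide)
      · have := mem_colourClass.mp (show v ∈ colourClass χ 2 from hv)
        rw [h3] at this; exact absurd this (by decide)
    · show (lowSet F₀ U).card + 2 * (lowSet F₀ U).card ≤ _
      omega
    · intro i hi
      fin_cases i
      · exact absurd rfl hi
      · show (lowSet F₁ (colourClass χ 1)).card + (lowSet F₁ (colourClass χ 1)).card +
          2 * (lowSet F₀ U).card ≤ _
        omega
      · show (lowSet F₂ (colourClass χ 2)).card + (lowSet F₂ (colourClass χ 2)).card +
          2 * (lowSet F₀ U).card ≤ _
        omega
    · show 4 * x + (lowSet F₀ U).card ≤ _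
      rw [card_univ, Fintype.card_fin]; omega
    · show (lowSet F₀ U).card = _
      omega
  obtain ⟨Y', A', F', E', hfin, hYY⟩ := hcomplete
  obtain ⟨H, hLH, hHG, hdeg, hreach⟩ := hfin.exists_two_factor fun v hv => by
    rcases frame.cover hv with ⟨i, hi⟩ | h | h
    · exact Or.inl ⟨i, hYY i hi⟩
    · exact Or.inr (Or.inl h)
    · exact Or.inr (Or.inr h)
  have hCrL : ∀ i, listGraph (Cr i) ≤ pathsGraph α β Cr := fun i =>
    le_trans (listGraph_le_of_isInfix (paths.nodup' i) ⟨[α i], [β i], by simp⟩)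
      (le_iSup (fun i => listGraph (α i :: (Cr i ++ [β i]))) i)
  have hCrm : ∀ {i u v}, (listGraph (Cr i)).Adj u v → u ∈ Framework.core Cr := fun h =>
    Framework.mem_core.mpr ⟨_, (mem_of_listGraph_adj h).1⟩
  refine exists_hamilton_path hLH hHG hdeg hreach hTv
    (fun i => (hTb i).trans (le_trans (sup_le (hCrL _) (hCrL _)) Framework.pathsGraph_le_base))
    hTd hab le_sup_right (fun i => ?_) (core := fun i => (Cr i).toFinset) (fun i u hu v hv => ?_)
    (fun c hc => ?_) (fun i => List.mem_toFinset.mpr (hTp i))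
    fun i => List.mem_toFinset.mpr (hTy i)
  · rw [SimpleGraph.disjoint_left]
    intro u v huv hold
    have hu : u ∈ Framework.core Cr := by
      rcases hTb i (show (T i).base.Adj u v from Or.inl hold) with h | h <;> exact hCrm h
    have h4 := (frame.colour_core hu).1
    rw [edge_adj] at huv
    rcases huv.1 with ⟨e, -⟩ | ⟨e, -⟩
    · rw [e, ha.1] at h4; exact absurd h4 (by decide)
    · rw [e, hb.1] at h4; exact absurd h4 (by decide)
  · have hch := (paths.isChain i).imp fun _ _ h => Framework.pathsGraph_le_base (a := a) (b := b) h
    rw [List.mem_toFinset] at hu hv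
    exact reachable_of_isChain hch (by simp [hu]) (by simp [hv])
  · obtain ⟨i, hi⟩ := Framework.mem_core.mp hc
    exact ⟨i, List.mem_toFinset.mpr hi⟩

end HamiltonLists

section Numerics

theorem pow_twelve_le {K : ℕ} (hK : 500 ≤ K) : 2 ^ 273 * K ^ 12 ≤ 2 ^ K := by
  obtain ⟨j, hj1, hj2⟩ : ∃ j, 32 * j ≤ K ∧ K < 32 * j + 32 := ⟨K / 32, by omega, by omega⟩
  have h1 : ∀ i, 15 ≤ i → 32 * i + 32 ≤ 2 ^ i := by
    intro i hi
    induction i, hi using Nat.le_induction with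
    | base => norm_num
    | succ i hi ih => rw [pow_succ]; omega
  have h2 : K ≤ 2 ^ j := hj2.le.trans (h1 j (by omega))
  calc 2 ^ 273 * K ^ 12 ≤ 2 ^ 273 * (2 ^ j) ^ 12 := by gcongr
    _ = 2 ^ (273 + j * 12) := by rw [← pow_mul, ← pow_add]
    _ ≤ 2 ^ K := Nat.pow_le_pow_right (by norm_num) (by omega)

theorem sqrt_le_four_mul {q : ℝ} (hq : 20 ≤ q) : Real.sqrt (4 * (q + 2) + 1) ≤ 4 * q :=
  Real.sqrt_le_iff.mpr ⟨by linarith, by nlinarith⟩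

theorem sq_le_of_pow_twelve_le {x z : ℝ} (hx : 0 ≤ x) {k : ℕ} (h : x ^ 273 * z ^ 12 ≤ x ^ (k + 4)) :
    (x ^ 84 * (x ^ 20 * z ^ 2) ^ 3) ^ 2 ≤ x ^ (k + 19) := by
  calc _ = x ^ 15 * (x ^ 273 * z ^ 12) := by ring
    _ ≤ x ^ 15 * x ^ (k + 4) := by gcongr
    _ = x ^ (k + 19) := by ring

theorem exists_scale {n : ℕ} (hn : 600 ≤ Nat.log 2 n) :
    ∃ k q J, k + 1 ≤ Nat.log 2 n ∧ Scale n (2 ^ 40) k q J := by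
  have hn0 : n ≠ 0 := by rintro rfl; simp at hn
  obtain ⟨k, hk⟩ : ∃ k, Nat.log 2 n = k + 19 := ⟨Nat.log 2 n - 19, by omega⟩
  have hle : 2 ^ (k + 19) ≤ n := hk ▸ Nat.pow_log_le_self 2 hn0
  have hlt : n < 2 ^ (k + 20) := by
    have := Nat.lt_pow_succ_log_self (b := 2) (by norm_num) n
    rw [hk] at this; exact this
  have h12 := pow_twelve_le (K := k + 4) (by omega)
  have e19 : 2 ^ (k + 19) = 2 ^ k * 2 ^ 19 := pow_add _ _ _
  have e20 : 2 ^ (k + 20) = 2 ^ k * 2 ^ 20 := pow_add _ _ _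
  have e4 : 2 ^ (k + 4) = 2 ^ k * 2 ^ 4 := pow_add _ _ _
  obtain ⟨q, hq⟩ : ∃ q, q = 2 ^ 20 * (k + 4) ^ 2 := ⟨_, rfl⟩
  have hq1 : 2 ^ 20 ≤ q := by
    have : 1 ≤ (k + 4) ^ 2 := Nat.one_le_pow _ _ (by omega)
    omega
  set l := Nat.clog 2 q with hl
  have hl1 : q ≤ 2 ^ l := Nat.le_pow_clog (by norm_num) q
  have hl2 : 2 ^ l ≤ 2 * q := by
    have h1 : l ≠ 0 := by
      intro h0
      rw [h0] at hl1
      omega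
    obtain ⟨l', hl'⟩ := Nat.exists_eq_succ_of_ne_zero h1
    have h2 : 2 ^ l' < q := by
      have := Nat.pow_pred_clog_lt_self (b := 2) (by norm_num) (x := q) (by omega)
      rwa [← hl, hl'] at this
    rw [hl', Nat.succ_eq_add_one, pow_succ]
    omega
  have hk1 : 1 ≤ 2 ^ k := Nat.one_le_two_pow
  clear_value l
  refine ⟨k, q, l / 60 + 1, by omega, ⟨?_, by omega, ?_, ?_, hq.ge, ?_, ?_, ?_⟩⟩
  · exact (Nat.pow_le_pow_right (by norm_num) (by omega)).trans hle
  · rw [e20] at hlt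
    have := Nat.div_lt_of_lt_mul (by rw [mul_comm] at hlt; exact hlt)
    omega
  · rw [Nat.le_div_iff_mul_le (by norm_num)]
    omega
  · have h1 : (k + 4) ^ 2 ≤ (k + 4) ^ 12 := Nat.pow_le_pow_right (by omega) (by norm_num)
    have h2 : q ≤ 2 ^ 273 * (k + 4) ^ 12 := hq.trans_le (Nat.mul_le_mul
      (Nat.pow_le_pow_right two_pos (show 20 ≤ 273 by decide)) h1)
    have h3 : 2 ^ (k + 4) ≤ 2 ^ (k + 19) := Nat.pow_le_pow_right (by norm_num) (by omega)
    exact h2.trans (h12.trans (h3.trans hle))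
  · have h1 : (2 ^ 20 / (((2 ^ 40 : ℕ) : ℝ)) ^ 2) = ((2 : ℝ) ^ 60)⁻¹ := by norm_num
    rw [h1, inv_pow, inv_mul_le_iff₀ (by positivity), mul_one, ← pow_mul]
    have h2 : q ≤ 2 ^ (60 * (l / 60 + 1)) :=
      hl1.trans (Nat.pow_le_pow_right (by norm_num) (by omega))
    exact_mod_cast h2
  · have hj : l / 60 + 1 + 1 ≤ 2 * q := by
      have : l < 2 ^ l := Nat.lt_two_pow_self
      omega
    have hj' : ((l / 60 + 1 : ℕ) : ℝ) + 1 ≤ 2 * q := by exact_mod_cast hj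
    have hc : (((2 ^ 40 : ℕ) : ℝ)) ^ (l / 60 + 1 + 1) ≤ 2 ^ 81 * q := by
      have h1 : ∀ e, 40 * e ≤ 80 + l → (((2 ^ 40 : ℕ) : ℝ)) ^ e ≤ 2 ^ 81 * q := by
        intro e he
        have hl3 : (2 : ℝ) ^ l ≤ 2 * q := by exact_mod_cast hl2
        have hcast : ((2 ^ 40 : ℕ) : ℝ) = 2 ^ 40 := by norm_num
        calc (((2 ^ 40 : ℕ) : ℝ)) ^ e = 2 ^ (40 * e) := by rw [hcast, ← pow_mul]
          _ ≤ 2 ^ (80 + l) := pow_le_pow_right₀ (by norm_num) he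
          _ = 2 ^ 80 * 2 ^ l := pow_add _ _ _
          _ ≤ 2 ^ 80 * (2 * q) := by gcongr
          _ = 2 ^ 81 * q := by ring
      exact h1 _ (by omega)
    have hq1' : (2 : ℝ) ^ 20 ≤ q := by exact_mod_cast hq1
    have hs : Real.sqrt (4 * (q + 2 : ℕ) + 1) ≤ 4 * q := by
      rw [Nat.cast_add, Nat.cast_two]
      exact sqrt_le_four_mul (le_trans (by norm_num) hq1')
    have hn' : (2 : ℝ) ^ 84 * q ^ 3 ≤ Real.sqrt n := by
      apply Real.le_sqrt_of_sq_le
      have h1 : (2 : ℝ) ^ 273 * (k + 4) ^ 12 ≤ 2 ^ (k + 4) := by exact_mod_cast h12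
      have h2 : (2 : ℝ) ^ (k + 19) ≤ n := by exact_mod_cast hle
      have h3 : (q : ℝ) = 2 ^ 20 * (k + 4) ^ 2 := by rw [hq]; push_cast; norm_num
      rw [h3]
      exact (sq_le_of_pow_twelve_le zero_le_two h1).trans h2
    have hmul : ∀ x y z : ℝ, 0 ≤ x → 0 ≤ y → 0 ≤ z → x ≤ 2 * q → y ≤ 2 ^ 81 * q → z ≤ 4 * q →
        x * (y * z) ≤ Real.sqrt n := by
      intro x y z hx hy hz h1 h2 h3
      have h4 : x * (y * z) ≤ (2 * (q : ℝ)) * ((2 ^ 81 * q) * (4 * q)) :=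
        mul_le_mul h1 (mul_le_mul h2 h3 hz (hy.trans h2)) (mul_nonneg hy hz) (hx.trans h1)
      refine h4.trans (le_trans (le_of_eq ?_) hn')
      ring
    exact hmul _ _ _ (add_nonneg (Nat.cast_nonneg _) zero_le_one)
      (pow_nonneg (Nat.cast_nonneg _) _) (Real.sqrt_nonneg _) hj' hc hs

end Numerics

section Main
open Finset
open scoped Classical

variable {V : Type} [Fintype V] {G : SimpleGraph V} {d : ℕ} {lam : ℝ}

theorem Pseudorandom.mono {lam' : ℝ} (P : Pseudorandom G d lam) (h : lam ≤ lam') :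
    Pseudorandom G d lam' :=
  ⟨P.card_nb, fun x y => (P.mix x y).trans (by gcongr)⟩

theorem Pseudorandom.hasSpanningKSubdivision {t : ℕ} (P : Pseudorandom G d lam)
    (hlam : lam * ((2 ^ 40 : ℕ) : ℝ) = d) (h0 : 0 < lam) (hd : 320 ≤ d)
    (hL : 600 ≤ Nat.log 2 (Fintype.card V)) (ht : 2 ≤ t) (ht1 : 128 * t ≤ d)
    (ht2 : 2 ^ 20 * (t ^ 2 * Nat.log 2 (Fintype.card V)) ≤ Fintype.card V) :
    HasSpanningKSubdivision G t := by
  obtain ⟨χ, hχ'⟩ := exists_balanced_colouring G d P.card_nb hd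
  have hχ : ∀ u c, d / 32 ≤ (nb G u ∩ colourClass χ c).card := by
    intro u c
    refine (hχ' u c).trans (card_le_card fun v hv => ?_)
    rw [mem_filter] at hv
    exact mem_inter.mpr ⟨hv.1, mem_colourClass.mpr hv.2⟩
  have hκ : d ≤ 64 * (d / 32) := by omega
  obtain ⟨k, q, J, hkL, hS⟩ := exists_scale hL
  set n := Fintype.card V with hn
  have hbig : 2 ^ 40 ≤ n := hS.large
  have htk : 2 ^ 20 * (t * t * (k + 1)) ≤ n := by
    refine le_trans (Nat.mul_le_mul_left _ ?_) ht2
    rw [pow_two]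
    exact Nat.mul_le_mul_left _ hkL
  have htt : 2 ^ 19 * (t * (t + 1)) ≤ n := by
    have h1 : t * (t + 1) ≤ 2 * (t * t * (k + 1)) := by
      have : t * t ≤ t * t * (k + 1) := Nat.le_mul_of_pos_right _ (by omega)
      nlinarith
    omega
  obtain ⟨f, hf1, hf2, hf3⟩ := P.exists_stars (by omega) hκ (colourClass χ 3) (fun v => hχ v 3)
    ht1 (by omega) (by omega : 1 ≤ t) t le_rfl
  have hf4 : ∀ i o, χ (f i o) = 3 := fun i o => mem_colourClass.mp (hf1 i o)
  let i₀ : Fin t := ⟨0, by omega⟩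
  let j₀ : Fin t := ⟨1, by omega⟩
  have hij₀ : i₀ < j₀ := by simp [i₀, j₀]
  let ι := {ij : Fin t × Fin t // ij.1 < ij.2 ∧ ij ≠ (i₀, j₀)}
  let s : ι → V := fun x => f x.1.1 (some x.1.2)
  let s' : ι → V := fun x => f x.1.2 (some x.1.1)
  have hst : ∀ x y : ι, s x ≠ s' y := by
    rintro ⟨⟨i, j⟩, h1, h2⟩ ⟨⟨i', j'⟩, h1', h2'⟩ h
    obtain ⟨h3, h4⟩ := hf2 _ _ _ _ h
    simp only [Option.some.injEq] at h3 h4 h1 h1'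
    subst h3; subst h4
    exact absurd h1 (not_lt.mpr h1'.le)
  have hss : Function.Injective s := by
    rintro ⟨⟨i, j⟩, h1, h2⟩ ⟨⟨i', j'⟩, h1', h2'⟩ h
    obtain ⟨h3, h4⟩ := hf2 _ _ _ _ h
    simp only [Option.some.injEq] at h3 h4
    subst h3; subst h4; rfl
  have hss' : Function.Injective s' := by
    rintro ⟨⟨i, j⟩, h1, h2⟩ ⟨⟨i', j'⟩, h1', h2'⟩ h
    obtain ⟨h3, h4⟩ := hf2 _ _ _ _ h
    simp only [Option.some.injEq] at h3 h4
    subst h3; subst h4; rfl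
  have hcard : Fintype.card ι ≤ t * t := by
    refine (Fintype.card_subtype_le _).trans ?_
    simp
  have hsc : ∀ v, χ v = 3 → v ∉ colourClass χ 4 := by
    intro v hv h
    rw [mem_colourClass, hv] at h
    exact absurd h (by decide)
  have hC : lam * ((2 ^ 40 : ℕ) : ℝ) ≤ d := hlam.le
  obtain ⟨Pa, hP1, hP2, hP3, hP4, hP5, A, hA1, hA2, hA3, hA4⟩ :=
    (P.extendable hC h0 le_rfl (colourClass χ 4) (d / 32) hκ (fun v => hχ v 4)).connect_many
      (P.hasSlack hC h0 le_rfl (colourClass χ 4) (d / 32) hκ (by omega) (fun v => hχ v 4) (by omega))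
      (by omega) (fun S T hS hT => P.joined_of_le hC h0 (by omega) S T hS hT) hS.le_pow
      (Subset.refl _) (by norm_num) (by norm_num) (ι := ι) (s := s) (s' := s')
      (fun x => hsc _ (hf4 _ _)) (fun x => hsc _ (hf4 _ _))
      hst hss hss'
      (by
        have h1 := hS.pow_le
        have h2 : Fintype.card ι * (2 * (k + 1)) ≤ 2 * (t * t * (k + 1)) := by
          calc _ ≤ t * t * (2 * (k + 1)) := Nat.mul_le_mul_right _ hcard
            _ = _ := by ring
        rw [sdiff_self, bot_eq_empty, card_empty]
        omega)
  let Q₁ : ι → List V := fun x => s x :: (Pa x ++ [s' x])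
  have hQ : ∀ x v, v ∈ Q₁ x ↔ v = s x ∨ v ∈ Pa x ∨ v = s' x := by simp [Q₁]
  have hP3' : ∀ x, ∀ v ∈ Pa x, χ v = 4 := fun x v hv => mem_colourClass.mp (hP3 x v hv)
  have hnb : ∀ x o, ∀ v ∈ Pa x, ∀ i, v ≠ f i o := by
    rintro x o v hv i rfl
    have := hP3' x _ hv
    rw [hf4] at this
    exact absurd this (by decide)
  have hnone : ∀ i x, f i none ∉ Q₁ x := by
    intro i x h
    rcases (hQ _ _).mp h with h | h | h
    · exact absurd (hf2 _ _ _ _ h).2 (by simp)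
    · exact hnb x _ _ h i rfl
    · exact absurd (hf2 _ _ _ _ h).2 (by simp)
  have hQdis : ∀ x y, ∀ v ∈ Q₁ x, v ∈ Q₁ y → x = y := by
    intro x y v hx hy
    rcases (hQ _ _).mp hx with h | h | h <;> rcases (hQ _ _).mp hy with h' | h' | h'
    · exact hss (h.symm.trans h')
    · exact absurd h (hnb y _ _ h' _)
    · exact absurd (h.symm.trans h') (hst x y)
    · exact absurd h' (hnb x _ _ h _)
    · by_contra hxy
      exact hP5 x y hxy v h h'
    · exact absurd h' (hnb x _ _ h _)
    · exact absurd (h'.symm.trans h) (hst y x)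
    · exact absurd h (hnb y _ _ h' _)
    · exact hss' (h.symm.trans h')
  have hQnd : ∀ x, (Q₁ x).Nodup := by
    intro x
    simp only [Q₁, List.nodup_cons, List.nodup_append', List.mem_append, List.mem_singleton, not_or]
    refine ⟨⟨fun h => hnb x _ _ h _ rfl, hst x x⟩, hP2 x, by simp, ?_⟩
    intro v h1 h2
    exact hnb x _ _ h1 _ (List.mem_singleton.mp h2)
  let W : Finset V := univ.filter fun v =>
    (∀ x, v ∉ Q₁ x) ∧ ∀ i, i ≠ i₀ → i ≠ j₀ → v ≠ f i none
  have hW : ∀ v, v ∈ W ↔ (∀ x, v ∉ Q₁ x) ∧ ∀ i, i ≠ i₀ → i ≠ j₀ → v ≠ f i none := by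
    intro v; simp [W]
  let U : Finset V := univ.image fun x : Fin t × Option (Fin t) => f x.1 x.2
  have hU : ∀ i o, f i o ∈ U := fun i o => mem_image.mpr ⟨(i, o), mem_univ _, rfl⟩
  have hUc : U.card ≤ t * (t + 1) := by
    refine card_image_le.trans ?_
    simp
  have hWU : ∀ v, v ∉ U → (∀ x, v ∉ Pa x) → v ∈ W := by
    intro v h1 h2
    refine (hW v).mpr ⟨fun x hx => ?_, fun i _ _ h => h1 (h ▸ hU _ _)⟩
    rcases (hQ _ _).mp hx with h | h | h
    · exact h1 (h ▸ hU _ _)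
    · exact h2 x h
    · exact h1 (h ▸ hU _ _)
  have hU3 : ∀ v ∈ U, χ v = 3 := by
    intro v hv
    obtain ⟨x, -, rfl⟩ := mem_image.mp hv
    exact hf4 _ _
  have hend : ∀ i, (i = i₀ ∨ i = j₀) → f i none ∈ W := by
    intro i hi
    refine (hW _).mpr ⟨hnone i, fun i' h1 h2 h => ?_⟩
    have := (hf2 _ _ _ _ h).1
    subst this
    exact hi.elim h1 h2
  obtain ⟨w, hw1, hw2, hw3⟩ := P.exists_spanning_list (Z := colourClass χ 3 \ U) (W := W) hlam h0
    (by omega) le_rfl hS hκ hχ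
    (fun v h3 h4 => hWU v (fun h => h3 (hU3 v h)) fun x hx => h4 (hP3' x v hx)) hA1
    (fun v hv => hWU v (fun h => hsc v (hU3 v h) (hA1 hv)) fun x hx => hA2 x v hx hv) hA3
    (by
      have h2 : Fintype.card ι * (2 * (k + 1)) ≤ 2 * (t * t * (k + 1)) := by
        calc _ ≤ t * t * (2 * (k + 1)) := Nat.mul_le_mul_right _ hcard
          _ = _ := by ring
      rw [sdiff_self, bot_eq_empty, card_empty] at hA4
      omega)
    sdiff_subset
    (fun v hv => hWU v (mem_sdiff.mp hv).2 fun x hx => by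
      have h1 := hP3' x v hx
      rw [mem_colourClass.mp (mem_sdiff.mp hv).1] at h1
      exact absurd h1 (by decide))
    (by
      have h1 := P.card_class (colourClass χ 3) (d / 32) 64 hκ (by omega) fun v => hχ v 3
      have h2 := le_card_sdiff U (colourClass χ 3)
      omega)
    (a := f i₀ none) (b := f j₀ none)
    ⟨hf4 _ _, hend _ (Or.inl rfl), fun h => (mem_sdiff.mp h).2 (hU _ _)⟩
    ⟨hf4 _ _, hend _ (Or.inr rfl), fun h => (mem_sdiff.mp h).2 (hU _ _)⟩
    (fun h => hij₀.ne (hf2 _ _ _ _ h).1)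
  have hwW : ∀ v ∈ w, v ∈ W := fun v hv => (hw3 v).mpr (by simp [hv])
  have hwnd : w.Nodup := (List.nodup_append'.mp (List.nodup_cons.mp hw1).2).1
  let Q : Fin t → Fin t → List V := fun i j =>
    if h : i < j ∧ (i, j) ≠ (i₀, j₀) then Q₁ ⟨(i, j), h⟩ else w
  have hQ1 : ∀ i j (h : i < j ∧ (i, j) ≠ (i₀, j₀)), Q i j = Q₁ ⟨(i, j), h⟩ := by
    intro i j h; simp only [Q]; rw [dif_pos h]
  have hQ2 : Q i₀ j₀ = w := by simp [Q]
  have hcase : ∀ i j, i < j → (i = i₀ ∧ j = j₀) ∨ (i < j ∧ (i, j) ≠ (i₀, j₀)) := by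
    intro i j h
    by_cases h1 : (i, j) = (i₀, j₀)
    · exact Or.inl (Prod.mk.injEq _ _ _ _ ▸ h1)
    · exact Or.inr ⟨h, h1⟩
  refine hasSpanningKSubdivision_of_lists ht (b := fun i => f i none)
    (fun i j h => (hf2 _ _ _ _ h).1) Q ?_ ?_ ?_ ?_ ?_
  · intro i j hij
    rcases hcase i j hij with ⟨rfl, rfl⟩ | h
    · rwa [hQ2]
    · rw [hQ1 i j h]; exact hQnd _
  · intro i j hij
    rcases hcase i j hij with ⟨rfl, rfl⟩ | h
    · rwa [hQ2]
    · rw [hQ1 i j h]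
      have h4 := hP4 ⟨(i, j), h⟩
      have h5 : (f i none :: s ⟨(i, j), h⟩ :: (Pa ⟨(i, j), h⟩ ++ [s' ⟨(i, j), h⟩])).IsChain G.Adj :=
        List.IsChain.cons_cons (hf3 i _) h4
      have h6 := List.isChain_append.mpr ⟨h5, List.isChain_singleton (f j none), fun u hu v hv => by
        simp only [List.head?_cons, Option.mem_some_iff] at hv
        subst hv
        rw [← List.cons_append, ← List.cons_append, List.getLast?_append_of_ne_nil _ (by simp)] at hu
        simp only [List.getLast?_singleton, Option.mem_some_iff] at hu
        subst hu
        exact (hf3 j i).symm⟩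
      exact h6
  · intro i j m hij
    rcases hcase i j hij with ⟨rfl, rfl⟩ | h
    · rw [hQ2]
      intro hm
      by_cases h1 : m = i₀
      · subst h1
        exact (List.nodup_cons.mp hw1).1 (by simp [hm])
      by_cases h2 : m = j₀
      · subst h2
        exact (List.nodup_append'.mp (List.nodup_cons.mp hw1).2).2.2 hm (by simp)
      exact ((hW _).mp (hwW _ hm)).2 m h1 h2 rfl
    · rw [hQ1 i j h]; exact hnone _ _
  · intro i j i' j' hij hij' x hx hx'
    rcases hcase i j hij with ⟨rfl, rfl⟩ | h <;> rcases hcase i' j' hij' with ⟨rfl, rfl⟩ | h'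
    · exact ⟨rfl, rfl⟩
    · rw [hQ2] at hx
      rw [hQ1 _ _ h'] at hx'
      exact absurd hx' (((hW x).mp (hwW x hx)).1 _)
    · rw [hQ2] at hx'
      rw [hQ1 _ _ h] at hx
      exact absurd hx (((hW x).mp (hwW x hx')).1 _)
    · rw [hQ1 _ _ h] at hx
      rw [hQ1 _ _ h'] at hx'
      have := hQdis _ _ x hx hx'
      exact Prod.mk.injEq _ _ _ _ ▸ Subtype.mk.inj this
  · intro v
    by_cases hv : v ∈ W
    · rcases List.mem_cons.mp ((hw3 v).mp hv) with h | h
      · exact Or.inl ⟨_, h⟩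
      rcases List.mem_append.mp h with h | h
      · exact Or.inr ⟨i₀, j₀, hij₀, by rwa [hQ2]⟩
      · exact Or.inl ⟨_, List.mem_singleton.mp h⟩
    · rw [hW] at hv
      by_cases h1 : ∃ x, v ∈ Q₁ x
      · obtain ⟨⟨⟨i, j⟩, h⟩, hx⟩ := h1
        exact Or.inr ⟨i, j, h.1, by rwa [hQ1 i j h]⟩
      · push Not at h1
        have h2 : ∃ i, v = f i none := by
          by_contra! h2
          exact hv ⟨h1, fun i _ _ => h2 i⟩
        exact Or.inl h2

end Main

/-- Theorem 1.1: there are constants `C > 0` and `c ∈ (0,1]` such that, whenever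
`d/λ ≥ C`, every `(n,d,λ)`-graph contains a spanning subdivision of `K_t` for all
`2 ≤ t ≤ min{cd, c√(n/log n)}`. -/
theorem spanning_clique_subdivision_in_pseudorandom :
    ∃ C : ℝ, 0 < C ∧ ∃ c : ℝ, 0 < c ∧ c ≤ 1 ∧
      ∀ (n d : ℕ) (lam : ℝ), 0 < lam →
        ∀ (V : Type) [Fintype V] [DecidableEq V] (G : SimpleGraph V) [DecidableRel G.Adj],
          IsNDLGraph n d lam G → C ≤ (d : ℝ) / lam →
          ∀ t : ℕ, 2 ≤ t → (t : ℝ) ≤ c * d →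
            (t : ℝ) ≤ c * Real.sqrt ((n : ℝ) / Real.log n) →
            HasSpanningKSubdivision G t := by
  refine ⟨2 ^ 40, by positivity, 1 / 2 ^ 301, by positivity, ?_, ?_⟩
  · rw [div_le_one (by positivity)]
    exact one_le_pow₀ (by norm_num)
  intro n d lam h0 V _ _ G _ hG hC t ht htd htn
  have ht' : (2 : ℝ) ≤ t := by exact_mod_cast ht
  have hdt : (2 : ℝ) ^ 301 * t ≤ d := by
    rw [div_mul_eq_mul_div, one_mul, le_div_iff₀ (by positivity)] at htd
    linarith
  have hpow : (2 : ℝ) ^ 10 ≤ 2 ^ 301 := pow_le_pow_right₀ (by norm_num) (by norm_num)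
  have hdt2 : (2 : ℝ) ^ 10 * t ≤ d := (mul_le_mul_of_nonneg_right hpow (by positivity)).trans hdt
  have hdt3 : 2 ^ 10 * t ≤ d := by exact_mod_cast hdt2
  have hlog : 0 < Real.log n := by
    by_contra! h
    have h1 : (n : ℝ) / Real.log n ≤ 0 := div_nonpos_of_nonneg_of_nonpos (Nat.cast_nonneg _) h
    rw [Real.sqrt_eq_zero_of_nonpos h1, mul_zero] at htn
    linarith
  have hn2 : 2 ≤ n := by
    by_contra! h
    interval_cases n <;> simp at hlog
  have hsq : (2 : ℝ) ^ 602 * ((t : ℝ) ^ 2 * Real.log n) ≤ n := by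
    rw [div_mul_eq_mul_div, one_mul, le_div_iff₀ (by positivity)] at htn
    have h1 := Real.le_sqrt' (by positivity) |>.mp htn
    rw [le_div_iff₀ hlog, mul_pow, ← pow_mul] at h1
    refine le_trans (le_of_eq ?_) h1
    ring
  have hlg : ((Nat.log 2 n : ℕ) : ℝ) ≤ 2 * Real.log n := by
    have h1 : (2 : ℝ) ^ Nat.log 2 n ≤ n := by
      exact_mod_cast Nat.pow_log_le_self 2 (by omega : n ≠ 0)
    have h2 := Real.log_le_log (by positivity) h1
    rw [Real.log_pow] at h2
    have h3 := Real.log_two_gt_d9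
    nlinarith [Nat.cast_nonneg (α := ℝ) (Nat.log 2 n)]
  have hlog2 : 1 / 2 ≤ Real.log n := by
    have h1 := Real.log_le_log (by norm_num) (show (2 : ℝ) ≤ n by exact_mod_cast hn2)
    have h3 := Real.log_two_gt_d9
    linarith
  have hL : 600 ≤ Nat.log 2 n := by
    apply Nat.le_log_of_pow_le (by norm_num)
    have h1 : (1 : ℝ) ≤ (t : ℝ) ^ 2 * Real.log n := by nlinarith
    have h2 : (2 : ℝ) ^ 600 ≤ n := by
      calc (2 : ℝ) ^ 600 ≤ 2 ^ 602 * 1 := by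
            rw [mul_one]; exact pow_le_pow_right₀ (by norm_num) (by norm_num)
        _ ≤ 2 ^ 602 * ((t : ℝ) ^ 2 * Real.log n) := by gcongr
        _ ≤ n := hsq
    exact_mod_cast h2
  have ht2 : 2 ^ 20 * (t ^ 2 * Nat.log 2 n) ≤ n := by
    have h1 : (2 : ℝ) ^ 20 * ((t : ℝ) ^ 2 * (Nat.log 2 n : ℕ)) ≤ n := by
      calc _ ≤ (2 : ℝ) ^ 20 * ((t : ℝ) ^ 2 * (2 * Real.log n)) := by gcongr
        _ = 2 ^ 21 * ((t : ℝ) ^ 2 * Real.log n) := by ring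
        _ ≤ 2 ^ 602 * ((t : ℝ) ^ 2 * Real.log n) := by
          gcongr <;> norm_num
        _ ≤ n := hsq
    exact_mod_cast h1
  rw [le_div_iff₀ h0] at hC
  have hlt : lam < d := by
    have : (1 : ℝ) < 2 ^ 40 := by norm_num
    exact (lt_mul_of_one_lt_left h0 this).trans_le hC
  have hVn := hG.1
  have P := (hG.pseudorandom h0 hlt).mono (lam' := d / ((2 ^ 40 : ℕ) : ℝ)) (by
    rw [le_div_iff₀ (by positivity)]
    rw [Nat.cast_pow, Nat.cast_ofNat, mul_comm]
    exact hC)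
  subst hVn
  exact P.hasSpanningKSubdivision (div_mul_cancel₀ _ (by positivity))
    (div_pos (h0.trans hlt) (by positivity)) (by omega) hL ht (by omega) ht2
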